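/- Let k > n ≥ 2 be integers. Consider a system of one degree-k equation Σ_{j=1}^s b_j x_j^k = 0 and two degree-n equations Σ_{j=1}^s c_{ij} x_j^n = 0 (i = 1,2) with nonzero integer coefficients such that every 2×2 minor of the matrix (c_{ij}) is nonzero. Suppose either k ≤ n(n−1) and s ≥ 2k(k−1) + 2n(n−1) + 1, or k ≥ n(n−1) and s ≥ 2k² + 1. If the system possesses a non-singular real solution with all coordinates positive and, for every prime p, a non-singular solution in ℚ_p^s, then there exists C > 0 such that the number N(P) of integer solutions x with 1 ≤ x_j ≤ P satisfies N(P) = (C + o(1)) P^{s−k−2n} as P → ∞. -/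

import Mathlib

open Finset

namespace PadicDecoupling

/-- Average of a real function over a finite type. -/
noncomputable def avg {G : Type*} [Fintype G] (f : G → ℝ) : ℝ :=
  (Fintype.card G : ℝ)⁻¹ * ∑ g, f g

section avg
variable {G H ι : Type*} [Fintype G] [Fintype H]

lemma avg_mono {f g : G → ℝ} (h : ∀ x, f x ≤ g x) : avg f ≤ avg g :=
  mul_le_mul_of_nonneg_left (sum_le_sum fun i _ => h i) (by positivity)

lemma avg_nonneg {f : G → ℝ} (h : ∀ x, 0 ≤ f x) : 0 ≤ avg f :=
  mul_nonneg (by positivity) (sum_nonneg fun i _ => h i)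

lemma avg_const_mul (a : ℝ) (f : G → ℝ) : avg (fun x => a * f x) = a * avg f := by
  simp only [avg, ← mul_sum]; ring

lemma avg_add (f g : G → ℝ) : avg (fun x => f x + g x) = avg f + avg g := by
  simp only [avg, sum_add_distrib]; ring

lemma avg_sum (s : Finset ι) (f : ι → G → ℝ) :
    avg (fun x => ∑ i ∈ s, f i x) = ∑ i ∈ s, avg (f i) := by
  simp only [avg, ← mul_sum]; rw [sum_comm]

lemma avg_comm (f : G → H → ℝ) :
    avg (fun x => avg (fun y => f x y)) = avg (fun y => avg (fun x => f x y)) := by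
  simp only [avg, ← mul_sum]; rw [sum_comm]; ring

lemma avg_const [Nonempty G] (a : ℝ) : avg (fun _ : G => a) = a := by
  simp [avg]

lemma avg_translate [AddCommGroup G] (f : G → ℝ) (g : G) :
    avg (fun x => f (x + g)) = avg f := by
  simp only [avg]; congr 1
  exact Fintype.sum_equiv (Equiv.addRight g) _ _ fun x => rfl

lemma avg_eq_avg_translate [AddCommGroup G] [Nonempty H] (f : G → ℝ) (j : H → G) :
    avg f = avg (fun c => avg (fun h => f (c + j h))) := by
  rw [avg_comm]; simp [avg_translate, avg_const]

end avg

/-- The polynomial phase with coefficients `c` modulo `q`. -/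
noncomputable def ph {q : ℕ} [NeZero q] {d : ℕ} (c : Fin (d + 1) → ZMod q) (x : ℤ) : ℂ :=
  ZMod.stdAddChar (∑ i, c i * (x : ZMod q) ^ (i : ℕ))

lemma norm_ph {q : ℕ} [NeZero q] {d : ℕ} (c : Fin (d + 1) → ZMod q) (x : ℤ) : ‖ph c x‖ = 1 := by
  rw [ph, ZMod.stdAddChar_apply]; exact Circle.norm_coe _

lemma ph_add {q : ℕ} [NeZero q] {d : ℕ} (c c' : Fin (d + 1) → ZMod q) (x : ℤ) :
    ph (c + c') x = ph c x * ph c' x := by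
  simp [ph, ← AddChar.map_add_eq_mul, ← sum_add_distrib, add_mul]

/-- Exponential sum with coefficients `A` over `T`. -/
noncomputable def ES {q : ℕ} [NeZero q] {d : ℕ} (A : ℤ → ℂ) (T : Finset ℤ)
    (c : Fin (d + 1) → ZMod q) : ℂ := ∑ x ∈ T, A x * ph c x

/-- The part of `T` in the class of `x₀` modulo `m`. -/
def cls (T : Finset ℤ) (m : ℤ) (x₀ : ℤ) : Finset ℤ := T.filter fun x => m ∣ x - x₀

/-- The pullback of `T` under `z ↦ x₀ + m z`. -/
noncomputable def pull (T : Finset ℤ) (m x₀ : ℤ) (hm : m ≠ 0) : Finset ℤ :=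
  T.preimage (fun z => x₀ + m * z) (fun a _ b _ h => by simpa [hm] using h)

lemma mem_pull {T : Finset ℤ} {m x₀ : ℤ} {hm : m ≠ 0} {z : ℤ} :
    z ∈ pull T m x₀ hm ↔ x₀ + m * z ∈ T := by
  unfold pull; exact mem_preimage

lemma sum_cls_pull (T : Finset ℤ) (m n x₀ t : ℤ) (hm : m ≠ 0) (g : ℤ → ℂ) :
    ∑ x ∈ cls T (m * n) (x₀ + m * t), g x = ∑ z ∈ cls (pull T m x₀ hm) n t, g (x₀ + m * z) := by
  symm
  refine sum_bij (fun z _ => x₀ + m * z) ?_ ?_ ?_ ?_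
  · intro z hz
    simp only [cls, mem_pull, mem_filter] at hz ⊢
    refine ⟨hz.1, ?_⟩
    have : x₀ + m * z - (x₀ + m * t) = m * (z - t) := by ring
    rw [this]; exact mul_dvd_mul_left _ hz.2
  · intro a _ b _ h; simpa [hm] using h
  · intro x hx
    simp only [cls, mem_filter] at hx
    obtain ⟨hxT, w, hw⟩ := hx
    refine ⟨t + n * w, ?_, by linear_combination -hw⟩
    simp only [cls, mem_pull, mem_filter]
    refine ⟨?_, by simp⟩
    convert hxT using 1; linear_combination -hw
  · intros; rfl

lemma sum_cls_pull' (T : Finset ℤ) (m x₀ : ℤ) (hm : m ≠ 0) (g : ℤ → ℂ) :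
    ∑ x ∈ cls T m x₀, g x = ∑ z ∈ pull T m x₀ hm, g (x₀ + m * z) := by
  have := sum_cls_pull T m 1 x₀ 0 hm g
  simpa [cls] using this

/-- `d (d + 1) / 2` -/
def rr (d : ℕ) : ℕ := d * (d + 1) / 2

lemma two_mul_rr (d : ℕ) : 2 * rr d = d * (d + 1) :=
  Nat.mul_div_cancel' (Nat.even_mul_succ_self d).two_dvd

lemma rr_pos {d : ℕ} (hd : 1 ≤ d) : 1 ≤ rr d := by
  have := two_mul_rr d; nlinarith

/-- Decoupling for polynomial phases of degree `d`, from the full line to classes mod `p ^ B`. -/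
def Dec (p d B : ℕ) [NeZero p] (D : ℝ) : Prop :=
  ∀ (A : ℤ → ℂ) (T : Finset ℤ) (ν : ℕ → ℝ), (∀ t, 0 < ν t) →
    avg (fun c : Fin (d + 1) → ZMod (p ^ (d * B)) => ‖ES A T c‖ ^ (2 * rr d)) ≤
      D ^ rr d * (∑ t ∈ range (p ^ B), ν t) ^ (rr d - 1) *
        ∑ t ∈ range (p ^ B), (ν t)⁻¹ ^ (rr d - 1) *
          avg (fun c : Fin (d + 1) → ZMod (p ^ (d * B)) =>
            ‖ES A (cls T ((p : ℤ) ^ B) t) c‖ ^ (2 * rr d))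

lemma Dec.transfer {p d B : ℕ} [NeZero p] {D : ℝ} (hD : Dec p d B D) {q K : ℕ} [NeZero q]
    (w : (Fin (K + 1) → ZMod q) → ℝ) (hw0 : ∀ c, 0 ≤ w c)
    (j : (Fin (d + 1) → ZMod (p ^ (d * B))) → (Fin (K + 1) → ZMod q))
    (hw : ∀ c h, w (c + j h) = w c) (x₀ : ℤ) (a : ℕ)
    (u : (Fin (d + 1) → ZMod (p ^ (d * B))) → ℂ) (hu : ∀ h, ‖u h‖ = 1)
    (hj : ∀ h z, ph (j h) (x₀ + (p : ℤ) ^ a * z) = u h * ph h z)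
    (A : ℤ → ℂ) (T : Finset ℤ) (ν : ℕ → ℝ) (hν : ∀ t, 0 < ν t) :
    avg (fun c => w c * ‖ES A (cls T ((p : ℤ) ^ a) x₀) c‖ ^ (2 * rr d)) ≤
      D ^ rr d * (∑ t ∈ range (p ^ B), ν t) ^ (rr d - 1) *
        ∑ t ∈ range (p ^ B), (ν t)⁻¹ ^ (rr d - 1) *
          avg (fun c => w c * ‖ES A (cls T ((p : ℤ) ^ (a + B)) (x₀ + (p : ℤ) ^ a * t)) c‖ ^
            (2 * rr d)) := by
  have hp : ((p : ℤ) ^ a) ≠ 0 := pow_ne_zero _ (by exact_mod_cast NeZero.ne p)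
  set T' := pull T ((p : ℤ) ^ a) x₀ hp
  let A' : (Fin (K + 1) → ZMod q) → ℤ → ℂ :=
    fun c z => A (x₀ + (p : ℤ) ^ a * z) * ph c (x₀ + (p : ℤ) ^ a * z)
  have e1 : ∀ c h, ‖ES A (cls T ((p : ℤ) ^ a) x₀) (c + j h)‖ = ‖ES (A' c) T' h‖ := by
    intro c h
    have : ES A (cls T ((p : ℤ) ^ a) x₀) (c + j h) = u h * ES (A' c) T' h := by
      simp only [ES]
      rw [sum_cls_pull' _ _ _ hp, mul_sum]
      refine sum_congr rfl fun z _ => ?_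
      rw [ph_add, hj]; simp only [A']; ring
    rw [this, norm_mul, hu, one_mul]
  have e2 : ∀ c h (t : ℕ), ‖ES A (cls T ((p : ℤ) ^ (a + B)) (x₀ + (p : ℤ) ^ a * t)) (c + j h)‖ =
      ‖ES (A' c) (cls T' ((p : ℤ) ^ B) t) h‖ := by
    intro c h t
    have : ES A (cls T ((p : ℤ) ^ (a + B)) (x₀ + (p : ℤ) ^ a * t)) (c + j h) =
        u h * ES (A' c) (cls T' ((p : ℤ) ^ B) t) h := by
      simp only [ES]
      rw [pow_add, sum_cls_pull _ _ _ _ _ hp, mul_sum]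
      refine sum_congr rfl fun z _ => ?_
      rw [ph_add, hj]; simp only [A']; ring
    rw [this, norm_mul, hu, one_mul]
  rw [avg_eq_avg_translate _ j]
  calc _ ≤ avg (fun c => D ^ rr d * (∑ t ∈ range (p ^ B), ν t) ^ (rr d - 1) *
        ∑ t ∈ range (p ^ B), (ν t)⁻¹ ^ (rr d - 1) * avg (fun h =>
          w (c + j h) * ‖ES A (cls T ((p : ℤ) ^ (a + B)) (x₀ + (p : ℤ) ^ a * t)) (c + j h)‖ ^
            (2 * rr d))) := by
        refine avg_mono fun c => ?_
        simp only [hw, e1, e2, avg_const_mul]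
        calc _ ≤ w c * _ := mul_le_mul_of_nonneg_left (hD (A' c) T' ν hν) (hw0 c)
          _ = _ := by simp only [mul_sum]; refine sum_congr rfl fun t _ => ?_; ring
    _ = _ := by
        rw [avg_const_mul, avg_sum]
        congr 1
        refine sum_congr rfl fun t _ => ?_
        rw [avg_const_mul]
        congr 1
        exact (avg_eq_avg_translate (fun c => w c *
          ‖ES A (cls T ((p : ℤ) ^ (a + B)) (x₀ + (p : ℤ) ^ a * t)) c‖ ^ (2 * rr d)) j).symm

lemma sum_range_mul_eq (m n : ℕ) (g : ℕ → ℝ) :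
    ∑ t ∈ range (m * n), g t = ∑ i ∈ range m, ∑ j ∈ range n, g (i + m * j) := by
  rw [sum_comm]
  induction n with
  | zero => simp
  | succ n ih => rw [Nat.mul_succ, sum_range_add, ih, sum_range_succ]; simp [add_comm]

/-- A positive additive weight on the tree of residue classes modulo powers of `p`. -/
structure IsTree (p B : ℕ) (ν : ℕ → ℤ → ℝ) : Prop where
  pos : ∀ a x, 0 < ν a x
  split : ∀ a < B, ∀ x, ν a x = ∑ t ∈ range p, ν (a + 1) (x + (p : ℤ) ^ a * t)

lemma IsTree.split_pow {p B : ℕ} {ν : ℕ → ℤ → ℝ} (h : IsTree p B ν) (a n : ℕ) (hn : a + n ≤ B)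
    (x : ℤ) : ν a x = ∑ t ∈ range (p ^ n), ν (a + n) (x + (p : ℤ) ^ a * t) := by
  induction n generalizing a x with
  | zero => simp
  | succ n ih =>
    rw [h.split a (by omega), pow_succ', sum_range_mul_eq]
    refine sum_congr rfl fun i _ => ?_
    rw [ih (a + 1) (by omega)]
    refine sum_congr rfl fun t _ => ?_
    rw [show a + 1 + n = a + (n + 1) by ring]
    congr 1
    push_cast; ring

lemma weighted_pow_sum_le {ι : Type*} (s : Finset ι) (ν y : ι → ℝ) (hν : ∀ i, 0 < ν i)
    (hy : ∀ i, 0 ≤ y i) {r : ℕ} (hr : 1 ≤ r) :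
    (∑ i ∈ s, y i) ^ r ≤ (∑ i ∈ s, ν i) ^ (r - 1) * ∑ i ∈ s, (ν i)⁻¹ ^ (r - 1) * y i ^ r := by
  rcases s.eq_empty_or_nonempty with rfl | hs
  · have : r ≠ 0 := by omega
    simp [this]
  set N := ∑ i ∈ s, ν i
  have hN : 0 < N := sum_pos (fun i _ => hν i) hs
  have := Real.pow_arith_mean_le_arith_mean_pow s (fun i => ν i / N) (fun i => y i / ν i)
    (fun i _ => (div_pos (hν i) hN).le) (by rw [← sum_div]; exact div_self hN.ne')
    (fun i _ => div_nonneg (hy i) (hν i).le) r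
  have e1 : ∑ i ∈ s, ν i / N * (y i / ν i) = (∑ i ∈ s, y i) / N := by
    rw [sum_div]; refine sum_congr rfl fun i _ => ?_
    have := (hν i).ne'; field_simp
  rw [e1, div_pow, div_le_iff₀ (by positivity)] at this
  refine this.trans (le_of_eq ?_)
  rw [sum_mul, mul_sum]
  refine sum_congr rfl fun i _ => ?_
  obtain ⟨r, rfl⟩ : ∃ k, r = k + 1 := ⟨r - 1, by omega⟩
  have := (hν i).ne'
  simp only [Nat.add_sub_cancel, div_pow, inv_pow, pow_succ]
  field_simp

lemma cls_sum_split {M : Type*} [AddCommMonoid M] (p : ℕ) [NeZero p] (T : Finset ℤ) (a n : ℕ)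
    (x₀ : ℤ) (g : ℤ → M) :
    ∑ x ∈ cls T ((p : ℤ) ^ a) x₀, g x =
      ∑ t ∈ range (p ^ n), ∑ x ∈ cls T ((p : ℤ) ^ (a + n)) (x₀ + (p : ℤ) ^ a * t), g x := by
  have hp : (0 : ℤ) < p := by exact_mod_cast Nat.pos_of_ne_zero (NeZero.ne p)
  have hpa : (0 : ℤ) < (p : ℤ) ^ a := by positivity
  have hpn : (0 : ℤ) < (p : ℤ) ^ n := by positivity
  rw [← sum_fiberwise_of_maps_to (t := range (p ^ n))
    (g := fun x => ((x - x₀) / (p : ℤ) ^ a % (p : ℤ) ^ n).toNat)]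
  · refine sum_congr rfl fun t ht => ?_
    refine sum_congr ?_ fun _ _ => rfl
    ext x
    simp only [cls, mem_filter, mem_range] at ht ⊢
    have ht' : (t : ℤ) < (p : ℤ) ^ n := by exact_mod_cast ht
    constructor
    · rintro ⟨⟨hx, w, hw⟩, h2⟩
      refine ⟨hx, ?_⟩
      rw [hw, Int.mul_ediv_cancel_left _ hpa.ne'] at h2
      have h3 : w % (p : ℤ) ^ n = t := by
        have := Int.emod_nonneg w hpn.ne'; omega
      refine ⟨w / (p : ℤ) ^ n, ?_⟩
      have := Int.mul_ediv_add_emod w ((p : ℤ) ^ n)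
      rw [h3] at this
      rw [pow_add]
      linear_combination hw - (p : ℤ) ^ a * this
    · rintro ⟨hx, w, hw⟩
      have e : x - x₀ = (p : ℤ) ^ a * (t + (p : ℤ) ^ n * w) := by
        rw [pow_add] at hw; linear_combination hw
      refine ⟨⟨hx, ⟨_, e⟩⟩, ?_⟩
      rw [e, Int.mul_ediv_cancel_left _ hpa.ne', Int.add_mul_emod_self_left,
        Int.emod_eq_of_lt (by positivity) ht']
      simp
  · intro x _
    simp only [mem_range]
    have h1 := Int.emod_nonneg ((x - x₀) / (p : ℤ) ^ a) hpn.ne'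
    have h2 := Int.emod_lt_of_pos ((x - x₀) / (p : ℤ) ^ a) hpn
    zify; rw [Int.toNat_of_nonneg h1]; exact h2

section steps
variable {p : ℕ} [NeZero p] {q K : ℕ} [NeZero q]

lemma Dec.step {d B' B : ℕ} {D : ℝ} (hD : Dec p d B' D) (hd : 1 ≤ d) (hD0 : 0 ≤ D)
    (w : (Fin (K + 1) → ZMod q) → ℝ) (hw0 : ∀ c, 0 ≤ w c)
    (j : (Fin (d + 1) → ZMod (p ^ (d * B'))) → (Fin (K + 1) → ZMod q))
    (hw : ∀ c h, w (c + j h) = w c) (x₀ : ℤ) (a : ℕ)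
    (u : (Fin (d + 1) → ZMod (p ^ (d * B'))) → ℂ) (hu : ∀ h, ‖u h‖ = 1)
    (hj : ∀ h z, ph (j h) (x₀ + (p : ℤ) ^ a * z) = u h * ph h z)
    (A : ℤ → ℂ) (T : Finset ℤ) {ν : ℕ → ℤ → ℝ} (hν : IsTree p B ν) (haB : a + B' ≤ B)
    {M : ℝ} (hM : ∀ t : ℕ, avg (fun c => w c *
      ‖ES A (cls T ((p : ℤ) ^ (a + B')) (x₀ + (p : ℤ) ^ a * t)) c‖ ^ (2 * rr d)) ≤
        M * ν (a + B') (x₀ + (p : ℤ) ^ a * t) ^ rr d) :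
    avg (fun c => w c * ‖ES A (cls T ((p : ℤ) ^ a) x₀) c‖ ^ (2 * rr d)) ≤
      D ^ rr d * (M * ν a x₀ ^ rr d) := by
  refine (hD.transfer w hw0 j hw x₀ a u hu hj A T (fun t => ν (a + B') (x₀ + (p : ℤ) ^ a * t))
    (fun t => hν.pos _ _)).trans ?_
  rw [← hν.split_pow a B' haB x₀, mul_assoc]
  refine mul_le_mul_of_nonneg_left ?_ (by positivity)
  have hr := rr_pos hd
  calc _ ≤ ν a x₀ ^ (rr d - 1) * ∑ t ∈ range (p ^ B'), M * ν (a + B') (x₀ + (p : ℤ) ^ a * t) := by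
        refine mul_le_mul_of_nonneg_left (sum_le_sum fun t _ => ?_)
          (pow_nonneg (hν.pos _ _).le _)
        have hpos := hν.pos (a + B') (x₀ + (p : ℤ) ^ a * t)
        calc _ ≤ _ := mul_le_mul_of_nonneg_left (hM t) (by positivity)
          _ = _ := by
            obtain ⟨r, hr'⟩ : ∃ k, rr d = k + 1 := ⟨rr d - 1, by omega⟩
            rw [hr']; simp only [Nat.add_sub_cancel, inv_pow, pow_succ]; field_simp
    _ = _ := by
      rw [← mul_sum, ← hν.split_pow a B' haB x₀]
      obtain ⟨r, hr'⟩ : ∃ k, rr d = k + 1 := ⟨rr d - 1, by omega⟩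
      rw [hr']; simp only [Nat.add_sub_cancel]; ring

lemma norm_sum_pow_le {ι : Type*} (s : Finset ι) (f : ι → ℂ) (r : ℕ) :
    ‖∑ i ∈ s, f i‖ ^ (2 * r) ≤ (s.card : ℝ) ^ r * (∑ i ∈ s, ‖f i‖ ^ 2) ^ r := by
  rw [pow_mul, ← mul_pow]
  refine pow_le_pow_left₀ (by positivity) ?_ r
  calc ‖∑ i ∈ s, f i‖ ^ 2 ≤ (∑ i ∈ s, ‖f i‖) ^ 2 :=
        pow_le_pow_left₀ (norm_nonneg _) (norm_sum_le _ _) 2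
    _ ≤ _ := sq_sum_le_card_mul_sum_sq

lemma trivial_pointwise {d : ℕ} (A : ℤ → ℂ) (T : Finset ℤ) (a n : ℕ) (x₀ : ℤ) (ν : ℕ → ℝ)
    (hν : ∀ t, 0 < ν t) {r : ℕ} (hr : 1 ≤ r) (c : Fin (d + 1) → ZMod q) :
    ‖ES A (cls T ((p : ℤ) ^ a) x₀) c‖ ^ (2 * r) ≤ ((p : ℝ) ^ n) ^ r *
      (∑ t ∈ range (p ^ n), ν t) ^ (r - 1) * ∑ t ∈ range (p ^ n), (ν t)⁻¹ ^ (r - 1) *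
        ‖ES A (cls T ((p : ℤ) ^ (a + n)) (x₀ + (p : ℤ) ^ a * t)) c‖ ^ (2 * r) := by
  have h1 : ES A (cls T ((p : ℤ) ^ a) x₀) c = ∑ t ∈ range (p ^ n),
      ES A (cls T ((p : ℤ) ^ (a + n)) (x₀ + (p : ℤ) ^ a * t)) c := by
    simp only [ES]; exact cls_sum_split p T a n x₀ _
  rw [h1]
  refine (norm_sum_pow_le _ _ r).trans ?_
  simp only [card_range, Nat.cast_pow, mul_assoc]
  refine mul_le_mul_of_nonneg_left ?_ (by positivity)
  have := weighted_pow_sum_le (range (p ^ n)) ν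
    (fun t => ‖ES A (cls T ((p : ℤ) ^ (a + n)) (x₀ + (p : ℤ) ^ a * t)) c‖ ^ 2) hν
    (fun _ => by positivity) hr
  simpa only [pow_mul] using this

lemma trivial_step {B : ℕ} (w : (Fin (K + 1) → ZMod q) → ℝ) (hw0 : ∀ c, 0 ≤ w c) (x₀ : ℤ)
    (a n : ℕ) (A : ℤ → ℂ) (T : Finset ℤ) {ν : ℕ → ℤ → ℝ} (hν : IsTree p B ν) (haB : a + n ≤ B)
    {r : ℕ} (hr : 1 ≤ r) {M : ℝ} (hM : ∀ t : ℕ, avg (fun c => w c *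
      ‖ES A (cls T ((p : ℤ) ^ (a + n)) (x₀ + (p : ℤ) ^ a * t)) c‖ ^ (2 * r)) ≤
        M * ν (a + n) (x₀ + (p : ℤ) ^ a * t) ^ r) :
    avg (fun c => w c * ‖ES A (cls T ((p : ℤ) ^ a) x₀) c‖ ^ (2 * r)) ≤
      ((p : ℝ) ^ n) ^ r * (M * ν a x₀ ^ r) := by
  have := hν.pos a x₀
  calc _ ≤ avg (fun c => ((p : ℝ) ^ n) ^ r * (ν a x₀) ^ (r - 1) *
        ∑ t ∈ range (p ^ n), (ν (a + n) (x₀ + (p : ℤ) ^ a * t))⁻¹ ^ (r - 1) *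
        (w c * ‖ES A (cls T ((p : ℤ) ^ (a + n)) (x₀ + (p : ℤ) ^ a * t)) c‖ ^ (2 * r))) := by
        refine avg_mono fun c => ?_
        refine (mul_le_mul_of_nonneg_left (trivial_pointwise (p := p) A T a n x₀
          (fun t => ν (a + n) (x₀ + (p : ℤ) ^ a * t)) (fun _ => hν.pos _ _) hr c)
          (hw0 c)).trans (le_of_eq ?_)
        rw [← hν.split_pow a n haB x₀]
        simp only [mul_sum]; refine sum_congr rfl fun t _ => ?_; ring
    _ ≤ ((p : ℝ) ^ n) ^ r * (ν a x₀) ^ (r - 1) *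
        ∑ t ∈ range (p ^ n), M * ν (a + n) (x₀ + (p : ℤ) ^ a * t) := by
        rw [avg_const_mul, avg_sum]
        refine mul_le_mul_of_nonneg_left (sum_le_sum fun t _ => ?_) (by positivity)
        have hpos := hν.pos (a + n) (x₀ + (p : ℤ) ^ a * t)
        rw [avg_const_mul]
        calc _ ≤ _ := mul_le_mul_of_nonneg_left (hM t) (by positivity)
          _ = _ := by
            obtain ⟨r, rfl⟩ : ∃ k, r = k + 1 := ⟨r - 1, by omega⟩
            simp only [Nat.add_sub_cancel, inv_pow, pow_succ]; field_simp
    _ = _ := by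
      rw [← mul_sum, ← hν.split_pow a n haB x₀]
      obtain ⟨r, rfl⟩ : ∃ k, r = k + 1 := ⟨r - 1, by omega⟩
      simp only [Nat.add_sub_cancel]; ring

end steps

lemma Dec.mono {p d B : ℕ} [NeZero p] {D D' : ℝ} (h : Dec p d B D) (hD : 0 ≤ D) (hDD' : D ≤ D') :
    Dec p d B D' := by
  intro A T ν hν
  refine (h A T ν hν).trans ?_
  have : 0 ≤ ∑ t ∈ range (p ^ B), ν t := sum_nonneg fun t _ => (hν t).le
  gcongr
  refine sum_nonneg fun t _ => mul_nonneg ?_ (avg_nonneg fun c => by positivity)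
  have := hν t
  positivity

lemma cls_one (T : Finset ℤ) (x : ℤ) : cls T 1 x = T := by simp [cls]

lemma Dec.of_trivial (p d B : ℕ) [NeZero p] (hd : 1 ≤ d) : Dec p d B ((p : ℝ) ^ B) := by
  intro A T ν hν
  have := fun c => trivial_pointwise (p := p) (q := p ^ (d * B)) (d := d) A T 0 B 0 ν hν
    (rr_pos hd) c
  simp only [pow_zero, cls_one, zero_add, one_mul] at this
  refine (avg_mono this).trans (le_of_eq ?_)
  rw [avg_const_mul, avg_sum]
  simp only [avg_const_mul]

lemma cls_congr {T : Finset ℤ} {m x y : ℤ} (h : m ∣ x - y) : cls T m x = cls T m y := by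
  ext z
  simp only [cls, mem_filter, and_congr_right_iff]
  intro _
  constructor
  · intro hz; have := dvd_add hz h; simpa using this
  · intro hz; have := dvd_sub hz h; simpa using this

/-- Additive weight on the tree of residue classes from weights on the leaves. -/
noncomputable def treeOf (p B : ℕ) (μ : ℕ → ℝ) (a : ℕ) (x : ℤ) : ℝ :=
  ∑ t ∈ range (p ^ (B - a)), μ ((x + (p : ℤ) ^ a * t) % (p : ℤ) ^ B).toNat

lemma isTree_treeOf (p B : ℕ) [NeZero p] (μ : ℕ → ℝ) (hμ : ∀ t, 0 < μ t) :
    IsTree p B (treeOf p B μ) where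
  pos a x := sum_pos (fun t _ => hμ _)
    ⟨0, mem_range.2 (pow_pos (Nat.pos_of_ne_zero (NeZero.ne p)) _)⟩
  split a ha x := by
    simp only [treeOf]
    rw [show B - a = (B - (a + 1)) + 1 by omega, pow_succ', sum_range_mul_eq]
    refine sum_congr rfl fun i _ => sum_congr rfl fun t _ => ?_
    congr 3
    push_cast; ring

lemma Dec.of_tree {p d B : ℕ} [NeZero p] {D : ℝ} (hd : 1 ≤ d) (hD : 0 ≤ D)
    (h : ∀ (A : ℤ → ℂ) (T : Finset ℤ) (ν : ℕ → ℤ → ℝ), IsTree p B ν →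
      (∀ x, avg (fun c : Fin (d + 1) → ZMod (p ^ (d * B)) =>
        ‖ES A (cls T ((p : ℤ) ^ B) x) c‖ ^ (2 * rr d)) ≤ ν B x ^ rr d) →
      avg (fun c : Fin (d + 1) → ZMod (p ^ (d * B)) => ‖ES A T c‖ ^ (2 * rr d)) ≤
        D ^ rr d * ν 0 0 ^ rr d) : Dec p d B D := by
  intro A T ν hν
  have hp : (0 : ℤ) < p := by exact_mod_cast Nat.pos_of_ne_zero (NeZero.ne p)
  have hpB : (0 : ℤ) < (p : ℤ) ^ B := by positivity
  have hr := rr_pos hd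
  set r := rr d
  set E : ℕ → ℝ := fun t => avg (fun c : Fin (d + 1) → ZMod (p ^ (d * B)) =>
    ‖ES A (cls T ((p : ℤ) ^ B) t) c‖ ^ (2 * r)) with hE
  have hE0 : ∀ t, 0 ≤ E t := fun t => avg_nonneg fun c => by positivity
  have hN : 0 ≤ ∑ t ∈ range (p ^ B), ν t := sum_nonneg fun t _ => (hν t).le
  set Z : ℝ := D ^ r * (∑ t ∈ range (p ^ B), ν t) ^ (r - 1) *
    ∑ t ∈ range (p ^ B), (ν t)⁻¹ ^ (r - 1) with hZ
  have hZ0 : 0 ≤ Z := by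
    refine mul_nonneg (by positivity) (sum_nonneg fun t _ => ?_)
    have := hν t; positivity
  refine le_of_forall_pos_le_add fun δ hδ => ?_
  set ε := δ / (Z + 1)
  have hε : 0 < ε := by positivity
  set μ : ℕ → ℝ := fun t => (E t + ε) ^ ((r : ℝ)⁻¹)
  have hμ : ∀ t, 0 < μ t := fun t => Real.rpow_pos_of_pos (by linarith [hE0 t]) _
  have hμr : ∀ t, μ t ^ r = E t + ε := fun t =>
    Real.rpow_inv_natCast_pow (by linarith [hE0 t]) (by omega)
  refine (h A T _ (isTree_treeOf p B μ hμ) ?_).trans ?_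
  · intro x
    have h1 : 0 ≤ x % (p : ℤ) ^ B := Int.emod_nonneg _ hpB.ne'
    have h2 : treeOf p B μ B x = μ (x % (p : ℤ) ^ B).toNat := by simp [treeOf]
    have h3 : cls T ((p : ℤ) ^ B) x = cls T ((p : ℤ) ^ B) ((x % (p : ℤ) ^ B).toNat : ℤ) := by
      rw [Int.toNat_of_nonneg h1]
      refine cls_congr ⟨x / (p : ℤ) ^ B, ?_⟩
      have := Int.mul_ediv_add_emod x ((p : ℤ) ^ B); linarith
    rw [h2, h3, hμr]
    show E _ ≤ _
    linarith
  · have h2 : treeOf p B μ 0 0 = ∑ t ∈ range (p ^ B), μ t := by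
      simp only [treeOf, Nat.sub_zero]
      refine sum_congr rfl fun t ht => ?_
      congr 1
      rw [mem_range] at ht
      have : (t : ℤ) < (p : ℤ) ^ B := by exact_mod_cast ht
      rw [pow_zero, one_mul, zero_add, Int.emod_eq_of_lt (by positivity) this]; simp
    rw [h2]
    calc _ ≤ D ^ r * ((∑ t ∈ range (p ^ B), ν t) ^ (r - 1) *
          ∑ t ∈ range (p ^ B), (ν t)⁻¹ ^ (r - 1) * μ t ^ r) :=
          mul_le_mul_of_nonneg_left
            (weighted_pow_sum_le _ ν μ hν (fun t => (hμ t).le) hr) (by positivity)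
      _ = D ^ r * (∑ t ∈ range (p ^ B), ν t) ^ (r - 1) *
          ∑ t ∈ range (p ^ B), (ν t)⁻¹ ^ (r - 1) * E t + ε * Z := by
          simp only [hμr, mul_add, sum_add_distrib, hZ, ← sum_mul]; ring
      _ ≤ _ := by
          refine add_le_add le_rfl ?_
          rw [div_mul_eq_mul_div, div_le_iff₀ (by positivity)]
          nlinarith

lemma stdAddChar_scale {q m n : ℕ} [NeZero q] [NeZero m] [NeZero n] (h : n = q * m) (x : ℤ) :
    ZMod.stdAddChar (((q * x : ℤ)) : ZMod n) = ZMod.stdAddChar ((x : ℤ) : ZMod m) := by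
  subst h
  rw [ZMod.stdAddChar_coe, ZMod.stdAddChar_coe]
  congr 1
  have h1 : (q : ℂ) ≠ 0 := by exact_mod_cast NeZero.ne q
  have h2 : (m : ℂ) ≠ 0 := by exact_mod_cast NeZero.ne m
  push_cast; field_simp

lemma ph_int {q d : ℕ} [NeZero q] (h : Fin (d + 1) → ZMod q) (z : ℤ) :
    ph h z = ZMod.stdAddChar ((∑ i, ((h i).val : ℤ) * z ^ (i : ℕ) : ℤ) : ZMod q) := by
  simp [ph]

lemma norm_stdAddChar {q : ℕ} [NeZero q] (x : ZMod q) : ‖ZMod.stdAddChar x‖ = 1 := by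
  rw [ZMod.stdAddChar_apply]; exact Circle.norm_coe _

lemma avg_norm_sq_sum {q : ℕ} [NeZero q] {ι : Type*} (s : Finset ι) (f : ι → ℂ) (e : ι → ZMod q)
    (he : Set.InjOn e s) :
    avg (fun h : ZMod q => ‖∑ i ∈ s, f i * ZMod.stdAddChar (h * e i)‖ ^ 2) =
      ∑ i ∈ s, ‖f i‖ ^ 2 := by
  classical
  have key : ∀ h : ZMod q, ((‖∑ i ∈ s, f i * ZMod.stdAddChar (h * e i)‖ ^ 2 : ℝ) : ℂ) =
      ∑ i ∈ s, ∑ j ∈ s, f i * (starRingEnd ℂ) (f j) * ZMod.stdAddChar (h * (e i - e j)) := by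
    intro h
    push_cast
    rw [← Complex.mul_conj', map_sum, sum_mul_sum]
    refine sum_congr rfl fun i _ => sum_congr rfl fun j _ => ?_
    rw [RingHom.map_mul, ← Complex.inv_eq_conj (norm_stdAddChar (h * e j)), mul_sub, sub_eq_add_neg,
      AddChar.map_add_eq_mul, AddChar.map_neg_eq_inv]
    ring
  have : ((avg (fun h : ZMod q => ‖∑ i ∈ s, f i * ZMod.stdAddChar (h * e i)‖ ^ 2) : ℝ) : ℂ) =
      ((∑ i ∈ s, ‖f i‖ ^ 2 : ℝ) : ℂ) := by
    unfold avg
    rw [Complex.ofReal_mul, Complex.ofReal_sum]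
    simp only [key]
    rw [sum_comm, mul_sum]
    push_cast
    refine sum_congr rfl fun i hi => ?_
    rw [sum_comm]
    have : ∀ j ∈ s, ∑ h : ZMod q, f i * (starRingEnd ℂ) (f j) *
        ZMod.stdAddChar (h * (e i - e j)) = if j = i then (q : ℂ) * ‖f i‖ ^ 2 else 0 := by
      intro j hj
      rw [← mul_sum, AddChar.sum_mulShift _ (ZMod.isPrimitive_stdAddChar q)]
      have : e i - e j = 0 ↔ j = i := by
        rw [sub_eq_zero]
        exact ⟨fun h => (he hi hj h).symm, fun h => by rw [h]⟩
      simp only [this]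
      split_ifs with hji
      · subst hji; rw [Complex.mul_conj', ZMod.card]; ring
      · simp
    rw [sum_congr rfl this, sum_ite_eq' ]
    simp only [hi, if_true, ZMod.card]
    have h1 : (q : ℂ) ≠ 0 := by exact_mod_cast NeZero.ne q
    field_simp
  exact_mod_cast this

lemma Dec.one (p B : ℕ) [NeZero p] : Dec p 1 B 1 := by
  intro A T ν hν
  have hp : (0 : ℤ) < p := by exact_mod_cast Nat.pos_of_ne_zero (NeZero.ne p)
  have hr : rr 1 = 1 := rfl
  simp only [hr, Nat.sub_self, pow_zero, one_pow, one_mul, mul_one]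
  have h1 := avg_eq_avg_translate (fun c : Fin (1 + 1) → ZMod (p ^ (1 * B)) => ‖ES A T c‖ ^ 2)
    (fun h : ZMod (p ^ (1 * B)) => Pi.single (1 : Fin 2) h)
  refine le_of_eq (h1.trans ?_)
  rw [← avg_sum]
  refine congrArg (avg (G := Fin 2 → ZMod (p ^ (1 * B)))) (funext fun c => ?_)
  rw [← avg_norm_sq_sum (range (p ^ B)) (fun t => ES A (cls T ((p : ℤ) ^ B) t) c)
    (fun t => ((t : ℕ) : ZMod (p ^ (1 * B))))]
  · congr 1; ext h
    congr 2
    have := cls_sum_split p T 0 B 0 (fun x => A x * ph (c + Pi.single (1 : Fin 2) h) x)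
    simp only [pow_zero, cls_one, zero_add, one_mul] at this
    simp only [ES]
    rw [this]
    refine sum_congr rfl fun t _ => ?_
    rw [sum_mul]
    refine sum_congr rfl fun x hx => ?_
    rw [ph_add, mul_assoc]
    congr 2
    simp only [cls, mem_filter] at hx
    have : ((x : ℤ) : ZMod (p ^ (1 * B))) = ((t : ℕ) : ZMod (p ^ (1 * B))) := by
      have h2 : (((x - t : ℤ)) : ZMod (p ^ (1 * B))) = 0 := by
        rw [ZMod.intCast_zmod_eq_zero_iff_dvd]; push_cast; simpa using hx.2
      push_cast at h2
      exact sub_eq_zero.1 h2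
    simp [ph, Fin.sum_univ_two, this]
  · intro t ht t' ht' h
    simp only [coe_range, Set.mem_Iio] at ht ht'
    rw [ZMod.natCast_eq_natCast_iff] at h
    have := Nat.ModEq.eq_of_lt_of_lt h (by simpa using ht) (by simpa using ht')
    exact this

end PadicDecoupling

namespace PadicDecoupling
open Polynomial

lemma ph_coeff {q K : ℕ} [NeZero q] (P : (ZMod q)[X]) (hP : P.natDegree ≤ K) (x : ℤ) :
    ph (fun i : Fin (K + 1) => P.coeff i) x = ZMod.stdAddChar (P.eval (x : ZMod q)) := by
  rw [ph, eval_eq_sum_range' (n := K + 1) (by omega)]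
  congr 1
  exact Fin.sum_univ_eq_sum_range (fun i => P.coeff i * (x : ZMod q) ^ i) (K + 1)

lemma exists_rescale (p k B a : ℕ) [NeZero p] (ha : a ≤ B) (x₀ : ℤ) :
    ∃ j : (Fin (k + 1) → ZMod (p ^ (k * (B - a)))) → (Fin (k + 1) → ZMod (p ^ (k * B))),
      ∀ h z, ph (j h) (x₀ + (p : ℤ) ^ a * z) = ph h z := by
  let P : (Fin (k + 1) → ZMod (p ^ (k * (B - a)))) → (ZMod (p ^ (k * B)))[X] := fun h =>
    ∑ i : Fin (k + 1), C ((((h i).val : ℤ) : ZMod (p ^ (k * B))) * (p : ZMod (p ^ (k * B))) ^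
      (a * (k - i))) * (X - C (x₀ : ZMod (p ^ (k * B)))) ^ (i : ℕ)
  refine ⟨fun h i => (P h).coeff i, fun h z => ?_⟩
  rw [ph_coeff]
  · rw [ph_int, ← stdAddChar_scale (q := p ^ (k * a)) (n := p ^ (k * B))
      (by rw [← pow_add, ← mul_add, Nat.add_sub_cancel' ha])]
    congr 1
    simp only [P, eval_finsetSum, eval_mul, eval_C, eval_pow, eval_sub, eval_X]
    push_cast
    rw [mul_sum]
    refine sum_congr rfl fun i _ => ?_
    have hi : (i : ℕ) ≤ k := by omega
    have : (p : ZMod (p ^ (k * B))) ^ (k * a) = p ^ (a * (k - i)) * (p ^ a) ^ (i : ℕ) := by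
      rw [← pow_mul, ← pow_add, ← mul_add, Nat.sub_add_cancel hi, mul_comm k a]
    rw [this]; ring
  · refine natDegree_sum_le_of_forall_le _ _ fun i _ => ?_
    refine (natDegree_C_mul_le _ _).trans ?_
    refine natDegree_pow_le.trans ?_
    have := natDegree_X_sub_C_le (x₀ : ZMod (p ^ (k * B)))
    have hi : (i : ℕ) ≤ k := by omega
    nlinarith

lemma exists_ode_solution {R : Type*} [CommRing R] (u : R) (m : ℕ) (n l : ℕ) (hn : n ≤ l)
    (hunit : ∀ i ≤ l + m, 1 ≤ i → IsUnit (i : R)) (S : R[X]) (hS : S.degree < n) :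
    ∃ Q : R[X], Q.degree < n ∧ ((m + 1 : ℕ) : R[X]) * Q + (X + C u) * derivative Q = S := by
  induction n generalizing S with
  | zero =>
    refine ⟨0, by simp [bot_lt_iff_ne_bot], ?_⟩
    have : S = 0 := by
      rw [← degree_eq_bot, ← Nat.WithBot.lt_zero_iff]; simpa using hS
    simp [this]
  | succ n ih =>
    obtain ⟨v, hv⟩ := (hunit (m + 1 + n) (by omega) (by omega)).exists_right_inv
    set s := S.coeff n
    set M : R[X] := C (v * s) * X ^ n with hMdef
    have hMc : ∀ i, M.coeff i = if i = n then v * s else 0 := fun i => by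
      rw [hMdef, coeff_C_mul, coeff_X_pow]; simp
    have hM : M.degree < (n + 1 : ℕ) :=
      lt_of_le_of_lt (degree_C_mul_X_pow_le _ _) (by exact_mod_cast Nat.lt_succ_self n)
    obtain ⟨Q, hQ, hQ2⟩ := ih (by omega)
      (S - (((m + 1 : ℕ) : R[X]) * M + (X + C u) * derivative M)) (by
        rw [degree_lt_iff_coeff_zero]
        intro i hi
        have hc : ∀ i, (((m + 1 : ℕ) : R[X]) * M + (X + C u) * derivative M).coeff i =
            (m + 1) * M.coeff i + i * M.coeff i + u * (M.coeff (i + 1) * (i + 1)) := by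
          intro i
          rw [add_mul, coeff_add, coeff_add, coeff_C_mul, ← C_eq_natCast, coeff_C_mul,
            coeff_derivative]
          cases i with
          | zero => simp
          | succ i => rw [coeff_X_mul, coeff_derivative]; push_cast; ring
        rw [coeff_sub, hc]
        rcases hi.eq_or_lt with rfl | hi
        · have h1 : M.coeff n = v * s := by simp [hMc]
          have h2 : M.coeff (n + 1) = 0 := by simp [hMc]
          rw [h1, h2]
          push_cast at hv
          have : S.coeff n = s := rfl
          rw [this]; linear_combination -s * hv
        · have h1 : M.coeff i = 0 := by rw [hMc, if_neg (by omega)]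
          have h2 : M.coeff (i + 1) = 0 := by rw [hMc, if_neg (by omega)]
          rw [h1, h2, (degree_lt_iff_coeff_zero _ _).1 hS i (by omega)]; simp)
    refine ⟨Q + M, (degree_add_le _ _).trans_lt (max_lt (hQ.trans (by
      exact_mod_cast Nat.lt_succ_self n)) hM), ?_⟩
    rw [derivative_add]; linear_combination hQ2

lemma exists_factored_polynomial {R : Type*} [CommRing R] (u : R) (hu : IsUnit u) (m l : ℕ)
    (hunit : ∀ i ≤ l + m, 1 ≤ i → IsUnit (i : R)) (W : R[X]) :
    ∃ Q : R[X], Q.degree < l ∧ ∀ i, 1 ≤ i → i ≤ l →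
      ((X + C u) ^ (m + 1) * Q).coeff i = W.coeff i := by
  nontriviality R
  have hcop : IsCoprime ((X + C u) ^ m) ((X : R[X]) ^ l) := by
    apply IsCoprime.pow
    obtain ⟨v, hv⟩ := hu.exists_right_inv
    refine ⟨C v, -C v, ?_⟩
    have : C u * C v = (1 : R[X]) := by rw [← C_mul, hv, C_1]
    linear_combination this
  obtain ⟨V, Z, hVZ⟩ := hcop
  have hmon : (X ^ l : R[X]).Monic := monic_X_pow l
  set S := (V * derivative W) %ₘ X ^ l
  have hS : S.degree < l := by
    have := degree_modByMonic_lt (V * derivative W) hmon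
    rwa [degree_X_pow] at this
  obtain ⟨Q, hQ, hQ2⟩ := exists_ode_solution u m l l le_rfl hunit S hS
  refine ⟨Q, hQ, fun i hi hil => ?_⟩
  have hder : derivative ((X + C u) ^ (m + 1) * Q) = (X + C u) ^ m * S := by
    rw [derivative_mul, derivative_pow, ← hQ2]
    simp only [derivative_add, derivative_X, derivative_C, Nat.add_sub_cancel, C_eq_natCast]
    ring
  have hdvd : (X : R[X]) ^ l ∣ derivative ((X + C u) ^ (m + 1) * Q) - derivative W := by
    rw [hder]
    have h1 := modByMonic_add_div (V * derivative W) (X ^ l : R[X])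
    refine ⟨-((X + C u) ^ m * (V * derivative W /ₘ X ^ l)) - Z * derivative W, ?_⟩
    have h1' : S = V * derivative W - X ^ l * (V * derivative W /ₘ X ^ l) := by
      linear_combination h1
    rw [h1']; linear_combination derivative W * hVZ
  rw [X_pow_dvd_iff] at hdvd
  obtain ⟨i, rfl⟩ : ∃ j, i = j + 1 := ⟨i - 1, by omega⟩
  have := hdvd i (by omega)
  rw [coeff_sub, coeff_derivative, coeff_derivative, ← sub_mul] at this
  have hun := hunit (i + 1) (by omega) (by omega)
  push_cast at hun
  rw [hun.mul_left_eq_zero] at this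
  exact sub_eq_zero.1 this

lemma isUnit_cast_of_not_dvd {p N : ℕ} (hp : p.Prime) (x : ℤ) (hx : ¬ (p : ℤ) ∣ x) :
    IsUnit (x : ZMod (p ^ N)) := by
  have : IsCoprime x ((p ^ N : ℕ) : ℤ) := by
    push_cast
    exact ((Prime.coprime_iff_not_dvd (Nat.prime_iff_prime_int.1 hp)).2 hx).symm.pow_right
  obtain ⟨a, b, h⟩ := this
  have h2 := congrArg (Int.cast : ℤ → ZMod (p ^ N)) h
  push_cast at h2
  have h3 : (p : ZMod (p ^ N)) ^ N = 0 := by exact_mod_cast ZMod.natCast_self (p ^ N)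
  rw [h3, mul_zero, add_zero] at h2
  exact IsUnit.of_mul_eq_one _ ((mul_comm _ _).trans h2)

/-- Phases trivial on a class modulo `p ^ b` that restrict to arbitrary degree `l` phases on a
transversal class. -/
lemma exists_transversal_phase (p k l m b a B' N : ℕ) [NeZero p] (hp : p.Prime) (hpk : k < p)
    (hlm : l + m = k) (hN : l * (a + B') ≤ N)
    (h1 : l * (a + B') ≤ (m + 1) * b) (h2 : l * (a + B') ≤ (l + 1) * a) (x₀ x' : ℤ)
    (hx : ¬ (p : ℤ) ∣ x₀ - x') :
    ∃ (j : (Fin (l + 1) → ZMod (p ^ (l * B'))) → (Fin (k + 1) → ZMod (p ^ N)))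
      (u : (Fin (l + 1) → ZMod (p ^ (l * B'))) → ℂ), (∀ h, ‖u h‖ = 1) ∧
      (∀ h z, ph (j h) (x₀ + (p : ℤ) ^ a * z) = u h * ph h z) ∧
      ∀ h x, (p : ℤ) ^ b ∣ x - x' → ph (j h) x = 1 := by
  have hpN : ∀ e, N ≤ e → (p : (ZMod (p ^ N))) ^ e = 0 := by
    intro e he
    have : (p : (ZMod (p ^ N))) ^ N = 0 := by exact_mod_cast ZMod.natCast_self (p ^ N)
    rw [← Nat.add_sub_cancel' he, pow_add, this, zero_mul]
  have hunit : ∀ i ≤ l + m, 1 ≤ i → IsUnit (i : (ZMod (p ^ N))) := by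
    intro i hi hi1
    have := isUnit_cast_of_not_dvd (N := N) hp i (fun h => by
      have := Nat.le_of_dvd (by omega) (Int.natCast_dvd_natCast.1 h); omega)
    simpa using this
  let W : (Fin (l + 1) → ZMod (p ^ (l * B'))) → (ZMod (p ^ N))[X] := fun h => ∑ i : Fin (l + 1),
    C ((((h i).val : ℤ) : (ZMod (p ^ N))) * (p : (ZMod (p ^ N))) ^ (a * (l - i))) * X ^ (i : ℕ)
  choose Q hQdeg hQ using fun h => exists_factored_polynomial ((x₀ - x' : ℤ) : (ZMod (p ^ N)))
    (isUnit_cast_of_not_dvd hp _ hx) m l hunit (W h)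
  set G : (Fin (l + 1) → ZMod (p ^ (l * B'))) → (ZMod (p ^ N))[X] := fun h =>
    (X + C ((x₀ - x' : ℤ) : (ZMod (p ^ N)))) ^ (m + 1) * Q h
  set P : (Fin (l + 1) → ZMod (p ^ (l * B'))) → (ZMod (p ^ N))[X] := fun h =>
    C ((p : (ZMod (p ^ N))) ^ (N - l * (a + B'))) * (G h).comp (X - C (x₀ : (ZMod (p ^ N))))
  have hPdeg : ∀ h, (P h).natDegree ≤ k := by
    intro h
    refine (natDegree_C_mul_le _ _).trans (natDegree_comp_le.trans ?_)
    have hX := natDegree_X_sub_C_le (x₀ : (ZMod (p ^ N)))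
    have hG : (G h).natDegree ≤ k := by
      by_cases hQ0 : Q h = 0
      · simp [G, hQ0]
      · have := (natDegree_lt_iff_degree_lt hQ0).2 (hQdeg h)
        refine natDegree_mul_le.trans ?_
        have h3 : ((X + C ((x₀ - x' : ℤ) : (ZMod (p ^ N)))) ^ (m + 1)).natDegree ≤ (m + 1) * 1 :=
          natDegree_pow_le.trans (Nat.mul_le_mul_left _ (natDegree_add_C.le.trans natDegree_X_le))
        omega
    nlinarith
  have hPeval : ∀ h (x : ℤ), (P h).eval (x : (ZMod (p ^ N))) =
      (p : (ZMod (p ^ N))) ^ (N - l * (a + B')) * (G h).eval ((x - x₀ : ℤ) : (ZMod (p ^ N))) := by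
    intro h x; simp [P, eval_comp]
  have hWc : ∀ h (i : ℕ) (hi : i < l + 1), (W h).coeff i =
      (((h ⟨i, hi⟩).val : ℤ) : (ZMod (p ^ N))) * (p : (ZMod (p ^ N))) ^ (a * (l - i)) := by
    intro h i hi
    simp only [W, finsetSum_coeff, coeff_C_mul, coeff_X_pow]
    rw [sum_eq_single ⟨i, hi⟩]
    · simp
    · intro j _ hj
      rw [if_neg, mul_zero]
      intro h; apply hj; ext; exact h.symm
    · simp
  have hWev : ∀ h (z : ℤ), (W h).eval ((p : (ZMod (p ^ N))) ^ a * z) =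
      (p : (ZMod (p ^ N))) ^ (a * l) * ((∑ i, ((h i).val : ℤ) * z ^ (i : ℕ) : ℤ) : (ZMod (p ^ N))) := by
    intro h z
    simp only [W, eval_finsetSum, eval_mul, eval_C, eval_pow, eval_X]
    push_cast
    rw [mul_sum]
    refine sum_congr rfl fun i _ => ?_
    have hi : (i : ℕ) ≤ l := by omega
    have : (p : (ZMod (p ^ N))) ^ (a * l) = p ^ (a * (l - i)) * (p ^ a) ^ (i : ℕ) := by
      rw [← pow_mul, ← pow_add, ← mul_add, Nat.sub_add_cancel hi]
    rw [this]; ring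
  refine ⟨fun h i => (P h).coeff i, fun h => ZMod.stdAddChar
    ((p : (ZMod (p ^ N))) ^ (N - l * (a + B')) * ((G h).coeff 0 - (W h).coeff 0)),
    fun h => norm_stdAddChar _, fun h z => ?_, fun h x hx => ?_⟩
  · rw [ph_coeff _ (hPdeg h), hPeval, ph_int,
      ← stdAddChar_scale (q := p ^ (N - l * B')) (n := p ^ N)
        (by rw [← pow_add, Nat.sub_add_cancel]; nlinarith), ← AddChar.map_add_eq_mul]
    congr 1
    have hdvd : (X : (ZMod (p ^ N))[X]) ^ (l + 1) ∣ G h - W h - C ((G h).coeff 0 - (W h).coeff 0) := by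
      rw [X_pow_dvd_iff]
      intro i hi
      rw [coeff_sub, coeff_sub]
      rcases Nat.eq_zero_or_pos i with rfl | hi0
      · simp
      · rw [hQ h i hi0 (by omega), coeff_C, if_neg (by omega)]; simp
    obtain ⟨Y, hY⟩ := hdvd
    have hY2 := congrArg (eval ((p : (ZMod (p ^ N))) ^ a * z)) hY
    simp only [eval_sub, eval_mul, eval_C, eval_pow, eval_X, hWev] at hY2
    have e1 : ((x₀ + (p : ℤ) ^ a * z - x₀ : ℤ) : (ZMod (p ^ N))) = (p : (ZMod (p ^ N))) ^ a * z := by push_cast; ring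
    rw [e1]
    have e2 : eval ((p : (ZMod (p ^ N))) ^ a * z) (G h) = ((p : (ZMod (p ^ N))) ^ (a * l) *
      ((∑ i, ((h i).val : ℤ) * z ^ (i : ℕ) : ℤ) : (ZMod (p ^ N)))) + ((G h).coeff 0 - (W h).coeff 0) +
      ((p : (ZMod (p ^ N))) ^ a * z) ^ (l + 1) * eval ((p : (ZMod (p ^ N))) ^ a * z) Y := by
      linear_combination hY2
    have e3 : (p : (ZMod (p ^ N))) ^ (N - l * (a + B')) * ((p : (ZMod (p ^ N))) ^ a * z) ^ (l + 1) = 0 := by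
      rw [mul_pow, ← mul_assoc, ← pow_mul, ← pow_add, hpN, zero_mul]
      nlinarith [Nat.sub_add_cancel hN]
    have e4 : (p : (ZMod (p ^ N))) ^ (N - l * B') = (p : (ZMod (p ^ N))) ^ (N - l * (a + B')) * (p : (ZMod (p ^ N))) ^ (a * l) := by
      rw [← pow_add]; congr 1
      have := Nat.sub_add_cancel hN
      have : l * (a + B') = a * l + l * B' := by ring
      omega
    rw [e2]
    push_cast at e4 ⊢
    rw [e4]
    linear_combination eval ((p : (ZMod (p ^ N))) ^ a * z) Y * e3
  · rw [ph_coeff _ (hPdeg h), hPeval]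
    have : (p : (ZMod (p ^ N))) ^ (N - l * (a + B')) * (G h).eval ((x - x₀ : ℤ) : (ZMod (p ^ N))) = 0 := by
      obtain ⟨w, hw⟩ := hx
      have e : ((x - x₀ : ℤ) : (ZMod (p ^ N))) + ((x₀ - x' : ℤ) : (ZMod (p ^ N))) = (p : (ZMod (p ^ N))) ^ b * w := by
        have := congrArg (Int.cast : ℤ → (ZMod (p ^ N))) hw
        push_cast at this ⊢
        linear_combination this
      simp only [G, eval_mul, eval_pow, eval_add, eval_X, eval_C]
      rw [e, mul_pow, ← pow_mul, ← mul_assoc, ← mul_assoc, ← pow_add, hpN, zero_mul, zero_mul]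
      nlinarith [Nat.sub_add_cancel hN]
    rw [this, AddChar.map_zero_eq_one]

end PadicDecoupling

namespace PadicDecoupling

/-- The absolute value of the exponential sum over a class modulo `p ^ a`. -/
noncomputable def nF (p k B : ℕ) [NeZero p] (A : ℤ → ℂ) (T : Finset ℤ) (a : ℕ) (x : ℤ)
    (c : Fin (k + 1) → ZMod (p ^ (k * B))) : ℝ := ‖ES A (cls T ((p : ℤ) ^ a) x) c‖

lemma nF_nonneg {p k B : ℕ} [NeZero p] {A : ℤ → ℂ} {T : Finset ℤ} {a : ℕ} {x : ℤ}
    {c : Fin (k + 1) → ZMod (p ^ (k * B))} : 0 ≤ nF p k B A T a x c := norm_nonneg _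

/-- Decoupling a class mod `p ^ a` into classes mod `p ^ c`, against weights from a transversal
class mod `p ^ b`. -/
def Good (p k B : ℕ) [NeZero p] (A : ℤ → ℂ) (T : Finset ℤ) (ν : ℕ → ℤ → ℝ) (l b a c : ℕ)
    (Λ : ℝ) : Prop :=
  ∀ x₀ x' : ℤ, ¬ (p : ℤ) ∣ x₀ - x' → ∀ M : ℝ, 0 ≤ M →
    (∀ x, (p : ℤ) ^ a ∣ x - x₀ → avg (fun c' => nF p k B A T b x' c' ^ (2 * (rr k - rr l)) *
      nF p k B A T c x c' ^ (2 * rr l)) ≤ M * ν c x ^ rr l) →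
    avg (fun c' => nF p k B A T b x' c' ^ (2 * (rr k - rr l)) *
      nF p k B A T a x₀ c' ^ (2 * rr l)) ≤ Λ ^ rr l * (M * ν a x₀ ^ rr l)

section
variable {p k B : ℕ} [NeZero p] {A : ℤ → ℂ} {T : Finset ℤ} {ν : ℕ → ℤ → ℝ} {l b a c : ℕ}

lemma not_dvd_of_pow_dvd {p : ℕ} {a : ℕ} (ha : 1 ≤ a) {x x₀ x' : ℤ} (h : ¬ (p : ℤ) ∣ x₀ - x')
    (hx : (p : ℤ) ^ a ∣ x - x₀) : ¬ (p : ℤ) ∣ x - x' := by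
  intro h2
  have h3 : (p : ℤ) ∣ x - x₀ := (dvd_pow_self _ (by omega)).trans hx
  apply h
  have := dvd_sub h2 h3
  simpa using this

lemma Good.comp {a' : ℕ} {Λ₁ Λ₂ : ℝ} (h₁ : Good p k B A T ν l b a a' Λ₁)
    (h₂ : Good p k B A T ν l b a' c Λ₂) (ha : 1 ≤ a) (haa' : a ≤ a') (hΛ : 0 ≤ Λ₂) :
    Good p k B A T ν l b a c (Λ₁ * Λ₂) := by
  intro x₀ x' hx M hM h
  refine (h₁ x₀ x' hx (Λ₂ ^ rr l * M) (by positivity) fun x hxx => ?_).trans (le_of_eq ?_)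
  · refine (h₂ x x' (not_dvd_of_pow_dvd ha hx hxx) M hM fun y hy => h y ?_).trans
      (le_of_eq (by ring))
    have := dvd_add ((pow_dvd_pow (p : ℤ) haa').trans hy) hxx
    simpa using this
  · ring

lemma Good.mono (hν : IsTree p B ν) {Λ Λ' : ℝ} (h : Good p k B A T ν l b a c Λ) (h0 : 0 ≤ Λ)
    (hΛ : Λ ≤ Λ') : Good p k B A T ν l b a c Λ' := by
  intro x₀ x' hx M hM hh
  refine (h x₀ x' hx M hM hh).trans ?_
  have := (hν.pos a x₀).le
  gcongr

lemma Good.of_trivial (hν : IsTree p B ν) (hl : 1 ≤ l) (hac : a ≤ c) (hc : c ≤ B) :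
    Good p k B A T ν l b a c ((p : ℝ) ^ (c - a)) := by
  intro x₀ x' _ M hM h
  obtain ⟨n, rfl⟩ := Nat.exists_eq_add_of_le hac
  rw [Nat.add_sub_cancel_left]
  refine trivial_step (p := p) (q := p ^ (k * B)) (K := k) (B := B)
    (fun c' => nF p k B A T b x' c' ^ (2 * (rr k - rr l)))
    (fun c' => by have := @nF_nonneg p k B _ A T b x' c'; positivity) x₀ a n A T hν hc
    (rr_pos hl) fun t => h _ ?_
  exact ⟨t, by ring⟩

lemma Good.of_dec {m B' : ℕ} (hp : p.Prime) (hpk : k < p) (hlm : l + m = k) (hl : 1 ≤ l)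
    (hν : IsTree p B ν) {D : ℝ} (hD : Dec p l B' D) (hD0 : 0 ≤ D) (hB : a + B' ≤ B)
    (h1 : l * (a + B') ≤ (m + 1) * b) (h2 : l * (a + B') ≤ (l + 1) * a) :
    Good p k B A T ν l b a (a + B') D := by
  intro x₀ x' hx M hM h
  obtain ⟨j, u, hu, hj, hjw⟩ := exists_transversal_phase p k l m b a B' (k * B) hp hpk hlm
    (Nat.mul_le_mul (by omega) hB) h1 h2 x₀ x' hx
  refine hD.step hl hD0 (fun c' => nF p k B A T b x' c' ^ (2 * (rr k - rr l)))
    (fun c' => by have := @nF_nonneg p k B _ A T b x' c'; positivity) j ?_ x₀ a u hu hj A T hν hB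
    fun t => h _ ⟨t, by ring⟩
  intro c' h'
  simp only [nF]
  congr 2
  simp only [ES]
  refine sum_congr rfl fun x hx' => ?_
  rw [ph_add, hjw h' x (mem_filter.1 hx').2, mul_one]

end

/-- Subexponential decoupling constants. -/
def SubExp (p d : ℕ) [NeZero p] (η : ℝ) : Prop :=
  ∃ C : ℝ, 0 < C ∧ ∀ B, Dec p d B (C * (p : ℝ) ^ (η * B))

lemma exists_good (p k l m : ℕ) [NeZero p] (hp : p.Prime) (hpk : k < p) (hlm : l + m = k)
    (hl : 1 ≤ l) (hsub : ∀ ε > 0, SubExp p l ε) (ε : ℝ) (hε : 0 < ε) :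
    ∃ C : ℝ, 0 < C ∧ ∀ (B : ℕ) (A : ℤ → ℂ) (T : Finset ℤ) (ν : ℕ → ℤ → ℝ), IsTree p B ν →
      ∀ a b c : ℕ, 1 ≤ a → a ≤ c → c ≤ B → l * c ≤ (m + 1) * b →
        Good p k B A T ν l b a c (C * (p : ℝ) ^ (ε * B)) := by
  have hp1 : (1 : ℝ) < p := by exact_mod_cast hp.one_lt
  have hp0 : (0 : ℝ) < p := by linarith
  obtain ⟨C₀, hC₀, hC⟩ := hsub (ε / 2) (by positivity)
  obtain ⟨B₀, hB₀⟩ : ∃ B₀ : ℕ, 1 ≤ B₀ ∧ C₀ ≤ (p : ℝ) ^ (ε / 2 * B₀) := by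
    have h1 : (1 : ℝ) < (p : ℝ) ^ (ε / 2) := Real.one_lt_rpow hp1 (by positivity)
    obtain ⟨n, hn⟩ := pow_unbounded_of_one_lt C₀ h1
    refine ⟨n + 1, by omega, hn.le.trans ?_⟩
    rw [← Real.rpow_natCast, ← Real.rpow_mul hp0.le]
    exact Real.rpow_le_rpow_of_exponent_le hp1.le
      (mul_le_mul_of_nonneg_left (by push_cast; linarith) (by positivity))
  obtain ⟨hB1, hB₀⟩ := hB₀
  have hdec : ∀ B', B₀ ≤ B' → Dec p l B' ((p : ℝ) ^ (ε * B')) := by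
    intro B' hB'
    refine (hC B').mono (by positivity) ?_
    calc C₀ * (p : ℝ) ^ (ε / 2 * B') ≤ (p : ℝ) ^ (ε / 2 * B') * (p : ℝ) ^ (ε / 2 * B') := by
          refine mul_le_mul_of_nonneg_right (hB₀.trans ?_) (by positivity)
          have : (B₀ : ℝ) ≤ B' := by exact_mod_cast hB'
          exact Real.rpow_le_rpow_of_exponent_le hp1.le (by gcongr)
      _ = _ := by rw [← Real.rpow_add hp0]; ring_nf
  refine ⟨(p : ℝ) ^ (l * B₀ + B₀), by positivity, ?_⟩
  intro B A T ν hν a b c ha hac hcB hcb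
  have main : ∀ n a, 1 ≤ a → a ≤ c → c - a = n → l * B₀ ≤ a →
      Good p k B A T ν l b a c ((p : ℝ) ^ B₀ * (p : ℝ) ^ (ε * n)) := by
    intro n
    induction n using Nat.strong_induction_on with
    | _ n ih =>
      intro a ha hac hn hla
      have hpe : (1 : ℝ) ≤ (p : ℝ) ^ (ε * n) := Real.one_le_rpow hp1.le (by positivity)
      have hpB : (1 : ℝ) ≤ (p : ℝ) ^ B₀ := one_le_pow₀ hp1.le
      by_cases h1 : n < B₀
      · refine (Good.of_trivial hν hl hac hcB).mono hν (by positivity) ?_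
        calc (p : ℝ) ^ (c - a) ≤ (p : ℝ) ^ B₀ := pow_le_pow_right₀ hp1.le (by omega)
          _ ≤ _ := le_mul_of_one_le_right (by positivity) hpe
      · by_cases h2 : l * c ≤ (l + 1) * a
        · obtain rfl : c = a + n := by omega
          refine (Good.of_dec hp hpk hlm hl hν (hdec n (by omega)) (by positivity) hcB hcb
            h2).mono hν (by positivity) ?_
          exact le_mul_of_one_le_left (by positivity) hpB
        · set s := a / l
          have hs : B₀ ≤ s := (Nat.le_div_iff_mul_le hl).2 (by linarith [mul_comm l B₀])
          have hsl : l * s ≤ a := Nat.mul_div_le a l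
          have hac' : a + s ≤ c := by
            by_contra hcon
            apply h2
            push Not at hcon h2
            nlinarith
          have hst : l * (a + s) ≤ (l + 1) * a := by nlinarith
          have g1 := Good.of_dec (A := A) (T := T) (b := b) hp hpk hlm hl hν (hdec s hs)
            (by positivity) (hac'.trans hcB) ((Nat.mul_le_mul_left l hac').trans hcb) hst
          have g2 := ih (n - s) (by omega) (a + s) (by omega) hac' (by omega)
            (hla.trans (by omega))
          refine (g1.comp g2 ha (by omega) (by positivity)).mono hν (by positivity) (le_of_eq ?_)
          have hsn : s ≤ n := by omega
          rw [mul_left_comm, ← Real.rpow_add hp0]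
          congr 2
          push_cast [Nat.cast_sub hsn]; ring
  have hfin : ∀ n : ℕ, n ≤ B → (p : ℝ) ^ (ε * n) ≤ (p : ℝ) ^ (ε * B) := fun n hn =>
    Real.rpow_le_rpow_of_exponent_le hp1.le (by
      have : (n : ℝ) ≤ B := by exact_mod_cast hn
      gcongr)
  by_cases h : l * B₀ ≤ a
  · refine (main (c - a) a ha hac rfl h).mono hν (by positivity) ?_
    exact mul_le_mul (pow_le_pow_right₀ hp1.le (by omega)) (hfin _ (by omega)) (by positivity)
      (by positivity)
  · have hpe : (1 : ℝ) ≤ (p : ℝ) ^ (ε * B) := Real.one_le_rpow hp1.le (by positivity)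
    by_cases h2 : l * B₀ ≤ c
    · have g1 := Good.of_trivial (p := p) (k := k) (B := B) (A := A) (T := T) (l := l) (b := b)
        hν hl (show a ≤ l * B₀ by omega) (h2.trans hcB)
      have g2 := main (c - l * B₀) (l * B₀) (by nlinarith) h2 rfl le_rfl
      refine (g1.comp g2 ha (by omega) (by positivity)).mono hν (by positivity) ?_
      rw [← mul_assoc, ← pow_add]
      exact mul_le_mul (pow_le_pow_right₀ hp1.le (by omega)) (hfin _ (by omega)) (by positivity)
        (by positivity)
    · refine (Good.of_trivial hν hl hac hcB).mono hν (by positivity) ?_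
      exact (pow_le_pow_right₀ hp1.le (by omega)).trans
        (le_mul_of_one_le_right (by positivity) hpe)

lemma avg_le_of_interpolation {G : Type*} [Fintype G] [Nonempty G] {f g h : G → ℝ} {α β n : ℕ}
    (hn : α + β = n) (hn0 : 1 ≤ n) (hf : ∀ x, 0 ≤ f x) (hg : ∀ x, 0 ≤ g x)
    (hfg : ∀ x, h x ^ n ≤ f x ^ α * g x ^ β) {X Y H : ℝ} (hX : 0 < X) (hY : 0 < Y) (hH : 0 < H)
    (hfX : avg f ≤ X) (hgY : avg g ≤ Y) (hXY : X ^ α * Y ^ β ≤ H ^ n) : avg h ≤ H := by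
  have hnR : (0 : ℝ) < n := by exact_mod_cast hn0
  have key : ∀ x, h x ≤ H * (α / n / X * f x + β / n / Y * g x) := by
    intro x
    have h1 : (h x / H) ^ n ≤ (f x / X) ^ α * (g x / Y) ^ β := by
      rw [div_pow, div_pow, div_pow, div_mul_div_comm]
      exact div_le_div₀ (mul_nonneg (pow_nonneg (hf x) _) (pow_nonneg (hg x) _)) (hfg x)
        (by positivity) hXY
    have h2 := Real.geom_mean_le_arith_mean2_weighted (w₁ := α / n) (w₂ := β / n)
      (p₁ := f x / X) (p₂ := g x / Y) (by positivity) (by positivity)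
      (div_nonneg (hf x) hX.le) (div_nonneg (hg x) hY.le)
      (by rw [← add_div, ← Nat.cast_add, hn]; exact div_self hnR.ne')
    have h3 : h x / H ≤ (f x / X) ^ ((α : ℝ) / n) * (g x / Y) ^ ((β : ℝ) / n) := by
      have hfx := div_nonneg (hf x) hX.le
      have hgx := div_nonneg (hg x) hY.le
      refine le_of_pow_le_pow_left₀ (n := n) (by omega) (by positivity) (h1.trans (le_of_eq ?_))
      rw [mul_pow, ← Real.rpow_mul_natCast hfx, ← Real.rpow_mul_natCast hgx,
        div_mul_cancel₀ _ hnR.ne', div_mul_cancel₀ _ hnR.ne', Real.rpow_natCast, Real.rpow_natCast]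
    have h4 := h3.trans h2
    rw [div_le_iff₀ hH] at h4
    refine h4.trans (le_of_eq ?_)
    ring
  refine (avg_mono key).trans ?_
  rw [avg_const_mul, avg_add, avg_const_mul, avg_const_mul]
  have h1 : (α : ℝ) / n / X * avg f ≤ α / n := by
    rw [div_mul_eq_mul_div, div_le_iff₀ hX]
    exact mul_le_mul_of_nonneg_left hfX (by positivity)
  have h2 : (β : ℝ) / n / Y * avg g ≤ β / n := by
    rw [div_mul_eq_mul_div, div_le_iff₀ hY]
    exact mul_le_mul_of_nonneg_left hgY (by positivity)
  have h3 : (α : ℝ) / n + β / n = 1 := by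
    rw [← add_div, ← Nat.cast_add, hn]; exact div_self hnR.ne'
  nlinarith

lemma rr_succ (d : ℕ) : rr (d + 1) = rr d + (d + 1) := by
  have h1 := two_mul_rr d; have h2 := two_mul_rr (d + 1); nlinarith

lemma rr_mono {l k : ℕ} (h : l ≤ k) : rr l ≤ rr k := by
  have h1 := two_mul_rr l; have h2 := two_mul_rr k; nlinarith

lemma rr_lt {l k : ℕ} (h : l < k) : rr l < rr k := by
  have h1 := two_mul_rr l; have h2 := two_mul_rr k; nlinarith

/-- Leaf bounds for the decoupling tree. -/
structure Leafy (p k B : ℕ) [NeZero p] (A : ℤ → ℂ) (T : Finset ℤ) (ν : ℕ → ℤ → ℝ) : Prop where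
  tree : IsTree p B ν
  leaf : ∀ x, avg (fun c => nF p k B A T B x c ^ (2 * rr k)) ≤ ν B x ^ rr k

/-- Bilinear bounds over transversal classes. -/
def Bil (p k B : ℕ) [NeZero p] (A : ℤ → ℂ) (T : Finset ℤ) (ν : ℕ → ℤ → ℝ) (l a b : ℕ)
    (M : ℝ) : Prop :=
  ∀ x₀ x' : ℤ, ¬ (p : ℤ) ∣ x₀ - x' → avg (fun c => nF p k B A T a x₀ c ^ (2 * rr l) *
      nF p k B A T b x' c ^ (2 * (rr k - rr l))) ≤
    M ^ rr k * (ν a x₀ ^ rr l * ν b x' ^ (rr k - rr l))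

section
variable {p k B : ℕ} [NeZero p] {A : ℤ → ℂ} {T : Finset ℤ} {ν : ℕ → ℤ → ℝ} {l b a c : ℕ}

lemma Leafy.single (h : Leafy p k B A T ν) (hk : 1 ≤ k) (ha : a ≤ B) {D : ℝ} (hD0 : 0 ≤ D)
    (hD : Dec p k (B - a) D) (x : ℤ) :
    avg (fun c => nF p k B A T a x c ^ (2 * rr k)) ≤ (D * ν a x) ^ rr k := by
  obtain ⟨j, hj⟩ := exists_rescale p k B a ha x
  have := hD.step (K := k) (q := p ^ (k * B)) (B := B) hk hD0 (fun _ => 1) (fun _ => zero_le_one) j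
    (fun _ _ => rfl) x a (fun _ => 1) (by simp) (fun h z => by rw [hj, one_mul]) A T h.tree
    (by omega) (M := 1) (fun t => by
      have := h.leaf (x + (p : ℤ) ^ a * t)
      simp only [one_mul, Nat.add_sub_cancel' ha]
      exact this)
  simp only [one_mul] at this
  rw [mul_pow]
  exact this

lemma Bil.of_good {Λ M : ℝ} (hg : Good p k B A T ν l b a c Λ) (hb : Bil p k B A T ν l c b M)
    (hν : IsTree p B ν) (hΛ : 1 ≤ Λ) (hM : 0 ≤ M) (hlk : l ≤ k) (ha : 1 ≤ a) :
    Bil p k B A T ν l a b (Λ * M) := by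
  intro x₀ x' hx
  have h1 := (hν.pos a x₀).le
  have h2 := (hν.pos b x').le
  have := hg x₀ x' hx (M ^ rr k * ν b x' ^ (rr k - rr l)) (by positivity) fun x hxx => by
    refine le_trans (le_of_eq ?_) ((hb x x' (not_dvd_of_pow_dvd ha hx hxx)).trans (le_of_eq ?_))
    · simp only [mul_comm]
    · ring
  calc _ = _ := by simp only [mul_comm]
    _ ≤ _ := this
    _ ≤ Λ ^ rr k * (M ^ rr k * ν b x' ^ (rr k - rr l) * ν a x₀ ^ rr l) := by
        refine mul_le_mul_of_nonneg_right (pow_le_pow_right₀ hΛ (rr_mono hlk)) (by positivity)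
    _ = _ := by ring

lemma Bil.interpolate (hν : IsTree p B ν) (hl : 1 ≤ l) (hlk : l < k) {M M₁ M₂ : ℝ}
    (h₁ : Bil p k B A T ν (k - l) b a M₁) (h₂ : Bil p k B A T ν (l - 1) a b M₂)
    (hM₁ : 0 < M₁) (hM₂ : 0 < M₂) (hM : 0 < M) (hMM : M₁ * M₂ ^ (k - l) ≤ M ^ (k - l + 1)) :
    Bil p k B A T ν l a b M := by
  intro x₀ x' hx
  have hx' : ¬ (p : ℤ) ∣ x' - x₀ := fun h => hx (by simpa using (dvd_neg.2 h))
  have p1 := hν.pos a x₀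
  have p2 := hν.pos b x'
  obtain ⟨l, rfl⟩ : ∃ i, l = i + 1 := ⟨l - 1, by omega⟩
  obtain ⟨m, rfl⟩ : ∃ m, k = l + 1 + m := ⟨k - (l + 1), by omega⟩
  simp only [Nat.add_sub_cancel_left, Nat.add_sub_cancel] at *
  obtain ⟨e, he⟩ : ∃ e, rr (l + 1 + m) = rr m + e :=
    ⟨_, (Nat.add_sub_cancel' (rr_mono (by omega))).symm⟩
  obtain ⟨g, hg⟩ : ∃ g, rr (l + 1 + m) = rr (l + 1) + g :=
    ⟨_, (Nat.add_sub_cancel' (rr_mono (by omega))).symm⟩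
  have hs := rr_succ l
  have t1 := two_mul_rr l
  have t2 := two_mul_rr m
  have t3 := two_mul_rr (l + 1 + m)
  have hg' : rr (l + 1 + m) = rr l + (g + (l + 1)) := by omega
  have E1 : (m + 1) * rr (l + 1) = e + m * rr l := by nlinarith
  have E2 : (m + 1) * g = rr m + m * (g + (l + 1)) := by nlinarith
  have s1 : rr (l + 1 + m) - rr m = e := by omega
  have s2 : rr (l + 1 + m) - rr (l + 1) = g := by omega
  have s3 : rr (l + 1 + m) - rr l = g + (l + 1) := by omega
  have h1 := h₁ x' x₀ hx'
  have h2 := h₂ x₀ x' hx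
  rw [s1] at h1; rw [s3] at h2; rw [s2]
  have pw : ∀ F G : ℝ, (F ^ rr (l + 1) * G ^ g) ^ (m + 1) =
      (G ^ rr m * F ^ e) ^ 1 * (F ^ rr l * G ^ (g + (l + 1))) ^ m := by
    intro F G
    rw [pow_one, mul_pow, mul_pow, ← pow_mul, ← pow_mul, ← pow_mul, ← pow_mul, mul_comm _ (m + 1),
      mul_comm _ (m + 1), E1, E2, pow_add, pow_add, mul_comm _ m, mul_comm _ m]
    ring
  refine avg_le_of_interpolation (α := 1) (β := m) (n := m + 1) (by ring) (by omega) ?_ ?_ ?_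
    (X := M₁ ^ rr (l + 1 + m) * (ν b x' ^ rr m * ν a x₀ ^ e))
    (Y := M₂ ^ rr (l + 1 + m) * (ν a x₀ ^ rr l * ν b x' ^ (g + (l + 1))))
    (by positivity) (by positivity) (by positivity) h1 h2 ?_
  · intro x; have := @nF_nonneg p (l + 1 + m) B _ A T b x' x
    have := @nF_nonneg p (l + 1 + m) B _ A T a x₀ x; positivity
  · intro x; have := @nF_nonneg p (l + 1 + m) B _ A T b x' x
    have := @nF_nonneg p (l + 1 + m) B _ A T a x₀ x; positivity
  · intro x
    refine le_of_eq ?_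
    simp only [pow_mul]
    exact pw _ _
  · calc _ = (M₁ * M₂ ^ m) ^ rr (l + 1 + m) * ((ν b x' ^ rr m * ν a x₀ ^ e) ^ 1 *
          (ν a x₀ ^ rr l * ν b x' ^ (g + (l + 1))) ^ m) := by ring
      _ ≤ (M ^ (m + 1)) ^ rr (l + 1 + m) * ((ν b x' ^ rr m * ν a x₀ ^ e) ^ 1 *
          (ν a x₀ ^ rr l * ν b x' ^ (g + (l + 1))) ^ m) := by gcongr
      _ = _ := by rw [← pw]; ring

lemma Bil.of_single (hν : IsTree p B ν) (hk : 1 ≤ k) (hlk : l ≤ k) {D : ℝ} (hD : 0 < D)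
    (h : ∀ x, avg (fun c => nF p k B A T a x c ^ (2 * rr k)) ≤ (D * ν a x) ^ rr k)
    (h' : ∀ x, avg (fun c => nF p k B A T b x c ^ (2 * rr k)) ≤ (D * ν b x) ^ rr k) :
    Bil p k B A T ν l a b D := by
  intro x₀ x' _
  have p1 := hν.pos a x₀
  have p2 := hν.pos b x'
  have hr := rr_mono hlk
  have hr' : rr l + (rr k - rr l) = rr k := Nat.add_sub_cancel' hr
  refine avg_le_of_interpolation (α := rr l) (β := rr k - rr l) (n := rr k) hr' (rr_pos hk)
    ?_ ?_ ?_ (X := (D * ν a x₀) ^ rr k) (Y := (D * ν b x') ^ rr k) (by positivity)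
    (by positivity) (by positivity) (h x₀) (h' x') ?_
  · intro x; have := @nF_nonneg p k B _ A T a x₀ x; positivity
  · intro x; have := @nF_nonneg p k B _ A T b x' x; positivity
  · intro x; refine le_of_eq ?_; simp only [mul_pow, ← pow_mul]; congr 2 <;> ring
  · refine le_of_eq ?_
    rw [← pow_mul, ← pow_mul, mul_pow, mul_pow, mul_pow, mul_pow, ← pow_mul, ← pow_mul, ← pow_mul,
      mul_mul_mul_comm, ← pow_add, ← mul_add, hr', mul_comm (rr k) (rr l),
      mul_comm (rr k) (rr k - rr l)]

end

/-- Exponent gains in the iteration. -/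
noncomputable def gain (k : ℕ) : ℕ → ℕ → ℝ
  | 0, l => if l = 0 then 1 else 0
  | m + 1, l => if l = 0 then 1 else
      gain k m (k - l) / l + gain k m (l - 1) * ((k : ℝ) - l) / ((k : ℝ) - l + 1)

lemma gain_zero (k m : ℕ) : gain k m 0 = 1 := by cases m <;> simp [gain]

lemma sum_gain (K m : ℕ) :
    ∑ i ∈ range K, gain (K + 1) m (i + 1) = m * (K / (K + 1 : ℝ)) := by
  induction m with
  | zero => simp [gain]
  | succ m ih =>
    set g : ℕ → ℝ := fun i => gain (K + 1) m i * ((K : ℝ) - i) / ((K : ℝ) - i + 1) with hg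
    have h1 : ∑ i ∈ range K, g i = ∑ i ∈ range K, g (i + 1) + K / (K + 1 : ℝ) := by
      have e := sum_range_succ g K
      rw [sum_range_succ'] at e
      have e1 : g K = 0 := by simp [hg]
      have e2 : g 0 = K / (K + 1 : ℝ) := by simp [hg, gain_zero]
      rw [e1, e2] at e; linarith
    have h2 : ∑ i ∈ range K, gain (K + 1) m (K - i) / ((i : ℝ) + 1) =
        ∑ i ∈ range K, gain (K + 1) m (i + 1) / ((K : ℝ) - i) := by
      rw [← sum_range_reflect]
      refine sum_congr rfl fun i hi => ?_
      rw [mem_range] at hi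
      rw [show K - (K - 1 - i) = i + 1 by omega]
      congr 1
      rw [show K - 1 - i = K - (i + 1) by omega, Nat.cast_sub (by omega)]
      push_cast; ring
    have h3 : ∀ i ∈ range K, gain (K + 1) (m + 1) (i + 1) =
        gain (K + 1) m (K - i) / ((i : ℝ) + 1) + g i := by
      intro i _
      simp only [gain, hg, Nat.add_eq_zero_iff, one_ne_zero, and_false, if_false,
        Nat.add_sub_cancel]
      rw [show K + 1 - (i + 1) = K - i by omega]
      push_cast
      congr 1
      congr 1 <;> ring
    rw [sum_congr rfl h3, sum_add_distrib, h1, h2, ← add_assoc, ← sum_add_distrib]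
    have h4 : ∀ i ∈ range K, gain (K + 1) m (i + 1) / ((K : ℝ) - i) + g (i + 1) =
        gain (K + 1) m (i + 1) := by
      intro i hi
      rw [mem_range] at hi
      have : (0 : ℝ) < (K : ℝ) - i := by
        have : (i : ℝ) < K := by exact_mod_cast hi
        linarith
      simp only [hg]
      push_cast
      rw [show (K : ℝ) - (i + 1) + 1 = K - i by ring]
      field_simp
      ring
    rw [sum_congr rfl h4, ih]; push_cast; ring

lemma exists_large_gain (k m : ℕ) (hk : 2 ≤ k) :
    ∃ l, 1 ≤ l ∧ l < k ∧ (m : ℝ) / k ≤ gain k m l := by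
  obtain ⟨K, rfl⟩ : ∃ K, k = K + 1 := ⟨k - 1, by omega⟩
  have hK : (0 : ℝ) < K := by exact_mod_cast (show 0 < K by omega)
  by_contra! h
  have := sum_lt_sum_of_nonempty (s := range K) ⟨0, mem_range.2 (by omega)⟩
    (fun i hi => h (i + 1) (by omega) (by rw [mem_range] at hi; omega))
  rw [sum_gain, sum_const, card_range, nsmul_eq_mul] at this
  push_cast at this
  have e : (m : ℝ) * (K / (K + 1)) = K * (m / (K + 1)) := by ring
  linarith

lemma Bil.mono {p k B : ℕ} [NeZero p] {A : ℤ → ℂ} {T : Finset ℤ} {ν : ℕ → ℤ → ℝ} {l b a : ℕ}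
    {M M' : ℝ} (h : Bil p k B A T ν l a b M) (hν : IsTree p B ν) (h0 : 0 ≤ M) (hM : M ≤ M') :
    Bil p k B A T ν l a b M' := by
  intro x₀ x' hx
  refine (h x₀ x' hx).trans ?_
  have h1 := (hν.pos a x₀).le
  have h2 := (hν.pos b x').le
  gcongr

theorem bil_iterate (p k : ℕ) [NeZero p] (hp : p.Prime) (hpk : k < p)
    (hsub : ∀ l, 1 ≤ l → l < k → ∀ ε > 0, SubExp p l ε) {η : ℝ} (hη : 0 ≤ η) (hsη : SubExp p k η)
    (m : ℕ) : ∀ l, l < k → ∀ ε : ℝ, 0 < ε → ∃ C : ℝ, 1 ≤ C ∧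
      ∀ (B : ℕ) (A : ℤ → ℂ) (T : Finset ℤ) (ν : ℕ → ℤ → ℝ), Leafy p k B A T ν →
        ∀ a b : ℕ, 1 ≤ a → a ≤ B → k.factorial ^ m ∣ b → b * k ^ m ≤ B →
          l * a ≤ (k - l + 1) * b →
          Bil p k B A T ν l a b (C * (p : ℝ) ^ ((η + ε) * B - η * gain k m l * b)) := by
  have hp1 : (1 : ℝ) < p := by exact_mod_cast hp.one_lt
  have hp0 : (0 : ℝ) < p := by linarith
  obtain ⟨C₀, hC₀, hC⟩ := hsη
  have hbB : ∀ {m b B : ℕ}, 1 ≤ k → b * k ^ m ≤ B → b ≤ B := fun hk h =>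
    (Nat.le_mul_of_pos_right _ (Nat.pos_of_ne_zero (pow_ne_zero _ (by omega)))).trans h
  have base : ∀ m, ∀ ε : ℝ, 0 < ε → 0 < k → ∃ C : ℝ, 1 ≤ C ∧
      ∀ (B : ℕ) (A : ℤ → ℂ) (T : Finset ℤ) (ν : ℕ → ℤ → ℝ), Leafy p k B A T ν →
        ∀ a b : ℕ, 1 ≤ a → a ≤ B → k.factorial ^ m ∣ b → b * k ^ m ≤ B →
          0 * a ≤ (k - 0 + 1) * b →
          Bil p k B A T ν 0 a b (C * (p : ℝ) ^ ((η + ε) * B - η * gain k m 0 * b)) := by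
    intro m ε hε hk
    refine ⟨max C₀ 1, le_max_right _ _, ?_⟩
    intro B A T ν hL a b ha haB hdvd hbk _ x₀ x' hx
    have hb := hbB hk hbk
    have h1 := hL.single hk hb (by positivity) (hC (B - b)) x'
    have h0 : rr 0 = 0 := rfl
    simp only [h0, mul_zero, pow_zero, one_mul, Nat.sub_zero]
    refine h1.trans ?_
    rw [← mul_pow]
    have hpos := (hL.tree.pos b x').le
    refine pow_le_pow_left₀ (by positivity) (mul_le_mul_of_nonneg_right ?_ hpos) _
    refine mul_le_mul (le_max_left _ _) ?_ (by positivity) (by positivity)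
    refine Real.rpow_le_rpow_of_exponent_le hp1.le ?_
    rw [gain_zero, Nat.cast_sub hb]
    have : (0 : ℝ) ≤ ε * B := by positivity
    nlinarith
  induction m with
  | zero =>
    intro l hl ε hε
    rcases Nat.eq_zero_or_pos l with rfl | hl0
    · exact base 0 ε hε hl
    refine ⟨max C₀ 1, le_max_right _ _, ?_⟩
    intro B A T ν hL a b ha haB hdvd hbk hlab
    have hb := hbB (by omega) hbk
    have hg : gain k 0 l = 0 := by simp [gain]; omega
    have hle : ∀ c, c ≤ B → C₀ * (p : ℝ) ^ (η * ((B - c : ℕ) : ℝ)) ≤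
        max C₀ 1 * (p : ℝ) ^ ((η + ε) * B - η * gain k 0 l * b) := by
      intro c hc
      refine mul_le_mul (le_max_left _ _) ?_ (by positivity) (by positivity)
      refine Real.rpow_le_rpow_of_exponent_le hp1.le ?_
      rw [hg, Nat.cast_sub hc]
      have : (0 : ℝ) ≤ ε * B := by positivity
      have : (0 : ℝ) ≤ η * c := by positivity
      nlinarith
    refine Bil.of_single hL.tree (by omega) hl.le (by positivity) (fun x => ?_) fun x => ?_
    · refine (hL.single (by omega) haB (by positivity) (hC (B - a)) x).trans ?_
      have hpos := (hL.tree.pos a x).le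
      exact pow_le_pow_left₀ (by positivity) (mul_le_mul_of_nonneg_right (hle a haB) hpos) _
    · refine (hL.single (by omega) hb (by positivity) (hC (B - b)) x).trans ?_
      have hpos := (hL.tree.pos b x).le
      exact pow_le_pow_left₀ (by positivity) (mul_le_mul_of_nonneg_right (hle b hb) hpos) _
  | succ m ih =>
    intro l hl ε hε
    rcases Nat.eq_zero_or_pos l with rfl | hl0
    · exact base (m + 1) ε hε hl
    obtain ⟨C₁, hC₁, h₁⟩ := exists_good p k l (k - l) hp hpk (by omega) hl0 (hsub l hl0 hl)
      (ε / 2) (by positivity)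
    obtain ⟨C₂, hC₂, h₂⟩ := ih (k - l) (by omega) (ε / 2) (by positivity)
    obtain ⟨C₃, hC₃, h₃⟩ := ih (l - 1) (by omega) (ε / 2) (by positivity)
    refine ⟨max C₁ 1 * (C₂ * C₃), by
      have := le_max_right C₁ 1
      have h := mul_le_mul hC₂ hC₃ zero_le_one (by linarith)
      have h' := mul_le_mul this h (by norm_num) (by linarith)
      simpa using h', ?_⟩
    intro B A T ν hL a b ha haB hdvd hbk hlab
    have hkf : l ∣ k.factorial := Nat.dvd_factorial hl0 hl.le
    rw [pow_succ] at hdvd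
    obtain ⟨b', rfl⟩ := hdvd
    obtain ⟨f, hf⟩ := hkf
    set n := k - l + 1 with hn
    set F := k.factorial ^ m with hF
    set c := n * (F * f * b') with hc
    have hlc : l * c = n * (F * k.factorial * b') := by rw [hc, hf]; ring
    have hac : a ≤ c := by
      refine Nat.le_of_mul_le_mul_left (c := l) ?_ hl0
      rw [hlc]; exact hlab
    have hck : c ≤ k * (F * k.factorial * b') := by
      calc c = n * (F * f * b') := hc
        _ ≤ k * (F * k.factorial * b') := by
          refine Nat.mul_le_mul (by omega) ?_
          rw [hf]
          refine Nat.mul_le_mul_right _ (Nat.mul_le_mul_left _ ?_)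
          exact Nat.le_mul_of_pos_left _ hl0
    have hckB : c * k ^ m ≤ B := by
      refine le_trans (Nat.mul_le_mul_right _ hck) (le_trans (le_of_eq ?_) hbk); ring
    have hk0 : 1 ≤ k := by omega
    have hcB : c ≤ B := hbB hk0 hckB
    have hbB' : F * k.factorial * b' ≤ B := hbB hk0 hbk
    have hbkm : F * k.factorial * b' * k ^ m ≤ B := by
      refine le_trans (Nat.mul_le_mul_left _ (Nat.pow_le_pow_right hk0 (Nat.le_succ m))) hbk
    have hb1 : 1 ≤ F * k.factorial * b' := by
      by_contra h
      have h0 : F * k.factorial * b' = 0 := by omega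
      rw [h0] at hlab; nlinarith
    have g := h₁ B A T ν hL.tree a (F * k.factorial * b') c ha hac hcB (by rw [hlc])
    have b1 := h₂ B A T ν hL (F * k.factorial * b') c hb1 hbB' ⟨n * f * b', by rw [hc]; ring⟩
      hckB (by
        rw [show k - (k - l) + 1 = l + 1 by omega]
        calc (k - l) * (F * k.factorial * b') ≤ n * (F * k.factorial * b') :=
              Nat.mul_le_mul_right _ (by omega)
          _ = l * c := hlc.symm
          _ ≤ _ := Nat.mul_le_mul_right _ (by omega))
    have b2 := h₃ B A T ν hL c (F * k.factorial * b') (ha.trans hac) hcB ⟨k.factorial * b', by ring⟩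
      hbkm (by
        calc (l - 1) * c ≤ l * c := Nat.mul_le_mul_right _ (by omega)
          _ = n * (F * k.factorial * b') := hlc
          _ ≤ _ := Nat.mul_le_mul_right _ (by omega))
    set b := F * k.factorial * b' with hbdef
    have hlR : (0 : ℝ) < l := by exact_mod_cast hl0
    have hcR : (l : ℝ) * c = n * b := by exact_mod_cast hlc
    have hkl : ((k - l : ℕ) : ℝ) = (k : ℝ) - l := Nat.cast_sub hl.le
    have hnR : (n : ℝ) = (k : ℝ) - l + 1 := by rw [hn]; push_cast [hkl]; ring
    have hn0 : (0 : ℝ) < (k : ℝ) - l + 1 := by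
      have : (l : ℝ) < k := by exact_mod_cast hl
      linarith
    have b3 : Bil p k B A T ν l c b
        (C₂ * C₃ * (p : ℝ) ^ ((η + ε / 2) * B - η * gain k (m + 1) l * b)) := by
      refine Bil.interpolate hL.tree hl0 hl b1 b2 (by positivity) (by positivity) (by positivity) ?_
      rw [← hn, mul_pow, mul_pow, mul_mul_mul_comm]
      refine mul_le_mul ?_ (le_of_eq ?_) (by positivity) (by positivity)
      · rw [mul_pow, hn, pow_succ C₃]
        refine mul_le_mul ?_ ?_ (by positivity) (by positivity)
        · exact le_self_pow₀ hC₂ (by omega)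
        · exact le_mul_of_one_le_right (by positivity) hC₃
      · rw [← Real.rpow_natCast, ← Real.rpow_natCast, ← Real.rpow_mul hp0.le,
          ← Real.rpow_mul hp0.le, ← Real.rpow_add hp0]
        congr 1
        have hgn : gain k (m + 1) l = gain k m (k - l) / l +
          gain k m (l - 1) * ((k : ℝ) - l) / ((k : ℝ) - l + 1) := by
          simp only [gain]; rw [if_neg (by omega)]
        rw [hgn, hkl, hnR]
        have hcR' : (c : ℝ) = ((k : ℝ) - l + 1) * b / l := by
          rw [eq_div_iff hlR.ne', mul_comm, hcR, hnR]
        rw [hcR']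
        field_simp
        ring
    have hone : (1 : ℝ) ≤ (p : ℝ) ^ (ε / 2 * B) := Real.one_le_rpow hp1.le (by positivity)
    have g' : Good p k B A T ν l b a c (max C₁ 1 * (p : ℝ) ^ (ε / 2 * B)) :=
      g.mono hL.tree (by positivity)
        (mul_le_mul_of_nonneg_right (le_max_left _ _) (by positivity))
    have := Bil.of_good g' b3 hL.tree (one_le_mul_of_one_le_of_one_le (le_max_right _ _) hone)
      (by positivity) hl.le ha
    convert this using 1
    rw [mul_mul_mul_comm, ← Real.rpow_add hp0]
    congr 2
    ring

lemma pow_sum_le_sum_pow_add {ι : Type*} (s : Finset ι) (f : ι → ℝ) (hf : ∀ i, 0 ≤ f i)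
    {r₁ r₂ : ℕ} (hr : 1 ≤ r₁ + r₂) {κ : ℝ} (hκ : 0 < κ) {n : ℝ} (hn : (s.card : ℝ) ≤ n)
    (g : ι → ι → ℝ) (hg0 : ∀ i j, 0 ≤ g i j)
    (hg : ∀ i ∈ s, ∀ j ∈ s, i ≠ j → g i j = f i ^ r₁ * f j ^ r₂) :
    (∑ i ∈ s, f i) ^ (r₁ + r₂) ≤ (1 + κ) ^ (r₁ + r₂) * ∑ i ∈ s, f i ^ (r₁ + r₂) +
      n ^ (r₁ + r₂) * (n / κ) ^ r₂ * ∑ i ∈ s, ∑ j ∈ s, g i j := by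
  have hn0 : 0 ≤ n := le_trans (by positivity) hn
  have hS : 0 ≤ ∑ i ∈ s, ∑ j ∈ s, g i j := sum_nonneg fun i _ => sum_nonneg fun j _ => hg0 i j
  have hS' : 0 ≤ ∑ i ∈ s, f i ^ (r₁ + r₂) := sum_nonneg fun i _ => pow_nonneg (hf i) _
  rcases s.eq_empty_or_nonempty with rfl | hs
  · rw [sum_empty, zero_pow (by omega)]; simp
  obtain ⟨i, hi, hmax⟩ := exists_max_image s f hs
  have hnpos : 0 < n := lt_of_lt_of_le (by exact_mod_cast hs.card_pos) hn
  by_cases hj : ∃ j ∈ s, i ≠ j ∧ f i ≤ n / κ * f j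
  · obtain ⟨j, hj, hij, hfj⟩ := hj
    have h1 : ∑ i ∈ s, f i ≤ n * f i := by
      refine (sum_le_card_nsmul s f (f i) hmax).trans ?_
      rw [nsmul_eq_mul]; exact mul_le_mul_of_nonneg_right hn (hf i)
    have h2 : (∑ i ∈ s, f i) ^ (r₁ + r₂) ≤ n ^ (r₁ + r₂) * (n / κ) ^ r₂ * g i j := by
      calc _ ≤ (n * f i) ^ (r₁ + r₂) := pow_le_pow_left₀ (sum_nonneg fun i _ => hf i) h1 _
        _ = n ^ (r₁ + r₂) * (f i ^ r₁ * f i ^ r₂) := by rw [mul_pow, pow_add (f i)]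
        _ ≤ n ^ (r₁ + r₂) * (f i ^ r₁ * (n / κ * f j) ^ r₂) := by
          have := hf i
          gcongr
        _ = _ := by rw [hg i hi j hj hij, mul_pow]; ring
    have h3 : g i j ≤ ∑ i ∈ s, ∑ j ∈ s, g i j :=
      (single_le_sum (f := fun j => g i j) (fun j _ => hg0 i j) hj).trans
        (single_le_sum (f := fun i => ∑ j ∈ s, g i j) (fun i _ => sum_nonneg fun j _ => hg0 i j) hi)
    have h4 : n ^ (r₁ + r₂) * (n / κ) ^ r₂ * g i j ≤ n ^ (r₁ + r₂) * (n / κ) ^ r₂ *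
        ∑ i ∈ s, ∑ j ∈ s, g i j := by gcongr
    have : 0 ≤ (1 + κ) ^ (r₁ + r₂) * ∑ i ∈ s, f i ^ (r₁ + r₂) := by positivity
    linarith
  · push Not at hj
    classical
    have h1 : ∑ i ∈ s, f i ≤ (1 + κ) * f i := by
      rw [← add_sum_erase s f hi]
      have : ∑ j ∈ s.erase i, f j ≤ ∑ j ∈ s.erase i, κ / n * f i := by
        refine sum_le_sum fun j hj' => ?_
        rw [mem_erase] at hj'
        have := (hj j hj'.2 hj'.1.symm).le
        rw [div_mul_eq_mul_div, div_le_iff₀ hκ] at this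
        rw [div_mul_eq_mul_div, le_div_iff₀ hnpos]
        linarith
      rw [sum_const, nsmul_eq_mul] at this
      have h2 : ((s.erase i).card : ℝ) ≤ n := le_trans (by exact_mod_cast card_erase_le) hn
      have h3 : ((s.erase i).card : ℝ) * (κ / n * f i) ≤ n * (κ / n * f i) :=
        mul_le_mul_of_nonneg_right h2 (mul_nonneg (by positivity) (hf i))
      have h4 : n * (κ / n * f i) = κ * f i := by field_simp
      linarith
    have h2 : (∑ i ∈ s, f i) ^ (r₁ + r₂) ≤ (1 + κ) ^ (r₁ + r₂) * ∑ i ∈ s, f i ^ (r₁ + r₂) := by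
      calc _ ≤ ((1 + κ) * f i) ^ (r₁ + r₂) := pow_le_pow_left₀ (sum_nonneg fun i _ => hf i) h1 _
        _ = (1 + κ) ^ (r₁ + r₂) * f i ^ (r₁ + r₂) := mul_pow _ _ _
        _ ≤ _ := by
          gcongr
          exact single_le_sum (f := fun i => f i ^ (r₁ + r₂)) (fun i _ => pow_nonneg (hf i) _) hi
    have : 0 ≤ n ^ (r₁ + r₂) * (n / κ) ^ r₂ * ∑ i ∈ s, ∑ j ∈ s, g i j := by positivity
    linarith

lemma sum_pow_le_pow_sum_of_nonneg {ι : Type*} (s : Finset ι) (f : ι → ℝ) (hf : ∀ i, 0 ≤ f i)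
    {r : ℕ} (hr : 1 ≤ r) : ∑ i ∈ s, f i ^ r ≤ (∑ i ∈ s, f i) ^ r := by
  obtain ⟨r, rfl⟩ : ∃ m, r = m + 1 := ⟨r - 1, by omega⟩
  simp only [pow_succ]
  rw [mul_sum]
  refine sum_le_sum fun i hi => mul_le_mul_of_nonneg_right ?_ (hf i)
  exact pow_le_pow_left₀ (hf i) (single_le_sum (fun j _ => hf j) hi) _

lemma avg_pow_le_of_bil {p k B : ℕ} [NeZero p] (hB : 1 ≤ B) (hk : 1 ≤ k) {l : ℕ} (hl : l < k)
    {A : ℤ → ℂ} {T : Finset ℤ} {ν : ℕ → ℤ → ℝ} (h : Leafy p k B A T ν) {D M : ℝ} (hD0 : 0 ≤ D)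
    (hD : Dec p k (B - 1) D) (hM0 : 0 ≤ M) (hM : Bil p k B A T ν l 1 1 M) {κ : ℝ} (hκ : 0 < κ) :
    avg (fun c : Fin (k + 1) → ZMod (p ^ (k * B)) => ‖ES A T c‖ ^ (2 * rr k)) ≤
      ((1 + κ) ^ (2 * rr k) * D ^ rr k + (p : ℝ) ^ (2 * rr k) *
        ((p : ℝ) / κ) ^ (2 * (rr k - rr l)) * (p ^ 2) * M ^ rr k) * ν 0 0 ^ rr k := by
  have hr := rr_pos hk
  have hlr := rr_lt hl
  have hν0 : ν 0 0 = ∑ t ∈ range p, ν 1 t := by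
    have := h.tree.split 0 (by omega) 0
    simpa using this
  have hν00 := h.tree.pos 0 0
  have hνle : ∀ t ∈ range p, ν 1 t ≤ ν 0 0 := fun t ht => by
    rw [hν0]; exact single_le_sum (f := fun t : ℕ => ν 1 t) (fun t _ => (h.tree.pos _ _).le) ht
  have e : 2 * rr k = 2 * rr l + 2 * (rr k - rr l) := by omega
  let F : ℕ → (Fin (k + 1) → ZMod (p ^ (k * B))) → ℝ := fun t => nF p k B A T 1 t
  have hF0 : ∀ t c, 0 ≤ F t c := fun t c => nF_nonneg
  let g : ℕ → ℕ → (Fin (k + 1) → ZMod (p ^ (k * B))) → ℝ := fun i j c =>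
    if i = j then 0 else F i c ^ (2 * rr l) * F j c ^ (2 * (rr k - rr l))
  have hg0 : ∀ i j c, 0 ≤ g i j c := by
    intro i j c; simp only [g]; split_ifs
    · exact le_rfl
    · have := hF0 i c; have := hF0 j c; positivity
  have hpt : ∀ c, ‖ES A T c‖ ^ (2 * rr k) ≤ (1 + κ) ^ (2 * rr k) * ∑ t ∈ range p, F t c ^ (2 * rr k)
      + (p : ℝ) ^ (2 * rr k) * ((p : ℝ) / κ) ^ (2 * (rr k - rr l)) *
        ∑ i ∈ range p, ∑ j ∈ range p, g i j c := by
    intro c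
    have h1 : ‖ES A T c‖ ≤ ∑ t ∈ range p, F t c := by
      have h2 : ES A T c = ∑ t ∈ range p, ES A (cls T ((p : ℤ) ^ 1) t) c := by
        have := cls_sum_split p T 0 1 0 (fun x => A x * ph c x)
        simp only [pow_zero, cls_one, zero_add, one_mul, pow_one] at this
        simp only [ES, pow_one]; exact this
      rw [h2]; exact norm_sum_le _ _
    have := pow_sum_le_sum_pow_add (range p) (fun t => F t c) (fun t => hF0 t c)
      (r₁ := 2 * rr l) (r₂ := 2 * (rr k - rr l)) (by omega) hκ (n := p) (by simp)
      (fun i j => g i j c) (fun i j => hg0 i j c) (fun i _ j _ hij => by simp only [g, if_neg hij])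
    rw [← e] at this
    exact (pow_le_pow_left₀ (norm_nonneg _) h1 _).trans this
  refine (avg_mono hpt).trans ?_
  simp only [avg_add, avg_const_mul, avg_sum]
  have h1 : ∑ t ∈ range p, avg (fun c => F t c ^ (2 * rr k)) ≤ D ^ rr k * ν 0 0 ^ rr k := by
    calc _ ≤ ∑ t ∈ range p, D ^ rr k * ν 1 t ^ rr k := by
          refine sum_le_sum fun t _ => ?_
          rw [← mul_pow]; exact h.single hk hB hD0 hD t
      _ ≤ _ := by
          rw [← mul_sum, hν0]
          exact mul_le_mul_of_nonneg_left (sum_pow_le_pow_sum_of_nonneg _ (fun t : ℕ => ν 1 t)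
            (fun t => (h.tree.pos _ _).le) hr) (by positivity)
  have h2 : ∑ i ∈ range p, ∑ j ∈ range p, avg (fun c => g i j c) ≤
      (p ^ 2) * M ^ rr k * ν 0 0 ^ rr k := by
    have : ∀ i ∈ range p, ∀ j ∈ range p, avg (fun c => g i j c) ≤ M ^ rr k * ν 0 0 ^ rr k := by
      intro i hi j hj
      by_cases hij : i = j
      · simp only [g, if_pos hij]; rw [avg_const]; positivity
      · simp only [g, if_neg hij]
        have hd : ¬ (p : ℤ) ∣ (i : ℤ) - j := by
          intro hd
          rw [mem_range] at hi hj
          have := Int.eq_zero_of_abs_lt_dvd hd (by rw [abs_lt]; omega)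
          omega
        refine (hM i j hd).trans ?_
        have a1 := (h.tree.pos 1 i).le
        have a2 := (h.tree.pos 1 j).le
        have e2 : rr k = rr l + (rr k - rr l) := by omega
        calc _ ≤ M ^ rr k * (ν 0 0 ^ rr l * ν 0 0 ^ (rr k - rr l)) := by
              have := hνle i hi; have := hνle j hj
              gcongr
          _ = _ := by rw [← pow_add, ← e2]
    calc _ ≤ ∑ i ∈ range p, ∑ j ∈ range p, M ^ rr k * ν 0 0 ^ rr k :=
          sum_le_sum fun i hi => sum_le_sum fun j hj => this i hi j hj
      _ = _ := by simp; ring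
  have h3 := mul_le_mul_of_nonneg_left h1 (show 0 ≤ (1 + κ) ^ (2 * rr k) by positivity)
  have h4 := mul_le_mul_of_nonneg_left h2
    (show 0 ≤ (p : ℝ) ^ (2 * rr k) * ((p : ℝ) / κ) ^ (2 * (rr k - rr l)) by positivity)
  refine (add_le_add h3 h4).trans (le_of_eq (by ring))

lemma SubExp.of_bil {p k : ℕ} [NeZero p] (hp : p.Prime) (hk : 1 ≤ k) {l : ℕ} (hl : l < k)
    {η : ℝ} (hη : 0 < η) {E : ℝ} (hE : 0 < E) {L : ℕ}
    (h : ∀ (B : ℕ) (A : ℤ → ℂ) (T : Finset ℤ) (ν : ℕ → ℤ → ℝ), L ≤ B → Leafy p k B A T ν →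
      Bil p k B A T ν l 1 1 (E * (p : ℝ) ^ (η * B))) : SubExp p k η := by
  have hp1 : (1 : ℝ) < p := by exact_mod_cast hp.one_lt
  have hp0 : (0 : ℝ) < p := by linarith
  have hr := rr_pos hk
  obtain ⟨κ, hκ, hκ2⟩ : ∃ κ : ℝ, 0 < κ ∧ (1 + κ) ^ 2 ≤ (p : ℝ) ^ (η / 2) := by
    have h1 : (1 : ℝ) < (p : ℝ) ^ (η / 4) := Real.one_lt_rpow hp1 (by positivity)
    refine ⟨(p : ℝ) ^ (η / 4) - 1, by linarith, ?_⟩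
    rw [add_sub_cancel, ← Real.rpow_natCast, ← Real.rpow_mul hp0.le]
    exact le_of_eq (by congr 1; push_cast; ring)
  set q := (p : ℝ) ^ (-(η / 2)) with hq
  have hq1 : q < 1 := Real.rpow_lt_one_of_one_lt_of_neg hp1 (by linarith)
  have hq0 : 0 < q := Real.rpow_pos_of_pos hp0 _
  set K := (p : ℝ) ^ (2 * rr k) * ((p : ℝ) / κ) ^ (2 * (rr k - rr l)) * (p ^ 2) with hK
  have hK0 : 0 < K := by positivity
  set C := E + (p : ℝ) ^ L + K * E / (1 - q) with hC
  have hC1 : 0 < K * E / (1 - q) := div_pos (by positivity) (by linarith)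
  have hpL : 0 < (p : ℝ) ^ L := by positivity
  have hC0 : 0 < C := by positivity
  refine ⟨C, hC0, fun B => ?_⟩
  induction B with
  | zero =>
    refine (Dec.of_trivial p k 0 hk).mono (by positivity) ?_
    simp only [pow_zero, Nat.cast_zero, mul_zero, Real.rpow_zero, mul_one]
    have := one_le_pow₀ hp1.le (n := L)
    linarith
  | succ B ih =>
    have hpB : 1 ≤ (p : ℝ) ^ (η * (B + 1 : ℕ)) := Real.one_le_rpow hp1.le (by positivity)
    rcases lt_or_ge (B + 1) L with hBL | hBL
    · refine (Dec.of_trivial p k (B + 1) hk).mono (by positivity) ?_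
      have h1 : (p : ℝ) ^ (B + 1) ≤ (p : ℝ) ^ L := pow_le_pow_right₀ hp1.le hBL.le
      nlinarith
    refine Dec.of_tree hk (by positivity) fun A T ν hν hleaf => ?_
    have hLf : Leafy p k (B + 1) A T ν := ⟨hν, hleaf⟩
    refine (avg_pow_le_of_bil (by omega) hk hl hLf (by positivity) ih
      (by positivity) (h (B + 1) A T ν hBL hLf) hκ).trans ?_
    refine mul_le_mul_of_nonneg_right ?_ (pow_nonneg (hν.pos _ _).le _)
    rw [← hK]
    set X := (p : ℝ) ^ (η * (B + 1 : ℕ)) with hX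
    have hX0 : 0 < X := by positivity
    have e1 : (p : ℝ) ^ (η / 2) * (p : ℝ) ^ (η * B) = q * X := by
      rw [hq, hX, ← Real.rpow_add hp0, ← Real.rpow_add hp0]; congr 1; push_cast; ring
    have h1 : (1 + κ) ^ (2 * rr k) * (C * (p : ℝ) ^ (η * B)) ^ rr k ≤ q * (C * X) ^ rr k := by
      calc _ = ((1 + κ) ^ 2 * (C * (p : ℝ) ^ (η * B))) ^ rr k := by rw [pow_mul, ← mul_pow]
        _ ≤ ((p : ℝ) ^ (η / 2) * (C * (p : ℝ) ^ (η * B))) ^ rr k := by gcongr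
        _ = (q * (C * X)) ^ rr k := by rw [mul_left_comm, e1]; ring_nf
        _ = q ^ rr k * (C * X) ^ rr k := mul_pow _ _ _
        _ ≤ _ := by
          gcongr
          exact pow_le_of_le_one hq0.le hq1.le (by omega)
    have h2 : K * (E * X) ^ rr k ≤ (1 - q) * (C * X) ^ rr k := by
      have h3 : K * E ^ rr k ≤ (1 - q) * C ^ rr k := by
        obtain ⟨r, hr'⟩ : ∃ m, rr k = m + 1 := ⟨rr k - 1, by omega⟩
        rw [hr', pow_succ, pow_succ]
        have h4 : K * E ≤ (1 - q) * C := by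
          have h5 : K * E / (1 - q) ≤ C := by linarith
          rw [div_le_iff₀ (by linarith)] at h5; linarith
        have h6 : E ^ r ≤ C ^ r := pow_le_pow_left₀ hE.le (by linarith) _
        calc _ = E ^ r * (K * E) := by ring
          _ ≤ C ^ r * ((1 - q) * C) := by gcongr
          _ = _ := by ring
      rw [mul_pow, mul_pow, ← mul_assoc, ← mul_assoc]
      gcongr
    linarith

lemma SubExp.mono {p d : ℕ} [NeZero p] (hp : 1 ≤ p) {η η' : ℝ} (h : SubExp p d η) (hη : η ≤ η') :
    SubExp p d η' := by
  obtain ⟨C, hC, h⟩ := h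
  have hp1 : (1 : ℝ) ≤ p := by exact_mod_cast hp
  refine ⟨C, hC, fun B => (h B).mono (by positivity) ?_⟩
  gcongr

lemma bil_one_one {p k : ℕ} [NeZero p] (hp : p.Prime) (hpk : k < p) (hk : 2 ≤ k)
    (hsub : ∀ l, 1 ≤ l → l < k → ∀ ε > 0, SubExp p l ε) {η : ℝ} (hη : 0 < η) (hsη : SubExp p k η)
    {m : ℕ} (hm : 2 ≤ η * (m / k)) : ∃ l, l < k ∧ ∃ E > 0, ∃ L : ℕ,
      ∀ (B : ℕ) (A : ℤ → ℂ) (T : Finset ℤ) (ν : ℕ → ℤ → ℝ), L ≤ B → Leafy p k B A T ν →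
      Bil p k B A T ν l 1 1 (E * (p : ℝ) ^ ((η - 1 / (2 * k ^ m)) * B)) := by
  have hp1 : (1 : ℝ) < p := by exact_mod_cast hp.one_lt
  have hp0 : (0 : ℝ) < p := by linarith
  have hkR : (0 : ℝ) < k := by exact_mod_cast (show 0 < k by omega)
  have hm1 : m ≠ 0 := by rintro rfl; norm_num at hm
  obtain ⟨l, hl1, hlk, hg⟩ := exists_large_gain k m hk
  obtain ⟨C, hC1, hC⟩ := bil_iterate p k hp hpk hsub hη.le hsη m l hlk (1 / (2 * k ^ m))
    (by positivity)
  set L₀ := k.factorial ^ m with hL₀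
  have hL₀k : k ≤ L₀ := (Nat.self_le_factorial k).trans (Nat.le_self_pow hm1 _)
  have hkm : 1 ≤ k ^ m := Nat.one_le_pow _ _ (by omega)
  have hL : 0 < L₀ * k ^ m := by positivity
  refine ⟨l, hlk, C * (p : ℝ) ^ (L₀ : ℝ), by positivity, L₀ * k ^ m, fun B A T ν hB hLf => ?_⟩
  set b := L₀ * (B / (L₀ * k ^ m)) with hb
  have hdiv : 1 ≤ B / (L₀ * k ^ m) := (Nat.one_le_div_iff hL).2 hB
  have hb1 : k ≤ b := hL₀k.trans (Nat.le_mul_of_pos_right _ hdiv)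
  have hbB : b * k ^ m ≤ B := by
    calc b * k ^ m = L₀ * k ^ m * (B / (L₀ * k ^ m)) := by rw [hb]; ring
      _ ≤ B := Nat.mul_div_le _ _
  have hbB' : b ≤ B := (Nat.le_mul_of_pos_right _ hkm).trans hbB
  have hblow : (B : ℝ) / k ^ m - L₀ ≤ b := by
    have h1 : B < L₀ * k ^ m * (B / (L₀ * k ^ m)) + L₀ * k ^ m := by
      have := Nat.lt_div_mul_add (a := B) hL; linarith
    have h2 : B < (b + L₀) * k ^ m := by rw [hb]; linarith
    have h3 : (B : ℝ) < (b + L₀) * k ^ m := by exact_mod_cast h2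
    rw [sub_le_iff_le_add, div_le_iff₀ (by positivity)]
    exact h3.le
  have hbil := hC B A T ν hLf 1 b le_rfl (by omega) (Dvd.intro _ rfl) hbB (by nlinarith)
  set M := C * (p : ℝ) ^ ((η + 1 / (2 * k ^ m)) * B - η * gain k m l * b) with hM
  have hM0 : 0 < M := by positivity
  clear_value M
  have hrl := rr_lt hlk
  have hfin : Bil p k B A T ν l 1 1 ((p : ℝ) ^ b * M) := by
    intro x₀ x' hx
    have := trivial_step (p := p) (K := k) (q := p ^ (k * B)) (B := B)
      (fun c => nF p k B A T 1 x₀ c ^ (2 * rr l)) (fun c => by have := nF_nonneg (p := p) (k := k) (B := B) (A := A) (T := T) (a := 1) (x := x₀) (c := c); positivity) x' 1 (b - 1) A T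
      hLf.tree (by omega) (r := rr k - rr l) (by omega) (M := M ^ rr k * ν 1 x₀ ^ rr l) (fun t => by
        rw [show 1 + (b - 1) = b by omega]
        have h1 : ¬ (p : ℤ) ∣ x₀ - (x' + (p : ℤ) ^ 1 * t) := by
          intro h; apply hx
          have : x₀ - x' = (x₀ - (x' + (p : ℤ) ^ 1 * t)) + p * t := by ring
          rw [this]; exact dvd_add h (Dvd.intro _ rfl)
        have := hbil x₀ _ h1
        rw [mul_assoc]
        exact this)
    refine this.trans ?_
    have a1 := (hLf.tree.pos 1 x₀).le
    have a2 := (hLf.tree.pos 1 x').le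
    have h2 : ((p : ℝ) ^ (b - 1)) ^ (rr k - rr l) ≤ ((p : ℝ) ^ b) ^ rr k := by
      calc _ ≤ ((p : ℝ) ^ b) ^ (rr k - rr l) := by
            gcongr
            · exact hp1.le
            · omega
        _ ≤ _ := pow_le_pow_right₀ (one_le_pow₀ hp1.le) (by omega)
    rw [mul_pow (_ ^ b) M, mul_assoc (((p : ℝ) ^ b) ^ rr k), ← mul_assoc (M ^ rr k)]
    exact mul_le_mul_of_nonneg_right h2 (by positivity)
  refine hfin.mono hLf.tree (by positivity) ?_
  rw [hM, ← Real.rpow_natCast, mul_left_comm, mul_assoc C, ← Real.rpow_add hp0, ← Real.rpow_add hp0]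
  refine mul_le_mul_of_nonneg_left ?_ (by linarith)
  refine Real.rpow_le_rpow_of_exponent_le hp1.le ?_
  have h1 : 2 ≤ η * gain k m l := hm.trans (mul_le_mul_of_nonneg_left hg hη.le)
  have h2 : 2 * (b : ℝ) ≤ η * gain k m l * b := mul_le_mul_of_nonneg_right h1 (by positivity)
  have h3 : (1 : ℝ) / (2 * k ^ m) * B = B / k ^ m / 2 := by field_simp
  rw [add_mul, sub_mul, h3]
  linarith

lemma SubExp.improve {p k : ℕ} [NeZero p] (hp : p.Prime) (hpk : k < p) (hk : 2 ≤ k)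
    (hsub : ∀ l, 1 ≤ l → l < k → ∀ ε > 0, SubExp p l ε) {η : ℝ} (hη : 0 < η) :
    ∃ β > 0, ∀ η' ≥ η, SubExp p k η' → SubExp p k (max (η' - β) η) := by
  have hkR : (0 : ℝ) < k := by exact_mod_cast (show 0 < k by omega)
  obtain ⟨m, hm⟩ := exists_nat_ge (2 * k / η)
  refine ⟨1 / (2 * k ^ m), by positivity, fun η' hη' h => ?_⟩
  have hm2 : 2 ≤ η' * (m / k) := by
    rw [div_le_iff₀ hη] at hm
    rw [← mul_div_assoc, le_div_iff₀ hkR]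
    have := mul_le_mul_of_nonneg_right hη' (Nat.cast_nonneg (α := ℝ) m)
    linarith
  obtain ⟨l, hl, E, hE, L, hL⟩ := bil_one_one hp hpk hk hsub (hη.trans_le hη') h hm2
  refine SubExp.of_bil hp (by omega) hl (lt_max_of_lt_right hη) hE (L := L)
    fun B A T ν hB hLf => (hL B A T ν hB hLf).mono hLf.tree (by positivity) ?_
  have hp1 : (1 : ℝ) ≤ p := by exact_mod_cast hp.one_lt.le
  gcongr
  exact le_max_left _ _

theorem subExp_of_prime {p : ℕ} [NeZero p] (hp : p.Prime) (d : ℕ) (hd : 1 ≤ d) (hdp : d < p)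
    {η : ℝ} (hη : 0 < η) : SubExp p d η := by
  induction d using Nat.strong_induction_on generalizing η with
  | _ d ih =>
  rcases Nat.eq_or_lt_of_le hd with rfl | hd2
  · refine ⟨1, one_pos, fun B => (Dec.one p B).mono zero_le_one ?_⟩
    rw [one_mul]
    exact Real.one_le_rpow (by exact_mod_cast hp.one_lt.le) (by positivity)
  obtain ⟨β, hβ, h⟩ := SubExp.improve hp hdp hd2
    (fun l hl hld ε hε => ih l hld hl (by omega) hε) hη
  have h1 : SubExp p d (max 1 η) := by
    refine SubExp.mono hp.one_lt.le ?_ (le_max_left _ _)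
    refine ⟨1, one_pos, fun B => (Dec.of_trivial p d B hd).mono (by positivity) ?_⟩
    rw [one_mul, one_mul, Real.rpow_natCast]
  have h2 : ∀ n : ℕ, SubExp p d (max (1 - n * β) η) := by
    intro n
    induction n with
    | zero => simpa using h1
    | succ n ihn =>
      refine SubExp.mono hp.one_lt.le (h _ (le_max_right _ _) ihn) ?_
      refine max_le ?_ (le_max_right _ _)
      rw [sub_le_iff_le_add]
      refine max_le ?_ ?_
      · have := le_max_left (1 - ((n + 1 : ℕ) : ℝ) * β) η
        push_cast at this ⊢
        linarith
      · have := le_max_right (1 - ((n + 1 : ℕ) : ℝ) * β) η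
        linarith
  obtain ⟨n, hn⟩ := exists_nat_ge (1 / β)
  have := h2 n
  rwa [max_eq_right] at this
  rw [div_le_iff₀ hβ] at hn
  linarith

/-- The number of pairs from `X` with equal images. -/
noncomputable def energy {ι β : Type*} [DecidableEq β] (X : Finset ι) (v : ι → β) : ℕ :=
  ((X ×ˢ X).filter fun z => v z.1 = v z.2).card

lemma stdAddChar_sum {q : ℕ} [NeZero q] {ι : Type*} (s : Finset ι) (f : ι → ZMod q) :
    (ZMod.stdAddChar (∑ i ∈ s, f i) : ℂ) = ∏ i ∈ s, ZMod.stdAddChar (f i) := by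
  classical
  induction s using Finset.induction_on with
  | empty => simp
  | insert a s ha ih => rw [sum_insert ha, prod_insert ha, AddChar.map_add_eq_mul, ih]

lemma sum_stdAddChar_pi {q m : ℕ} [NeZero q] (w : Fin m → ZMod q) :
    ∑ c : Fin m → ZMod q, ZMod.stdAddChar (∑ i, c i * w i) =
      if w = 0 then (Fintype.card (Fin m → ZMod q) : ℂ) else 0 := by
  have h1 : ∀ c : Fin m → ZMod q, ZMod.stdAddChar (∑ i, c i * w i) =
      ∏ i, ZMod.stdAddChar (c i * w i) := by
    intro c
    exact stdAddChar_sum _ _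
  simp only [h1]
  rw [← Fintype.piFinset_univ, ← prod_univ_sum (fun _ => univ)
    (fun (i : Fin m) (x : ZMod q) => (ZMod.stdAddChar (x * w i) : ℂ))]
  simp only [AddChar.sum_mulShift _ (ZMod.isPrimitive_stdAddChar q)]
  split_ifs with h
  · subst h; simp
  · obtain ⟨i, hi⟩ := Function.ne_iff.1 h
    exact prod_eq_zero (mem_univ i) (by rw [if_neg (by simpa using hi)]; simp)

lemma avg_norm_sq_eq_energy {q m : ℕ} [NeZero q] {ι : Type*} (X : Finset ι)
    (v : ι → Fin m → ZMod q) :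
    avg (fun c : Fin m → ZMod q => ‖∑ x ∈ X, ZMod.stdAddChar (∑ i, c i * v x i)‖ ^ 2) =
      energy X v := by
  have key : ∀ c : Fin m → ZMod q,
      ((‖∑ x ∈ X, ZMod.stdAddChar (∑ i, c i * v x i)‖ ^ 2 : ℝ) : ℂ) =
      ∑ x ∈ X, ∑ y ∈ X, ZMod.stdAddChar (∑ i, c i * (v x - v y) i) := by
    intro c
    push_cast
    rw [← Complex.mul_conj', map_sum, sum_mul_sum]
    refine sum_congr rfl fun x _ => sum_congr rfl fun y _ => ?_
    rw [← Complex.inv_eq_conj (norm_stdAddChar _), ← AddChar.map_neg_eq_inv,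
      ← AddChar.map_add_eq_mul]
    congr 1
    rw [← sum_neg_distrib, ← sum_add_distrib]
    refine sum_congr rfl fun i _ => ?_
    simp only [Pi.sub_apply]; ring
  have : ((avg (fun c : Fin m → ZMod q =>
      ‖∑ x ∈ X, ZMod.stdAddChar (∑ i, c i * v x i)‖ ^ 2) : ℝ) : ℂ) = ((energy X v : ℝ) : ℂ) := by
    unfold avg
    rw [Complex.ofReal_mul, Complex.ofReal_sum]
    simp only [key]
    rw [sum_comm]
    have h1 : ∀ x ∈ X, ∑ c : Fin m → ZMod q, ∑ y ∈ X,
        ZMod.stdAddChar (∑ i, c i * (v x - v y) i) =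
        ∑ y ∈ X, if v x = v y then (Fintype.card (Fin m → ZMod q) : ℂ) else 0 := by
      intro x _
      rw [sum_comm]
      refine sum_congr rfl fun y _ => ?_
      rw [sum_stdAddChar_pi]
      simp only [sub_eq_zero]
    rw [sum_congr rfl h1, energy, card_filter, sum_product]
    push_cast
    rw [mul_sum]
    refine sum_congr rfl fun x _ => ?_
    rw [mul_sum]
    refine sum_congr rfl fun y _ => ?_
    have h2 : (Fintype.card (Fin m → ZMod q) : ℂ) ≠ 0 := by
      exact_mod_cast Fintype.card_ne_zero
    split_ifs
    · push_cast at h2 ⊢; field_simp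
    · simp
  exact_mod_cast this

lemma energy_le_of_comp {ι β γ : Type*} [DecidableEq β] [DecidableEq γ] (X : Finset ι) (v : ι → β)
    (w : ι → γ) (h : ∀ x ∈ X, ∀ y ∈ X, v x = v y → w x = w y) : energy X v ≤ energy X w := by
  refine card_le_card fun z hz => ?_
  simp only [mem_filter, mem_product] at hz ⊢
  exact ⟨hz.1, h _ hz.1.1 _ hz.1.2 hz.2⟩

/-- Tuples of length `r` from `{1, …, P}`. -/
noncomputable def box (r P : ℕ) : Finset (Fin r → ℤ) :=
  Fintype.piFinset fun _ => Icc (1 : ℤ) P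

/-- The vector of power sums. -/
def psum (k : ℕ) {r : ℕ} (x : Fin r → ℤ) (i : Fin (k + 1)) : ℤ := ∑ j, x j ^ (i : ℕ)

lemma energy_psum_le_avg (q k r P : ℕ) [NeZero q] :
    (energy (box r P) (psum k) : ℝ) ≤
      avg (fun c : Fin (k + 1) → ZMod q => ‖ES (fun _ => 1) (Icc (1 : ℤ) P) c‖ ^ (2 * r)) := by
  have h1 : ∀ c : Fin (k + 1) → ZMod q, ‖ES (fun _ => 1) (Icc (1 : ℤ) P) c‖ ^ (2 * r) =
      ‖∑ x ∈ box r P, ZMod.stdAddChar (∑ i, c i * ((psum k x i : ℤ) : ZMod q))‖ ^ 2 := by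
    intro c
    rw [mul_comm, pow_mul, ← norm_pow, ES, sum_pow', box]
    congr 2
    refine sum_congr rfl fun x _ => ?_
    simp only [one_mul, ph]
    rw [← stdAddChar_sum]
    congr 1
    rw [sum_comm]
    refine sum_congr rfl fun i _ => ?_
    rw [← mul_sum]; simp [psum]
  simp only [h1]
  rw [avg_norm_sq_eq_energy _ (fun x i => ((psum k x i : ℤ) : ZMod q))]
  exact_mod_cast energy_le_of_comp _ _ _ fun x _ y _ h => by rw [h]

/-- The main conjecture in Vinogradov's mean value theorem at the critical exponent. -/
theorem vinogradov_mean_value (k : ℕ) (hk : 1 ≤ k) {ε : ℝ} (hε : 0 < ε) :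
    ∃ C : ℝ, 0 < C ∧ ∀ P : ℕ, 1 ≤ P →
      (energy (box (rr k) P) (psum k) : ℝ) ≤ C * (P : ℝ) ^ ((rr k : ℝ) + ε) := by
  obtain ⟨p, hpk, hp⟩ := Nat.exists_infinite_primes (k + 1)
  have : NeZero p := ⟨hp.ne_zero⟩
  have hp1 : (1 : ℝ) < p := by exact_mod_cast hp.one_lt
  have hp0 : (0 : ℝ) < p := by linarith
  have hr := rr_pos hk
  have hrR : (0 : ℝ) < rr k := by exact_mod_cast hr
  obtain ⟨C, hC, hD⟩ := subExp_of_prime hp k hk (by omega) (η := ε / rr k) (by positivity)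
  refine ⟨(C * (p : ℝ) ^ (ε / rr k) * p) ^ rr k, by positivity, fun P hP => ?_⟩
  set B := Nat.log p P + 1 with hB
  have hPB : P < p ^ B := Nat.lt_pow_succ_log_self hp.one_lt P
  have hBP : p ^ (B - 1) ≤ P := by
    rw [hB, Nat.add_sub_cancel]; exact Nat.pow_log_le_self p (by omega)
  have hpP : (p : ℝ) ^ B ≤ p * P := by
    have : p ^ B ≤ p * P := by
      rw [show B = (B - 1) + 1 by omega, pow_succ']; exact Nat.mul_le_mul_left _ hBP
    exact_mod_cast this
  refine (energy_psum_le_avg (p ^ (k * B)) k (rr k) P).trans ?_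
  refine (hD B (fun _ => 1) (Icc (1 : ℤ) P) (fun _ => 1) (fun _ => one_pos)).trans ?_
  have hleaf : ∀ t : ℕ, ∀ c : Fin (k + 1) → ZMod (p ^ (k * B)),
      ‖ES (fun _ => 1) (cls (Icc (1 : ℤ) P) ((p : ℤ) ^ B) t) c‖ ^ (2 * rr k) ≤ 1 := by
    intro t c
    refine pow_le_one₀ (norm_nonneg _) ?_
    have hcard : (cls (Icc (1 : ℤ) P) ((p : ℤ) ^ B) t).card ≤ 1 := by
      rw [card_le_one]
      intro a ha b hb
      simp only [cls, mem_filter, mem_Icc] at ha hb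
      have h1 : (p : ℤ) ^ B ∣ a - b := by
        have := dvd_sub ha.2 hb.2
        simpa using this
      have h2 : (P : ℤ) < (p : ℤ) ^ B := by exact_mod_cast hPB
      have := Int.eq_zero_of_abs_lt_dvd h1 (by rw [abs_lt]; constructor <;> linarith)
      linarith
    refine (norm_sum_le _ _).trans ?_
    simp only [one_mul, norm_ph, sum_const, nsmul_eq_mul, mul_one]
    exact_mod_cast hcard
  simp only [inv_one, one_pow, one_mul, sum_const, card_range, nsmul_eq_mul, mul_one]
  have h3 : ∑ t ∈ range (p ^ B), avg (fun c : Fin (k + 1) → ZMod (p ^ (k * B)) =>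
      ‖ES (fun _ => 1) (cls (Icc (1 : ℤ) P) ((p : ℤ) ^ B) t) c‖ ^ (2 * rr k)) ≤ (p : ℝ) ^ B := by
    refine (sum_le_sum fun t _ => (avg_mono (hleaf t)).trans (le_of_eq (avg_const 1))).trans ?_
    simp
  push_cast
  calc _ ≤ (C * (p : ℝ) ^ (ε / rr k * B)) ^ rr k * ((p : ℝ) ^ B) ^ (rr k - 1) * (p : ℝ) ^ B := by
        gcongr
    _ = (C * ((p : ℝ) ^ B) ^ (ε / rr k) * (p : ℝ) ^ B) ^ rr k := by
        rw [mul_assoc, ← pow_succ, Nat.sub_add_cancel hr, ← mul_pow, ← Real.rpow_natCast _ B,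
          ← Real.rpow_mul hp0.le, mul_comm (B : ℝ)]
    _ ≤ (C * ((p : ℝ) * P) ^ (ε / rr k) * (p * P)) ^ rr k := by gcongr
    _ = _ := by
        have hP0 : (0 : ℝ) < P := by exact_mod_cast hP
        rw [Real.mul_rpow hp0.le hP0.le]
        have : C * ((p : ℝ) ^ (ε / rr k) * (P : ℝ) ^ (ε / rr k)) * (p * P) =
            (C * (p : ℝ) ^ (ε / rr k) * p) * ((P : ℝ) ^ (ε / rr k) * P) := by ring
        rw [this, mul_pow]
        congr 1
        rw [mul_pow, ← Real.rpow_natCast ((P : ℝ) ^ (ε / rr k)), ← Real.rpow_mul hP0.le,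
          div_mul_cancel₀ _ hrR.ne', Real.rpow_add hP0, Real.rpow_natCast, mul_comm]

lemma card_shift_le_energy {ι G : Type*} [AddCommGroup G] [DecidableEq G] (X : Finset ι)
    (w : ι → G) (d : G) :
    ((X ×ˢ X).filter fun z => w z.1 - w z.2 = d).card ≤ energy X w := by
  set N : G → ℕ := fun v => (X.filter fun x => w x = v).card with hN
  have h1 : ∀ d, ((X ×ˢ X).filter fun z => w z.1 - w z.2 = d).card =
      ∑ v ∈ X.image w, N v * N (v + d) := by
    intro d
    have := sum_comp (s := X) (fun v => N (v + d)) w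
    simp only [smul_eq_mul] at this
    rw [← this, card_filter, sum_product_right]
    refine sum_congr rfl fun y _ => ?_
    rw [hN]; simp only [card_filter]
    refine sum_congr rfl fun x _ => ?_
    simp only [sub_eq_iff_eq_add, add_comm d]
  have h2 : energy X w = ∑ v ∈ X.image w, N v * N v := by
    have := h1 0
    simp only [add_zero, sub_eq_zero] at this
    exact this
  rw [h1, h2]
  have h3 : ∑ v ∈ X.image w, N (v + d) * N (v + d) ≤ ∑ v ∈ X.image w, N v * N v := by
    rw [← sum_filter_add_sum_filter_not (X.image w) (fun v => v + d ∈ X.image w)]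
    have h4 : ∑ v ∈ (X.image w).filter (fun v => ¬ (v + d ∈ X.image w)), N (v + d) * N (v + d) = 0 := by
      refine sum_eq_zero fun v hv => ?_
      rw [mem_filter] at hv
      have : N (v + d) = 0 := by
        rw [hN]; simp only [card_eq_zero]
        rw [filter_eq_empty_iff]
        intro x hx hxv
        exact hv.2 (mem_image.2 ⟨x, hx, hxv⟩)
      rw [this, zero_mul]
    rw [h4, add_zero]
    rw [← sum_image (g := fun v => v + d) (f := fun u => N u * N u)
      (fun a _ b _ hab => add_right_cancel hab)]
    refine sum_le_sum_of_subset fun u hu => ?_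
    rw [mem_image] at hu
    obtain ⟨v, hv, rfl⟩ := hu
    exact (mem_filter.1 hv).2
  have h5 : ∑ v ∈ X.image w, 2 * (N v * N (v + d)) ≤
      ∑ v ∈ X.image w, (N v * N v + N (v + d) * N (v + d)) := by
    refine sum_le_sum fun v _ => ?_
    have := two_mul_le_add_sq (N v) (N (v + d))
    nlinarith
  rw [← mul_sum, sum_add_distrib] at h5
  omega

lemma energy_le_card_mul {ι β G : Type*} [AddCommGroup G] [DecidableEq G] [DecidableEq β]
    (X : Finset ι) (v : ι → β) (w : ι → G) (D : Finset G)
    (h : ∀ x ∈ X, ∀ y ∈ X, v x = v y → w x - w y ∈ D) :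
    energy X v ≤ D.card * energy X w := by
  classical
  have : ((X ×ˢ X).filter fun z => v z.1 = v z.2) ⊆
      D.biUnion fun d => (X ×ˢ X).filter fun z => w z.1 - w z.2 = d := by
    intro z hz
    rw [mem_filter, mem_product] at hz
    simp only [mem_biUnion, mem_filter, mem_product]
    exact ⟨_, h _ hz.1.1 _ hz.1.2 hz.2, hz.1, rfl⟩
  exact (card_le_card this).trans
    (card_biUnion_le_card_mul _ _ _ fun d _ => card_shift_le_energy X w d)

lemma sum_fin_eq_rr (k : ℕ) : ∑ i : Fin (k + 1), (i : ℕ) = rr k := by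
  rw [Fin.sum_univ_eq_sum_range (fun i => i), sum_range_id, rr, Nat.add_sub_cancel, mul_comm]

/-- Mean value bound for incomplete systems, given by the degrees in `E`. -/
lemma energy_incomplete (k : ℕ) (hk : 1 ≤ k) (E : Finset (Fin (k + 1))) {ε : ℝ} (hε : 0 < ε) :
    ∃ C : ℝ, 0 < C ∧ ∀ P : ℕ, 1 ≤ P →
      (energy (box (rr k) P) (fun x i => if i ∈ E then psum k x i else 0) : ℝ) ≤
        C * (P : ℝ) ^ (2 * (rr k : ℝ) - (∑ i ∈ E, (i : ℕ) : ℕ) + ε) := by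
  obtain ⟨C, hC, h⟩ := vinogradov_mean_value k hk hε
  have hr := rr_pos hk
  refine ⟨(3 * rr k) ^ (k + 1) * C, by positivity, fun P hP => ?_⟩
  have hP0 : (0 : ℝ) < P := by exact_mod_cast hP
  let D : Finset (Fin (k + 1) → ℤ) := Fintype.piFinset fun i =>
    if i ∈ E then {0} else Icc (-((rr k : ℤ) * (P : ℤ) ^ (i : ℕ))) ((rr k : ℤ) * (P : ℤ) ^ (i : ℕ))
  have h1 := energy_le_card_mul (box (rr k) P) (fun x i => if i ∈ E then psum k x i else 0)
    (psum k) D (by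
      intro x hx y hy hxy
      rw [Fintype.mem_piFinset]
      intro i
      split_ifs with hi
      · have := congrFun hxy i
        simp only [hi, if_true] at this
        simp [this]
      · have hb : ∀ z ∈ box (rr k) P, 0 ≤ psum k z i ∧ psum k z i ≤ (rr k : ℤ) * (P : ℤ) ^ (i : ℕ) := by
          intro z hz
          simp only [box, Fintype.mem_piFinset, mem_Icc] at hz
          constructor
          · exact sum_nonneg fun j _ => pow_nonneg (by linarith [(hz j).1]) _
          · calc psum k z i ≤ ∑ j : Fin (rr k), (P : ℤ) ^ (i : ℕ) :=
                sum_le_sum fun j _ => pow_le_pow_left₀ (by linarith [(hz j).1]) (hz j).2 _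
              _ = _ := by simp
        have := hb x hx; have := hb y hy
        rw [mem_Icc, Pi.sub_apply]; constructor <;> linarith)
  have h2 : (D.card : ℝ) ≤ (3 * rr k) ^ (k + 1) * (P : ℝ) ^ (rr k - ∑ i ∈ E, (i : ℕ)) := by
    have e1 : D.card = ∏ i, (if i ∈ E then ({0} : Finset ℤ) else
        Icc (-((rr k : ℤ) * (P : ℤ) ^ (i : ℕ))) ((rr k : ℤ) * (P : ℤ) ^ (i : ℕ))).card :=
      Fintype.card_piFinset _
    have e2 : ∏ i : Fin (k + 1), (3 * rr k * P ^ (if i ∈ E then 0 else (i : ℕ))) =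
        (3 * rr k) ^ (k + 1) * P ^ (rr k - ∑ i ∈ E, (i : ℕ)) := by
      rw [prod_mul_distrib, prod_pow_eq_pow_sum]
      simp only [prod_const, card_univ, Fintype.card_fin]
      congr 2
      have : ∑ i : Fin (k + 1), (if i ∈ E then 0 else (i : ℕ)) + ∑ i ∈ E, (i : ℕ) = rr k := by
        rw [← sum_fin_eq_rr, ← sum_filter_add_sum_filter_not univ (fun i => i ∈ E) (fun i : Fin (k+1) => (i : ℕ))]
        rw [sum_ite, sum_const_zero, zero_add, filter_mem_eq_inter, univ_inter]
        ring
      omega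
    have e3 : D.card ≤ ∏ i : Fin (k + 1), (3 * rr k * P ^ (if i ∈ E then 0 else (i : ℕ))) := by
      rw [e1]
      refine prod_le_prod' fun i _ => ?_
      split_ifs
      · simp; omega
      · rw [Int.card_Icc]
        have : 1 ≤ rr k * P ^ (i : ℕ) := Nat.mul_pos hr (pow_pos hP _)
        zify at this ⊢
        rw [Int.toNat_of_nonneg (by linarith)]
        linarith
    rw [e2] at e3
    exact_mod_cast e3
  have hE : ∑ i ∈ E, (i : ℕ) ≤ rr k := by
    rw [← sum_fin_eq_rr]; exact sum_le_sum_of_subset (subset_univ E)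
  calc (energy (box (rr k) P) (fun x i => if i ∈ E then psum k x i else 0) : ℝ)
      ≤ D.card * energy (box (rr k) P) (psum k) := by exact_mod_cast h1
    _ ≤ ((3 * rr k) ^ (k + 1) * (P : ℝ) ^ (rr k - ∑ i ∈ E, (i : ℕ))) *
        (C * (P : ℝ) ^ ((rr k : ℝ) + ε)) := by gcongr; exact h P hP
    _ = _ := by
      rw [← Real.rpow_natCast _ (rr k - ∑ i ∈ E, (i : ℕ)), Nat.cast_sub hE, mul_mul_mul_comm,
        ← Real.rpow_add hP0]
      congr 2
      ring

/-- The sum of the `d`-th powers. -/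
def powsum (d : ℕ) {r : ℕ} (x : Fin r → ℤ) : ℤ := ∑ j, x j ^ d

lemma energy_one_degree (n : ℕ) (hn : 1 ≤ n) {ε : ℝ} (hε : 0 < ε) :
    ∃ C : ℝ, 0 < C ∧ ∀ P : ℕ, 1 ≤ P →
      (energy (box (rr n) P) (powsum n) : ℝ) ≤ C * (P : ℝ) ^ (2 * (rr n : ℝ) - n + ε) := by
  obtain ⟨C, hC, h⟩ := energy_incomplete n hn {Fin.last n} hε
  refine ⟨C, hC, fun P hP => le_trans ?_ ((h P hP).trans (le_of_eq (by simp)))⟩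
  exact_mod_cast energy_le_of_comp _ _ _ fun x _ y _ hxy => by
    ext i
    split_ifs with hi
    · simp only [mem_singleton] at hi; subst hi; exact hxy
    · rfl

lemma energy_two_degrees (k n : ℕ) (hkn : n < k) {ε : ℝ} (hε : 0 < ε) :
    ∃ C : ℝ, 0 < C ∧ ∀ P : ℕ, 1 ≤ P →
      (energy (box (rr k) P) (fun x => (powsum k x, powsum n x)) : ℝ) ≤
        C * (P : ℝ) ^ (2 * (rr k : ℝ) - k - n + ε) := by
  have hne : Fin.last k ≠ ⟨n, by omega⟩ := by
    intro h; have := congrArg Fin.val h; simp at this; omega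
  obtain ⟨C, hC, h⟩ := energy_incomplete k (by omega) {Fin.last k, ⟨n, by omega⟩} hε
  refine ⟨C, hC, fun P hP => le_trans ?_ ((h P hP).trans (le_of_eq ?_))⟩
  · exact_mod_cast energy_le_of_comp _ _ _ fun x _ y _ hxy => by
      simp only [Prod.mk.injEq] at hxy
      ext i
      split_ifs with hi
      · simp only [mem_insert, mem_singleton] at hi
        rcases hi with rfl | rfl
        · exact hxy.1
        · exact hxy.2
      · rfl
  · rw [sum_pair hne]; simp only [Fin.val_last]; push_cast; congr 2; ring

/-- The pair mean value, as a count. -/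
lemma energy_pair (k n : ℕ) (hkn : n < k) (hn : 1 ≤ n) {ε : ℝ} (hε : 0 < ε) :
    ∃ C : ℝ, 0 < C ∧ ∀ P : ℕ, 1 ≤ P → ∀ b b' c₀ c₀' c₁ c₁' : ℤ, b ≠ 0 →
      c₀ * c₁' - c₀' * c₁ ≠ 0 →
      (energy (box (rr k) P ×ˢ box (rr n) P) (fun z =>
        (b * powsum k z.1 + b' * powsum k z.2, c₀ * powsum n z.1 + c₀' * powsum n z.2,
          c₁ * powsum n z.1 + c₁' * powsum n z.2)) : ℝ) ≤
        C * (P : ℝ) ^ (2 * (rr k : ℝ) + 2 * (rr n : ℝ) - k - 2 * n + ε) := by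
  obtain ⟨C₁, hC₁, h₁⟩ := energy_two_degrees k n hkn (half_pos hε)
  obtain ⟨C₂, hC₂, h₂⟩ := energy_one_degree n hn (half_pos hε)
  refine ⟨C₁ * C₂, by positivity, fun P hP b b' c₀ c₀' c₁ c₁' hb hdet => ?_⟩
  have hP0 : (0 : ℝ) < P := by exact_mod_cast hP
  set X := box (rr k) P
  set Y := box (rr n) P
  have key : energy (X ×ˢ Y) (fun z =>
        (b * powsum k z.1 + b' * powsum k z.2, c₀ * powsum n z.1 + c₀' * powsum n z.2,
          c₁ * powsum n z.1 + c₁' * powsum n z.2)) ≤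
      energy Y (powsum n) * energy X (fun x => (powsum k x, powsum n x)) := by
    have hX : energy X (fun x => (b * powsum k x, powsum n x)) ≤
        energy X (fun x => (powsum k x, powsum n x)) :=
      energy_le_of_comp _ _ _ fun x _ y _ hxy => by
        simp only [Prod.mk.injEq] at hxy ⊢
        exact ⟨mul_left_cancel₀ hb hxy.1, hxy.2⟩
    refine le_trans ?_ (Nat.mul_le_mul_left _ hX)
    rw [energy]
    refine (card_le_card_of_injOn (t := ((Y ×ˢ Y).filter fun z => powsum n z.1 = powsum n z.2).biUnion
      fun y => ((X ×ˢ X).filter fun z => (b * powsum k z.1, powsum n z.1) -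
        (b * powsum k z.2, powsum n z.2) =
        (b' * powsum k y.2 - b' * powsum k y.1, (0 : ℤ))).image fun x => (x, y))
      (fun z => ((z.1.1, z.2.1), (z.1.2, z.2.2))) ?_ ?_).trans ?_
    · intro z hz
      simp only [coe_filter, Set.mem_ofPred_eq, mem_product, Prod.mk.injEq] at hz
      obtain ⟨⟨⟨hx, hy⟩, hx', hy'⟩, e1, e2, e3⟩ := hz
      have d1 : (c₀ * c₁' - c₀' * c₁) * (powsum n z.1.1 - powsum n z.2.1) = 0 := by
        linear_combination c₁' * e2 - c₀' * e3
      have d2 : (c₀ * c₁' - c₀' * c₁) * (powsum n z.1.2 - powsum n z.2.2) = 0 := by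
        linear_combination c₀ * e3 - c₁ * e2
      have d1' := (mul_eq_zero.1 d1).resolve_left hdet
      have d2' := (mul_eq_zero.1 d2).resolve_left hdet
      simp only [coe_biUnion, Set.mem_iUnion, coe_image, Set.mem_image, mem_coe, mem_filter,
        mem_product, Prod.mk.injEq, Prod.mk_sub_mk]
      refine ⟨(z.1.2, z.2.2), ⟨⟨hy, hy'⟩, by linarith⟩, (z.1.1, z.2.1), ⟨⟨hx, hx'⟩, ?_, by linarith⟩, ?_, ?_⟩
      · linarith
      · simp
      · simp
    · intro z _ z' _ h
      simp only [Prod.mk.injEq] at h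
      ext1 <;> ext1 <;> tauto
    · refine card_biUnion_le_card_mul _ _ _ fun y _ => card_image_le.trans ?_
      exact card_shift_le_energy X (fun x => (b * powsum k x, powsum n x)) _
  calc _ ≤ (energy Y (powsum n) : ℝ) * energy X (fun x => (powsum k x, powsum n x)) := by
        exact_mod_cast key
    _ ≤ (C₂ * (P : ℝ) ^ (2 * (rr n : ℝ) - n + ε / 2)) *
        (C₁ * (P : ℝ) ^ (2 * (rr k : ℝ) - k - n + ε / 2)) := by
        gcongr
        · exact h₂ P hP
        · exact h₁ P hP
    _ = _ := by
      rw [mul_mul_mul_comm, ← Real.rpow_add hP0, mul_comm C₂]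
      congr 2; ring

end PadicDecoupling

namespace CircleMethod
open MeasureTheory PadicDecoupling

/-- The additive character `exp (2 π i t)`. -/
noncomputable def ee (t : ℝ) : ℂ := Complex.exp (2 * Real.pi * Complex.I * t)

lemma norm_ee (t : ℝ) : ‖ee t‖ = 1 := by
  rw [ee, show (2 * Real.pi * Complex.I * t : ℂ) = ((2 * Real.pi * t : ℝ) : ℂ) * Complex.I by
    push_cast; ring]
  exact Complex.norm_exp_ofReal_mul_I _

lemma ee_add (s t : ℝ) : ee (s + t) = ee s * ee t := by
  rw [ee, ee, ee, ← Complex.exp_add]; congr 1; push_cast; ring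

lemma ee_zero : ee 0 = 1 := by simp [ee]

lemma ee_int (m : ℤ) : ee m = 1 := by
  rw [ee, Complex.exp_eq_one_iff]; exact ⟨m, by push_cast; ring⟩

lemma ee_neg (t : ℝ) : ee (-t) = (ee t)⁻¹ := by
  exact eq_inv_of_mul_eq_one_left (by rw [← ee_add, neg_add_cancel, ee_zero])

lemma conj_ee (t : ℝ) : (starRingEnd ℂ) (ee t) = ee (-t) := by
  rw [ee_neg, Complex.inv_eq_conj (norm_ee t)]

lemma ee_sum {ι : Type*} (s : Finset ι) (f : ι → ℝ) : ee (∑ i ∈ s, f i) = ∏ i ∈ s, ee (f i) := by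
  classical
  induction s using Finset.induction_on with
  | empty => simp [ee_zero]
  | insert a s ha ih => rw [sum_insert ha, prod_insert ha, ee_add, ih]

lemma continuous_ee : Continuous ee := by unfold ee; fun_prop

/-- The half-open unit cube with corner `u`. -/
def cube (u : Fin 3 → ℝ) : Set (Fin 3 → ℝ) := Set.pi Set.univ fun i => Set.Ioc (u i) (u i + 1)

lemma measurableSet_cube (u : Fin 3 → ℝ) : MeasurableSet (cube u) :=
  MeasurableSet.univ_pi fun _ => measurableSet_Ioc

lemma integrableOn_cube {E : Type*} [NormedAddCommGroup E] {f : (Fin 3 → ℝ) → E} (hf : Continuous f) (u : Fin 3 → ℝ) :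
    IntegrableOn f (cube u) := by
  have : cube u ⊆ Set.Icc u (fun i => u i + 1) := by
    rw [← Set.pi_univ_Icc]
    exact Set.pi_mono fun i _ => Set.Ioc_subset_Icc_self
  exact (hf.continuousOn.integrableOn_compact isCompact_Icc).mono_set this

lemma integral_ee_mul_int (u : ℝ) (h : ℤ) :
    ∫ x in Set.Ioc u (u + 1), ee (x * h) = if h = 0 then 1 else 0 := by
  rw [← intervalIntegral.integral_of_le (by linarith)]
  split_ifs with hh
  · subst hh; simp [ee_zero]
  · have hc : (2 * Real.pi * Complex.I * h : ℂ) ≠ 0 := by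
      have : (h : ℂ) ≠ 0 := by exact_mod_cast hh
      have := Complex.two_pi_I_ne_zero
      positivity
    have := integral_exp_mul_complex (a := u) (b := u + 1) hc
    have e1 : ∀ x : ℝ, ee (x * h) = Complex.exp (2 * Real.pi * Complex.I * h * x) := by
      intro x; rw [ee]; congr 1; push_cast; ring
    simp only [e1]
    rw [this]
    rw [← e1, ← e1, add_mul, one_mul, ee_add, ee_int, mul_one, sub_self, zero_div]

lemma integral_cube_ee (u : Fin 3 → ℝ) (h : Fin 3 → ℤ) :
    ∫ α in cube u, ee (∑ i, α i * h i) = if h = 0 then 1 else 0 := by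
  simp only [ee_sum]
  rw [cube, volume_pi, Measure.restrict_pi_pi,
    integral_fintype_prod_eq_prod (μ := fun i => volume.restrict (Set.Ioc (u i) (u i + 1)))
      (fun i (x : ℝ) => ee (x * h i))]
  simp only [integral_ee_mul_int]
  split_ifs with hh
  · subst hh; simp
  · obtain ⟨i, hi⟩ := Function.ne_iff.1 hh
    exact prod_eq_zero (mem_univ i) (if_neg hi)

lemma continuous_ee_dot (h : Fin 3 → ℤ) : Continuous fun α : Fin 3 → ℝ => ee (∑ i, α i * h i) :=
  continuous_ee.comp (by fun_prop)

lemma integral_cube_sum_ee {ι : Type*} (u : Fin 3 → ℝ) (X : Finset ι) (v : ι → Fin 3 → ℤ) :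
    ∫ α in cube u, ∑ x ∈ X, ee (∑ i, α i * v x i) = ((X.filter fun x => v x = 0).card : ℂ) := by
  rw [integral_finsetSum _ fun x _ => integrableOn_cube (continuous_ee_dot _) u]
  simp only [integral_cube_ee, card_filter]
  push_cast; rfl

lemma integral_cube_norm_sq {ι : Type*} (u : Fin 3 → ℝ) (X : Finset ι) (v : ι → Fin 3 → ℤ) :
    ∫ α in cube u, ‖∑ x ∈ X, ee (∑ i, α i * v x i)‖ ^ 2 = (energy X v : ℝ) := by
  have key : ∀ α : Fin 3 → ℝ, ((‖∑ x ∈ X, ee (∑ i, α i * v x i)‖ ^ 2 : ℝ) : ℂ) =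
      ∑ z ∈ X ×ˢ X, ee (∑ i, α i * (v z.1 - v z.2) i) := by
    intro α
    push_cast
    rw [← Complex.mul_conj', map_sum, sum_mul_sum, sum_product]
    refine sum_congr rfl fun x _ => sum_congr rfl fun y _ => ?_
    rw [conj_ee, ← ee_add, ← sum_neg_distrib, ← sum_add_distrib]
    congr 1
    refine sum_congr rfl fun i _ => ?_
    simp only [Pi.sub_apply]; push_cast; ring
  have := integral_cube_sum_ee u (X ×ˢ X) (fun z => v z.1 - v z.2)
  simp only [← key, sub_eq_zero] at this
  have h2 := (integral_ofReal (𝕜 := ℂ) (μ := volume.restrict (cube u))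
    (f := fun α => ‖∑ x ∈ X, ee (∑ i, α i * v x i)‖ ^ 2)).symm.trans this
  refine Complex.ofReal_injective (h2.trans ?_)
  rw [energy, Complex.ofReal_natCast]

/-- The Weyl sum with degrees `k` and `n`. -/
noncomputable def weyl (k n P : ℕ) (s t : ℝ) : ℂ :=
  ∑ x ∈ Icc (1 : ℤ) P, ee (s * (x : ℝ) ^ k + t * (x : ℝ) ^ n)

lemma norm_weyl_le (k n P : ℕ) (s t : ℝ) : ‖weyl k n P s t‖ ≤ P := by
  refine (norm_sum_le _ _).trans ?_
  simp [norm_ee]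

lemma continuous_weyl (k n P : ℕ) {X : Type*} [TopologicalSpace X] {f g : X → ℝ}
    (hf : Continuous f) (hg : Continuous g) : Continuous fun x => weyl k n P (f x) (g x) :=
  continuous_finsetSum _ fun _ _ => continuous_ee.comp (by fun_prop)

lemma weyl_pow (k n P r : ℕ) (s t : ℝ) :
    weyl k n P s t ^ r = ∑ x ∈ box r P, ee (s * powsum k x + t * powsum n x) := by
  rw [weyl, sum_pow', PadicDecoupling.box]
  refine sum_congr rfl fun x _ => ?_
  rw [← ee_sum]
  congr 1
  simp only [powsum]
  push_cast
  rw [sum_add_distrib, mul_sum, mul_sum]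

/-- The Weyl sum of the `j`-th variable. -/
noncomputable def fsum {s : ℕ} (k n P : ℕ) (b : Fin s → ℤ) (c : Fin 2 → Fin s → ℤ) (j : Fin s)
    (α : Fin 3 → ℝ) : ℂ :=
  weyl k n P (b j * α 0) (c 0 j * α 1 + c 1 j * α 2)

section
variable {s : ℕ} (k n : ℕ) (b : Fin s → ℤ) (c : Fin 2 → Fin s → ℤ)

lemma continuous_fsum (P : ℕ) (j : Fin s) : Continuous (fsum k n P b c j) :=
  continuous_weyl _ _ _ (by fun_prop) (by fun_prop)

lemma norm_fsum_le (P : ℕ) (j : Fin s) (α : Fin 3 → ℝ) : ‖fsum k n P b c j α‖ ≤ P :=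
  norm_weyl_le _ _ _ _ _

lemma integral_pair (P r₁ r₂ : ℕ) (u : Fin 3 → ℝ) (i j : Fin s) :
    ∫ α in cube u, ‖fsum k n P b c i α‖ ^ (2 * r₁) * ‖fsum k n P b c j α‖ ^ (2 * r₂) =
      (energy (box r₁ P ×ˢ box r₂ P) (fun z =>
        (b i * powsum k z.1 + b j * powsum k z.2, c 0 i * powsum n z.1 + c 0 j * powsum n z.2,
          c 1 i * powsum n z.1 + c 1 j * powsum n z.2)) : ℝ) := by
  have e1 : energy (box r₁ P ×ˢ box r₂ P) (fun z =>
        (b i * powsum k z.1 + b j * powsum k z.2, c 0 i * powsum n z.1 + c 0 j * powsum n z.2,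
          c 1 i * powsum n z.1 + c 1 j * powsum n z.2)) =
      energy (box r₁ P ×ˢ box r₂ P) (fun z =>
        ![b i * powsum k z.1 + b j * powsum k z.2, c 0 i * powsum n z.1 + c 0 j * powsum n z.2,
          c 1 i * powsum n z.1 + c 1 j * powsum n z.2]) := by
    unfold energy; congr 1
    refine filter_congr fun z _ => ?_
    simp [funext_iff, Fin.forall_fin_succ, Prod.ext_iff]
  rw [e1, ← integral_cube_norm_sq u]
  congr 1
  ext α
  rw [mul_comm 2 r₁, mul_comm 2 r₂, pow_mul, pow_mul, ← mul_pow, ← norm_pow, ← norm_pow,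
    ← norm_mul, fsum, fsum, weyl_pow, weyl_pow, sum_mul_sum, sum_product]
  congr 2
  refine sum_congr rfl fun x _ => sum_congr rfl fun y _ => ?_
  rw [← ee_add]
  congr 1
  simp only [Fin.sum_univ_three, Matrix.cons_val]
  push_cast
  ring

lemma integral_pair_le (hkn : n < k) (hn : 1 ≤ n) (hb0 : ∀ j, b j ≠ 0)
    (hminor : ∀ j₁ j₂ : Fin s, j₁ ≠ j₂ → c 0 j₁ * c 1 j₂ - c 0 j₂ * c 1 j₁ ≠ 0)
    {ε : ℝ} (hε : 0 < ε) : ∃ C : ℝ, 0 < C ∧ ∀ P : ℕ, 1 ≤ P → ∀ u : Fin 3 → ℝ, ∀ i j, i ≠ j →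
      ∫ α in cube u, ‖fsum k n P b c i α‖ ^ (2 * rr k) * ‖fsum k n P b c j α‖ ^ (2 * rr n) ≤
        C * (P : ℝ) ^ (2 * (rr k : ℝ) + 2 * (rr n : ℝ) - k - 2 * n + ε) := by
  obtain ⟨C, hC, h⟩ := energy_pair k n hkn hn hε
  refine ⟨C, hC, fun P hP u i j hij => ?_⟩
  rw [integral_pair]
  exact h P hP _ _ _ _ _ _ (hb0 i) (hminor i j hij)

lemma prod_le_sum_pairs {ι : Type*} [DecidableEq ι] (S : Finset ι) (y : ι → ℝ) {P : ℝ}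
    (hy0 : ∀ j, 0 ≤ y j) (hyP : ∀ j, y j ≤ P) {r₁ r₂ : ℕ} (h₁ : 1 ≤ r₁) (h₂ : 1 ≤ r₂)
    (hS : r₁ + r₂ ≤ S.card) :
    ∏ j ∈ S, y j ≤ P ^ (S.card - (r₁ + r₂)) *
      ∑ i ∈ S, ∑ l ∈ S.erase i, y i ^ r₁ * y l ^ r₂ := by
  have hP : S.Nonempty → 0 ≤ P := fun ⟨j, _⟩ => (hy0 j).trans (hyP j)
  have hne : S.Nonempty := card_pos.1 (by omega)
  replace hP := hP hne
  obtain ⟨i, hi, hmax⟩ := exists_max_image S y hne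
  have hce : (S.erase i).card = S.card - 1 := card_erase_of_mem hi
  obtain ⟨l, hl, hmax2⟩ := exists_max_image (S.erase i) y (card_pos.1 (by omega))
  have h1 : ∏ j ∈ S, y j ≤ y i * y l ^ (S.card - 1) := by
    rw [← mul_prod_erase S y hi, ← hce]
    exact mul_le_mul_of_nonneg_left ((prod_le_prod (fun j _ => hy0 j) fun j hj => hmax2 j hj).trans_eq (prod_const _)) (hy0 i)
  have hli : y l ≤ y i := hmax l (mem_of_mem_erase hl)
  have h2 : y i * y l ^ (S.card - 1) ≤ P ^ (S.card - (r₁ + r₂)) * (y i ^ r₁ * y l ^ r₂) := by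
    have e : S.card - 1 = (S.card - (r₁ + r₂)) + (r₁ - 1) + r₂ := by omega
    rw [e, pow_add, pow_add]
    have a1 := hy0 i
    have a2 := hy0 l
    calc _ ≤ y i * (P ^ (S.card - (r₁ + r₂)) * y i ^ (r₁ - 1) * y l ^ r₂) := by
          gcongr
          exact hyP l
      _ = P ^ (S.card - (r₁ + r₂)) * ((y i ^ (r₁ - 1) * y i) * y l ^ r₂) := by ring
      _ = _ := by rw [← pow_succ, Nat.sub_add_cancel h₁]
  refine h1.trans (h2.trans (mul_le_mul_of_nonneg_left ?_ (pow_nonneg hP _)))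
  refine (single_le_sum (f := fun l => y i ^ r₁ * y l ^ r₂) (fun l _ => ?_) hl).trans
    (single_le_sum (f := fun i => ∑ l ∈ S.erase i, y i ^ r₁ * y l ^ r₂) (fun i _ => ?_) hi)
  · exact mul_nonneg (pow_nonneg (hy0 _) _) (pow_nonneg (hy0 _) _)
  · exact sum_nonneg fun l _ => mul_nonneg (pow_nonneg (hy0 _) _) (pow_nonneg (hy0 _) _)

/-- Mean value of products of at least `k (k + 1) + n (n + 1)` Weyl sums. -/
lemma integral_prod_le (hkn : n < k) (hn : 1 ≤ n) (hb0 : ∀ j, b j ≠ 0)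
    (hminor : ∀ j₁ j₂ : Fin s, j₁ ≠ j₂ → c 0 j₁ * c 1 j₂ - c 0 j₂ * c 1 j₁ ≠ 0)
    {ε : ℝ} (hε : 0 < ε) : ∃ C : ℝ, 0 < C ∧ ∀ P : ℕ, 1 ≤ P → ∀ u : Fin 3 → ℝ,
      ∀ S : Finset (Fin s), 2 * rr k + 2 * rr n ≤ S.card →
      ∫ α in cube u, ∏ j ∈ S, ‖fsum k n P b c j α‖ ≤
        C * (P : ℝ) ^ ((S.card : ℝ) - k - 2 * n + ε) := by
  obtain ⟨C, hC, h⟩ := integral_pair_le k n b c hkn hn hb0 hminor hε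
  refine ⟨(s + 1) ^ 2 * C, by positivity, fun P hP u S hS => ?_⟩
  have hP0 : (0 : ℝ) < P := by exact_mod_cast hP
  have hr1 := rr_pos (d := k) (by omega)
  have hr2 := rr_pos (d := n) hn
  have hcont : ∀ i j, Continuous fun α =>
      ‖fsum k n P b c i α‖ ^ (2 * rr k) * ‖fsum k n P b c j α‖ ^ (2 * rr n) := fun i j =>
    ((continuous_fsum k n b c P i).norm.pow _).mul ((continuous_fsum k n b c P j).norm.pow _)
  set t := 2 * rr k + 2 * rr n with ht
  calc _ ≤ ∫ α in cube u, (P : ℝ) ^ (S.card - t) * ∑ i ∈ S, ∑ l ∈ S.erase i,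
        ‖fsum k n P b c i α‖ ^ (2 * rr k) * ‖fsum k n P b c l α‖ ^ (2 * rr n) := by
        refine integral_mono (integrableOn_cube (continuous_finsetProd _ fun j _ =>
          (continuous_fsum k n b c P j).norm) u) (integrableOn_cube (continuous_const.mul
          (continuous_finsetSum _ fun i _ => continuous_finsetSum _ fun l _ => hcont i l)) u)
          fun α => ?_
        exact prod_le_sum_pairs S (fun j => ‖fsum k n P b c j α‖) (fun j => norm_nonneg _)
          (fun j => norm_fsum_le _ _ _ _ _ _ _) (by omega) (by omega) hS
    _ = (P : ℝ) ^ (S.card - t) * ∑ i ∈ S, ∑ l ∈ S.erase i, ∫ α in cube u,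
        ‖fsum k n P b c i α‖ ^ (2 * rr k) * ‖fsum k n P b c l α‖ ^ (2 * rr n) := by
        rw [integral_const_mul, integral_finsetSum _ fun i _ => integrableOn_cube
          (continuous_finsetSum _ fun l _ => hcont i l) u]
        congr 1
        refine sum_congr rfl fun i _ => ?_
        rw [integral_finsetSum _ fun l _ => integrableOn_cube (hcont i l) u]
    _ ≤ (P : ℝ) ^ (S.card - t) * ∑ i ∈ S, ∑ l ∈ S.erase i,
        C * (P : ℝ) ^ (2 * (rr k : ℝ) + 2 * (rr n : ℝ) - k - 2 * n + ε) := by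
        gcongr with i hi l hl
        exact h P hP u i l (ne_of_mem_erase hl).symm
    _ ≤ (P : ℝ) ^ (S.card - t) * ((s + 1) ^ 2 *
        (C * (P : ℝ) ^ (2 * (rr k : ℝ) + 2 * (rr n : ℝ) - k - 2 * n + ε))) := by
        set Z := C * (P : ℝ) ^ (2 * (rr k : ℝ) + 2 * (rr n : ℝ) - k - 2 * n + ε) with hZ
        have hZ0 : 0 ≤ Z := by positivity
        have hSs : (S.card : ℝ) ≤ s + 1 := by
          have := card_le_univ S; rw [Fintype.card_fin] at this
          have : (S.card : ℝ) ≤ s := by exact_mod_cast this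
          linarith
        refine mul_le_mul_of_nonneg_left ?_ (by positivity)
        calc _ ≤ ∑ i ∈ S, (s + 1) * Z := by
              refine sum_le_sum fun i _ => ?_
              rw [sum_const, nsmul_eq_mul]
              have : ((S.erase i).card : ℝ) ≤ S.card := by exact_mod_cast card_erase_le
              exact mul_le_mul_of_nonneg_right (this.trans hSs) hZ0
          _ = S.card * ((s + 1) * Z) := by rw [sum_const, nsmul_eq_mul]
          _ ≤ (s + 1) * ((s + 1) * Z) := by gcongr
          _ = _ := by ring
    _ = _ := by
        have : ((S.card : ℝ) - k - 2 * n + ε) =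
            ((S.card - t : ℕ) : ℝ) + (2 * (rr k : ℝ) + 2 * (rr n : ℝ) - k - 2 * n + ε) := by
          rw [Nat.cast_sub hS, ht]; push_cast; ring
        rw [this, Real.rpow_add hP0 ((S.card - t : ℕ) : ℝ), Real.rpow_natCast]; ring

end

lemma card_range_modEq_le {N q : ℕ} {G : Finset ℕ} (hG : ∀ h ∈ G, h < N)
    (hmod : ∀ h ∈ G, ∀ h' ∈ G, (q : ℤ) ∣ (h : ℤ) - h') : G.card ≤ N / q + 1 := by
  rw [← card_range (N / q + 1)]
  refine card_le_card_of_injOn (fun h => h / q) (fun h hh => ?_) fun h hh h' hh' he => ?_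
  · simp only [coe_range, Set.mem_Iio]
    exact Nat.lt_succ_of_le (Nat.div_le_div_right (hG h hh).le)
  · have h1 : h % q = h' % q := by
      have := (Nat.modEq_iff_dvd (n := q) (a := h') (b := h)).2 (hmod h hh h' hh')
      exact this.symm
    simp only at he
    rw [← Nat.div_add_mod h q, ← Nat.div_add_mod h' q, h1, he]

/-- If many multiples `h α`, `h < N`, are very close to integers, then `α` is close to a rational
with small denominator. -/
lemma exists_approx_of_many {N : ℕ} {α κ τ : ℝ} {G : Finset ℕ} (hτ0 : 0 < τ)
    (hκ0 : 0 ≤ κ) (hG : ∀ h ∈ G, h < N) (hGa : ∀ h ∈ G, ∃ a : ℤ, |α * h - a| ≤ κ)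
    (hcard : τ * N ≤ G.card) (hκ : 48 * κ ≤ τ) (hN : 8 ≤ τ * N) :
    ∃ q : ℕ, 1 ≤ q ∧ (q : ℝ) ≤ 4 / τ ∧ ∃ a : ℤ, |q * α - a| ≤ 8 * κ / (τ ^ 2 * N) := by
  have hN0 : 0 < N := by
    rcases Nat.eq_zero_or_pos N with h | h
    · subst h; norm_num at hN
    · exact h
  have hNr : (0 : ℝ) < N := by exact_mod_cast hN0
  obtain ⟨r, hr1, hr2⟩ := Real.exists_rat_abs_sub_le_and_den_le α (n := 2 * N) (by omega)
  set q := r.den with hq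
  have hq0 : 0 < q := r.den_pos
  have hqr : (0 : ℝ) < q := by exact_mod_cast hq0
  have hq2 : (q : ℝ) ≤ 2 * N := by exact_mod_cast hr2
  have hrq : (r : ℝ) = r.num / q := by rw [hq]; exact_mod_cast (Rat.num_div_den r).symm
  set θ := α - r with hθ
  have hθ1 : |θ| * (q * (2 * N)) < 1 := by
    rw [le_div_iff₀ (by positivity)] at hr1
    push_cast at hr1
    rcases eq_or_ne θ 0 with h0 | h0
    · rw [h0]; norm_num
    · have := abs_pos.2 h0
      nlinarith [mul_pos this hqr]
  choose! A hA using hGa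
  have hdvd : ∀ h h' a : ℤ, |h - h'| ≤ (N : ℤ) → |α * (h - h') - a| ≤ 1 / (2 * q) →
      (q : ℤ) ∣ h - h' := by
    intro h h' a hh ht
    have e : ((h - h' : ℤ) : ℝ) * r.num - q * a = q * ((α * (h - h') - a) - (h - h') * θ) := by
      have : (q : ℝ) * r = r.num := by rw [hrq]; field_simp
      rw [← this, hθ]; push_cast; ring
    have hhr : |(h - h' : ℝ)| ≤ N := by exact_mod_cast hh
    have hlt : |((h - h' : ℤ) : ℝ) * r.num - q * a| < 1 := by
      rw [e, abs_mul, abs_of_pos hqr]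
      have h1 : |(α * (h - h') - a) - (h - h') * θ| ≤ 1 / (2 * q) + N * |θ| := by
        refine (abs_sub _ _).trans (add_le_add ht ?_)
        rw [abs_mul]; gcongr
      calc _ ≤ q * (1 / (2 * q) + N * |θ|) := by gcongr
        _ = 1 / 2 + (|θ| * (q * (2 * N))) / 2 := by field_simp
        _ < 1 := by linarith
    have hz : (h - h') * r.num - q * a = 0 := by
      rw [← Int.abs_lt_one_iff]; exact_mod_cast hlt
    have h2 : (q : ℤ) ∣ (h - h') * r.num := ⟨a, by linarith⟩
    refine IsCoprime.dvd_of_dvd_mul_right ?_ h2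
    have := r.reduced
    rw [Int.isCoprime_iff_gcd_eq_one, Int.gcd_eq_natAbs, Int.natAbs_natCast, Nat.gcd_comm]
    exact this
  -- the denominator is small
  have hqτ : (q : ℝ) ≤ 4 / τ := by
    have hfib : ∀ y ∈ G.image (fun h => ⌊2 * q * (α * h - A h)⌋),
        (G.filter fun h => ⌊2 * q * (α * h - A h)⌋ = y).card ≤ N / q + 1 := by
      intro y _
      refine card_range_modEq_le (fun h hh => hG h (mem_filter.1 hh).1) fun h hh h' hh' => ?_
      obtain ⟨h1, h2⟩ := mem_filter.1 hh
      obtain ⟨h1', h2'⟩ := mem_filter.1 hh'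
      refine hdvd h h' (A h - A h') ?_ ?_
      · have := hG h h1
        have := hG h' h1'
        rw [abs_le]; constructor <;> omega
      · have := (Int.abs_sub_lt_one_of_floor_eq_floor (h2.trans h2'.symm)).le
        rw [← mul_sub, abs_mul, abs_of_pos (by positivity)] at this
        rw [le_div_iff₀ (by positivity)]
        push_cast
        rw [show α * ((h : ℝ) - h') - (A h - A h') = α * h - A h - (α * h' - A h') by ring]
        linarith
    have h1 := card_le_mul_card_image G (N / q + 1) hfib
    have h2 : ((G.image (fun h => ⌊2 * q * (α * h - A h)⌋)).card : ℝ) ≤ 4 * q * κ + 2 := by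
      have hsub : G.image (fun h => ⌊2 * q * (α * h - A h)⌋) ⊆
          Icc ⌊-(2 * q * κ)⌋ ⌊2 * q * κ⌋ := by
        intro y hy
        obtain ⟨h, hh, rfl⟩ := mem_image.1 hy
        have := abs_le.1 (hA h hh)
        rw [mem_Icc]
        constructor <;> apply Int.floor_le_floor <;> nlinarith
      have h3 := card_le_card hsub
      rw [Int.card_Icc] at h3
      have h4 : ⌊-(2 * q * κ)⌋ ≤ ⌊2 * q * κ⌋ := Int.floor_le_floor (by nlinarith [mul_nonneg hqr.le hκ0])
      have h5 : (((⌊2 * q * κ⌋ + 1 - ⌊-(2 * q * κ)⌋).toNat : ℤ) : ℝ) ≤ 4 * q * κ + 2 := by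
        rw [Int.toNat_of_nonneg (by omega)]
        push_cast
        have a1 := Int.floor_le (2 * q * κ : ℝ)
        have a2 := Int.sub_one_lt_floor (-(2 * q * κ) : ℝ)
        linarith
      refine le_trans ?_ h5
      exact_mod_cast h3
    have h3 : (G.card : ℝ) ≤ (N / q + 1) * (4 * q * κ + 2) := by
      calc (G.card : ℝ) ≤ ((N / q + 1 : ℕ) : ℝ) *
            ((G.image (fun h => ⌊2 * q * (α * h - A h)⌋)).card : ℝ) := by exact_mod_cast h1
        _ ≤ _ := by
            gcongr
            push_cast
            gcongr
            exact Nat.cast_div_le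
    have h4 : ((N : ℝ) / q + 1) * (4 * q * κ + 2) = 4 * κ * N + 4 * q * κ + 2 * (N / q) + 2 := by
      field_simp; ring
    have h5 : 4 * q * κ ≤ 8 * κ * N := by nlinarith
    have h6 : τ * N / 2 ≤ 2 * (N / q) := by nlinarith
    rw [le_div_iff₀ hτ0]
    have h7 : τ * N / 2 * q ≤ 2 * N := by
      calc τ * N / 2 * q ≤ 2 * ((N : ℝ) / q) * q := by gcongr
        _ = 2 * N := by field_simp
    nlinarith
  refine ⟨q, hq0, hqτ, r.num, ?_⟩
  -- the largest good multiple
  have hGne : G.Nonempty := by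
    rw [← card_pos]; exact_mod_cast (by linarith : (0 : ℝ) < G.card)
  obtain ⟨h, hh, hmax⟩ := exists_max_image G id hGne
  have hhτ : τ * N ≤ 2 * h := by
    have : G ⊆ range (h + 1) := fun x hx => mem_range.2 (Nat.lt_succ_of_le (hmax x hx))
    have h1 := card_le_card this
    rw [card_range] at h1
    have h2 : (G.card : ℝ) ≤ h + 1 := by exact_mod_cast h1
    linarith
  have hκq : κ ≤ 1 / (2 * q) := by
    rw [le_div_iff₀ (by positivity)]
    rw [le_div_iff₀ hτ0] at hqτ
    nlinarith
  have hqh : (q : ℤ) ∣ h := by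
    have := hdvd h 0 (A h) (by rw [sub_zero, abs_of_nonneg (by positivity)]; exact_mod_cast (hG h hh).le)
      (by push_cast; rw [sub_zero]; exact (hA h hh).trans hκq)
    simpa using this
  obtain ⟨m, hm⟩ := hqh
  have hhN : (h : ℝ) ≤ N := by exact_mod_cast (hG h hh).le
  have e1 : α * h - A h = h * θ + ((m * r.num - A h : ℤ) : ℝ) := by
    have h1 : (h : ℝ) = q * m := by exact_mod_cast hm
    have h2 : (r : ℝ) * h = m * r.num := by rw [hrq, h1]; field_simp
    push_cast
    rw [← h2, hθ]; ring
  have hhθ : |h * θ| < 1 / 2 := by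
    rw [abs_mul, abs_of_nonneg (by positivity : (0 : ℝ) ≤ h)]
    have hq1 : (1 : ℝ) ≤ q := by exact_mod_cast hq0
    have : |θ| * (2 * N) ≤ |θ| * (q * (2 * N)) := by
      have := abs_nonneg θ
      have := mul_nonneg this hNr.le
      nlinarith
    have h3 : h * |θ| ≤ N * |θ| := by gcongr
    linarith
  have hκ2 : κ ≤ 1 / 2 := by
    refine hκq.trans ?_
    have hq1 : (1 : ℝ) ≤ q := by exact_mod_cast hq0
    rw [div_le_div_iff₀ (by positivity) (by norm_num)]; linarith
  have hInt : m * r.num - A h = 0 := by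
    rw [← Int.abs_lt_one_iff]
    have : |((m * r.num - A h : ℤ) : ℝ)| < 1 := by
      have : ((m * r.num - A h : ℤ) : ℝ) = (α * h - A h) - h * θ := by rw [e1]; ring
      rw [this]
      refine (abs_sub _ _).trans_lt ?_
      linarith [hA h hh]
    exact_mod_cast this
  have hfin : |h * θ| ≤ κ := by
    have := hA h hh
    rwa [e1, hInt, Int.cast_zero, add_zero] at this
  rw [abs_mul, abs_of_nonneg (by positivity : (0 : ℝ) ≤ h)] at hfin
  have e2 : q * α - r.num = q * θ := by
    have : (q : ℝ) * r = r.num := by rw [hrq]; field_simp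
    rw [hθ, ← this]; ring
  rw [e2, abs_mul, abs_of_pos hqr, le_div_iff₀ (by positivity)]
  rw [le_div_iff₀ hτ0] at hqτ
  have := abs_nonneg θ
  calc q * |θ| * (τ ^ 2 * N) = (q * τ) * (τ * N * |θ|) := by ring
    _ ≤ 4 * (2 * h * |θ|) := by gcongr
    _ ≤ 8 * κ := by nlinarith

/-- The van der Corput (Weyl) differencing inequality. -/
lemma norm_sum_sq_le (z : ℕ → ℂ) (N : ℕ) :
    ‖∑ x ∈ range N, z x‖ ^ 2 ≤
      2 * ∑ h ∈ range N, ‖∑ x ∈ range (N - h), z (x + h) * (starRingEnd ℂ) (z x)‖ := by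
  have h1 : ∀ N : ℕ, ‖∑ x ∈ range N, z x‖ ^ 2 ≤
      2 * (∑ x ∈ range N, ∑ y ∈ range (x + 1), z x * (starRingEnd ℂ) (z y)).re := by
    intro N
    induction N with
    | zero => simp
    | succ N ih =>
      rw [sum_range_succ, sum_range_succ]
      rw [← mul_sum, ← map_sum, sum_range_succ]
      simp only [← Complex.normSq_eq_norm_sq, Complex.normSq_add] at ih ⊢
      rw [map_add, mul_add, Complex.add_re, Complex.add_re, Complex.mul_conj, Complex.ofReal_re]
      have : ((∑ x ∈ range N, z x) * (starRingEnd ℂ) (z N)).re =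
          (z N * (starRingEnd ℂ) (∑ x ∈ range N, z x)).re := by
        simp only [Complex.mul_re, Complex.conj_re, Complex.conj_im]; ring
      have := Complex.normSq_nonneg (z N)
      linarith
  have h2 : ∑ x ∈ range N, ∑ y ∈ range (x + 1), z x * (starRingEnd ℂ) (z y) =
      ∑ h ∈ range N, ∑ x ∈ range (N - h), z (x + h) * (starRingEnd ℂ) (z x) := by
    rw [sum_sigma', sum_sigma']
    refine sum_bij' (fun a _ => ⟨a.1 - a.2, a.2⟩) (fun a _ => ⟨a.2 + a.1, a.2⟩) ?_ ?_ ?_ ?_ ?_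
    · rintro ⟨x, y⟩ h; simp only [mem_sigma, mem_range] at h ⊢; omega
    · rintro ⟨x, y⟩ h; simp only [mem_sigma, mem_range] at h ⊢; omega
    · rintro ⟨x, y⟩ h; simp only [mem_sigma, mem_range] at h ⊢
      rw [Nat.add_sub_cancel' (by omega)]
    · rintro ⟨x, y⟩ h; simp
    · rintro ⟨x, y⟩ h; simp only [mem_sigma, mem_range] at h ⊢
      rw [Nat.add_sub_cancel' (by omega)]
  refine (h1 N).trans ?_
  rw [h2]
  refine mul_le_mul_of_nonneg_left ?_ (by norm_num)
  exact (Complex.re_le_norm _).trans (norm_sum_le _ _)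

open Polynomial in
lemma diff_poly {d : ℕ} {p : ℝ[X]} (hp : p.natDegree ≤ d + 1) (h : ℝ) :
    (taylor h p - p).natDegree ≤ d ∧ (taylor h p - p).coeff d = (d + 1) * h * p.coeff (d + 1) := by
  have hc : ∀ m, p.coeff (d + 1 + 1 + m) = 0 := fun m =>
    coeff_eq_zero_of_natDegree_lt (by omega)
  constructor
  · rw [natDegree_le_iff_coeff_eq_zero]
    intro m hm
    obtain ⟨m, rfl⟩ := Nat.exists_eq_add_of_lt hm
    rw [coeff_sub, taylor_coeff, eval_eq_sum_range' (n := 1)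
      ((natDegree_hasseDeriv_le p _).trans_lt (by omega))]
    simp [hasseDeriv_coeff]
  · rw [coeff_sub, taylor_coeff, eval_eq_sum_range' (n := 2)
      ((natDegree_hasseDeriv_le p _).trans_lt (by omega))]
    simp [hasseDeriv_coeff, sum_range_succ]
    rw [add_comm 1 d, Nat.choose_succ_self_right]; push_cast; ring

lemma norm_geom_ee_le (α β : ℝ) (N : ℕ) (a : ℤ) (ha : |α - a| ≤ 1 / 2) :
    ‖∑ x ∈ range N, ee (α * x + β)‖ * |α - a| ≤ 1 := by
  set t := α - a with ht
  have e : ∀ x : ℕ, ee (α * x + β) = ee β * ee t ^ x := by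
    intro x
    have : α * x + β = β + ((a * x : ℤ) : ℝ) + x * t := by rw [ht]; push_cast; ring
    rw [this, ee_add, ee_add, ee_int, mul_one]
    congr 1
    rw [ee, ee, ← Complex.exp_nat_mul]; congr 1; push_cast; ring
  simp only [e]
  rw [← mul_sum, norm_mul, norm_ee, one_mul]
  by_cases h1 : t = 0
  · rw [h1]; simp
  have hsin : 4 * |t| ≤ ‖ee t - 1‖ := by
    have h2 : ee t - 1 = Complex.exp (Complex.I * (2 * Real.pi * t : ℝ)) - 1 := by
      rw [ee]; congr 2; push_cast; ring
    rw [h2, Complex.norm_exp_I_mul_ofReal_sub_one, norm_mul, Real.norm_eq_abs, Real.norm_eq_abs,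
      show 2 * Real.pi * t / 2 = Real.pi * t by ring]
    have h3 := Real.mul_abs_le_abs_sin (x := Real.pi * t) (by
      rw [abs_mul, abs_of_pos Real.pi_pos]; nlinarith [Real.pi_pos])
    rw [abs_mul Real.pi, abs_of_pos Real.pi_pos] at h3
    have : 2 / Real.pi * (Real.pi * |t|) = 2 * |t| := by field_simp
    rw [abs_of_pos (by norm_num : (0 : ℝ) < 2)]
    linarith
  have hne : ee t ≠ 1 := by
    intro h; rw [h, sub_self, norm_zero] at hsin
    have := abs_pos.2 h1; linarith
  rw [geom_sum_eq hne, norm_div]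
  have h4 : ‖ee t ^ N - 1‖ ≤ 2 := by
    refine (norm_sub_le _ _).trans ?_
    rw [norm_pow, norm_ee, one_pow, norm_one]; norm_num
  have h5 : 0 < ‖ee t - 1‖ := norm_pos_iff.2 (sub_ne_zero.2 hne)
  rw [div_mul_eq_mul_div, div_le_one h5]
  have := abs_nonneg t
  nlinarith

lemma exists_abs_mul_sub_le_trivial (α : ℝ) {A X : ℝ} (hX : 0 < X) (hXA : X ≤ A) :
    ∃ a : ℤ, |((1 : ℕ) : ℝ) * α - a| ≤ A / X := by
  refine ⟨round α, ?_⟩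
  rw [Nat.cast_one, one_mul]
  refine (abs_sub_round α).trans ?_
  have : 1 ≤ A / X := by rwa [le_div_iff₀ hX, one_mul]
  linarith

open Polynomial in
/-- Weyl's inequality in inverse form: a large exponential sum forces the leading coefficient to
be close to a rational with small denominator. -/
theorem weyl_inverse (d : ℕ) : ∃ C : ℕ, ∀ R : ℝ, 2 ≤ R → ∀ N : ℕ, 1 ≤ N → ∀ p : ℝ[X],
    p.natDegree ≤ d + 1 → N ≤ R * ‖∑ x ∈ range N, ee (p.eval (x : ℝ))‖ →
    ∃ q : ℕ, 1 ≤ q ∧ (q : ℝ) ≤ R ^ C ∧ ∃ a : ℤ,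
      |q * p.coeff (d + 1) - a| ≤ R ^ C / (N : ℝ) ^ (d + 1) := by
  induction d with
  | zero =>
    refine ⟨1, fun R hR N hN p hp hS => ⟨1, le_rfl, by norm_num; linarith, round (p.coeff 1), ?_⟩⟩
    have hNr : (0 : ℝ) < N := by exact_mod_cast hN
    have h1 := norm_geom_ee_le (p.coeff 1) (p.coeff 0) N _ (abs_sub_round _)
    have h2 : ∀ x : ℕ, p.eval (x : ℝ) = p.coeff 1 * x + p.coeff 0 := by
      intro x
      rw [eval_eq_sum_range' (n := 2) (by omega)]
      simp [sum_range_succ]; ring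
    simp only [h2] at hS
    rw [Nat.cast_one, one_mul, zero_add, pow_one, pow_one, le_div_iff₀ hNr]
    have h3 := abs_nonneg (p.coeff 1 - round (p.coeff 1))
    calc _ ≤ |p.coeff 1 - round (p.coeff 1)| *
          (R * ‖∑ x ∈ range N, ee (p.coeff 1 * x + p.coeff 0)‖) := by gcongr
      _ = R * (‖∑ x ∈ range N, ee (p.coeff 1 * x + p.coeff 0)‖ *
          |p.coeff 1 - round (p.coeff 1)|) := by ring
      _ ≤ R * 1 := by gcongr
      _ = R := mul_one R
  | succ d ih =>
    obtain ⟨C, hC⟩ := ih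
    obtain ⟨C₃, hC₃⟩ : ∃ C₃, C₃ = 8 * C + 4 * (d + 1) + 11 := ⟨_, rfl⟩
    refine ⟨C₃ * (d + 2) + (12 * C + 4 * (d + 1) + 13) + d, fun R hR N hN p hp hS => ?_⟩
    have hNr : (0 : ℝ) < N := by exact_mod_cast hN
    have hR1 : 1 ≤ R := by linarith
    have hR0 : 0 < R := by linarith
    have hle : ∀ {a b : ℕ}, a ≤ b → R ^ a ≤ R ^ b := fun h => pow_le_pow_right₀ hR1 h
    have h2 : ∀ m : ℕ, (2 : ℝ) ^ m ≤ R ^ m := fun m => pow_le_pow_left₀ (by norm_num) hR m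
    rcases le_or_gt (N : ℝ) (R ^ C₃) with hsmall | hbig
    · refine ⟨1, le_rfl, ?_, exists_abs_mul_sub_le_trivial _ (by positivity) ?_⟩
      · rw [Nat.cast_one]; exact one_le_pow₀ hR1
      · calc (N : ℝ) ^ (d + 1 + 1) ≤ (R ^ C₃) ^ (d + 1 + 1) := by gcongr
          _ = R ^ (C₃ * (d + 2)) := by rw [← pow_mul]
          _ ≤ _ := hle (by omega)
    set Sh : ℕ → ℂ := fun h => ∑ x ∈ range (N - h), ee ((taylor (h : ℝ) p - p).eval (x : ℝ))
      with hSh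
    have hvdc : (N : ℝ) ^ 2 ≤ R ^ 2 * (2 * ∑ h ∈ range N, ‖Sh h‖) := by
      have h1 := norm_sum_sq_le (fun x => ee (p.eval (x : ℝ))) N
      have e : ∀ h x : ℕ, ee (p.eval ((x + h : ℕ) : ℝ)) * (starRingEnd ℂ) (ee (p.eval (x : ℝ))) =
          ee ((taylor (h : ℝ) p - p).eval (x : ℝ)) := by
        intro h x
        rw [conj_ee, ← ee_add, eval_sub, taylor_eval]; push_cast; rfl
      simp only [e] at h1
      calc (N : ℝ) ^ 2 ≤ (R * ‖∑ x ∈ range N, ee (p.eval (x : ℝ))‖) ^ 2 := by gcongr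
        _ = R ^ 2 * ‖∑ x ∈ range N, ee (p.eval (x : ℝ))‖ ^ 2 := by rw [mul_pow]
        _ ≤ _ := by gcongr
    have hShN : ∀ h, ‖Sh h‖ ≤ ((N - h : ℕ) : ℝ) := by
      intro h
      refine (norm_sum_le _ _).trans ?_
      simp [norm_ee]
    set G : Finset ℕ := (range N).filter fun h => h ≠ 0 ∧ (N : ℝ) ≤ R ^ 4 * ‖Sh h‖ with hG
    have hGcard : N / R ^ 5 ≤ (G.card : ℝ) := by
      have h1 : ∑ h ∈ range N, ‖Sh h‖ ≤ ∑ h ∈ range N, ((if h = 0 then (N : ℝ) else 0) +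
          (if h ∈ G then (N : ℝ) else 0) + N / R ^ 4) := by
        refine sum_le_sum fun h hh => ?_
        have hn : ‖Sh h‖ ≤ N := (hShN h).trans (by exact_mod_cast Nat.sub_le N h)
        have hpos : 0 ≤ N / R ^ 4 := by positivity
        by_cases h0 : h = 0
        · rw [if_pos h0]; split_ifs <;> linarith
        · rw [if_neg h0]
          split_ifs with hg
          · linarith
          · have : ¬ (N : ℝ) ≤ R ^ 4 * ‖Sh h‖ := fun hc => hg (mem_filter.2 ⟨hh, h0, hc⟩)
            rw [zero_add, zero_add, le_div_iff₀ (by positivity)]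
            linarith
      rw [sum_add_distrib, sum_add_distrib, sum_ite_eq', if_pos (mem_range.2 hN), sum_const,
        card_range, nsmul_eq_mul, ← sum_filter, sum_const, nsmul_eq_mul] at h1
      have h3 : (filter (fun h => h ∈ G) (range N)) = G := by
        rw [filter_mem_eq_inter, inter_eq_right]; exact filter_subset _ _
      rw [h3] at h1
      have h4 : (N : ℝ) ^ 2 ≤ R ^ 2 * (2 * (N + G.card * N + N * (N / R ^ 4))) :=
        hvdc.trans (by gcongr)
      have h5 : (N : ℝ) * (N : ℝ) ≤ N * (2 * R ^ 2 * (1 + G.card) + 2 * (N / R ^ 2)) := by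
        rw [← sq]
        refine h4.trans (le_of_eq ?_)
        have : (N : ℝ) / R ^ 4 * R ^ 2 = N / R ^ 2 := by field_simp
        calc _ = N * (2 * R ^ 2 * (1 + G.card) + 2 * ((N : ℝ) / R ^ 4 * R ^ 2)) := by ring
          _ = _ := by rw [this]
      have hR4 : 4 ≤ R ^ 2 := by nlinarith
      have h6 := le_of_mul_le_mul_left h5 hNr
      have h7 : 2 * ((N : ℝ) / R ^ 2) ≤ N / 2 := by
        rw [← mul_div_assoc, div_le_div_iff₀ (by positivity) (by norm_num)]
        nlinarith
      have h8 : 4 * R ^ 2 ≤ R ^ 4 := by nlinarith [sq_nonneg R]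
      have h9 : (N : ℝ) ≤ R ^ 4 * (1 + G.card) := by
        have : (0 : ℝ) ≤ 1 + G.card := by positivity
        nlinarith
      have h10 : 2 * R ^ 4 ≤ N := by
        have : R ^ 5 ≤ R ^ C₃ := hle (by omega)
        have : R ^ 5 = R * R ^ 4 := by ring
        have : 0 < R ^ 4 := by positivity
        nlinarith
      rw [div_le_iff₀ (by positivity)]
      have : R ^ 5 = R * R ^ 4 := by ring
      have h11 : 2 * R ^ 4 ≤ R ^ 5 := by rw [this]; gcongr
      have : (0 : ℝ) ≤ G.card := by positivity
      nlinarith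
    -- approximations for the good shifts
    have happ : ∀ h ∈ G, ∃ q : ℕ, (1 ≤ q ∧ (q : ℝ) ≤ R ^ (4 * C)) ∧ ∃ a : ℤ,
        |q * ((d + 2) * p.coeff (d + 2)) * h - a| ≤
          R ^ (4 * C + 4 * (d + 1)) / (N : ℝ) ^ (d + 1) := by
      intro h hh
      obtain ⟨hhN, h0, hbigS⟩ := mem_filter.1 hh
      rw [mem_range] at hhN
      have hM1 : 1 ≤ N - h := by omega
      have hMN : ((N - h : ℕ) : ℝ) ≤ N := by exact_mod_cast Nat.sub_le N h
      obtain ⟨hdeg, hcoef⟩ := diff_poly (d := d + 1) hp (h : ℝ)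
      obtain ⟨q, hq1, hq2, a, ha⟩ := hC (R ^ 4) (by nlinarith [h2 4]) (N - h) hM1 _ hdeg
        (hMN.trans hbigS)
      rw [← pow_mul] at hq2
      refine ⟨q, ⟨hq1, hq2⟩, a, ?_⟩
      have hNM : (N : ℝ) ≤ R ^ 4 * ((N - h : ℕ) : ℝ) := hbigS.trans (by gcongr; exact hShN h)
      rw [hcoef, ← pow_mul] at ha
      have hM0 : (0 : ℝ) < ((N - h : ℕ) : ℝ) := by exact_mod_cast hM1
      calc _ = |q * (((d + 1 : ℕ) + 1) * h * p.coeff (d + 1 + 1)) - a| := by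
            push_cast; congr 2; ring
        _ ≤ _ := ha
        _ ≤ _ := by
            rw [div_le_div_iff₀ (by positivity) (by positivity), pow_add R, mul_assoc]
            gcongr
            calc (N : ℝ) ^ (d + 1) ≤ (R ^ 4 * ((N - h : ℕ) : ℝ)) ^ (d + 1) := by gcongr
              _ = _ := by rw [mul_pow, ← pow_mul]
    choose! Q hQ1 hQ2 using happ
    have hmaps : ∀ h ∈ G, Q h ∈ Icc 1 ⌊R ^ (4 * C)⌋₊ := fun h hh =>
      mem_Icc.2 ⟨(hQ1 h hh).1, Nat.le_floor (hQ1 h hh).2⟩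
    have hfloor : (⌊R ^ (4 * C)⌋₊ : ℝ) ≤ R ^ (4 * C) := Nat.floor_le (by positivity)
    obtain ⟨q, hq, hqcard⟩ := exists_le_card_fiber_of_nsmul_le_card_of_maps_to
      (b := (N : ℝ) / R ^ (5 + 4 * C)) hmaps
      ⟨1, mem_Icc.2 ⟨le_rfl, Nat.le_floor (by rw [Nat.cast_one]; exact one_le_pow₀ hR1)⟩⟩ (by
        rw [Nat.card_Icc, Nat.add_sub_cancel, nsmul_eq_mul]
        refine le_trans ?_ hGcard
        calc _ ≤ R ^ (4 * C) * (N / R ^ (5 + 4 * C)) := by gcongr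
          _ = _ := by rw [pow_add]; field_simp)
    obtain ⟨hq1, hq2⟩ := mem_Icc.1 hq
    have hq2' : (q : ℝ) ≤ R ^ (4 * C) := le_trans (by exact_mod_cast hq2) hfloor
    have hNd : R ^ C₃ ≤ (N : ℝ) ^ (d + 1) := by
      calc R ^ C₃ ≤ N := hbig.le
        _ = (N : ℝ) ^ 1 := (pow_one _).symm
        _ ≤ _ := pow_le_pow_right₀ (by exact_mod_cast hN) (by omega)
    obtain ⟨q', hq'1, hq'2, a, ha⟩ := exists_approx_of_many (N := N)
      (α := q * ((d + 2) * p.coeff (d + 2))) (τ := 1 / R ^ (5 + 4 * C))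
      (κ := R ^ (4 * C + 4 * (d + 1)) / (N : ℝ) ^ (d + 1)) (G := G.filter fun h => Q h = q)
      (by positivity) (by positivity)
      (fun h hh => mem_range.1 (mem_filter.1 (mem_filter.1 hh).1).1)
      (fun h hh => by
        obtain ⟨h1, h3⟩ := mem_filter.1 hh
        have := hQ2 h h1
        rwa [h3] at this)
      (by rw [one_div_mul_eq_div]; exact hqcard)
      (by
        rw [← mul_div_assoc, div_le_div_iff₀ (by positivity) (by positivity), one_mul]
        refine le_trans ?_ hNd
        calc 48 * R ^ (4 * C + 4 * (d + 1)) * R ^ (5 + 4 * C) ≤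
            R ^ 6 * R ^ (4 * C + 4 * (d + 1)) * R ^ (5 + 4 * C) := by
              gcongr; linarith [h2 6]
          _ = R ^ C₃ := by rw [hC₃]; ring)
      (by
        rw [one_div_mul_eq_div, le_div_iff₀ (by positivity)]
        refine le_trans ?_ hbig.le
        calc 8 * R ^ (5 + 4 * C) ≤ R ^ 3 * R ^ (5 + 4 * C) := by gcongr; linarith [h2 3]
          _ = R ^ (8 + 4 * C) := by ring
          _ ≤ _ := hle (by omega))
    have hd2 : ((d + 2 : ℕ) : ℝ) ≤ R ^ (d + 2) := by
      refine le_trans ?_ (h2 _)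
      exact_mod_cast Nat.lt_two_pow_self.le
    refine ⟨q' * q * (d + 2), Nat.mul_pos (Nat.mul_pos hq'1 hq1) (by omega), ?_, a, ?_⟩
    · push_cast at hd2 ⊢
      calc (q' : ℝ) * q * (d + 2) ≤ (4 / (1 / R ^ (5 + 4 * C))) * R ^ (4 * C) * R ^ (d + 2) := by
            gcongr
        _ = 4 * R ^ (5 + 8 * C + d + 2) := by rw [one_div, div_inv_eq_mul]; ring
        _ ≤ R ^ 2 * R ^ (5 + 8 * C + d + 2) := by gcongr; linarith [h2 2]
        _ = R ^ (5 + 8 * C + d + 2 + 2) := by ring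
        _ ≤ _ := hle (by nlinarith)
    · calc _ = |q' * (q * ((d + 2) * p.coeff (d + 2))) - a| := by
            push_cast; congr 2; ring
        _ ≤ _ := ha
        _ = 8 * R ^ (4 * C + 4 * (d + 1) + 2 * (5 + 4 * C)) / (N : ℝ) ^ (d + 1 + 1) := by
            rw [div_pow, one_pow, ← pow_mul, pow_add R _ (2 * (5 + 4 * C)), pow_succ _ (d + 1),
              mul_comm 2 (5 + 4 * C)]
            field_simp
        _ ≤ R ^ 3 * R ^ (4 * C + 4 * (d + 1) + 2 * (5 + 4 * C)) / (N : ℝ) ^ (d + 1 + 1) := by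
            gcongr; linarith [h2 3]
        _ = R ^ (4 * C + 4 * (d + 1) + 2 * (5 + 4 * C) + 3) / (N : ℝ) ^ (d + 1 + 1) := by ring
        _ ≤ _ := by
            refine div_le_div_of_nonneg_right (hle ?_) (by positivity)
            nlinarith

lemma norm_ee_sub_one_le (t : ℝ) : ‖ee t - 1‖ ≤ 7 * |t| := by
  have h2 : ee t - 1 = Complex.exp (Complex.I * (2 * Real.pi * t : ℝ)) - 1 := by
    rw [ee]; congr 2; push_cast; ring
  rw [h2]
  refine (Real.norm_exp_I_mul_ofReal_sub_one_le).trans ?_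
  rw [Real.norm_eq_abs, abs_mul, abs_mul, abs_of_pos Real.pi_pos, abs_two]
  have := Real.pi_lt_d2
  have := abs_nonneg t
  nlinarith

lemma norm_sum_shift_le {F : ℕ → ℂ} (hF : ∀ x, ‖F x‖ ≤ 1) (P m : ℕ) :
    ‖∑ x ∈ range P, F x - ∑ x ∈ range P, F (x + m)‖ ≤ 2 * m := by
  induction m with
  | zero => simp
  | succ m ih =>
    have h1 := sum_range_succ (fun x => F (x + m)) P
    rw [sum_range_succ'] at h1
    have h2 : ∑ x ∈ range P, F (x + (m + 1)) = ∑ x ∈ range P, F (x + m) + F (P + m) - F (0 + m) := by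
      rw [← h1, add_sub_cancel_right]
      refine sum_congr rfl fun x _ => ?_
      congr 1; ring
    have h3 : ∑ x ∈ range P, F x - ∑ x ∈ range P, F (x + (m + 1)) =
        (∑ x ∈ range P, F x - ∑ x ∈ range P, F (x + m)) + (F (0 + m) - F (P + m)) := by
      rw [h2]; ring
    rw [h3]
    refine (norm_add_le _ _).trans ?_
    have := norm_sub_le (F (0 + m)) (F (P + m))
    have := hF (0 + m)
    have := hF (P + m)
    push_cast; linarith

lemma exists_progression {F : ℕ → ℂ} (hF : ∀ x, ‖F x‖ ≤ 1) {P : ℕ} (hP : 1 ≤ P) (q L : ℕ) :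
    ∃ x < P, L * ‖∑ x ∈ range P, F x‖ - 2 * q * L ^ 2 ≤
      P * ‖∑ y ∈ range L, F (x + q * y)‖ := by
  by_contra! hcon
  set S := ∑ x ∈ range P, F x with hS
  have h1 : ∑ x ∈ range P, ‖∑ y ∈ range L, F (x + q * y)‖ < L * ‖S‖ - 2 * q * L ^ 2 := by
    have : ∑ x ∈ range P, P * ‖∑ y ∈ range L, F (x + q * y)‖ <
        ∑ x ∈ range P, (L * ‖S‖ - 2 * q * L ^ 2) :=
      sum_lt_sum_of_nonempty (nonempty_range_iff.2 (by omega)) fun x hx => hcon x (mem_range.1 hx)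
    rw [← mul_sum, sum_const, card_range, nsmul_eq_mul] at this
    exact lt_of_mul_lt_mul_left this (by positivity)
  have h2 : (L : ℂ) * S = ∑ y ∈ range L, (S - ∑ x ∈ range P, F (x + q * y)) +
      ∑ x ∈ range P, ∑ y ∈ range L, F (x + q * y) := by
    rw [sum_sub_distrib, sum_const, card_range, nsmul_eq_mul, sum_comm (s := range P)]; ring
  have h3 : L * ‖S‖ ≤ L * (2 * (q * L)) + ∑ x ∈ range P, ‖∑ y ∈ range L, F (x + q * y)‖ := by
    calc L * ‖S‖ = ‖(L : ℂ) * S‖ := by rw [norm_mul, Complex.norm_natCast]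
      _ ≤ _ := by
        rw [h2]
        refine (norm_add_le _ _).trans (add_le_add ?_ (norm_sum_le _ _))
        refine (norm_sum_le _ _).trans ?_
        calc _ ≤ ∑ y ∈ range L, 2 * ((q : ℝ) * L) := by
              refine sum_le_sum fun y hy => ?_
              refine (norm_sum_shift_le hF P (q * y)).trans ?_
              have : (y : ℝ) ≤ L := by exact_mod_cast (mem_range.1 hy).le
              push_cast
              gcongr
          _ = _ := by rw [sum_const, card_range, nsmul_eq_mul]
  nlinarith

lemma weyl_eq_range (k n P : ℕ) (s t : ℝ) :
    weyl k n P s t = ∑ x ∈ range P, ee (s * ((x : ℝ) + 1) ^ k + t * ((x : ℝ) + 1) ^ n) := by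
  rw [weyl]
  refine sum_bij' (fun x _ => (x - 1).toNat) (fun x _ => (x : ℤ) + 1) ?_ ?_ ?_ ?_ ?_
  · intro x hx; rw [mem_Icc] at hx; rw [mem_range]; omega
  · intro x hx; rw [mem_range] at hx; rw [mem_Icc]; omega
  · intro x hx; rw [mem_Icc] at hx; omega
  · intro x hx; omega
  · intro x hx
    rw [mem_Icc] at hx
    have : (((x - 1).toNat : ℤ) : ℝ) = x - 1 := by
      rw [Int.toNat_of_nonneg (by omega)]; push_cast; ring
    rw [Int.cast_natCast] at this
    rw [this, sub_add_cancel]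

lemma pow_sub_pow_le {x y B : ℝ} (hx : 0 ≤ x) (hxy : x ≤ y) (hy : y ≤ B) (k : ℕ) :
    y ^ k - x ^ k ≤ k * B ^ (k - 1) * (y - x) := by
  rcases Nat.eq_zero_or_pos k with hk | hk
  · subst hk; simp
  have h1 : y ^ k - x ^ k = (∑ i ∈ range k, y ^ i * x ^ (k - 1 - i)) * (y - x) :=
    (geom_sum₂_mul y x k).symm
  rw [h1]
  have hB : 0 ≤ B := hx.trans (hxy.trans hy)
  refine mul_le_mul_of_nonneg_right ?_ (by linarith)
  calc _ ≤ ∑ i ∈ range k, B ^ (k - 1) := by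
        refine sum_le_sum fun i hi => ?_
        rw [mem_range] at hi
        calc y ^ i * x ^ (k - 1 - i) ≤ B ^ i * B ^ (k - 1 - i) := by
              gcongr
              · exact hx.trans hxy
              · exact hxy.trans hy
          _ = B ^ (k - 1) := by rw [← pow_add]; congr 1; omega
    _ = _ := by rw [sum_const, card_range, nsmul_eq_mul]

set_option maxHeartbeats 1000000 in
open Polynomial in
/-- The inverse form of Weyl's inequality for the polynomial `s x ^ k + t x ^ n`. -/
theorem weyl_pair_inverse {k n : ℕ} (hkn : n < k) (hn : 1 ≤ n) : ∃ C : ℕ, ∀ R : ℝ, 2 ≤ R →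
    ∀ P : ℕ, 1 ≤ P → ∀ s t : ℝ, P ≤ R * ‖weyl k n P s t‖ →
    ∃ q : ℕ, 1 ≤ q ∧ (q : ℝ) ≤ R ^ C ∧ (∃ a : ℤ, |q * s - a| ≤ R ^ C / (P : ℝ) ^ k) ∧
      ∃ a : ℤ, |q * t - a| ≤ R ^ C / (P : ℝ) ^ n := by
  obtain ⟨C₁, hC₁⟩ := weyl_inverse (k - 1)
  obtain ⟨C₂, hC₂⟩ := weyl_inverse (n - 1)
  rw [Nat.sub_add_cancel (by omega)] at hC₁
  rw [Nat.sub_add_cancel (by omega)] at hC₂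
  obtain ⟨C₄, hC₄⟩ : ∃ C₄, C₄ = C₁ + 2 * k + 6 := ⟨_, rfl⟩
  refine ⟨C₄ * k + 2 * C₂ + n * C₁ + n * (C₄ + 1), fun R hR P hP s t hS => ?_⟩
  have hPr : (0 : ℝ) < P := by exact_mod_cast hP
  have hR1 : 1 ≤ R := by linarith
  have hR0 : 0 < R := by linarith
  have hle : ∀ {a b : ℕ}, a ≤ b → R ^ a ≤ R ^ b := fun h => pow_le_pow_right₀ hR1 h
  have h2 : ∀ m : ℕ, (2 : ℝ) ^ m ≤ R ^ m := fun m => pow_le_pow_left₀ (by norm_num) hR m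
  rcases le_or_gt (P : ℝ) (R ^ C₄) with hsmall | hbig
  · have key : ∀ m ≤ k, (P : ℝ) ^ m ≤ R ^ (C₄ * k + 2 * C₂ + n * C₁ + n * (C₄ + 1)) := by
      intro m hm
      calc (P : ℝ) ^ m ≤ (R ^ C₄) ^ m := by gcongr
        _ = R ^ (C₄ * m) := by rw [← pow_mul]
        _ ≤ _ := hle (by nlinarith [Nat.mul_le_mul_left C₄ hm])
    exact ⟨1, le_rfl, by rw [Nat.cast_one]; exact one_le_pow₀ hR1,
      exists_abs_mul_sub_le_trivial _ (by positivity) (key k le_rfl),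
      exists_abs_mul_sub_le_trivial _ (by positivity) (key n hkn.le)⟩
  rw [weyl_eq_range] at hS
  -- the leading coefficient
  obtain ⟨q, hq1, hqC, a, ha⟩ := hC₁ R hR P hP (C s * (X + C 1) ^ k + C t * (X + C 1) ^ n) (by
      compute_degree!; exact hkn.le) (by simpa using hS)
  have hcoef : (C s * (X + C 1) ^ k + C t * (X + C 1) ^ n).coeff k = s := by
    rw [coeff_add, coeff_C_mul, coeff_C_mul, coeff_X_add_C_pow, coeff_X_add_C_pow,
      Nat.choose_eq_zero_of_lt hkn]
    simp
  rw [hcoef] at ha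
  have hqr : (0 : ℝ) < q := by exact_mod_cast hq1
  set L := ⌊(P : ℝ) / R ^ C₄⌋₊ with hL
  have hLP : (L : ℝ) * R ^ C₄ ≤ P := by
    rw [← le_div_iff₀ (by positivity)]; exact Nat.floor_le (by positivity)
  have hL1 : 1 ≤ L := Nat.le_floor (by
    rw [Nat.cast_one, le_div_iff₀ (by positivity), one_mul]; exact hbig.le)
  have hLr : (1 : ℝ) ≤ L := by exact_mod_cast hL1
  have hPL : (P : ℝ) ≤ L * R ^ (C₄ + 1) := by
    have := Nat.lt_floor_add_one ((P : ℝ) / R ^ C₄)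
    rw [div_lt_iff₀ (by positivity)] at this
    calc (P : ℝ) ≤ (L + 1) * R ^ C₄ := this.le
      _ ≤ (L * R) * R ^ C₄ := by gcongr; nlinarith
      _ = _ := by ring
  obtain ⟨x, hx, hprog⟩ := exists_progression
    (F := fun x : ℕ => ee (s * ((x : ℝ) + 1) ^ k + t * ((x : ℝ) + 1) ^ n))
    (fun x => (norm_ee _).le) hP q L
  set θ := s - a / q with hθ
  have hθ1 : |θ| * q ≤ R ^ C₁ / (P : ℝ) ^ k := by
    have : q * s - a = θ * q := by rw [hθ]; field_simp
    rwa [this, abs_mul, abs_of_pos hqr] at ha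
  have hqL : (q : ℝ) * L * (8 * R) ≤ P := by
    refine le_trans ?_ hLP
    calc (q : ℝ) * L * (8 * R) ≤ R ^ C₁ * L * (R ^ 3 * R) := by
          gcongr; linarith [h2 3]
      _ = L * R ^ (C₁ + 4) := by ring
      _ ≤ _ := mul_le_mul_of_nonneg_left (hle (by omega)) (by positivity)
  -- freezing the leading term
  have hfreeze : ‖∑ y ∈ range L, ee (s * (((x + q * y : ℕ) : ℝ) + 1) ^ k +
      t * (((x + q * y : ℕ) : ℝ) + 1) ^ n)‖ ≤
      ‖∑ y ∈ range L, ee (t * (x + 1 + q * (y : ℝ)) ^ n)‖ + L / (4 * R) := by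
    have h3 : ∀ y ∈ range L, ‖ee (s * (((x + q * y : ℕ) : ℝ) + 1) ^ k +
        t * (((x + q * y : ℕ) : ℝ) + 1) ^ n) -
        ee (s * ((x : ℝ) + 1) ^ k) * ee (t * (x + 1 + q * (y : ℝ)) ^ n)‖ ≤ 1 / (4 * R) := by
      intro y hy
      rw [mem_range] at hy
      have hyL : (y : ℝ) ≤ L := by exact_mod_cast hy.le
      set X₁ : ℝ := (x : ℝ) + 1
      have e0 : (((x + q * y : ℕ) : ℝ) + 1) = X₁ + q * y := by push_cast; ring
      obtain ⟨w, hw⟩ : ∃ w : ℤ, (X₁ + q * y) ^ k - X₁ ^ k = q * w := by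
        obtain ⟨w, hw⟩ := sub_dvd_pow_sub_pow ((x : ℤ) + 1 + q * y) ((x : ℤ) + 1) k
        refine ⟨y * w, ?_⟩
        have : ((x : ℝ) + 1 + q * y) ^ k - ((x : ℝ) + 1) ^ k =
            ((x : ℝ) + 1 + q * y - (x + 1)) * w := by exact_mod_cast hw
        rw [this]; push_cast; ring
      have e1 : s * (X₁ + q * y) ^ k + t * (X₁ + q * y) ^ n =
          θ * ((X₁ + q * y) ^ k - X₁ ^ k) + ((a * w : ℤ) : ℝ) +
            (s * X₁ ^ k + t * (X₁ + q * y) ^ n) := by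
        have : (a : ℝ) / q * ((X₁ + q * y) ^ k - X₁ ^ k) = a * w := by
          rw [hw]; field_simp
        push_cast
        rw [← this, hθ]; ring
      rw [e0, e1, ee_add, ee_add, ee_int, mul_one, ee_add (s * X₁ ^ k), ← sub_one_mul, norm_mul,
        norm_mul, norm_ee, norm_ee, mul_one, mul_one]
      refine (norm_ee_sub_one_le _).trans ?_
      have hX0 : 0 ≤ X₁ := by positivity
      have hqy : (0 : ℝ) ≤ q * y := by positivity
      have hXP : X₁ + q * y ≤ 2 * P := by
        have h5 : X₁ ≤ P := by
          have : x + 1 ≤ P := hx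
          change (x : ℝ) + 1 ≤ P
          exact_mod_cast this
        have h6 : (q : ℝ) * y ≤ q * L := by gcongr
        have h7 : (0 : ℝ) ≤ q * L := by positivity
        nlinarith
      have h8 := pow_sub_pow_le hX0 (by linarith : X₁ ≤ X₁ + q * y) hXP k
      have h9 : 0 ≤ (X₁ + q * y) ^ k - X₁ ^ k := by
        rw [sub_nonneg]; gcongr; linarith
      rw [abs_mul, abs_of_nonneg h9]
      have hkk : (k : ℝ) ≤ R ^ k := by
        refine le_trans ?_ (h2 k)
        exact_mod_cast Nat.lt_two_pow_self.le
      have hPk : (P : ℝ) ^ k = P ^ (k - 1) * P := by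
        rw [← pow_succ, Nat.sub_add_cancel (by omega)]
      calc 7 * (|θ| * ((X₁ + q * y) ^ k - X₁ ^ k)) ≤
            8 * (|θ| * (k * (2 * P) ^ (k - 1) * (q * L))) := by
            refine mul_le_mul (by norm_num) ?_ (by positivity) (by norm_num)
            refine mul_le_mul_of_nonneg_left (h8.trans ?_) (abs_nonneg _)
            rw [add_sub_cancel_left]
            gcongr
        _ = (8 * k * 2 ^ (k - 1) * L * P ^ (k - 1)) * (|θ| * q) := by rw [mul_pow]; ring
        _ ≤ (8 * k * 2 ^ (k - 1) * L * P ^ (k - 1)) * (R ^ C₁ / (P : ℝ) ^ k) := by gcongr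
        _ = (8 * k * 2 ^ (k - 1) * L) * R ^ C₁ / P := by rw [hPk]; field_simp
        _ ≤ (R ^ 3 * R ^ k * R ^ (k - 1) * L) * R ^ C₁ / P := by
            gcongr
            · linarith [h2 3]
        _ ≤ 1 / (4 * R) := by
            rw [div_le_div_iff₀ hPr (by positivity), one_mul]
            refine le_trans ?_ hLP
            calc _ ≤ R ^ 3 * R ^ k * R ^ (k - 1) * L * R ^ C₁ * (R ^ 2 * R) := by
                  gcongr; linarith [h2 2]
              _ = L * R ^ (C₁ + (k + (k - 1)) + 6) := by ring
              _ ≤ _ := by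
                  refine mul_le_mul_of_nonneg_left (hle ?_) (by positivity)
                  omega
    calc _ = ‖∑ y ∈ range L, (ee (s * (((x + q * y : ℕ) : ℝ) + 1) ^ k +
        t * (((x + q * y : ℕ) : ℝ) + 1) ^ n) -
        ee (s * ((x : ℝ) + 1) ^ k) * ee (t * (x + 1 + q * (y : ℝ)) ^ n)) +
          ee (s * ((x : ℝ) + 1) ^ k) * ∑ y ∈ range L, ee (t * (x + 1 + q * (y : ℝ)) ^ n)‖ := by
          rw [mul_sum, ← sum_add_distrib]; congr 1
          exact sum_congr rfl fun y _ => by ring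
      _ ≤ (∑ y ∈ range L, 1 / (4 * R)) + ‖∑ y ∈ range L, ee (t * (x + 1 + q * (y : ℝ)) ^ n)‖ := by
          refine (norm_add_le _ _).trans (add_le_add ((norm_sum_le _ _).trans (sum_le_sum h3)) ?_)
          rw [norm_mul, norm_ee, one_mul]
      _ = _ := by
          rw [sum_const, card_range, nsmul_eq_mul]; ring
  have hbigsum : (L : ℝ) ≤ R ^ 2 * ‖∑ y ∈ range L, ee (t * (x + 1 + q * (y : ℝ)) ^ n)‖ := by
    set T := ‖∑ y ∈ range L, ee (t * (x + 1 + q * (y : ℝ)) ^ n)‖ with hT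
    set S := ‖∑ x ∈ range P, ee (s * ((x : ℝ) + 1) ^ k + t * ((x : ℝ) + 1) ^ n)‖ with hSdef
    have h3 : L * S - 2 * q * L ^ 2 ≤ P * (T + L / (4 * R)) :=
      hprog.trans (mul_le_mul_of_nonneg_left hfreeze hPr.le)
    have h4 : (L : ℝ) * P ≤ R * (L * S) := by nlinarith
    have h5 : R * (P * (T + L / (4 * R))) = P * (R * T + L / 4) := by field_simp
    have h6 : (L : ℝ) * P ≤ P * (R * T + L / 4) + 2 * q * L ^ 2 * R := by nlinarith
    have h7 : 2 * q * L ^ 2 * R ≤ P * (L / 4) := by nlinarith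
    have h8 : P * (L / 2) ≤ P * (R * T) := by nlinarith
    have h9 := le_of_mul_le_mul_left h8 hPr
    have : 0 ≤ R * T := by positivity
    nlinarith
  have hpoly : ∀ y : ℕ, ee (t * (x + 1 + q * (y : ℝ)) ^ n) =
      ee ((C t * (C (q : ℝ) * X + C ((x : ℝ) + 1)) ^ n).eval (y : ℝ)) := by
    intro y; congr 1; simp; left; ring
  simp only [hpoly] at hbigsum
  obtain ⟨q₂, hq₂1, hq₂C, a₂, ha₂⟩ := hC₂ (R ^ 2) (by nlinarith) L hL1 _ (by
      compute_degree!) hbigsum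
  have hcoef₂ : (C t * (C (q : ℝ) * X + C ((x : ℝ) + 1)) ^ n).coeff n = t * q ^ n := by
    rw [coeff_C_mul]
    congr 1
    have := coeff_pow_of_natDegree_le (p := C (q : ℝ) * X + C ((x : ℝ) + 1)) (m := n) (n := 1)
      (by compute_degree!)
    rw [mul_one] at this
    rw [this, coeff_add, coeff_C_mul, coeff_X_one, coeff_C_succ, mul_one, add_zero]
  rw [hcoef₂, ← pow_mul] at ha₂
  rw [← pow_mul] at hq₂C
  have hQ : (q₂ : ℝ) * q ^ n ≤ R ^ (2 * C₂ + n * C₁) := by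
    calc (q₂ : ℝ) * q ^ n ≤ R ^ (2 * C₂) * (R ^ C₁) ^ n := by gcongr
      _ = _ := by rw [← pow_mul, ← pow_add, mul_comm C₁]
  refine ⟨q₂ * q ^ n, Nat.mul_pos hq₂1 (pow_pos hq1 n), ?_, ⟨q₂ * q ^ (n - 1) * a, ?_⟩, a₂, ?_⟩
  · push_cast
    exact hQ.trans (hle (by omega))
  · have e : ((q₂ * q ^ n : ℕ) : ℝ) * s - ((q₂ * q ^ (n - 1) * a : ℤ) : ℝ) =
        q₂ * q ^ (n - 1) * (q * s - a) := by
      have : (q : ℝ) ^ n = q ^ (n - 1) * q := by rw [← pow_succ, Nat.sub_add_cancel hn]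
      push_cast; rw [this]; ring
    rw [e, abs_mul, abs_of_nonneg (by positivity)]
    calc _ ≤ R ^ (2 * C₂) * (R ^ C₁) ^ (n - 1) * (R ^ C₁ / (P : ℝ) ^ k) := by gcongr
      _ = R ^ (2 * C₂ + (C₁ * (n - 1) + C₁)) / (P : ℝ) ^ k := by
          rw [← pow_mul]; ring
      _ ≤ _ := by
          refine div_le_div_of_nonneg_right (hle ?_) (by positivity)
          have : C₁ * (n - 1) + C₁ = n * C₁ := by
            rw [← Nat.mul_succ, Nat.succ_eq_add_one, Nat.sub_add_cancel hn, mul_comm]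
          omega
  · have e : ((q₂ * q ^ n : ℕ) : ℝ) * t - a₂ = q₂ * (t * q ^ n) - a₂ := by push_cast; ring
    rw [e]
    refine ha₂.trans ?_
    rw [div_le_div_iff₀ (by positivity) (by positivity)]
    calc R ^ (2 * C₂) * (P : ℝ) ^ n ≤ R ^ (2 * C₂) * (L * R ^ (C₄ + 1)) ^ n := by gcongr
      _ = R ^ (2 * C₂ + n * (C₄ + 1)) * (L : ℝ) ^ n := by rw [mul_pow, ← pow_mul]; ring
      _ ≤ _ := mul_le_mul_of_nonneg_right (hle (by omega)) (by positivity)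

/-- The degrees of the three equations. -/
def deg (k n : ℕ) : Fin 3 → ℕ := ![k, n, n]

/-- The box around `r` with side lengths proportional to `Q / P ^ (deg i)`. -/
def arc (k n P : ℕ) (Q : ℝ) (r : Fin 3 → ℝ) : Set (Fin 3 → ℝ) :=
  {α | ∀ i, |α i - r i| ≤ Q / (P : ℝ) ^ deg k n i}

/-- The rational points in `(0, 1]³` with a common denominator at most `Q`. -/
def ratPts (Q : ℕ) : Finset (Fin 3 → ℚ) :=
  (Icc 1 Q).biUnion fun q => (Fintype.piFinset fun _ => Icc 1 q).image fun a i => (a i : ℚ) / q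

lemma mem_ratPts {Q : ℕ} {r : Fin 3 → ℚ} : r ∈ ratPts Q ↔
    ∃ q : ℕ, (1 ≤ q ∧ q ≤ Q) ∧ ∃ a : Fin 3 → ℕ, (∀ i, 1 ≤ a i ∧ a i ≤ q) ∧ ∀ i, r i = a i / q := by
  simp only [ratPts, mem_biUnion, mem_Icc, mem_image, Fintype.mem_piFinset]
  constructor
  · rintro ⟨q, hq, a, ha, rfl⟩; exact ⟨q, hq, a, ha, fun _ => rfl⟩
  · rintro ⟨q, hq, a, ha, h⟩; exact ⟨q, hq, a, ha, (funext h).symm⟩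

/-- The coordinates of a rational point as real numbers. -/
def toR (r : Fin 3 → ℚ) : Fin 3 → ℝ := fun i => (r i : ℝ)

/-- The major arcs. -/
def major (k n P Q : ℕ) : Set (Fin 3 → ℝ) := ⋃ r ∈ ratPts Q, arc k n P Q (toR r)

/-- The corner of the cube used with level `Q`. -/
noncomputable def corner (Q : ℕ) : Fin 3 → ℝ := fun _ => 1 / (2 * Q)

section
variable {s : ℕ} (k n : ℕ) (b : Fin s → ℤ) (c : Fin 2 → Fin s → ℤ)

lemma exists_common_approx (hkn : n < k) (hn : 1 ≤ n) {i j : Fin s} (hb : b i ≠ 0)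
    (hdet : c 0 i * c 1 j - c 0 j * c 1 i ≠ 0) :
    ∃ C : ℕ, 1 ≤ C ∧ ∀ R : ℝ, 2 ≤ R → ∀ P : ℕ, 1 ≤ P → ∀ α : Fin 3 → ℝ,
      P ≤ R * ‖fsum k n P b c i α‖ → P ≤ R * ‖fsum k n P b c j α‖ →
      ∃ q : ℕ, 1 ≤ q ∧ (q : ℝ) ≤ R ^ C ∧ ∃ a : Fin 3 → ℤ,
        ∀ l, |q * α l - a l| ≤ R ^ C / (P : ℝ) ^ deg k n l := by
  obtain ⟨C, hC⟩ := weyl_pair_inverse hkn hn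
  obtain ⟨Δ, hΔ⟩ : ∃ Δ, Δ = c 0 i * c 1 j - c 0 j * c 1 i := ⟨_, rfl⟩
  rw [← hΔ] at hdet
  obtain ⟨K, hK⟩ : ∃ K : ℕ, K = (b i).natAbs * Δ.natAbs *
    (1 + (c 0 i).natAbs + (c 1 i).natAbs + (c 0 j).natAbs + (c 1 j).natAbs) := ⟨_, rfl⟩
  refine ⟨2 * C + K + 1, by omega, fun R hR P hP α hi hj => ?_⟩
  have hPr : (0 : ℝ) < P := by exact_mod_cast hP
  have hR1 : 1 ≤ R := by linarith
  have hR0 : 0 < R := by linarith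
  obtain ⟨q, hq1, hqC, ⟨a, ha⟩, a', ha'⟩ := hC R hR P hP _ _ hi
  obtain ⟨p, hp1, hpC, -, d, hd⟩ := hC R hR P hP _ _ hj
  have hB1 : 1 ≤ (b i).natAbs := Int.natAbs_pos.2 hb
  have hΔ1 : 1 ≤ Δ.natAbs := Int.natAbs_pos.2 hdet
  have hKR : (K : ℝ) ≤ R ^ K := by
    calc (K : ℝ) ≤ 2 ^ K := by exact_mod_cast Nat.lt_two_pow_self.le
      _ ≤ R ^ K := by gcongr
  have hnat : ∀ z : ℤ, (z.natAbs : ℝ) = |(z : ℝ)| := fun z => by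
    rw [Nat.cast_natAbs, Int.cast_abs]
  have hKr : (K : ℝ) = |(b i : ℝ)| * |(Δ : ℝ)| *
      (1 + |(c 0 i : ℝ)| + |(c 1 i : ℝ)| + |(c 0 j : ℝ)| + |(c 1 j : ℝ)|) := by
    rw [hK]; push_cast [hnat]; rfl
  have hBr : (1 : ℝ) ≤ |(b i : ℝ)| := by rw [← hnat]; exact_mod_cast hB1
  have hΔr : (1 : ℝ) ≤ |(Δ : ℝ)| := by rw [← hnat]; exact_mod_cast hΔ1
  have hRC : 1 ≤ R ^ C := one_le_pow₀ hR1
  have hC0 : ∀ m : ℕ, 0 < R ^ C / (P : ℝ) ^ m := fun m => by positivity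
  have hfin : ∀ {x : ℝ} {m : ℕ}, x ≤ K * R ^ C * (R ^ C / (P : ℝ) ^ m) →
      x ≤ R ^ (2 * C + K + 1) / (P : ℝ) ^ m := by
    intro x m hx
    refine hx.trans ?_
    rw [← mul_div_assoc]
    refine div_le_div_of_nonneg_right ?_ (by positivity)
    calc (K : ℝ) * R ^ C * R ^ C ≤ R ^ K * R ^ C * R ^ C := by gcongr
      _ = R ^ (2 * C + K) := by ring
      _ ≤ _ := pow_le_pow_right₀ hR1 (by omega)
  have hBΔK : |(b i : ℝ)| * |(Δ : ℝ)| ≤ K := by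
    rw [hKr]
    refine le_mul_of_one_le_right (by positivity) ?_
    have := abs_nonneg (c 0 i : ℝ)
    have := abs_nonneg (c 1 i : ℝ)
    have := abs_nonneg (c 0 j : ℝ)
    have := abs_nonneg (c 1 j : ℝ)
    linarith
  have hsg : ((Δ.natAbs : ℤ) : ℝ) = Δ.sign * Δ := by
    exact_mod_cast (Int.sign_mul_self_eq_natAbs Δ).symm
  have hsb : (((b i).natAbs : ℤ) : ℝ) = (b i).sign * b i := by
    exact_mod_cast (Int.sign_mul_self_eq_natAbs (b i)).symm
  have hsign : ∀ z : ℤ, |((z.sign : ℤ) : ℝ)| ≤ 1 := by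
    intro z
    rcases Int.sign_trichotomy z with h | h | h <;> rw [h] <;> norm_num
  rw [Int.cast_natCast] at hsg hsb
  -- combination of the two degree `n` approximations
  have hlin : ∀ x y z : ℤ, ∀ w : ℝ, Δ * w = x * (c 0 i * α 1 + c 1 i * α 2) +
      y * (c 0 j * α 1 + c 1 j * α 2) → |(x : ℝ)| + |(y : ℝ)| ≤
        1 + |(c 0 i : ℝ)| + |(c 1 i : ℝ)| + |(c 0 j : ℝ)| + |(c 1 j : ℝ)| →
      ∃ e : ℤ, |((q * p * (b i).natAbs * Δ.natAbs : ℕ) : ℝ) * w - e| ≤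
        K * R ^ C * (R ^ C / (P : ℝ) ^ n) := by
    intro x y _ w hw hxy
    refine ⟨Δ.sign * (b i).natAbs * (x * p * a' + y * q * d), ?_⟩
    have e1 : ((q * p * (b i).natAbs * Δ.natAbs : ℕ) : ℝ) * w -
        ((Δ.sign * (b i).natAbs * (x * p * a' + y * q * d) : ℤ) : ℝ) =
        Δ.sign * (b i).natAbs * (x * (p * (q * (c 0 i * α 1 + c 1 i * α 2) - a')) +
          y * (q * (p * (c 0 j * α 1 + c 1 j * α 2) - d))) := by
      push_cast
      rw [hsg]
      simp only [hnat]
      linear_combination ((q : ℝ) * p * |(b i : ℝ)| * Δ.sign) * hw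
    rw [e1, abs_mul, abs_mul, Nat.abs_cast, hnat]
    have e2 : |(x : ℝ) * (p * (q * (c 0 i * α 1 + c 1 i * α 2) - a')) +
          y * (q * (p * (c 0 j * α 1 + c 1 j * α 2) - d))| ≤
          (|(x : ℝ)| + |(y : ℝ)|) * (R ^ C * (R ^ C / (P : ℝ) ^ n)) := by
      refine (abs_add_le _ _).trans ?_
      rw [abs_mul, abs_mul, abs_mul, abs_mul, Nat.abs_cast, Nat.abs_cast, add_mul]
      gcongr
    calc _ ≤ 1 * |(b i : ℝ)| * ((1 + |(c 0 i : ℝ)| + |(c 1 i : ℝ)| + |(c 0 j : ℝ)| +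
          |(c 1 j : ℝ)|) * (R ^ C * (R ^ C / (P : ℝ) ^ n))) := by
          gcongr
          · exact hsign Δ
          · refine e2.trans ?_
            gcongr
      _ ≤ |(Δ : ℝ)| * |(b i : ℝ)| * ((1 + |(c 0 i : ℝ)| + |(c 1 i : ℝ)| + |(c 0 j : ℝ)| +
          |(c 1 j : ℝ)|) * (R ^ C * (R ^ C / (P : ℝ) ^ n))) := by
          gcongr
      _ = _ := by rw [hKr]; ring
  obtain ⟨e₁, he₁⟩ := hlin (c 1 j) (-(c 1 i)) 0 (α 1) (by rw [hΔ]; push_cast; ring) (by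
    push_cast; rw [abs_neg]
    have := abs_nonneg (c 0 i : ℝ)
    have := abs_nonneg (c 0 j : ℝ)
    linarith)
  obtain ⟨e₂, he₂⟩ := hlin (-(c 0 j)) (c 0 i) 0 (α 2) (by rw [hΔ]; push_cast; ring) (by
    push_cast; rw [abs_neg]
    have := abs_nonneg (c 1 i : ℝ)
    have := abs_nonneg (c 1 j : ℝ)
    linarith)
  refine ⟨q * p * (b i).natAbs * Δ.natAbs, Nat.mul_pos (Nat.mul_pos (Nat.mul_pos hq1 hp1) hB1) hΔ1,
    ?_,
    ![(b i).sign * p * Δ.natAbs * a, e₁, e₂], ?_⟩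
  · push_cast [hnat]
    calc (q : ℝ) * p * |(b i : ℝ)| * |(Δ : ℝ)| = q * p * (|(b i : ℝ)| * |(Δ : ℝ)|) := by ring
      _ ≤ R ^ C * R ^ C * R ^ K := by gcongr; exact hBΔK.trans hKR
      _ = R ^ (2 * C + K) := by ring
      _ ≤ _ := pow_le_pow_right₀ hR1 (by omega)
  · intro l
    fin_cases l
    · refine hfin (m := k) ?_
      have e1 : ((q * p * (b i).natAbs * Δ.natAbs : ℕ) : ℝ) * α 0 -
          (((b i).sign * p * Δ.natAbs * a : ℤ) : ℝ) =
          (b i).sign * (p * Δ.natAbs * (q * (b i * α 0) - a)) := by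
        push_cast
        rw [hsb]; simp only [hnat]; ring
      change |((q * p * (b i).natAbs * Δ.natAbs : ℕ) : ℝ) * α 0 -
          (((b i).sign * p * Δ.natAbs * a : ℤ) : ℝ)| ≤ _
      rw [e1, abs_mul, abs_mul, abs_mul, Nat.abs_cast, Nat.abs_cast, hnat]
      calc _ ≤ 1 * (R ^ C * |(Δ : ℝ)| * (R ^ C / (P : ℝ) ^ k)) := by
            gcongr
            exact hsign _
        _ ≤ |(b i : ℝ)| * (R ^ C * |(Δ : ℝ)| * (R ^ C / (P : ℝ) ^ k)) := by gcongr
        _ = (|(b i : ℝ)| * |(Δ : ℝ)|) * R ^ C * (R ^ C / (P : ℝ) ^ k) := by ring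
        _ ≤ _ := by gcongr
    · exact hfin (m := n) he₁
    · exact hfin (m := n) he₂

end

lemma le_deg {k n : ℕ} (hkn : n < k) (hn : 1 ≤ n) (i : Fin 3) : 1 ≤ deg k n i := by
  fin_cases i <;> simp [deg] <;> omega

lemma div_pow_deg_lt {k n P Q Q' : ℕ} (hkn : n < k) (hn : 1 ≤ n) (hQ : 1 ≤ Q) (hQ' : Q' ≤ 2 * Q)
    (hQ0 : 1 ≤ Q') (hP : 16 * Q ^ 3 < P) (i : Fin 3) :
    (Q : ℝ) / (P : ℝ) ^ deg k n i < 1 / (2 * Q') := by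
  have hP1 : 1 ≤ P := by omega
  have hPr : (1 : ℝ) ≤ P := by exact_mod_cast hP1
  have hQr : (1 : ℝ) ≤ Q' := by exact_mod_cast hQ0
  have h1 : (P : ℝ) ≤ (P : ℝ) ^ deg k n i := le_self_pow₀ hPr (by have := le_deg hkn hn i; omega)
  rw [div_lt_div_iff₀ (by positivity) (by positivity), one_mul]
  refine lt_of_lt_of_le ?_ h1
  have : Q * (2 * Q') < P := by
    have : Q ^ 2 ≤ Q ^ 3 := Nat.pow_le_pow_right hQ (by norm_num)
    nlinarith
  exact_mod_cast this

lemma isClosed_arc (k n P : ℕ) (Q : ℝ) (r : Fin 3 → ℝ) : IsClosed (arc k n P Q r) := by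
  simp only [arc, Set.ofPred_forall]
  exact isClosed_iInter fun i => isClosed_le (by fun_prop) (by fun_prop)

lemma measurableSet_major (k n P Q : ℕ) : MeasurableSet (major k n P Q) :=
  Finset.measurableSet_biUnion _ fun r _ => (isClosed_arc k n P Q (toR r)).measurableSet

section
variable {s : ℕ} (k n : ℕ) (b : Fin s → ℤ) (c : Fin 2 → Fin s → ℤ)

lemma minor_bound (hkn : n < k) (hn : 1 ≤ n) (hb0 : ∀ j, b j ≠ 0)
    (hminor : ∀ j₁ j₂ : Fin s, j₁ ≠ j₂ → c 0 j₁ * c 1 j₂ - c 0 j₂ * c 1 j₁ ≠ 0)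
    (hs : 2 * rr k + 2 * rr n + 1 ≤ s) {η : ℝ} (hη : 0 < η) :
    ∃ δ : ℝ, 0 < δ ∧ ∃ C : ℝ, 0 < C ∧ ∃ Q₀ : ℕ, 1 ≤ Q₀ ∧ ∀ P Q Q' : ℕ, Q₀ ≤ Q → Q ≤ Q' →
      Q' ≤ 2 * Q → 16 * Q ^ 3 < P → (P : ℝ) ^ η ≤ Q →
      ∫ α in cube (corner Q') \ major k n P Q, ∏ j, ‖fsum k n P b c j α‖ ≤
        C * (P : ℝ) ^ ((s : ℝ) - k - 2 * n) * (Q : ℝ) ^ (-δ) := by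
  have hr1 := rr_pos (d := k) (by omega)
  obtain ⟨j₀, hj₀⟩ : ∃ j : Fin s, j = ⟨0, by omega⟩ := ⟨_, rfl⟩
  obtain ⟨j₁, hj₁⟩ : ∃ j : Fin s, j = ⟨1, by omega⟩ := ⟨_, rfl⟩
  have hne : j₀ ≠ j₁ := by rw [hj₀, hj₁]; simp
  obtain ⟨C₀, hC₀, happ⟩ := exists_common_approx k n b c hkn hn (hb0 j₀) (hminor j₀ j₁ hne)
  have hC₀r : (0 : ℝ) < C₀ := by exact_mod_cast hC₀
  obtain ⟨C, hC, hInt⟩ := integral_prod_le k n b c hkn hn hb0 hminor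
    (ε := η / (2 * C₀)) (by positivity)
  refine ⟨1 / (2 * C₀), by positivity, 2 * C, by positivity, 2 ^ C₀, Nat.one_le_two_pow,
    fun P Q Q' hQ hQQ' hQ' hP hPQ => ?_⟩
  have hQ1 : 1 ≤ Q := Nat.one_le_two_pow.trans hQ
  have hQr : (0 : ℝ) < Q := by exact_mod_cast hQ1
  have hQ'r : (0 : ℝ) < Q' := by exact_mod_cast hQ1.trans hQQ'
  have hP1 : 1 ≤ P := by omega
  have hPr : (0 : ℝ) < P := by exact_mod_cast hP1
  obtain ⟨R, hR⟩ : ∃ R : ℝ, R = (Q : ℝ) ^ ((C₀ : ℝ)⁻¹) := ⟨_, rfl⟩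
  have hRC : R ^ C₀ = Q := by rw [hR]; exact Real.rpow_inv_natCast_pow hQr.le (by omega)
  have hR0 : 0 ≤ R := by rw [hR]; positivity
  have hR2 : 2 ≤ R := by
    refine le_of_pow_le_pow_left₀ (n := C₀) (by omega) hR0 ?_
    rw [hRC]; exact_mod_cast hQ
  have hRp : 0 < R := by linarith
  have hcases : ∀ α ∈ cube (corner Q') \ major k n P Q,
      ‖fsum k n P b c j₀ α‖ ≤ P / R ∨ ‖fsum k n P b c j₁ α‖ ≤ P / R := by
    intro α hα
    by_contra! hlt
    rw [div_lt_iff₀ hRp, mul_comm, div_lt_iff₀ hRp, mul_comm _ R] at hlt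
    obtain ⟨q, hq1, hqR, a, ha⟩ := happ R hR2 P hP1 α hlt.1.le hlt.2.le
    rw [hRC] at hqR ha
    have hqQ : q ≤ Q := by exact_mod_cast hqR
    have hqr : (1 : ℝ) ≤ q := by exact_mod_cast hq1
    have haq : ∀ i, 1 ≤ a i ∧ a i ≤ q := by
      intro i
      have h1 := ha i
      have h2 := div_pow_deg_lt hkn hn hQ1 hQ' (hQ1.trans hQQ') hP i
      have h3 := hα.1 i (Set.mem_univ i)
      simp only [corner, Set.mem_Ioc] at h3
      rw [abs_le] at h1
      have h5 : (q : ℝ) * (1 / (2 * Q')) ≤ 1 / 2 := by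
        rw [mul_one_div, div_le_div_iff₀ (by positivity) (by norm_num)]
        have : (q : ℝ) ≤ Q' := by exact_mod_cast hqQ.trans hQQ'
        linarith
      have h7 : (0 : ℝ) < 1 / (2 * Q') := by positivity
      obtain ⟨w, hw⟩ : ∃ w : ℝ, w = 1 / (2 * Q') := ⟨_, rfl⟩
      rw [← hw] at h2 h3 h5 h7
      have h6 : w ≤ q * w := le_mul_of_one_le_left h7.le hqr
      constructor
      · have : (0 : ℝ) < a i := by nlinarith
        exact_mod_cast this
      · have : (a i : ℝ) < q + 1 := by nlinarith
        have : a i < q + 1 := by exact_mod_cast this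
        omega
    refine hα.2 ?_
    refine Set.mem_biUnion (x := fun i => ((a i).toNat : ℚ) / q) ?_ ?_
    · exact mem_ratPts.2 ⟨q, ⟨hq1, hqQ⟩, fun i => (a i).toNat, fun i => by
        have := haq i; dsimp only; omega, fun i => rfl⟩
    · intro i
      have e : ((a i).toNat : ℝ) = a i := by
        have : (((a i).toNat : ℤ) : ℝ) = a i := by
          rw [Int.toNat_of_nonneg (by have := haq i; omega)]
        rwa [Int.cast_natCast] at this
      simp only [toR, Rat.cast_div, Rat.cast_natCast, e]
      have e2 : α i - a i / q = (q * α i - a i) / q := by field_simp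
      rw [e2, abs_div, Nat.abs_cast]
      exact (div_le_self (abs_nonneg _) hqr).trans (ha i)
  have hcont : ∀ S : Finset (Fin s), Continuous fun α => ∏ j ∈ S, ‖fsum k n P b c j α‖ :=
    fun S => continuous_finsetProd _ fun j _ => (continuous_fsum k n b c P j).norm
  have hnn : ∀ (S : Finset (Fin s)) α, 0 ≤ ∏ j ∈ S, ‖fsum k n P b c j α‖ := fun S α =>
    prod_nonneg fun j _ => norm_nonneg _
  have hE : ∀ j : Fin s, ∫ α in cube (corner Q'), ∏ l ∈ univ.erase j, ‖fsum k n P b c l α‖ ≤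
      C * (P : ℝ) ^ ((s : ℝ) - 1 - k - 2 * n + η / (2 * C₀)) := by
    intro j
    have hcard : (univ.erase j : Finset (Fin s)).card = s - 1 := by
      rw [card_erase_of_mem (mem_univ _), card_univ, Fintype.card_fin]
    have := hInt P hP1 (corner Q') (univ.erase j) (by rw [hcard]; omega)
    rwa [hcard, Nat.cast_sub (by omega), Nat.cast_one] at this
  calc ∫ α in cube (corner Q') \ major k n P Q, ∏ j, ‖fsum k n P b c j α‖
      ≤ ∫ α in cube (corner Q') \ major k n P Q, P / R *
        (∏ l ∈ univ.erase j₀, ‖fsum k n P b c l α‖ +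
          ∏ l ∈ univ.erase j₁, ‖fsum k n P b c l α‖) := by
        refine setIntegral_mono_on ((integrableOn_cube (hcont _) _).mono_set Set.sdiff_subset)
          ((integrableOn_cube (continuous_const.mul ((hcont _).add (hcont _))) _).mono_set
            Set.sdiff_subset) ((measurableSet_cube _).diff (measurableSet_major k n P Q)) ?_
        intro α hα
        rcases hcases α hα with h | h
        · rw [← mul_prod_erase _ _ (mem_univ j₀)]
          refine mul_le_mul h ?_ (hnn _ _) (by positivity)
          exact le_add_of_nonneg_right (hnn _ _)
        · rw [← mul_prod_erase _ _ (mem_univ j₁)]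
          refine mul_le_mul h ?_ (hnn _ _) (by positivity)
          exact le_add_of_nonneg_left (hnn _ _)
    _ ≤ ∫ α in cube (corner Q'), P / R *
        (∏ l ∈ univ.erase j₀, ‖fsum k n P b c l α‖ +
          ∏ l ∈ univ.erase j₁, ‖fsum k n P b c l α‖) := by
        refine setIntegral_mono_set (integrableOn_cube (continuous_const.mul
          ((hcont _).add (hcont _))) _) (ae_of_all _ fun α => ?_)
          (Set.sdiff_subset.eventuallyLE)
        exact mul_nonneg (by positivity) (add_nonneg (hnn _ _) (hnn _ _))
    _ ≤ P / R * (C * (P : ℝ) ^ ((s : ℝ) - 1 - k - 2 * n + η / (2 * C₀)) +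
        C * (P : ℝ) ^ ((s : ℝ) - 1 - k - 2 * n + η / (2 * C₀))) := by
        rw [integral_const_mul, integral_add (integrableOn_cube (hcont _) _)
          (integrableOn_cube (hcont _) _)]
        exact mul_le_mul_of_nonneg_left (add_le_add (hE _) (hE _)) (by positivity)
    _ = 2 * C * (P : ℝ) ^ ((s : ℝ) - k - 2 * n) * (((P : ℝ) ^ η) ^ (1 / (2 * C₀) : ℝ) / R) := by
        have e1 : (s : ℝ) - 1 - k - 2 * n + η / (2 * C₀) =
          ((s : ℝ) - k - 2 * n) + η * (1 / (2 * C₀)) - 1 := by ring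
        rw [e1, Real.rpow_sub hPr, Real.rpow_add hPr, Real.rpow_mul hPr.le, Real.rpow_one]
        field_simp
        ring
    _ ≤ 2 * C * (P : ℝ) ^ ((s : ℝ) - k - 2 * n) * ((Q : ℝ) ^ (1 / (2 * C₀) : ℝ) / R) := by
        gcongr
    _ = _ := by
        congr 1
        rw [hR, ← Real.rpow_sub hQr]
        congr 1
        field_simp
        norm_num

end

lemma norm_ee_sub_le (x y : ℝ) : ‖ee x - ee y‖ ≤ 7 * |x - y| := by
  have h : ee x - ee y = ee y * (ee (x - y) - 1) := by
    rw [mul_sub, ← ee_add, mul_one]; congr 2; ring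
  rw [h, norm_mul, norm_ee, one_mul]
  exact norm_ee_sub_one_le _

/-- The average of `F` over an initial segment. -/
noncomputable def avg (q : ℕ) (F : ℕ → ℂ) : ℂ := (∑ x ∈ range q, F x) / q

lemma sum_range_shift {F : ℕ → ℂ} {q : ℕ} (hF : ∀ x, F (x + q) = F x) (m : ℕ) :
    ∑ x ∈ range q, F (x + m) = ∑ x ∈ range q, F x := by
  induction m with
  | zero => simp
  | succ m ih =>
    rw [← ih]
    have h1 := sum_range_succ' (fun x => F (x + m)) q
    have h2 := sum_range_succ (fun x => F (x + m)) q
    rw [h2] at h1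
    have h3 : F (q + m) = F (0 + m) := by rw [zero_add, add_comm q m]; exact hF m
    have h4 : ∀ x, F (x + (m + 1)) = F (x + 1 + m) := fun x => by congr 1; ring
    simp only [h4]
    rw [h3] at h1
    exact (add_right_cancel h1).symm

lemma sum_range_mul_of_periodic {F : ℕ → ℂ} {q : ℕ} (hF : ∀ x, F (x + q) = F x) (m : ℕ) :
    ∑ x ∈ range (m * q), F x = m * ∑ x ∈ range q, F x := by
  induction m with
  | zero => simp
  | succ m ih =>
    rw [add_mul, one_mul, sum_range_add, ih]
    have : ∑ x ∈ range q, F (m * q + x) = ∑ x ∈ range q, F x := by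
      rw [← sum_range_shift hF (m * q)]
      exact sum_congr rfl fun x _ => by rw [add_comm]
    rw [this]; push_cast; ring

lemma avg_mul {F : ℕ → ℂ} {q : ℕ} (hq : 1 ≤ q) (hF : ∀ x, F (x + q) = F x) {m : ℕ} (hm : 1 ≤ m) :
    avg (m * q) F = avg q F := by
  rw [avg, avg, sum_range_mul_of_periodic hF]
  have : (m : ℂ) ≠ 0 := by exact_mod_cast (by omega : m ≠ 0)
  have : (q : ℂ) ≠ 0 := by exact_mod_cast (by omega : q ≠ 0)
  push_cast
  field_simp

lemma avg_eq_avg {F : ℕ → ℂ} {q q' : ℕ} (hq : 1 ≤ q) (hq' : 1 ≤ q') (hF : ∀ x, F (x + q) = F x)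
    (hF' : ∀ x, F (x + q') = F x) : avg q F = avg q' F := by
  rw [← avg_mul hq hF hq', ← avg_mul hq' hF' hq, mul_comm]

lemma norm_avg_le {q : ℕ} (hq : 1 ≤ q) {F : ℕ → ℂ} (hF : ∀ x, ‖F x‖ ≤ 1) : ‖avg q F‖ ≤ 1 := by
  have : (0 : ℝ) < q := by exact_mod_cast hq
  rw [avg, norm_div, Complex.norm_natCast, div_le_one this]
  refine (norm_sum_le _ _).trans ?_
  calc _ ≤ ∑ x ∈ range q, (1 : ℝ) := sum_le_sum fun x _ => hF x
    _ = q := by simp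

/-- The phase at a rational point. -/
noncomputable def phase (k n : ℕ) (u v : ℚ) (x : ℕ) : ℂ :=
  ee ((u : ℝ) * (x : ℝ) ^ k + (v : ℝ) * (x : ℝ) ^ n)

lemma ee_rat_periodic {u : ℚ} {q : ℕ} {a : ℤ} (hu : q * u = a) (k x : ℕ) :
    ee ((u : ℝ) * ((x + q : ℕ) : ℝ) ^ k) = ee ((u : ℝ) * (x : ℝ) ^ k) := by
  obtain ⟨m, hm⟩ : ((q : ℕ) : ℤ) ∣ ((x + q : ℕ) : ℤ) ^ k - (x : ℤ) ^ k := by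
    have := sub_dvd_pow_sub_pow ((x + q : ℕ) : ℤ) (x : ℤ) k
    rwa [Nat.cast_add, add_sub_cancel_left] at this
  have hm' : ((x + q : ℕ) : ℝ) ^ k - (x : ℝ) ^ k = q * m := by exact_mod_cast congrArg (Int.cast (R := ℝ)) hm
  have hu' : (q : ℝ) * (u : ℝ) = a := by exact_mod_cast congrArg (Rat.cast (K := ℝ)) hu
  have : (u : ℝ) * ((x + q : ℕ) : ℝ) ^ k = (u : ℝ) * (x : ℝ) ^ k + ((a * m : ℤ) : ℝ) := by
    push_cast
    push_cast at hm'
    linear_combination (u : ℝ) * hm' + m * hu'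
  rw [this, ee_add, ee_int, mul_one]

lemma phase_periodic {k n : ℕ} {u v : ℚ} {q : ℕ} {a a' : ℤ} (hu : q * u = a) (hv : q * v = a')
    (x : ℕ) : phase k n u v (x + q) = phase k n u v x := by
  rw [phase, phase, ee_add, ee_add, ee_rat_periodic hu, ee_rat_periodic hv]

/-- The normalised complete exponential sum at a rational point. -/
noncomputable def gauss (k n : ℕ) (u v : ℚ) : ℂ := avg (u.den * v.den) (phase k n u v)

lemma gauss_eq (k n : ℕ) {u v : ℚ} {q : ℕ} (hq : 1 ≤ q) {a a' : ℤ} (hu : q * u = a)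
    (hv : q * v = a') : gauss k n u v = avg q (phase k n u v) := by
  refine avg_eq_avg (Nat.mul_pos u.den_pos v.den_pos) hq
    (phase_periodic (a := v.den * u.num) (a' := u.den * v.num) ?_ ?_)
    (phase_periodic hu hv)
  · push_cast; rw [mul_comm (u.den : ℚ), mul_assoc, Rat.den_mul_eq_num]
  · push_cast; rw [mul_assoc, Rat.den_mul_eq_num]

lemma norm_phase (k n : ℕ) (u v : ℚ) (x : ℕ) : ‖phase k n u v x‖ = 1 := norm_ee _

lemma norm_gauss_le (k n : ℕ) (u v : ℚ) : ‖gauss k n u v‖ ≤ 1 :=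
  norm_avg_le (Nat.mul_pos u.den_pos v.den_pos) fun _ => (norm_phase _ _ _ _ _).le

/-- The oscillatory integral attached to `β x ^ k + γ x ^ n`. -/
noncomputable def osc (k n : ℕ) (β γ : ℝ) : ℂ := ∫ x in (0 : ℝ)..1, ee (β * x ^ k + γ * x ^ n)

lemma norm_osc_le (k n : ℕ) (β γ : ℝ) : ‖osc k n β γ‖ ≤ 1 := by
  have := intervalIntegral.norm_integral_le_of_norm_le_const (a := 0) (b := 1) (C := 1)
    (f := fun x => ee (β * x ^ k + γ * x ^ n)) fun x _ => (norm_ee _).le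
  simpa [osc] using this

/-- A Lipschitz constant for `x ↦ ee (β x ^ k + γ x ^ n)` on `[0, 2]`. -/
noncomputable def lip (k n : ℕ) (β γ : ℝ) : ℝ :=
  7 * (|β| * (k * 2 ^ (k - 1)) + |γ| * (n * 2 ^ (n - 1)))

lemma lip_nonneg (k n : ℕ) (β γ : ℝ) : 0 ≤ lip k n β γ := by unfold lip; positivity

lemma norm_ee_poly_sub_le (k n : ℕ) (β γ : ℝ) {x y : ℝ} (hx : 0 ≤ x) (hxy : x ≤ y) (hy : y ≤ 2) :
    ‖ee (β * y ^ k + γ * y ^ n) - ee (β * x ^ k + γ * x ^ n)‖ ≤ lip k n β γ * (y - x) := by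
  refine (norm_ee_sub_le _ _).trans ?_
  have e : β * y ^ k + γ * y ^ n - (β * x ^ k + γ * x ^ n) =
    β * (y ^ k - x ^ k) + γ * (y ^ n - x ^ n) := by ring
  have hp : ∀ m : ℕ, |y ^ m - x ^ m| ≤ m * 2 ^ (m - 1) * (y - x) := fun m => by
    rw [abs_of_nonneg (sub_nonneg.2 (pow_le_pow_left₀ hx hxy m))]
    exact pow_sub_pow_le hx hxy hy m
  rw [e, lip, mul_assoc]
  refine mul_le_mul_of_nonneg_left ?_ (by norm_num)
  refine (abs_add_le _ _).trans ?_
  rw [abs_mul, abs_mul, add_mul, mul_assoc |β|, mul_assoc |γ|]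
  exact add_le_add (mul_le_mul_of_nonneg_left (hp k) (abs_nonneg _))
    (mul_le_mul_of_nonneg_left (hp n) (abs_nonneg _))

lemma norm_sum_sub_osc_le (k n : ℕ) {P : ℕ} (hP : 1 ≤ P) (β γ : ℝ) :
    ‖∑ x ∈ range P, ee (β * ((x : ℝ) / P) ^ k + γ * ((x : ℝ) / P) ^ n) - P * osc k n β γ‖ ≤
      lip k n β γ := by
  have hPr : (0 : ℝ) < P := by exact_mod_cast hP
  obtain ⟨H, hH⟩ : ∃ H : ℝ → ℂ, H = fun x => ee (β * x ^ k + γ * x ^ n) := ⟨_, rfl⟩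
  have hHc : Continuous H := by rw [hH]; exact continuous_ee.comp (by fun_prop)
  have h1 : osc k n β γ = ∑ x ∈ range P, ∫ t in ((x : ℝ) / P)..(((x + 1 : ℕ) : ℝ) / P), H t := by
    rw [intervalIntegral.sum_integral_adjacent_intervals (a := fun x : ℕ => (x : ℝ) / P)
      fun k _ => hHc.intervalIntegrable _ _]
    rw [osc, hH, Nat.cast_zero, zero_div, div_self hPr.ne']
  have h2 : ∀ x ∈ range P, ‖H ((x : ℝ) / P) -
      P * ∫ t in ((x : ℝ) / P)..(((x + 1 : ℕ) : ℝ) / P), H t‖ ≤ lip k n β γ / P := by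
    intro x hx
    have hxP : ((x + 1 : ℕ) : ℝ) ≤ P := by exact_mod_cast mem_range.1 hx
    have hlen : ((x + 1 : ℕ) : ℝ) / P - (x : ℝ) / P = 1 / P := by push_cast; ring
    have e : H ((x : ℝ) / P) - P * ∫ t in ((x : ℝ) / P)..(((x + 1 : ℕ) : ℝ) / P), H t =
        -(P * ∫ t in ((x : ℝ) / P)..(((x + 1 : ℕ) : ℝ) / P), (H t - H ((x : ℝ) / P))) := by
      rw [intervalIntegral.integral_sub (hHc.intervalIntegrable _ _)
        (continuous_const.intervalIntegrable _ _), intervalIntegral.integral_const, hlen,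
        Complex.real_smul]
      have : (P : ℂ) ≠ 0 := by exact_mod_cast hPr.ne'
      push_cast
      field_simp
      ring
    rw [e, norm_neg, norm_mul, Complex.norm_natCast]
    have h3 : ‖∫ t in ((x : ℝ) / P)..(((x + 1 : ℕ) : ℝ) / P), (H t - H ((x : ℝ) / P))‖ ≤
        lip k n β γ * (1 / P) * |((x + 1 : ℕ) : ℝ) / P - (x : ℝ) / P| := by
      refine intervalIntegral.norm_integral_le_of_norm_le_const fun t ht => ?_
      rw [Set.uIoc_of_le (by gcongr; linarith)] at ht
      have ht2 : t ≤ 2 := ht.2.trans (((div_le_one hPr).2 hxP).trans (by norm_num))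
      rw [hH]
      refine (norm_ee_poly_sub_le k n β γ (by positivity) ht.1.le ht2).trans ?_
      refine mul_le_mul_of_nonneg_left ?_ (lip_nonneg _ _ _ _)
      rw [← hlen]; linarith [ht.2]
    rw [hlen, abs_of_pos (by positivity)] at h3
    calc _ ≤ (P : ℝ) * (lip k n β γ * (1 / P) * (1 / P)) := by gcongr
      _ = _ := by field_simp
  have h4 : ∑ x ∈ range P, ee (β * ((x : ℝ) / P) ^ k + γ * ((x : ℝ) / P) ^ n) =
    ∑ x ∈ range P, H ((x : ℝ) / P) := by rw [hH]
  rw [h4, h1, mul_sum, ← sum_sub_distrib]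
  refine (norm_sum_le _ _).trans ((sum_le_sum h2).trans ?_)
  rw [sum_const, card_range, nsmul_eq_mul]
  field_simp
  exact le_rfl

lemma weyl_approx_lip (k n : ℕ) {P q : ℕ} (hP : 1 ≤ P) (hq : 1 ≤ q) {u v : ℚ} {a a' : ℤ}
    (hu : q * u = a) (hv : q * v = a') (β γ : ℝ) :
    ‖weyl k n P (u + β / (P : ℝ) ^ k) (v + γ / (P : ℝ) ^ n) - P * (gauss k n u v * osc k n β γ)‖ ≤
      q * (2 + 2 * lip k n β γ) := by
  have hPr : (0 : ℝ) < P := by exact_mod_cast hP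
  have hqr : (0 : ℝ) < q := by exact_mod_cast hq
  have hL := lip_nonneg k n β γ
  obtain ⟨L, hLdef⟩ : ∃ L, L = lip k n β γ := ⟨_, rfl⟩
  rw [← hLdef] at hL ⊢
  rcases lt_or_ge P q with hPq | hqP
  · have hPq' : (P : ℝ) ≤ q := by exact_mod_cast hPq.le
    have h1 : ‖gauss k n u v * osc k n β γ‖ ≤ 1 := by
      rw [norm_mul]
      exact mul_le_one₀ (norm_gauss_le _ _ _ _) (norm_nonneg _) (norm_osc_le _ _ _ _)
    calc _ ≤ (P : ℝ) + P * 1 := by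
          refine (norm_sub_le _ _).trans (add_le_add (norm_weyl_le _ _ _ _ _) ?_)
          rw [norm_mul, Complex.norm_natCast]
          gcongr
      _ ≤ _ := by nlinarith
  have hqP' : (q : ℝ) ≤ P := by exact_mod_cast hqP
  obtain ⟨G, hG⟩ : ∃ G, G = phase k n u v := ⟨_, rfl⟩
  obtain ⟨H, hH⟩ : ∃ H : ℕ → ℂ, H = fun x : ℕ =>
    ee (β * ((x : ℝ) / P) ^ k + γ * ((x : ℝ) / P) ^ n) := ⟨_, rfl⟩
  obtain ⟨F, hF⟩ : ∃ F : ℕ → ℂ, F = fun x => G x * H x := ⟨_, rfl⟩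
  have hG1 : ∀ x, ‖G x‖ = 1 := fun x => by rw [hG]; exact norm_phase _ _ _ _ _
  have hF1 : ∀ x, ‖F x‖ ≤ 1 := fun x => by
    simp only [hF, hH, norm_mul, hG1, norm_ee, mul_one, le_refl]
  have hw : weyl k n P (u + β / (P : ℝ) ^ k) (v + γ / (P : ℝ) ^ n) = ∑ x ∈ range P, F (x + 1) := by
    rw [weyl_eq_range]
    refine sum_congr rfl fun x _ => ?_
    simp only [hF, hG, hH, phase]
    rw [← ee_add]
    congr 1
    push_cast
    rw [div_pow, div_pow]
    ring
  have hstep : ∀ m ∈ range q, ‖weyl k n P (u + β / (P : ℝ) ^ k) (v + γ / (P : ℝ) ^ n) -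
      ∑ x ∈ range P, G (x + m) * H x‖ ≤ q * (2 + L) := by
    intro m hm
    have hmq : m + 1 ≤ q := mem_range.1 hm
    have hmr : (m : ℝ) + 1 ≤ q := by exact_mod_cast hmq
    have h1 := norm_sum_shift_le hF1 P 1
    have h2 := norm_sum_shift_le hF1 P m
    have h3 : ‖∑ x ∈ range P, F (x + m) - ∑ x ∈ range P, G (x + m) * H x‖ ≤ q * L := by
      rw [← sum_sub_distrib]
      refine (norm_sum_le _ _).trans ?_
      calc _ ≤ ∑ x ∈ range P, L * (q / P) := by
            refine sum_le_sum fun x hx => ?_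
            have hxP : (x : ℝ) ≤ P := by exact_mod_cast (mem_range.1 hx).le
            simp only [hF]
            rw [← mul_sub, norm_mul, hG1, one_mul, hH]
            have hle : (x : ℝ) / P ≤ ((x + m : ℕ) : ℝ) / P := by gcongr; omega
            have hle2 : ((x + m : ℕ) : ℝ) / P ≤ 2 := by
              rw [div_le_iff₀ hPr]; push_cast; linarith
            refine (norm_ee_poly_sub_le k n β γ (by positivity) hle hle2).trans ?_
            rw [← hLdef]
            refine mul_le_mul_of_nonneg_left ?_ hL
            rw [← sub_div]
            gcongr
            push_cast; linarith
        _ = _ := by rw [sum_const, card_range, nsmul_eq_mul]; field_simp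
    rw [hw]
    calc _ = ‖-(∑ x ∈ range P, F x - ∑ x ∈ range P, F (x + 1)) +
          (∑ x ∈ range P, F x - ∑ x ∈ range P, F (x + m)) +
          (∑ x ∈ range P, F (x + m) - ∑ x ∈ range P, G (x + m) * H x)‖ := by congr 1; ring
      _ ≤ 2 * (1 : ℕ) + 2 * m + q * L := by
          refine (norm_add_le _ _).trans (add_le_add ((norm_add_le _ _).trans
            (add_le_add ?_ h2)) h3)
          rwa [norm_neg]
      _ ≤ _ := by push_cast; nlinarith
  have hGper : ∀ x, G (x + q) = G x := fun x => by rw [hG]; exact phase_periodic hu hv x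
  have hsum : ∑ m ∈ range q, ∑ x ∈ range P, G (x + m) * H x =
      q * (gauss k n u v * ∑ x ∈ range P, H x) := by
    rw [sum_comm]
    have : ∀ x ∈ range P, ∑ m ∈ range q, G (x + m) * H x = q * gauss k n u v * H x := by
      intro x _
      rw [← sum_mul]
      congr 1
      rw [gauss_eq k n hq hu hv, ← hG, avg, mul_div_cancel₀ _ (by exact_mod_cast hqr.ne'),
        ← sum_range_shift hGper x]
      exact sum_congr rfl fun m _ => by rw [add_comm]
    rw [sum_congr rfl this, ← mul_sum]; ring
  have hav : ‖weyl k n P (u + β / (P : ℝ) ^ k) (v + γ / (P : ℝ) ^ n) -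
      gauss k n u v * ∑ x ∈ range P, H x‖ ≤ q * (2 + L) := by
    refine le_of_mul_le_mul_left ?_ hqr
    calc _ = ‖∑ m ∈ range q, (weyl k n P (u + β / (P : ℝ) ^ k) (v + γ / (P : ℝ) ^ n) -
          ∑ x ∈ range P, G (x + m) * H x)‖ := by
          rw [sum_sub_distrib, hsum, sum_const, card_range, nsmul_eq_mul, ← mul_sub, norm_mul,
            Complex.norm_natCast]
      _ ≤ ∑ m ∈ range q, q * (2 + L) := (norm_sum_le _ _).trans (sum_le_sum hstep)
      _ = _ := by rw [sum_const, card_range, nsmul_eq_mul]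
  have hosc : ‖gauss k n u v * ∑ x ∈ range P, H x - P * (gauss k n u v * osc k n β γ)‖ ≤ L := by
    have e : gauss k n u v * ∑ x ∈ range P, H x - P * (gauss k n u v * osc k n β γ) =
      gauss k n u v * (∑ x ∈ range P, H x - P * osc k n β γ) := by ring
    rw [e, norm_mul]
    have := norm_sum_sub_osc_le k n hP β γ
    rw [← hLdef] at this
    rw [hH]
    calc _ ≤ 1 * L := mul_le_mul (norm_gauss_le _ _ _ _) this (norm_nonneg _) zero_le_one
      _ = L := one_mul L
  have hq1 : (1 : ℝ) ≤ q := by exact_mod_cast hq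
  calc _ ≤ _ := norm_sub_le_norm_sub_add_norm_sub _ (gauss k n u v * ∑ x ∈ range P, H x) _
    _ ≤ q * (2 + L) + L := add_le_add hav hosc
    _ ≤ _ := by nlinarith

lemma norm_prod_sub_prod_le {ι : Type*} [DecidableEq ι] (S : Finset ι) {x y : ι → ℂ} {M ε : ℝ}
    (hx : ∀ j ∈ S, ‖x j‖ ≤ M) (hy : ∀ j ∈ S, ‖y j‖ ≤ M) (hxy : ∀ j ∈ S, ‖x j - y j‖ ≤ ε)
    (hM : 0 ≤ M) (hε : 0 ≤ ε) :
    M * ‖∏ j ∈ S, x j - ∏ j ∈ S, y j‖ ≤ S.card * M ^ S.card * ε := by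
  induction S using Finset.induction_on with
  | empty => simp
  | insert a S ha ih =>
    rw [prod_insert ha, prod_insert ha, card_insert_of_notMem ha]
    have ih' := ih (fun j hj => hx j (mem_insert_of_mem hj)) (fun j hj => hy j (mem_insert_of_mem hj))
      (fun j hj => hxy j (mem_insert_of_mem hj))
    have e : x a * ∏ j ∈ S, x j - y a * ∏ j ∈ S, y j =
      (x a - y a) * ∏ j ∈ S, x j + y a * (∏ j ∈ S, x j - ∏ j ∈ S, y j) := by ring
    have hp : ‖∏ j ∈ S, x j‖ ≤ M ^ S.card := by
      rw [norm_prod]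
      refine (prod_le_prod (fun j _ => norm_nonneg _)
        fun j hj => hx j (mem_insert_of_mem hj)).trans ?_
      rw [prod_const]
    rw [e]
    calc _ ≤ M * (ε * M ^ S.card + M * ‖∏ j ∈ S, x j - ∏ j ∈ S, y j‖) := by
          refine mul_le_mul_of_nonneg_left ((norm_add_le _ _).trans ?_) hM
          rw [norm_mul, norm_mul]
          refine add_le_add (mul_le_mul (hxy a (mem_insert_self _ _)) hp (norm_nonneg _) hε)
            (mul_le_mul_of_nonneg_right (hy a (mem_insert_self _ _)) (norm_nonneg _))
      _ ≤ M * (ε * M ^ S.card + S.card * M ^ S.card * ε) :=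
          mul_le_mul_of_nonneg_left (add_le_add le_rfl ih') hM
      _ = _ := by push_cast; ring

/-- The cube `[-Q, Q]³`. -/
def sbox (Q : ℝ) : Set (Fin 3 → ℝ) := {θ | ∀ i, |θ i| ≤ Q}

lemma sbox_eq (Q : ℝ) : sbox Q = Set.Icc (fun _ => -Q) (fun _ => Q) := by
  ext θ
  simp only [sbox, Set.mem_ofPred_eq, Set.mem_Icc, Pi.le_def, abs_le, forall_and]

lemma isCompact_sbox (Q : ℝ) : IsCompact (sbox Q) := by rw [sbox_eq]; exact isCompact_Icc

lemma measurableSet_sbox (Q : ℝ) : MeasurableSet (sbox Q) := (isCompact_sbox Q).measurableSet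

lemma volume_sbox {Q : ℝ} (hQ : 0 ≤ Q) : volume.real (sbox Q) = (2 * Q) ^ 3 := by
  rw [sbox_eq, measureReal_def, Real.volume_Icc_pi_toReal (fun _ => by linarith)]
  simp; ring

/-- The rescaling of a neighbourhood of `r`. -/
noncomputable def rescale (k n P : ℕ) (r θ : Fin 3 → ℝ) : Fin 3 → ℝ :=
  fun i => r i + θ i / (P : ℝ) ^ deg k n i

lemma continuous_rescale (k n P : ℕ) (r : Fin 3 → ℝ) : Continuous (rescale k n P r) := by
  unfold rescale; fun_prop

lemma rescale_image (k n : ℕ) {P : ℕ} (hP : 1 ≤ P) (Q : ℝ) (r : Fin 3 → ℝ) :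
    rescale k n P r '' sbox Q = arc k n P Q r := by
  have hPr : (0 : ℝ) < P := by exact_mod_cast hP
  ext α
  constructor
  · rintro ⟨θ, hθ, rfl⟩ i
    have hp : 0 < (P : ℝ) ^ deg k n i := by positivity
    simp only [rescale, add_sub_cancel_left, abs_div, abs_of_pos hp]
    exact div_le_div_of_nonneg_right (hθ i) hp.le
  · intro hα
    refine ⟨fun i => (α i - r i) * (P : ℝ) ^ deg k n i, fun i => ?_, ?_⟩
    · have hp : 0 < (P : ℝ) ^ deg k n i := by positivity
      rw [abs_mul, abs_of_pos hp, ← le_div_iff₀ hp]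
      exact hα i
    · funext i
      have hp : 0 < (P : ℝ) ^ deg k n i := by positivity
      simp only [rescale]
      field_simp
      ring

lemma integral_arc {E : Type*} [NormedAddCommGroup E] [NormedSpace ℝ E] (k n : ℕ) {P : ℕ}
    (hP : 1 ≤ P) (Q : ℝ) (r : Fin 3 → ℝ) (G : (Fin 3 → ℝ) → E) :
    ∫ α in arc k n P Q r, G α =
      ((P : ℝ) ^ (k + 2 * n))⁻¹ • ∫ θ in sbox Q, G (rescale k n P r θ) := by
  have hPr : (0 : ℝ) < P := by exact_mod_cast hP
  obtain ⟨d, hd⟩ : ∃ d : Fin 3 → ℝ, d = fun i => ((P : ℝ) ^ deg k n i)⁻¹ := ⟨_, rfl⟩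
  obtain ⟨L, hL⟩ : ∃ L : (Fin 3 → ℝ) →L[ℝ] (Fin 3 → ℝ),
    L = LinearMap.toContinuousLinearMap (Matrix.toLin' (Matrix.diagonal d)) := ⟨_, rfl⟩
  have hLapp : ∀ θ i, L θ i = d i * θ i := fun θ i => by
    rw [hL]; simp [Matrix.mulVec_diagonal]
  have hdet : |L.det| = ((P : ℝ) ^ (k + 2 * n))⁻¹ := by
    rw [hL, ContinuousLinearMap.det, LinearMap.coe_toContinuousLinearMap, LinearMap.det_toLin',
      Matrix.det_diagonal, hd, Fin.prod_univ_three, abs_of_pos (by positivity)]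
    simp only [deg, Matrix.cons_val_zero, Matrix.cons_val_one, Matrix.cons_val]
    rw [← mul_inv, ← mul_inv, ← pow_add, ← pow_add]
    congr 2; ring
  have hres : rescale k n P r = fun θ => r + L θ := by
    funext θ i
    rw [Pi.add_apply, hLapp, hd, rescale]
    ring
  have hder : ∀ θ ∈ sbox Q, HasFDerivWithinAt (rescale k n P r) L (sbox Q) θ := fun θ _ => by
    rw [hres]
    exact (L.hasFDerivAt.const_add r).hasFDerivWithinAt
  have hinj : Set.InjOn (rescale k n P r) (sbox Q) := by
    intro x _ y _ hxy
    funext i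
    have := congrFun hxy i
    simp only [rescale] at this
    have hp : 0 < (P : ℝ) ^ deg k n i := by positivity
    exact (div_left_inj' hp.ne').1 (add_left_cancel this)
  rw [← rescale_image k n hP, integral_image_eq_integral_abs_det_fderiv_smul volume
    (measurableSet_sbox Q) hder hinj, hdet, integral_smul]

section
variable {s : ℕ} (k n : ℕ) (b : Fin s → ℤ) (c : Fin 2 → Fin s → ℤ)

/-- The summand of the singular series. -/
noncomputable def sser (r : Fin 3 → ℚ) : ℂ :=
  ∏ j, gauss k n (b j * r 0) (c 0 j * r 1 + c 1 j * r 2)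

/-- The integrand of the singular integral. -/
noncomputable def sint (θ : Fin 3 → ℝ) : ℂ :=
  ∏ j, osc k n (b j * θ 0) (c 0 j * θ 1 + c 1 j * θ 2)

lemma continuous_osc : Continuous fun p : ℝ × ℝ => osc k n p.1 p.2 := by
  unfold osc
  refine intervalIntegral.continuous_parametric_intervalIntegral_of_continuous' ?_ 0 1
  exact continuous_ee.comp (by fun_prop)

lemma continuous_sint : Continuous (sint k n b c) := by
  refine continuous_finsetProd _ fun j _ => ?_
  exact (continuous_osc k n).comp (f := fun θ : Fin 3 → ℝ =>
    ((b j : ℝ) * θ 0, (c 0 j : ℝ) * θ 1 + (c 1 j : ℝ) * θ 2)) (by fun_prop)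

lemma exists_prod_approx : ∃ C : ℝ, 0 < C ∧ ∀ P q : ℕ, 1 ≤ P → 1 ≤ q →
    ∀ (r : Fin 3 → ℚ) (a : Fin 3 → ℤ), (∀ i, q * r i = a i) → ∀ Q : ℝ, 1 ≤ Q → ∀ θ ∈ sbox Q,
      P * ‖∏ j, fsum k n P b c j (rescale k n P (toR r) θ) -
        P ^ s * (sser k n b c r * sint k n b c θ)‖ ≤ C * (q * Q) * P ^ s := by
  obtain ⟨B, hB⟩ : ∃ B : ℝ, B = ∑ j, (|(b j : ℝ)| + |(c 0 j : ℝ)| + |(c 1 j : ℝ)|) := ⟨_, rfl⟩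
  have hBj : ∀ j, |(b j : ℝ)| + |(c 0 j : ℝ)| + |(c 1 j : ℝ)| ≤ B := fun j => by
    rw [hB]
    exact single_le_sum (f := fun j => |(b j : ℝ)| + |(c 0 j : ℝ)| + |(c 1 j : ℝ)|)
      (fun j _ => by positivity) (mem_univ j)
  have hB0 : 0 ≤ B := by rw [hB]; exact sum_nonneg fun j _ => by positivity
  obtain ⟨D, hD⟩ : ∃ D : ℝ, D = k * 2 ^ (k - 1) + n * 2 ^ (n - 1) := ⟨_, rfl⟩
  have hD0 : 0 ≤ D := by rw [hD]; positivity
  refine ⟨s * (2 + 14 * (B * D)) + 1, by positivity, fun P q hP hq r a ha Q hQ θ hθ => ?_⟩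
  have hPr : (0 : ℝ) < P := by exact_mod_cast hP
  have hqr : (1 : ℝ) ≤ q := by exact_mod_cast hq
  have hj : ∀ j, ‖fsum k n P b c j (rescale k n P (toR r) θ) -
      P * (gauss k n (b j * r 0) (c 0 j * r 1 + c 1 j * r 2) *
        osc k n (b j * θ 0) (c 0 j * θ 1 + c 1 j * θ 2))‖ ≤ (2 + 14 * (B * D)) * (q * Q) := by
    intro j
    have hu : (q : ℚ) * (b j * r 0) = ((b j * a 0 : ℤ) : ℚ) := by
      push_cast; rw [← ha 0]; ring
    have hv : (q : ℚ) * (c 0 j * r 1 + c 1 j * r 2) = ((c 0 j * a 1 + c 1 j * a 2 : ℤ) : ℚ) := by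
      push_cast; rw [← ha 1, ← ha 2]; ring
    have h1 := weyl_approx_lip k n hP hq hu hv (b j * θ 0) (c 0 j * θ 1 + c 1 j * θ 2)
    have e : fsum k n P b c j (rescale k n P (toR r) θ) =
        weyl k n P (((b j * r 0 : ℚ) : ℝ) + b j * θ 0 / (P : ℝ) ^ k)
          (((c 0 j * r 1 + c 1 j * r 2 : ℚ) : ℝ) + (c 0 j * θ 1 + c 1 j * θ 2) / (P : ℝ) ^ n) := by
      rw [fsum]
      congr 1
      · simp only [rescale, toR, deg, Matrix.cons_val_zero]; push_cast; ring
      · simp only [rescale, toR, deg, Matrix.cons_val_one, Matrix.cons_val]; push_cast; ring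
    rw [e]
    refine h1.trans ?_
    have hlip : lip k n (b j * θ 0) (c 0 j * θ 1 + c 1 j * θ 2) ≤ 7 * (B * D * Q) := by
      rw [lip]
      have h2 : |(b j : ℝ) * θ 0| ≤ B * Q := by
        rw [abs_mul]
        refine mul_le_mul ?_ (hθ 0) (abs_nonneg _) hB0
        have := hBj j
        have := abs_nonneg (c 0 j : ℝ)
        have := abs_nonneg (c 1 j : ℝ)
        linarith
      have h3 : |(c 0 j : ℝ) * θ 1 + c 1 j * θ 2| ≤ B * Q := by
        refine (abs_add_le _ _).trans ?_
        rw [abs_mul, abs_mul]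
        have h4 : |(c 0 j : ℝ)| * |θ 1| ≤ |(c 0 j : ℝ)| * Q :=
          mul_le_mul_of_nonneg_left (hθ 1) (abs_nonneg _)
        have h5 : |(c 1 j : ℝ)| * |θ 2| ≤ |(c 1 j : ℝ)| * Q :=
          mul_le_mul_of_nonneg_left (hθ 2) (abs_nonneg _)
        have h6 : (|(c 0 j : ℝ)| + |(c 1 j : ℝ)|) * Q ≤ B * Q := by
          refine mul_le_mul_of_nonneg_right ?_ (by linarith)
          have := hBj j
          have := abs_nonneg (b j : ℝ)
          linarith
        linarith
      refine mul_le_mul_of_nonneg_left ?_ (by norm_num)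
      calc _ ≤ B * Q * (k * 2 ^ (k - 1)) + B * Q * (n * 2 ^ (n - 1)) := by gcongr
        _ = _ := by rw [hD]; ring
    calc (q : ℝ) * (2 + 2 * lip k n (b j * θ 0) (c 0 j * θ 1 + c 1 j * θ 2))
        ≤ q * (2 * Q + 2 * (7 * (B * D * Q))) := by
          refine mul_le_mul_of_nonneg_left ?_ (by positivity)
          linarith
      _ = _ := by ring
  have hprod := norm_prod_sub_prod_le (univ : Finset (Fin s)) (M := P)
    (ε := (2 + 14 * (B * D)) * (q * Q)) (fun j _ => norm_fsum_le k n b c P j _)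
    (fun j _ => by
      rw [norm_mul, norm_mul, Complex.norm_natCast]
      refine mul_le_of_le_one_right hPr.le ?_
      exact mul_le_one₀ (norm_gauss_le _ _ _ _) (norm_nonneg _) (norm_osc_le _ _ _ _))
    (fun j _ => hj j) hPr.le (by positivity)
  rw [prod_mul_distrib, prod_mul_distrib, prod_const, card_univ, Fintype.card_fin] at hprod
  refine hprod.trans ?_
  have : (0 : ℝ) ≤ q * Q * P ^ s := by positivity
  nlinarith

end

lemma card_ratPts_le (Q : ℕ) : (ratPts Q).card ≤ Q ^ 4 := by
  refine card_biUnion_le.trans ?_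
  calc _ ≤ ∑ _q ∈ Icc 1 Q, Q ^ 3 := by
        refine sum_le_sum fun q hq => card_image_le.trans ?_
        rw [Fintype.card_piFinset]
        simp only [Nat.card_Icc, add_tsub_cancel_right, prod_const, card_univ, Fintype.card_fin]
        exact Nat.pow_le_pow_left (mem_Icc.1 hq).2 3
    _ = Q ^ 4 := by simp; ring

lemma ratPts_mono {Q Q' : ℕ} (h : Q ≤ Q') : ratPts Q ⊆ ratPts Q' := by
  intro r hr
  obtain ⟨q, hq, a, ha⟩ := mem_ratPts.1 hr
  exact mem_ratPts.2 ⟨q, ⟨hq.1, hq.2.trans h⟩, a, ha⟩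

lemma one_div_sq_le {Q : ℕ} {r r' : Fin 3 → ℚ} (hr : r ∈ ratPts Q) (hr' : r' ∈ ratPts Q)
    {i : Fin 3} (hi : r i ≠ r' i) : 1 / (Q : ℝ) ^ 2 ≤ |toR r i - toR r' i| := by
  obtain ⟨q, hq, a, ha, hra⟩ := mem_ratPts.1 hr
  obtain ⟨q', hq', a', ha', hra'⟩ := mem_ratPts.1 hr'
  have hq0 : (0 : ℝ) < q := by exact_mod_cast hq.1
  have hq'0 : (0 : ℝ) < q' := by exact_mod_cast hq'.1
  have e : toR r i - toR r' i = ((a i * q' - a' i * q : ℤ) : ℝ) / (q * q') := by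
    simp only [toR, hra i, hra' i]
    push_cast
    field_simp
  have hne : (a i * q' - a' i * q : ℤ) ≠ 0 := by
    intro h0
    rw [h0, Int.cast_zero, zero_div, sub_eq_zero] at e
    exact hi (Rat.cast_injective (α := ℝ) e)
  have h1 : (1 : ℝ) ≤ |((a i * q' - a' i * q : ℤ) : ℝ)| := by
    rw [← Int.cast_abs]; exact_mod_cast Int.one_le_abs hne
  rw [e, abs_div, abs_of_pos (mul_pos hq0 hq'0)]
  have h2 : (q : ℝ) * q' ≤ Q ^ 2 := by
    rw [sq]
    have h3 : (q : ℝ) ≤ Q := by exact_mod_cast hq.2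
    have h4 : (q' : ℝ) ≤ Q := by exact_mod_cast hq'.2
    gcongr
  exact div_le_div₀ (abs_nonneg _) h1 (by positivity) h2

lemma arc_disjoint {k n P Q : ℕ} (hkn : n < k) (hn : 1 ≤ n) (hQ : 1 ≤ Q) (hP : 16 * Q ^ 3 < P) :
    Set.Pairwise (ratPts Q : Set (Fin 3 → ℚ))
      (Function.onFun Disjoint fun r => arc k n P Q (toR r)) := by
  intro r hr r' hr' hne
  rw [Function.onFun, Set.disjoint_left]
  intro α hα hα'
  obtain ⟨i, hi⟩ := Function.ne_iff.1 hne
  have h1 := one_div_sq_le hr hr' hi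
  have hPr : (1 : ℝ) ≤ P := by exact_mod_cast (by omega : 1 ≤ P)
  have hQr : (1 : ℝ) ≤ Q := by exact_mod_cast hQ
  have h2 : (P : ℝ) ≤ (P : ℝ) ^ deg k n i := le_self_pow₀ hPr (by have := le_deg hkn hn i; omega)
  have h3 : (Q : ℝ) / (P : ℝ) ^ deg k n i ≤ Q / P := by gcongr
  have h4 : |toR r i - toR r' i| ≤ Q / P + Q / P := by
    have e : toR r i - toR r' i = (α i - toR r' i) - (α i - toR r i) := by ring
    rw [e]
    exact (abs_sub _ _).trans (add_le_add ((hα' i).trans h3) ((hα i).trans h3))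
  have h5 : (Q : ℝ) / P + Q / P < 1 / (Q : ℝ) ^ 2 := by
    rw [← add_div, div_lt_div_iff₀ (by linarith) (by positivity)]
    have : 16 * (Q : ℝ) ^ 3 < P := by exact_mod_cast hP
    have : (0 : ℝ) < (Q : ℝ) ^ 3 := by positivity
    nlinarith
  linarith

lemma major_subset_cube {k n P Q Q' : ℕ} (hkn : n < k) (hn : 1 ≤ n) (hQ : 1 ≤ Q) (hQQ' : Q ≤ Q')
    (hQ' : Q' ≤ 2 * Q) (hP : 16 * Q ^ 3 < P) : major k n P Q ⊆ cube (corner Q') := by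
  intro α hα
  obtain ⟨r, hr, hα⟩ := Set.mem_iUnion₂.1 hα
  obtain ⟨q, hq, a, ha, hra⟩ := mem_ratPts.1 hr
  intro i _
  have h1 := abs_le.1 (hα i)
  have h2 := div_pow_deg_lt hkn hn hQ hQ' (hQ.trans hQQ') hP i
  have hq0 : (0 : ℝ) < q := by exact_mod_cast hq.1
  have hQr : (1 : ℝ) ≤ Q := by exact_mod_cast hQ
  have hQr' : (Q : ℝ) ≤ Q' := by exact_mod_cast hQQ'
  have e : toR r i = a i / q := by simp [toR, hra i]
  have h3 : toR r i ≤ 1 := by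
    rw [e, div_le_one hq0]; exact_mod_cast (ha i).2
  have h4 : 1 / (Q' : ℝ) ≤ toR r i := by
    rw [e]
    refine div_le_div₀ (by positivity) (by exact_mod_cast (ha i).1) hq0 ?_
    exact_mod_cast hq.2.trans hQQ'
  have h5 : 1 / (Q' : ℝ) = 1 / (2 * Q') + 1 / (2 * Q') := by field_simp; norm_num
  simp only [corner, Set.mem_Ioc]
  constructor <;> linarith

section
variable {s : ℕ} (k n : ℕ) (b : Fin s → ℤ) (c : Fin 2 → Fin s → ℤ)

lemma exists_major_approx (hkn : n < k) (hn : 1 ≤ n) (Φ : ℂ → ℂ)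
    (hlip : ∀ x y, ‖Φ x - Φ y‖ ≤ ‖x - y‖) (hmul : ∀ x y, Φ (x * y) = Φ x * Φ y)
    (hnat : ∀ N : ℕ, Φ N = N) :
    ∃ C : ℝ, 0 < C ∧ ∀ P Q : ℕ, 1 ≤ Q → 16 * Q ^ 3 < P →
      ‖(∫ α in major k n P Q, Φ (∏ j, fsum k n P b c j α)) -
        (P : ℂ) ^ s / (P : ℂ) ^ (k + 2 * n) * ((∑ r ∈ ratPts Q, Φ (sser k n b c r)) *
          ∫ θ in sbox Q, Φ (sint k n b c θ))‖ ≤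
        C * (Q : ℝ) ^ 9 / P * ((P : ℝ) ^ s / (P : ℝ) ^ (k + 2 * n)) := by
  obtain ⟨C, hC, happ⟩ := exists_prod_approx k n b c
  have hΦc : Continuous Φ := by
    refine (LipschitzWith.of_dist_le_mul (K := 1) fun x y => ?_).continuous
    rw [dist_eq_norm, dist_eq_norm, NNReal.coe_one, one_mul]
    exact hlip x y
  refine ⟨8 * C, by positivity, fun P Q hQ hP => ?_⟩
  have hP1 : 1 ≤ P := by omega
  have hPr : (0 : ℝ) < P := by exact_mod_cast hP1
  have hQr : (1 : ℝ) ≤ Q := by exact_mod_cast hQ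
  have hcont : Continuous fun α => Φ (∏ j, fsum k n P b c j α) :=
    hΦc.comp (continuous_finsetProd _ fun j _ => continuous_fsum k n b c P j)
  rw [major, integral_biUnion_finset _ (fun r _ => (isClosed_arc k n P Q (toR r)).measurableSet)
    (arc_disjoint hkn hn hQ hP) (fun r _ => by
      rw [← rescale_image k n hP1]
      exact hcont.continuousOn.integrableOn_compact
        ((isCompact_sbox Q).image (continuous_rescale k n P _)))]
  rw [sum_mul, mul_sum, ← sum_sub_distrib]
  have hr : ∀ r ∈ ratPts Q, ‖(∫ α in arc k n P Q (toR r), Φ (∏ j, fsum k n P b c j α)) -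
      (P : ℂ) ^ s / (P : ℂ) ^ (k + 2 * n) * (Φ (sser k n b c r) *
        ∫ θ in sbox Q, Φ (sint k n b c θ))‖ ≤
      ((P : ℝ) ^ (k + 2 * n))⁻¹ * (C * (Q * Q) * P ^ s / P * (2 * Q) ^ 3) := by
    intro r hr
    obtain ⟨q, hq, a, ha, hra⟩ := mem_ratPts.1 hr
    have hq0 : (q : ℚ) ≠ 0 := by exact_mod_cast (by omega : q ≠ 0)
    have e : (∫ α in arc k n P Q (toR r), Φ (∏ j, fsum k n P b c j α)) -
        (P : ℂ) ^ s / (P : ℂ) ^ (k + 2 * n) * (Φ (sser k n b c r) *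
          ∫ θ in sbox Q, Φ (sint k n b c θ)) =
        ((P : ℝ) ^ (k + 2 * n))⁻¹ • ∫ θ in sbox Q,
          (Φ (∏ j, fsum k n P b c j (rescale k n P (toR r) θ)) -
            Φ ((P ^ s : ℕ) * (sser k n b c r * sint k n b c θ))) := by
      have hc1 : Continuous fun θ => Φ (∏ j, fsum k n P b c j (rescale k n P (toR r) θ)) :=
        hcont.comp (continuous_rescale k n P (toR r))
      have hc2 : Continuous fun θ =>
          Φ ((P ^ s : ℕ) * (sser k n b c r * sint k n b c θ)) :=
        hΦc.comp (continuous_const.mul (continuous_const.mul (continuous_sint k n b c)))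
      rw [integral_arc k n hP1, integral_sub
        (hc1.continuousOn.integrableOn_compact (isCompact_sbox Q))
        (hc2.continuousOn.integrableOn_compact (isCompact_sbox Q))]
      simp only [hmul, hnat]
      rw [integral_const_mul, integral_const_mul, smul_sub]
      congr 1
      rw [Complex.real_smul]
      push_cast
      ring
    rw [e, norm_smul, Real.norm_of_nonneg (by positivity)]
    refine mul_le_mul_of_nonneg_left ?_ (by positivity)
    rw [← volume_sbox (by positivity : (0 : ℝ) ≤ Q)]
    refine norm_setIntegral_le_of_norm_le_const (isCompact_sbox Q).measure_lt_top fun θ hθ => ?_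
    refine (hlip _ _).trans ?_
    rw [le_div_iff₀ hPr, mul_comm _ (P : ℝ)]
    have := happ P q hP1 hq.1 r (fun i => a i) (fun i => by
      rw [hra i, mul_div_cancel₀ _ hq0]; simp) Q hQr θ hθ
    push_cast
    refine this.trans ?_
    have hqQ : (q : ℝ) ≤ Q := by exact_mod_cast hq.2
    gcongr
  refine (norm_sum_le _ _).trans ((sum_le_sum hr).trans ?_)
  rw [sum_const, nsmul_eq_mul]
  have hcard : ((ratPts Q).card : ℝ) ≤ Q ^ 4 := by exact_mod_cast card_ratPts_le Q
  calc _ ≤ (Q : ℝ) ^ 4 * (((P : ℝ) ^ (k + 2 * n))⁻¹ * (C * (Q * Q) * P ^ s / P * (2 * Q) ^ 3)) := by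
        gcongr
    _ = _ := by field_simp; ring

end

/-- The rational points of `(0, 1]³`. -/
def unitPts : Set (Fin 3 → ℚ) := {r | ∀ i, 0 < r i ∧ r i ≤ 1}

lemma exists_mem_ratPts {r : Fin 3 → ℚ} (hr : r ∈ unitPts) : ∃ Q, r ∈ ratPts Q := by
  obtain ⟨q, hq⟩ : ∃ q, q = (r 0).den * (r 1).den * (r 2).den := ⟨_, rfl⟩
  have hq1 : 1 ≤ q := by
    rw [hq]; exact Nat.mul_pos (Nat.mul_pos (r 0).den_pos (r 1).den_pos) (r 2).den_pos
  have hq0 : (0 : ℚ) < q := by exact_mod_cast hq1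
  have hd : ∀ i, ∃ a : ℤ, r i * q = a := by
    intro i
    have h0 : ((r i).den : ℤ) ∣ q := by
      rw [hq]; push_cast
      fin_cases i
      · exact (Dvd.intro _ rfl : _ ∣ _).mul_right _
      · exact (Dvd.intro_left _ rfl : _ ∣ _).mul_right _
      · exact Dvd.intro_left _ rfl
    obtain ⟨m, hm⟩ := h0
    refine ⟨(r i).num * m, ?_⟩
    have : (q : ℚ) = (r i).den * m := by exact_mod_cast hm
    rw [this, ← mul_assoc, Rat.mul_den_eq_num]; push_cast; rfl
  choose a ha using hd
  have ha0 : ∀ i, 0 < a i := fun i => by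
    have : (0 : ℚ) < a i := by rw [← ha i]; exact mul_pos (hr i).1 hq0
    exact_mod_cast this
  have haq : ∀ i, a i ≤ q := fun i => by
    have : (a i : ℚ) ≤ q := by rw [← ha i]; exact mul_le_of_le_one_left hq0.le (hr i).2
    exact_mod_cast this
  refine ⟨q, mem_ratPts.2 ⟨q, ⟨hq1, le_rfl⟩, fun i => (a i).toNat, fun i => ?_, fun i => ?_⟩⟩
  · have := ha0 i; have := haq i; dsimp only; omega
  · rw [eq_div_iff hq0.ne', ha i]
    have : (((a i).toNat : ℤ) : ℚ) = a i := by rw [Int.toNat_of_nonneg (ha0 i).le]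
    rw [Int.cast_natCast] at this; exact this.symm

lemma mem_unitPts_of_mem_ratPts {Q : ℕ} {r : Fin 3 → ℚ} (hr : r ∈ ratPts Q) : r ∈ unitPts := by
  obtain ⟨q, hq, a, ha, hra⟩ := mem_ratPts.1 hr
  intro i
  have hq0 : (0 : ℚ) < q := by exact_mod_cast hq.1
  rw [hra i]
  refine ⟨div_pos (by exact_mod_cast (ha i).1) hq0, ?_⟩
  rw [div_le_one hq0]
  exact_mod_cast (ha i).2

lemma exists_subset_ratPts (u : Finset (Fin 3 → ℚ)) (hu : ∀ r ∈ u, r ∈ unitPts) :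
    ∃ Q, 1 ≤ Q ∧ u ⊆ ratPts Q := by
  induction u using Finset.induction_on with
  | empty => exact ⟨1, le_rfl, by simp⟩
  | insert a u _ ih =>
    obtain ⟨Q, hQ, h⟩ := ih fun r hr => hu r (mem_insert_of_mem hr)
    obtain ⟨Q', hQ'⟩ := exists_mem_ratPts (hu a (mem_insert_self _ _))
    refine ⟨max Q Q', hQ.trans (le_max_left _ _), insert_subset ?_ ?_⟩
    · exact ratPts_mono (le_max_right _ _) hQ'
    · exact h.trans (ratPts_mono (le_max_left _ _))

section
variable {s : ℕ} (k n : ℕ) (b : Fin s → ℤ) (c : Fin 2 → Fin s → ℤ)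

/-- The truncated absolute singular series times the truncated absolute singular integral. -/
noncomputable def absTrunc (Q : ℕ) : ℝ :=
  (∑ r ∈ ratPts Q, ‖sser k n b c r‖) * ∫ θ in sbox Q, ‖sint k n b c θ‖

lemma exists_abs_major_approx (hkn : n < k) (hn : 1 ≤ n) :
    ∃ C : ℝ, 0 < C ∧ ∀ P Q : ℕ, 1 ≤ Q → 16 * Q ^ 3 < P →
      |(∫ α in major k n P Q, ∏ j, ‖fsum k n P b c j α‖) -
        (P : ℝ) ^ s / (P : ℝ) ^ (k + 2 * n) * absTrunc k n b c Q| ≤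
        C * (Q : ℝ) ^ 9 / P * ((P : ℝ) ^ s / (P : ℝ) ^ (k + 2 * n)) := by
  obtain ⟨C, hC, h⟩ := exists_major_approx k n b c hkn hn (fun z => ((‖z‖ : ℝ) : ℂ))
    (fun x y => by
      rw [← Complex.ofReal_sub, Complex.norm_real]
      exact abs_norm_sub_norm_le x y)
    (fun x y => by rw [norm_mul]; push_cast; rfl) (fun N => by rw [Complex.norm_natCast]; simp)
  refine ⟨C, hC, fun P Q hQ hP => ?_⟩
  have := h P Q hQ hP
  simp only [integral_complex_ofReal, norm_prod] at this
  rw [← Real.norm_eq_abs, ← Complex.norm_real]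
  refine le_trans (le_of_eq ?_) this
  congr 1
  rw [absTrunc]
  push_cast
  rfl

lemma integrableOn_sint (Q : ℝ) : IntegrableOn (sint k n b c) (sbox Q) :=
  (continuous_sint k n b c).continuousOn.integrableOn_compact (isCompact_sbox Q)

lemma sbox_mono {Q Q' : ℝ} (h : Q ≤ Q') : sbox Q ⊆ sbox Q' := fun _ hθ i => (hθ i).trans h

lemma integral_sbox_mono {Q Q' : ℝ} (h : Q ≤ Q') :
    ∫ θ in sbox Q, ‖sint k n b c θ‖ ≤ ∫ θ in sbox Q', ‖sint k n b c θ‖ :=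
  setIntegral_mono_set (integrableOn_sint k n b c Q').norm (ae_of_all _ fun _ => norm_nonneg _)
    (sbox_mono h).eventuallyLE

lemma sum_ratPts_mono {Q Q' : ℕ} (h : Q ≤ Q') :
    ∑ r ∈ ratPts Q, ‖sser k n b c r‖ ≤ ∑ r ∈ ratPts Q', ‖sser k n b c r‖ :=
  sum_le_sum_of_subset_of_nonneg (ratPts_mono h) fun _ _ _ => norm_nonneg _

lemma absTrunc_mono {Q Q' : ℕ} (h : Q ≤ Q') : absTrunc k n b c Q ≤ absTrunc k n b c Q' :=
  mul_le_mul (sum_ratPts_mono k n b c h) (integral_sbox_mono k n b c (by exact_mod_cast h))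
    (integral_nonneg fun _ => norm_nonneg _) (sum_nonneg fun _ _ => norm_nonneg _)

lemma rpow_eq_pow_div {P : ℕ} (hP : 1 ≤ P) :
    (P : ℝ) ^ ((s : ℝ) - k - 2 * n) = (P : ℝ) ^ s / (P : ℝ) ^ (k + 2 * n) := by
  have hPr : (0 : ℝ) < P := by exact_mod_cast hP
  have : (s : ℝ) - k - 2 * n = (s : ℝ) - ((k + 2 * n : ℕ) : ℝ) := by push_cast; ring
  rw [this, Real.rpow_sub hPr, Real.rpow_natCast, Real.rpow_natCast]

lemma exists_absTrunc_step (hkn : n < k) (hn : 1 ≤ n) (hb0 : ∀ j, b j ≠ 0)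
    (hminor : ∀ j₁ j₂ : Fin s, j₁ ≠ j₂ → c 0 j₁ * c 1 j₂ - c 0 j₂ * c 1 j₁ ≠ 0)
    (hs : 2 * rr k + 2 * rr n + 1 ≤ s) :
    ∃ δ : ℝ, 0 < δ ∧ ∃ C : ℝ, 0 < C ∧ ∃ Q₀ : ℕ, 1 ≤ Q₀ ∧ ∀ Q : ℕ, Q₀ ≤ Q →
      absTrunc k n b c (2 * Q) ≤ absTrunc k n b c Q + C * (1 / (Q : ℝ) + (Q : ℝ) ^ (-δ)) := by
  obtain ⟨C₁, hC₁, hmaj⟩ := exists_abs_major_approx k n b c hkn hn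
  obtain ⟨δ, hδ, C₂, hC₂, Q₀, hQ₀, hmin⟩ := minor_bound k n b c hkn hn hb0 hminor hs
    (η := 1 / 20) (by norm_num)
  refine ⟨δ, hδ, 513 * C₁ + C₂, by positivity, max Q₀ 2, le_max_of_le_right (by norm_num),
    fun Q hQ => ?_⟩
  have hQ0 : Q₀ ≤ Q := (le_max_left _ _).trans hQ
  have hQ2 : 2 ≤ Q := (le_max_right _ _).trans hQ
  have hQr : (0 : ℝ) < Q := by exact_mod_cast (by omega : 0 < Q)
  obtain ⟨P, hP⟩ : ∃ P, P = 129 * Q ^ 10 := ⟨_, rfl⟩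
  have hQ10 : Q ^ 3 ≤ Q ^ 10 := Nat.pow_le_pow_right (by omega) (by norm_num)
  have hQ3 : 1 ≤ Q ^ 3 := Nat.one_le_pow _ _ (by omega)
  have hP2 : 16 * (2 * Q) ^ 3 < P := by rw [hP, mul_pow]; omega
  have hP1 : 16 * Q ^ 3 < P := by omega
  have hPr : (0 : ℝ) < P := by exact_mod_cast (by omega : 0 < P)
  have hPη : (P : ℝ) ^ (1 / 20 : ℝ) ≤ Q := by
    have h1 : P ≤ Q ^ 20 := by
      have : 2 ^ 10 ≤ Q ^ 10 := Nat.pow_le_pow_left hQ2 10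
      rw [hP, show Q ^ 20 = Q ^ 10 * Q ^ 10 by ring]
      exact Nat.mul_le_mul_right _ (by omega)
    have h2 : (P : ℝ) ≤ (Q : ℝ) ^ 20 := by exact_mod_cast h1
    calc (P : ℝ) ^ (1 / 20 : ℝ) ≤ ((Q : ℝ) ^ 20) ^ (1 / 20 : ℝ) := by gcongr
      _ = Q := by
        rw [← Real.rpow_natCast, ← Real.rpow_mul hQr.le]; norm_num
  obtain ⟨X, hX⟩ : ∃ X, X = (P : ℝ) ^ s / (P : ℝ) ^ (k + 2 * n) := ⟨_, rfl⟩
  have hX0 : 0 < X := by rw [hX]; positivity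
  have hmin' := hmin P Q (2 * Q) hQ0 (by omega) le_rfl hP1 hPη
  have hmaj1 := abs_le.1 (hmaj P Q (by omega) hP1)
  have hmaj2 := abs_le.1 (hmaj P (2 * Q) (by omega) hP2)
  rw [rpow_eq_pow_div k n (by omega)] at hmin'
  rw [← hX] at hmin' hmaj1 hmaj2
  have hcont : Continuous fun α => ∏ j, ‖fsum k n P b c j α‖ :=
    continuous_finsetProd _ fun j _ => (continuous_fsum k n b c P j).norm
  have hI := integrableOn_cube hcont (corner (2 * Q))
  have hsub1 := major_subset_cube hkn hn (by omega : 1 ≤ Q) (by omega : Q ≤ 2 * Q) le_rfl hP1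
  have hsub2 := major_subset_cube hkn hn (by omega : 1 ≤ 2 * Q) le_rfl (by omega) hP2
  have h1 : ∫ α in major k n P (2 * Q), ∏ j, ‖fsum k n P b c j α‖ ≤
      ∫ α in cube (corner (2 * Q)), ∏ j, ‖fsum k n P b c j α‖ :=
    setIntegral_mono_set hI (ae_of_all _ fun _ => prod_nonneg fun _ _ => norm_nonneg _)
      hsub2.eventuallyLE
  have h2 := integral_inter_add_sdiff (μ := volume) (measurableSet_major k n P Q) hI
  rw [Set.inter_eq_right.2 hsub1] at h2
  have h3 : C₁ * (Q : ℝ) ^ 9 / P ≤ C₁ * (1 / Q) := by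
    rw [hP, mul_div_assoc]
    refine mul_le_mul_of_nonneg_left ?_ hC₁.le
    rw [div_le_div_iff₀ (by positivity) hQr]
    push_cast
    have : (0 : ℝ) < (Q : ℝ) ^ 10 := by positivity
    nlinarith
  have h4 : C₁ * ((2 * Q : ℕ) : ℝ) ^ 9 / P ≤ 512 * (C₁ * (1 / Q)) := by
    calc _ = 512 * (C₁ * (Q : ℝ) ^ 9 / P) := by push_cast; ring
      _ ≤ _ := by linarith
  have h5 := mul_le_mul_of_nonneg_right h3 hX0.le
  have h6 := mul_le_mul_of_nonneg_right h4 hX0.le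
  refine le_of_mul_le_mul_left ?_ hX0
  have h7 : X * (absTrunc k n b c Q + (513 * C₁ + C₂) * (1 / (Q : ℝ) + (Q : ℝ) ^ (-δ))) =
      X * absTrunc k n b c Q + C₁ * (1 / Q) * X + 512 * (C₁ * (1 / Q)) * X +
        C₂ * X * (Q : ℝ) ^ (-δ) + (C₂ * (1 / Q) * X + 513 * C₁ * (Q : ℝ) ^ (-δ) * X) := by ring
  have h8 : 0 ≤ C₂ * (1 / Q) * X + 513 * C₁ * (Q : ℝ) ^ (-δ) * X := by positivity
  rw [h7]
  linarith [hmaj1.2, hmaj2.1]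

lemma exists_absTrunc_le (hkn : n < k) (hn : 1 ≤ n) (hb0 : ∀ j, b j ≠ 0)
    (hminor : ∀ j₁ j₂ : Fin s, j₁ ≠ j₂ → c 0 j₁ * c 1 j₂ - c 0 j₂ * c 1 j₁ ≠ 0)
    (hs : 2 * rr k + 2 * rr n + 1 ≤ s) : ∃ B : ℝ, ∀ Q, absTrunc k n b c Q ≤ B := by
  obtain ⟨δ, hδ, C, hC, Q₀, hQ₀, hstep⟩ := exists_absTrunc_step k n b c hkn hn hb0 hminor hs
  obtain ⟨ρ, hρ⟩ : ∃ ρ : ℝ, ρ = (2 : ℝ) ^ (-δ) := ⟨_, rfl⟩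
  have hρ0 : 0 < ρ := by rw [hρ]; positivity
  have hρ1 : ρ < 1 := by
    rw [hρ]; exact Real.rpow_lt_one_of_one_lt_of_neg (by norm_num) (by linarith)
  have hg : ∀ {x : ℝ}, 0 < x → x < 1 → ∀ m : ℕ, ∑ i ∈ range m, x ^ i ≤ 1 / (1 - x) := by
    intro x hx hx1 m
    rw [geom_sum_eq hx1.ne, ← neg_div_neg_eq, neg_sub, neg_sub]
    refine div_le_div_of_nonneg_right ?_ (by linarith)
    have := pow_pos hx m
    linarith
  have hQ₀r : (1 : ℝ) ≤ Q₀ := by exact_mod_cast hQ₀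
  have hind : ∀ m : ℕ, absTrunc k n b c (Q₀ * 2 ^ m) ≤ absTrunc k n b c Q₀ +
      C * (∑ i ∈ range m, (1 / 2 : ℝ) ^ i + ∑ i ∈ range m, ρ ^ i) := by
    intro m
    induction m with
    | zero => simp
    | succ m ih =>
      have h1 := hstep (Q₀ * 2 ^ m) (Nat.le_mul_of_pos_right _ (by positivity))
      rw [show 2 * (Q₀ * 2 ^ m) = Q₀ * 2 ^ (m + 1) by ring] at h1
      have hle : (2 : ℝ) ^ m ≤ ((Q₀ * 2 ^ m : ℕ) : ℝ) := by
        push_cast; exact le_mul_of_one_le_left (by positivity) hQ₀r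
      have h2 : 1 / ((Q₀ * 2 ^ m : ℕ) : ℝ) ≤ (1 / 2) ^ m := by
        rw [one_div_pow]; gcongr
      have h3 : ((Q₀ * 2 ^ m : ℕ) : ℝ) ^ (-δ) ≤ ρ ^ m := by
        calc _ ≤ ((2 : ℝ) ^ m) ^ (-δ) :=
              Real.rpow_le_rpow_of_nonpos (by positivity) hle (by linarith)
          _ = ρ ^ m := by
              rw [hρ, ← Real.rpow_natCast, ← Real.rpow_natCast, ← Real.rpow_mul (by norm_num),
                ← Real.rpow_mul (by norm_num), mul_comm]
      rw [sum_range_succ, sum_range_succ]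
      have h4 : C * (1 / ((Q₀ * 2 ^ m : ℕ) : ℝ) + ((Q₀ * 2 ^ m : ℕ) : ℝ) ^ (-δ)) ≤
        C * ((1 / 2) ^ m + ρ ^ m) := mul_le_mul_of_nonneg_left (add_le_add h2 h3) hC.le
      linarith
  refine ⟨absTrunc k n b c Q₀ + C * (1 / (1 - 1 / 2) + 1 / (1 - ρ)), fun Q => ?_⟩
  have hQ : Q ≤ Q₀ * 2 ^ Q :=
    Nat.lt_two_pow_self.le.trans (Nat.le_mul_of_pos_left _ hQ₀)
  refine (absTrunc_mono k n b c hQ).trans ((hind Q).trans ?_)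
  have := mul_le_mul_of_nonneg_left (add_le_add (hg (x := 1 / 2) (by norm_num) (by norm_num) Q)
    (hg hρ0 hρ1 Q)) hC.le
  linarith

lemma gauss_int (u v : ℤ) : gauss k n u v = 1 := by
  rw [gauss_eq k n (q := 1) le_rfl (a := u) (a' := v) (by simp) (by simp), avg]
  simp [phase]
  have : ((u : ℝ) * 0 ^ k + v * 0 ^ n) = ((u * 0 ^ k + v * 0 ^ n : ℤ) : ℝ) := by push_cast; rfl
  rw [this, ee_int]

lemma sser_one : sser k n b c (fun _ => 1) = 1 := by
  rw [sser]
  refine prod_eq_one fun j _ => ?_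
  have := gauss_int k n (b j) (c 0 j + c 1 j)
  push_cast at this
  simpa using this

lemma sint_zero : sint k n b c 0 = 1 := by
  rw [sint]
  refine prod_eq_one fun j _ => ?_
  simp [osc, ee_zero]

lemma integral_sbox_one_pos : 0 < ∫ θ in sbox 1, ‖sint k n b c θ‖ := by
  rw [setIntegral_pos_iff_support_of_nonneg_ae (ae_of_all _ fun _ => norm_nonneg _)
    (integrableOn_sint k n b c 1).norm]
  have hopen : IsOpen (Function.support (fun θ => ‖sint k n b c θ‖) ∩ interior (sbox 1)) :=
    (continuous_sint k n b c).norm.isOpen_support.inter isOpen_interior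
  refine lt_of_lt_of_le (hopen.measure_pos volume ⟨0, ?_, ?_⟩)
    (measure_mono (Set.inter_subset_inter_right _ interior_subset))
  · rw [Function.mem_support, sint_zero]; simp
  · rw [sbox_eq, ← Set.pi_univ_Icc, interior_pi_set Set.finite_univ]
    intro i _
    rw [interior_Icc]; simp

theorem summable_sser (hkn : n < k) (hn : 1 ≤ n) (hb0 : ∀ j, b j ≠ 0)
    (hminor : ∀ j₁ j₂ : Fin s, j₁ ≠ j₂ → c 0 j₁ * c 1 j₂ - c 0 j₂ * c 1 j₁ ≠ 0)
    (hs : 2 * rr k + 2 * rr n + 1 ≤ s) :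
    Summable (unitPts.indicator fun r => ‖sser k n b c r‖) := by
  obtain ⟨B, hB⟩ := exists_absTrunc_le k n b c hkn hn hb0 hminor hs
  have hJ := integral_sbox_one_pos k n b c
  refine summable_of_sum_le (c := B / ∫ θ in sbox 1, ‖sint k n b c θ‖)
    (fun r => Set.indicator_nonneg (fun _ _ => norm_nonneg _) r) fun u => ?_
  classical
  have h1 : ∑ r ∈ u, unitPts.indicator (fun r => ‖sser k n b c r‖) r =
      ∑ r ∈ u with r ∈ unitPts, ‖sser k n b c r‖ := by
    rw [sum_filter]; rfl
  obtain ⟨Q, hQ, hsub⟩ := exists_subset_ratPts (u.filter (· ∈ unitPts))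
    fun r hr => (mem_filter.1 hr).2
  rw [h1, le_div_iff₀ hJ]
  refine le_trans ?_ (hB Q)
  exact mul_le_mul (sum_le_sum_of_subset_of_nonneg hsub fun _ _ _ => norm_nonneg _)
    (integral_sbox_mono k n b c (by exact_mod_cast hQ)) hJ.le
    (sum_nonneg fun _ _ => norm_nonneg _)

lemma aecover_sbox : AECover (volume : Measure (Fin 3 → ℝ)) Filter.atTop fun Q : ℕ => sbox Q where
  ae_eventually_mem := ae_of_all _ fun θ => by
    obtain ⟨Q, hQ⟩ := exists_nat_ge (∑ i, |θ i|)
    filter_upwards [Filter.eventually_ge_atTop Q] with Q' hQ' i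
    refine (single_le_sum (f := fun i => |θ i|) (fun _ _ => abs_nonneg _) (mem_univ i)).trans
      (hQ.trans ?_)
    exact_mod_cast hQ'
  measurableSet := fun Q => measurableSet_sbox Q

theorem integrable_sint (hkn : n < k) (hn : 1 ≤ n) (hb0 : ∀ j, b j ≠ 0)
    (hminor : ∀ j₁ j₂ : Fin s, j₁ ≠ j₂ → c 0 j₁ * c 1 j₂ - c 0 j₂ * c 1 j₁ ≠ 0)
    (hs : 2 * rr k + 2 * rr n + 1 ≤ s) : Integrable (sint k n b c) := by
  obtain ⟨B, hB⟩ := exists_absTrunc_le k n b c hkn hn hb0 hminor hs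
  refine aecover_sbox.integrable_of_integral_norm_bounded B
    (fun Q => integrableOn_sint k n b c Q) ?_
  filter_upwards [Filter.eventually_ge_atTop 1] with Q hQ
  refine le_trans ?_ (hB Q)
  refine le_mul_of_one_le_left (integral_nonneg fun _ => norm_nonneg _) ?_
  have hmem : (fun _ => 1 : Fin 3 → ℚ) ∈ ratPts Q :=
    mem_ratPts.2 ⟨1, ⟨le_rfl, hQ⟩, fun _ => 1, fun _ => ⟨le_rfl, le_rfl⟩, fun _ => by simp⟩
  have := single_le_sum (f := fun r => ‖sser k n b c r‖) (fun _ _ => norm_nonneg _) hmem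
  simpa [sser_one] using this

end

section
variable {s : ℕ} (k n : ℕ) (b : Fin s → ℤ) (c : Fin 2 → Fin s → ℤ)

/-- The number of solutions of the system with `1 ≤ x_j ≤ P`. -/
noncomputable def solCount (P : ℕ) : ℕ :=
  Nat.card {x : Fin s → ℕ // (∀ j, 1 ≤ x j ∧ x j ≤ P) ∧
    (∑ j, b j * (x j : ℤ) ^ k = 0) ∧ (∀ i : Fin 2, ∑ j, c i j * (x j : ℤ) ^ n = 0)}

/-- The values of the three forms at an integer point. -/
def forms (x : Fin s → ℤ) : Fin 3 → ℤ :=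
  ![∑ j, b j * x j ^ k, ∑ j, c 0 j * x j ^ n, ∑ j, c 1 j * x j ^ n]

lemma forms_eq_zero {x : Fin s → ℤ} : forms k n b c x = 0 ↔
    ∑ j, b j * x j ^ k = 0 ∧ ∀ i : Fin 2, ∑ j, c i j * x j ^ n = 0 := by
  simp [forms, funext_iff, Fin.forall_fin_succ]

lemma solCount_eq (P : ℕ) : solCount k n b c P =
    #{x ∈ Fintype.piFinset fun _ : Fin s => Icc (1 : ℤ) P | forms k n b c x = 0} := by
  classical
  rw [solCount, Nat.subtype_card ((Fintype.piFinset fun _ : Fin s => Icc 1 P).filter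
    fun x => forms k n b c (fun j => (x j : ℤ)) = 0)]
  · refine card_bij (fun x _ j => (x j : ℤ)) ?_ ?_ ?_
    · intro x hx
      simp only [mem_filter, Fintype.mem_piFinset, mem_Icc] at hx ⊢
      exact ⟨fun j => ⟨by exact_mod_cast (hx.1 j).1, by exact_mod_cast (hx.1 j).2⟩, hx.2⟩
    · intro x _ y _ h
      funext j
      exact_mod_cast congrFun h j
    · intro x hx
      simp only [mem_filter, Fintype.mem_piFinset, mem_Icc] at hx
      have hcast : (fun j => ((x j).toNat : ℤ)) = x :=
        funext fun j => Int.toNat_of_nonneg (by have := hx.1 j; omega)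
      refine ⟨fun j => (x j).toNat, ?_, hcast⟩
      simp only [mem_filter, Fintype.mem_piFinset, mem_Icc, hcast]
      exact ⟨fun j => by have := hx.1 j; omega, hx.2⟩
  · intro x
    simp only [mem_filter, Fintype.mem_piFinset, mem_Icc, forms_eq_zero]

lemma dot_forms (α : Fin 3 → ℝ) (x : Fin s → ℤ) : ∑ i, α i * forms k n b c x i =
    ∑ j, (b j * α 0 * (x j : ℝ) ^ k + (c 0 j * α 1 + c 1 j * α 2) * (x j : ℝ) ^ n) := by
  simp only [Fin.sum_univ_three, forms, Matrix.cons_val_zero, Matrix.cons_val_one,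
    Matrix.cons_val_two, Matrix.tail_cons, Matrix.head_cons]
  push_cast
  rw [mul_sum, mul_sum, mul_sum, ← sum_add_distrib, ← sum_add_distrib]
  exact sum_congr rfl fun j _ => by ring

lemma integral_prod_fsum (u : Fin 3 → ℝ) (P : ℕ) :
    ∫ α in cube u, ∏ j, fsum k n P b c j α = solCount k n b c P := by
  rw [solCount_eq, ← integral_cube_sum_ee]
  congr 1
  funext α
  simp only [fsum, weyl]
  rw [prod_univ_sum]
  refine sum_congr rfl fun x _ => ?_
  rw [dot_forms, ee_sum]

end

/-- Sums over finite sets that exhaust the support of a summable family converge. -/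
lemma tendsto_sum_of_exhaust {α β : Type*} {f : α → ℂ} {S : Set α}
    (hf : Summable (S.indicator fun r => ‖f r‖)) {R : β → Finset α} {l : Filter β}
    (hsub : ∀ W, ∀ r ∈ R W, r ∈ S) (hev : ∀ r ∈ S, ∀ᶠ W in l, r ∈ R W) :
    Filter.Tendsto (fun W => ∑ r ∈ R W, f r) l (nhds (∑' r, S.indicator f r)) := by
  classical
  have h := tendsto_tsum_of_dominated_convergence (𝓕 := l)
    (f := fun W r => (R W : Set α).indicator f r) (g := S.indicator f) hf ?_ ?_
  · refine h.congr fun W => ?_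
    rw [tsum_eq_sum (s := R W) fun r hr => Set.indicator_of_notMem (by simpa using hr) _]
    exact sum_congr rfl fun r hr => Set.indicator_of_mem (by simpa using hr) _
  · intro r
    by_cases hr : r ∈ S
    · refine tendsto_const_nhds.congr' ?_
      filter_upwards [hev r hr] with W hW
      rw [Set.indicator_of_mem hr, Set.indicator_of_mem (by simpa using hW)]
    · refine tendsto_const_nhds.congr fun W => ?_
      rw [Set.indicator_of_notMem hr, Set.indicator_of_notMem fun h => hr (hsub W r (by simpa using h))]
  · refine Filter.Eventually.of_forall fun W r => ?_
    by_cases hr : r ∈ R W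
    · rw [Set.indicator_of_mem (by simpa using hr), Set.indicator_of_mem (hsub W r hr)]
    · rw [Set.indicator_of_notMem (by simpa using hr), norm_zero]
      exact Set.indicator_nonneg (fun _ _ => norm_nonneg _) r

lemma exists_cutoff : ∃ Q : ℕ → ℕ, Filter.Tendsto Q Filter.atTop Filter.atTop ∧
    ∀ P : ℕ, 1 ≤ P → (P : ℝ) ^ (1 / 20 : ℝ) ≤ Q P ∧ (Q P : ℝ) ^ 20 ≤ 2 ^ 20 * P := by
  refine ⟨fun P : ℕ => ⌈(P : ℝ) ^ (1 / 20 : ℝ)⌉₊, ?_, fun P hP => ⟨Nat.le_ceil _, ?_⟩⟩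
  · exact tendsto_nat_ceil_atTop.comp
      ((tendsto_rpow_atTop (by norm_num)).comp tendsto_natCast_atTop_atTop)
  · have hP1 : (1 : ℝ) ≤ P := by exact_mod_cast hP
    have h1 : (1 : ℝ) ≤ (P : ℝ) ^ (1 / 20 : ℝ) := Real.one_le_rpow hP1 (by norm_num)
    have h2 : (⌈(P : ℝ) ^ (1 / 20 : ℝ)⌉₊ : ℝ) ≤ 2 * (P : ℝ) ^ (1 / 20 : ℝ) := by
      have := (Nat.ceil_lt_add_one (by positivity : (0 : ℝ) ≤ (P : ℝ) ^ (1 / 20 : ℝ))).le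
      linarith
    show (⌈(P : ℝ) ^ (1 / 20 : ℝ)⌉₊ : ℝ) ^ 20 ≤ 2 ^ 20 * (P : ℝ)
    calc (⌈(P : ℝ) ^ (1 / 20 : ℝ)⌉₊ : ℝ) ^ 20 ≤ (2 * (P : ℝ) ^ (1 / 20 : ℝ)) ^ 20 := by gcongr
      _ = 2 ^ 20 * (P : ℝ) := by
        rw [mul_pow, ← Real.rpow_natCast ((P : ℝ) ^ (1 / 20 : ℝ)), ← Real.rpow_mul (by linarith)]
        norm_num

section
variable {s : ℕ} (k n : ℕ) (b : Fin s → ℤ) (c : Fin 2 → Fin s → ℤ)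

lemma exists_solCount_approx (hkn : n < k) (hn : 1 ≤ n) (hb0 : ∀ j, b j ≠ 0)
    (hminor : ∀ j₁ j₂ : Fin s, j₁ ≠ j₂ → c 0 j₁ * c 1 j₂ - c 0 j₂ * c 1 j₁ ≠ 0)
    (hs : 2 * rr k + 2 * rr n + 1 ≤ s) :
    ∃ δ : ℝ, 0 < δ ∧ ∃ C : ℝ, 0 < C ∧ ∃ Q₀ : ℕ, 3 ≤ Q₀ ∧ ∀ P Q : ℕ, Q₀ ≤ Q →
      1 ≤ P → (P : ℝ) ^ (1 / 20 : ℝ) ≤ Q → (Q : ℝ) ^ 20 ≤ 2 ^ 20 * P →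
      ‖(solCount k n b c P : ℂ) / ((P : ℂ) ^ s / (P : ℂ) ^ (k + 2 * n)) -
        (∑ r ∈ ratPts Q, sser k n b c r) * ∫ θ in sbox Q, sint k n b c θ‖ ≤
          C * (1 / (Q : ℝ) + (Q : ℝ) ^ (-δ)) := by
  obtain ⟨C₁, hC₁, hmaj⟩ := exists_major_approx k n b c hkn hn id (fun _ _ => le_rfl)
    (fun _ _ => rfl) (fun _ => rfl)
  obtain ⟨δ, hδ, C₂, hC₂, Q₀, hQ₀, hmin⟩ := minor_bound k n b c hkn hn hb0 hminor hs
    (η := 1 / 20) (by norm_num)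
  refine ⟨δ, hδ, 2 ^ 20 * C₁ + C₂, by positivity, max Q₀ 3, le_max_right _ _,
    fun P Q hQ hP hPQ hQP => ?_⟩
  have hQ0 : Q₀ ≤ Q := (le_max_left _ _).trans hQ
  have hQ3 : 3 ≤ Q := (le_max_right _ _).trans hQ
  have hQr : (3 : ℝ) ≤ Q := by exact_mod_cast hQ3
  have hPr : (0 : ℝ) < P := by exact_mod_cast hP
  have hP1 : 16 * Q ^ 3 < P := by
    have h1 : (3 : ℝ) ^ 17 ≤ (Q : ℝ) ^ 17 := by gcongr
    have h2 : (0 : ℝ) < (Q : ℝ) ^ 3 := by positivity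
    have h3 : (Q : ℝ) ^ 20 = (Q : ℝ) ^ 17 * (Q : ℝ) ^ 3 := by ring
    have h4 := mul_le_mul_of_nonneg_right h1 h2.le
    have : (16 : ℝ) * (Q : ℝ) ^ 3 < P := by nlinarith
    exact_mod_cast this
  obtain ⟨X, hX⟩ : ∃ X, X = (P : ℝ) ^ s / (P : ℝ) ^ (k + 2 * n) := ⟨_, rfl⟩
  have hX0 : 0 < X := by rw [hX]; positivity
  have hXc : (X : ℂ) = (P : ℂ) ^ s / (P : ℂ) ^ (k + 2 * n) := by rw [hX]; push_cast; rfl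
  have hXc0 : (X : ℂ) ≠ 0 := by exact_mod_cast hX0.ne'
  have hmin' := hmin P Q Q hQ0 le_rfl (by omega) hP1 hPQ
  have hmaj' := hmaj P Q (by omega) hP1
  rw [rpow_eq_pow_div k n hP] at hmin'
  rw [← hX] at hmin' hmaj'
  rw [← hXc] at hmaj' ⊢
  simp only [id] at hmaj'
  have hcont : Continuous fun α => ∏ j, fsum k n P b c j α :=
    continuous_finsetProd _ fun j _ => continuous_fsum k n b c P j
  have hI := integrableOn_cube hcont (corner Q)
  have hsub := major_subset_cube hkn hn (by omega : 1 ≤ Q) le_rfl (by omega) hP1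
  have h2 := integral_inter_add_sdiff (μ := volume) (measurableSet_major k n P Q) hI
  rw [Set.inter_eq_right.2 hsub, integral_prod_fsum] at h2
  have h3 : ‖∫ α in cube (corner Q) \ major k n P Q, ∏ j, fsum k n P b c j α‖ ≤
      C₂ * X * (Q : ℝ) ^ (-δ) := by
    refine (norm_integral_le_integral_norm _).trans ?_
    simpa only [norm_prod] using hmin'
  obtain ⟨M, hM⟩ : ∃ M, M = (∑ r ∈ ratPts Q, sser k n b c r) * ∫ θ in sbox Q, sint k n b c θ :=
    ⟨_, rfl⟩
  rw [← hM] at hmaj' ⊢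
  have h4 : C₁ * (Q : ℝ) ^ 9 / P ≤ 2 ^ 20 * C₁ * (1 / Q) := by
    rw [mul_one_div, div_le_div_iff₀ hPr (by linarith)]
    have h5 : (Q : ℝ) ^ 10 ≤ 2 ^ 20 * P :=
      le_trans (pow_le_pow_right₀ (by linarith) (by norm_num)) hQP
    calc C₁ * (Q : ℝ) ^ 9 * Q = C₁ * (Q : ℝ) ^ 10 := by ring
      _ ≤ C₁ * (2 ^ 20 * P) := by gcongr
      _ = _ := by ring
  have h6 : (solCount k n b c P : ℂ) / X - M =
      ((solCount k n b c P : ℂ) - X * M) / X := by field_simp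
  rw [h6, norm_div, Complex.norm_real, Real.norm_of_nonneg hX0.le, div_le_iff₀ hX0, ← h2]
  calc _ = ‖((∫ α in major k n P Q, ∏ j, fsum k n P b c j α) - X * M) +
        ∫ α in cube (corner Q) \ major k n P Q, ∏ j, fsum k n P b c j α‖ := by congr 1; ring
    _ ≤ C₁ * (Q : ℝ) ^ 9 / P * X + C₂ * X * (Q : ℝ) ^ (-δ) :=
      (norm_add_le _ _).trans (add_le_add hmaj' h3)
    _ ≤ 2 ^ 20 * C₁ * (1 / Q) * X + C₂ * X * (Q : ℝ) ^ (-δ) := by gcongr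
    _ ≤ 2 ^ 20 * C₁ * (1 / Q) * X + C₂ * X * (Q : ℝ) ^ (-δ) +
        (C₂ * (1 / Q) * X + 2 ^ 20 * C₁ * (Q : ℝ) ^ (-δ) * X) :=
      le_add_of_nonneg_right (by positivity)
    _ = _ := by ring

theorem tendsto_solCount (hkn : n < k) (hn : 1 ≤ n) (hb0 : ∀ j, b j ≠ 0)
    (hminor : ∀ j₁ j₂ : Fin s, j₁ ≠ j₂ → c 0 j₁ * c 1 j₂ - c 0 j₂ * c 1 j₁ ≠ 0)
    (hs : 2 * rr k + 2 * rr n + 1 ≤ s) :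
    Filter.Tendsto
      (fun P : ℕ => (solCount k n b c P : ℂ) / ((P : ℂ) ^ s / (P : ℂ) ^ (k + 2 * n)))
      Filter.atTop
      (nhds ((∑' r, unitPts.indicator (sser k n b c) r) * ∫ θ, sint k n b c θ)) := by
  obtain ⟨δ, hδ, C, hC, Q₀, hQ₀, happrox⟩ := exists_solCount_approx k n b c hkn hn hb0 hminor hs
  obtain ⟨Q, hQ, hQP⟩ := exists_cutoff
  have hQr : Filter.Tendsto (fun P => (Q P : ℝ)) Filter.atTop Filter.atTop :=
    tendsto_natCast_atTop_atTop.comp hQ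
  have herr : Filter.Tendsto (fun P => C * (1 / (Q P : ℝ) + (Q P : ℝ) ^ (-δ))) Filter.atTop
      (nhds 0) := by
    have h1 : Filter.Tendsto (fun P => 1 / (Q P : ℝ)) Filter.atTop (nhds 0) :=
      tendsto_const_nhds.div_atTop hQr
    have h2 := (tendsto_rpow_neg_atTop hδ).comp hQr
    simpa using (h1.add h2).const_mul C
  have h1 : Filter.Tendsto (fun P => ∑ r ∈ ratPts (Q P), sser k n b c r) Filter.atTop
      (nhds (∑' r, unitPts.indicator (sser k n b c) r)) := by
    refine Filter.Tendsto.comp (g := fun q => ∑ r ∈ ratPts q, sser k n b c r) ?_ hQ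
    refine tendsto_sum_of_exhaust (summable_sser k n b c hkn hn hb0 hminor hs)
      (fun W r hr => mem_unitPts_of_mem_ratPts hr) fun r hr => ?_
    obtain ⟨q, hq⟩ := exists_mem_ratPts hr
    filter_upwards [Filter.eventually_ge_atTop q] with W hW using ratPts_mono hW hq
  have h2 : Filter.Tendsto (fun P => ∫ θ in sbox (Q P), sint k n b c θ) Filter.atTop
      (nhds (∫ θ, sint k n b c θ)) :=
    (aecover_sbox.integral_tendsto_of_countably_generated
      (integrable_sint k n b c hkn hn hb0 hminor hs)).comp hQ
  have h3 := squeeze_zero_norm' (a := fun P => C * (1 / (Q P : ℝ) + (Q P : ℝ) ^ (-δ)))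
    (f := fun P : ℕ => (solCount k n b c P : ℂ) / ((P : ℂ) ^ s / (P : ℂ) ^ (k + 2 * n)) -
      (∑ r ∈ ratPts (Q P), sser k n b c r) * ∫ θ in sbox (Q P), sint k n b c θ)
    (t₀ := Filter.atTop) ?_ herr
  · simpa using h3.add (h1.mul h2)
  · filter_upwards [Filter.eventually_ge_atTop 1, hQ.eventually_ge_atTop Q₀] with P hP hP'
    exact happrox P (Q P) hP' hP (hQP P hP).1 (hQP P hP).2

end

section
variable {s : ℕ} (k n : ℕ) (b : Fin s → ℤ) (c : Fin 2 → Fin s → ℤ)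

/-- The coefficient matrix of the system. -/
def coef : Fin 3 → Fin s → ℤ := ![b, c 0, c 1]

/-- The three forms of the system over a ring. -/
def polyMap {R : Type*} [CommRing R] (x : Fin s → R) (i : Fin 3) : R :=
  ∑ j, (coef b c i j : R) * x j ^ deg k n i

/-- The Jacobian matrix of the system. -/
def jac {R : Type*} [CommRing R] (x : Fin s → R) : Matrix (Fin 3) (Fin s) R :=
  fun i j => deg k n i * coef b c i j * x j ^ (deg k n i - 1)

lemma polyMap_eq_zero {R : Type*} [CommRing R] {x : Fin s → R} : polyMap k n b c x = 0 ↔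
    ∑ j, (b j : R) * x j ^ k = 0 ∧ ∀ i : Fin 2, ∑ j, (c i j : R) * x j ^ n = 0 := by
  simp [polyMap, coef, deg, funext_iff, Fin.forall_fin_succ]

lemma rank_jac {K : Type*} [Field K] (x : Fin s → K) :
    (jac k n b c x).rank = (Matrix.of fun (i : Fin 1 ⊕ Fin 2) (j : Fin s) =>
      Sum.elim (fun _ : Fin 1 => (k : K) * (b j : K) * x j ^ (k - 1))
        (fun i₂ : Fin 2 => (n : K) * (c i₂ j : K) * x j ^ (n - 1)) i).rank := by
  rw [← Matrix.rank_submatrix _ (finSumFinEquiv (m := 1) (n := 2)).symm (Equiv.refl (Fin s))]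
  congr 1
  funext i j
  fin_cases i <;> rfl

lemma polyMap_smul {R : Type*} [CommRing R] (t : R) (x : Fin s → R) (i : Fin 3) :
    polyMap k n b c (t • x) i = t ^ deg k n i * polyMap k n b c x i := by
  simp only [polyMap, Pi.smul_apply, smul_eq_mul, mul_pow, mul_sum]
  exact sum_congr rfl fun j _ => by ring

lemma rank_jac_smul {K : Type*} [Field K] {t : K} (ht : t ≠ 0) (x : Fin s → K) :
    (jac k n b c (t • x)).rank = (jac k n b c x).rank := by
  have h : jac k n b c (t • x) =
      Matrix.diagonal (fun i => t ^ (deg k n i - 1)) * jac k n b c x := by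
    ext i j
    simp only [jac, Matrix.diagonal_mul, Pi.smul_apply, smul_eq_mul, mul_pow]
    ring
  rw [h, Matrix.rank_mul_eq_right_of_isUnit_det]
  rw [Matrix.det_diagonal, isUnit_iff_ne_zero]
  exact prod_ne_zero_iff.2 fun i _ => pow_ne_zero _ ht

section
variable {K : Type*} [NontriviallyNormedField K]

lemma hasStrictFDerivAt_diag (a : Fin s → K) (d : ℕ) (x : Fin s → K) :
    HasStrictFDerivAt (fun x : Fin s → K => ∑ j, a j * x j ^ d)
      (∑ j, (d * a j * x j ^ (d - 1)) • ContinuousLinearMap.proj (R := K) (φ := fun _ : Fin s => K) j) x := by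
  refine HasStrictFDerivAt.fun_sum fun j _ => ?_
  have h := (((hasStrictFDerivAt_apply (𝕜 := K) (F' := fun _ : Fin s => K) j x).pow d).const_mul
    (a j))
  refine h.congr_fderiv ?_
  ext v
  simp only [smul_apply, smul_eq_mul, nsmul_eq_mul]
  ring

/-- The derivative of the system. -/
noncomputable def derivMap (x : Fin s → K) : (Fin s → K) →L[K] (Fin 3 → K) :=
  ContinuousLinearMap.pi fun i => ∑ j, jac k n b c x i j • ContinuousLinearMap.proj (R := K) (φ := fun _ : Fin s => K) j

lemma derivMap_apply (x v : Fin s → K) : derivMap k n b c x v = ∑ j, v j • (jac k n b c x).col j := by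
  funext i
  simp [derivMap, Matrix.col, mul_comm]

lemma hasStrictFDerivAt_polyMap (x : Fin s → K) :
    HasStrictFDerivAt (polyMap k n b c) (derivMap k n b c x) x :=
  hasStrictFDerivAt_pi.2 fun i => hasStrictFDerivAt_diag (fun j => (coef b c i j : K)) (deg k n i) x

lemma exists_columns (M : Matrix (Fin 3) (Fin s) K) (hM : M.rank = 3) :
    ∃ e : Fin 3 ↪ Fin s, Submodule.span K (Set.range fun i => M.col (e i)) = ⊤ := by
  obtain ⟨κ, a, ha, hsp, hli⟩ := exists_linearIndependent' K M.col
  have htop : Submodule.span K (Set.range M.col) = ⊤ := by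
    apply Submodule.eq_top_of_finrank_eq
    rw [← Matrix.rank_eq_finrank_span_cols, hM]; simp
  have hfin : Finite κ := Finite.of_injective a ha
  have := Fintype.ofFinite κ
  rw [htop] at hsp
  have hcard : Fintype.card κ = 3 := by
    have := finrank_span_eq_card hli
    rw [hsp, finrank_top] at this
    simpa using this.symm
  obtain ⟨f⟩ : Nonempty (Fin 3 ≃ κ) := ⟨(Fintype.equivFinOfCardEq hcard).symm⟩
  refine ⟨⟨fun i => a (f i), ha.comp f.injective⟩, ?_⟩
  rw [← hsp]
  congr 1
  exact f.surjective.range_comp (M.col ∘ a)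

/-- Replace the coordinates on the range of `e` by the values of the system. -/
noncomputable def mixMap (e : Fin 3 ↪ Fin s) (x : Fin s → K) : Fin s → K :=
  Function.extend e (polyMap k n b c x) x

lemma mixMap_apply (e : Fin 3 ↪ Fin s) (x : Fin s → K) (i : Fin 3) :
    mixMap k n b c e x (e i) = polyMap k n b c x i := e.injective.extend_apply _ _ _

lemma mixMap_apply' (e : Fin 3 ↪ Fin s) (x : Fin s → K) {j : Fin s} (hj : ¬∃ i, e i = j) :
    mixMap k n b c e x j = x j := Function.extend_apply' _ _ _ hj

lemma exists_hasStrictFDerivAt_mixMap (e : Fin 3 ↪ Fin s) (x : Fin s → K) :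
    ∃ D : (Fin s → K) →L[K] (Fin s → K), HasStrictFDerivAt (mixMap k n b c e) D x ∧
      (∀ v i, D v (e i) = derivMap k n b c x v i) ∧ ∀ v j, (¬∃ i, e i = j) → D v j = v j := by
  classical
  have hd : ∀ i, HasStrictFDerivAt (fun x => polyMap k n b c x i)
      ((ContinuousLinearMap.proj i).comp (derivMap k n b c x)) x := fun i =>
    hasStrictFDerivAt_pi'.1 (hasStrictFDerivAt_polyMap k n b c x) i
  obtain ⟨D, hD⟩ : ∃ D : (Fin s → K) →L[K] (Fin s → K), D = ContinuousLinearMap.pi fun j =>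
      if h : ∃ i, e i = j then (ContinuousLinearMap.proj h.choose).comp (derivMap k n b c x)
      else ContinuousLinearMap.proj j := ⟨_, rfl⟩
  have hD1 : ∀ v i, D v (e i) = derivMap k n b c x v i := fun v i => by
    have h : ∃ i', e i' = e i := ⟨i, rfl⟩
    have h' : h.choose = i := e.injective h.choose_spec
    rw [hD, ContinuousLinearMap.pi_apply, dif_pos h, h']; rfl
  have hD2 : ∀ v j, (¬∃ i, e i = j) → D v j = v j := fun v j hj => by
    rw [hD, ContinuousLinearMap.pi_apply, dif_neg hj]; rfl
  refine ⟨D, hasStrictFDerivAt_pi'.2 fun j => ?_, hD1, hD2⟩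
  by_cases hj : ∃ i, e i = j
  · obtain ⟨i, rfl⟩ := hj
    refine ((hd i).congr_fderiv ?_).congr_of_eventuallyEq
      (Filter.Eventually.of_forall fun y => (mixMap_apply k n b c e y i).symm)
    ext v
    simp [hD1]
  · refine ((hasStrictFDerivAt_apply (𝕜 := K) (F' := fun _ : Fin s => K) j x).congr_fderiv
      ?_).congr_of_eventuallyEq
      (Filter.Eventually.of_forall fun y => (mixMap_apply' k n b c e y hj).symm)
    refine ContinuousLinearMap.ext fun v => ?_
    exact (hD2 v j hj).symm

lemma map_nhds_mixMap [CompleteSpace K] (e : Fin 3 ↪ Fin s) (x : Fin s → K)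
    (he : Submodule.span K (Set.range fun i => (jac k n b c x).col (e i)) = ⊤) :
    Filter.map (mixMap k n b c e) (nhds x) = nhds (mixMap k n b c e x) := by
  classical
  obtain ⟨D, hderiv, hD1, hD2⟩ := exists_hasStrictFDerivAt_mixMap k n b c e x
  refine hderiv.map_nhds_eq_of_surj (LinearMap.range_eq_top.2 fun w => ?_)
  obtain ⟨v₀, hv₀⟩ : ∃ v₀ : Fin s → K, v₀ = Function.extend e 0 w := ⟨_, rfl⟩
  have hmem : (fun i => w (e i)) - derivMap k n b c x v₀ ∈
      Submodule.span K (Set.range fun i => (jac k n b c x).col (e i)) := by rw [he]; trivial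
  obtain ⟨a, ha⟩ := (Submodule.mem_span_range_iff_exists_fun K).1 hmem
  have hsing : ∀ j, derivMap k n b c x (Pi.single j 1) = (jac k n b c x).col j := fun j => by
    rw [derivMap_apply, sum_eq_single j] <;> simp +contextual
  refine ⟨v₀ + ∑ i, a i • Pi.single (e i) 1, ?_⟩
  funext j
  show D _ j = w j
  by_cases hj : ∃ i, e i = j
  · obtain ⟨i, rfl⟩ := hj
    rw [hD1, map_add, map_sum]
    simp only [map_smul, hsing]
    rw [ha]
    simp
  · rw [hD2 _ _ hj, hv₀, Pi.add_apply, Function.extend_apply' _ _ _ hj]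
    have : ∀ i, j ≠ e i := fun i h => hj ⟨i, h.symm⟩
    simp [this]

lemma exists_mixMap_preimage [CompleteSpace K] {x : Fin s → K} (hx : (jac k n b c x).rank = 3) :
    ∃ e : Fin 3 ↪ Fin s, ∀ U ∈ nhds x, ∃ ε > 0, ∀ w : Fin s → K,
      ‖w - mixMap k n b c e x‖ < ε → ∃ y ∈ U, mixMap k n b c e y = w := by
  obtain ⟨e, he⟩ := exists_columns _ hx
  refine ⟨e, fun U hU => ?_⟩
  have h := Filter.image_mem_map (m := mixMap k n b c e) hU
  rw [map_nhds_mixMap k n b c e x he, Metric.mem_nhds_iff] at h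
  obtain ⟨ε, hε, h⟩ := h
  exact ⟨ε, hε, fun w hw => h (by rwa [Metric.mem_ball, dist_eq_norm])⟩

end

end

lemma integral_ee_gaussian {η : ℝ} (hη : 0 < η) (w : ℝ) :
    ∫ t : ℝ, ee (t * w) * (Real.exp (-(Real.pi * η ^ 2) * t ^ 2) : ℂ) =
      ((η⁻¹ * Real.exp (-(Real.pi * w ^ 2 / η ^ 2)) : ℝ) : ℂ) := by
  have hb : 0 < ((Real.pi * η ^ 2 : ℝ) : ℂ).re := by
    rw [Complex.ofReal_re]; positivity
  have h := fourierIntegral_gaussian hb ((2 * Real.pi * w : ℝ) : ℂ)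
  have hπ := Real.pi_pos
  calc _ = ∫ t : ℝ, Complex.exp (Complex.I * ((2 * Real.pi * w : ℝ) : ℂ) * t) *
        Complex.exp (-((Real.pi * η ^ 2 : ℝ) : ℂ) * (t : ℂ) ^ 2) := by
        refine integral_congr_ae (ae_of_all _ fun t => ?_)
        simp only [ee]
        push_cast
        congr 2
        ring
    _ = _ := h
    _ = _ := by
      rw [Complex.ofReal_mul η⁻¹, Complex.ofReal_exp, ← Complex.ofReal_div]
      have h1 : Real.pi / (Real.pi * η ^ 2) = (η⁻¹) ^ 2 := by field_simp
      rw [h1, show (1 / 2 : ℂ) = ((1 / 2 : ℝ) : ℂ) by push_cast; rfl,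
        ← Complex.ofReal_cpow (by positivity), ← Real.sqrt_eq_rpow,
        Real.sqrt_sq (by positivity)]
      congr 2
      push_cast
      have : (η : ℂ) ≠ 0 := by exact_mod_cast hη.ne'
      have : (Real.pi : ℂ) ≠ 0 := by exact_mod_cast hπ.ne'
      field_simp
      ring

/-- The Gaussian weight of width `1 / η` on `ℝ³`. -/
noncomputable def gaussW (η : ℝ) (θ : Fin 3 → ℝ) : ℝ :=
  ∏ i, Real.exp (-(Real.pi * η ^ 2) * θ i ^ 2)

lemma gaussW_nonneg (η : ℝ) (θ : Fin 3 → ℝ) : 0 ≤ gaussW η θ :=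
  prod_nonneg fun _ _ => (Real.exp_pos _).le

lemma gaussW_le_one (η : ℝ) (θ : Fin 3 → ℝ) : gaussW η θ ≤ 1 := by
  refine prod_le_one (fun _ _ => (Real.exp_pos _).le) fun i _ => ?_
  rw [Real.exp_le_one_iff]
  have : 0 ≤ Real.pi * η ^ 2 * θ i ^ 2 := by positivity
  linarith

lemma continuous_gaussW (η : ℝ) : Continuous (gaussW η) := by unfold gaussW; fun_prop

lemma integrable_gaussW {η : ℝ} (hη : 0 < η) : Integrable (gaussW η) := by
  rw [volume_pi]
  exact Integrable.fintype_prod (f := fun _ t => Real.exp (-(Real.pi * η ^ 2) * t ^ 2))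
    fun i => integrable_exp_neg_mul_sq (by positivity)

section
variable {s : ℕ} (k n : ℕ) (b : Fin s → ℤ) (c : Fin 2 → Fin s → ℤ)

/-- The uniform measure on the unit cube. -/
noncomputable def unitMeas (s : ℕ) : Measure (Fin s → ℝ) :=
  Measure.pi fun _ => volume.restrict (Set.Ioc 0 1)

instance : IsFiniteMeasure (unitMeas s) := by unfold unitMeas; infer_instance

lemma continuous_polyMap : Continuous (polyMap k n b c : (Fin s → ℝ) → Fin 3 → ℝ) := by
  unfold polyMap; fun_prop

lemma sint_eq_integral (θ : Fin 3 → ℝ) :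
    sint k n b c θ = ∫ z, ee (∑ i, θ i * polyMap k n b c z i) ∂unitMeas s := by
  have h : ∀ z : Fin s → ℝ, ee (∑ i, θ i * polyMap k n b c z i) =
      ∏ j, ee (b j * θ 0 * z j ^ k + (c 0 j * θ 1 + c 1 j * θ 2) * z j ^ n) := fun z => by
    rw [← ee_sum]
    congr 1
    simp only [Fin.sum_univ_three, polyMap, mul_sum, ← sum_add_distrib]
    refine sum_congr rfl fun j _ => ?_
    simp [coef, deg]
    ring
  simp only [h]
  rw [unitMeas, integral_fintype_prod_eq_prod
    (fun j (x : ℝ) => ee (b j * θ 0 * x ^ k + (c 0 j * θ 1 + c 1 j * θ 2) * x ^ n))]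
  simp only [sint, osc, intervalIntegral.integral_of_le zero_le_one]

lemma integral_sint_gaussW {η : ℝ} (hη : 0 < η) :
    ∫ θ, sint k n b c θ * (gaussW η θ : ℂ) =
      ((∫ z, ∏ i, η⁻¹ * Real.exp (-(Real.pi * polyMap k n b c z i ^ 2 / η ^ 2)) ∂unitMeas s : ℝ) :
        ℂ) := by
  have hcont : Continuous fun p : (Fin 3 → ℝ) × (Fin s → ℝ) =>
      ee (∑ i, p.1 i * polyMap k n b c p.2 i) * (gaussW η p.1 : ℂ) := by
    have h1 := continuous_polyMap k n b c
    refine Continuous.mul (continuous_ee.comp ?_)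
      (Complex.continuous_ofReal.comp ((continuous_gaussW η).comp continuous_fst))
    exact continuous_finsetSum _ fun i _ => ((continuous_apply i).comp continuous_fst).mul
      ((continuous_apply i).comp (h1.comp continuous_snd))
  have hInt : Integrable (Function.uncurry fun (θ : Fin 3 → ℝ) (z : Fin s → ℝ) =>
      ee (∑ i, θ i * polyMap k n b c z i) * (gaussW η θ : ℂ)) (volume.prod (unitMeas s)) := by
    refine Integrable.mono' ((integrable_gaussW hη).comp_fst (unitMeas s))
      hcont.aestronglyMeasurable (ae_of_all _ fun p => ?_)
    simp only [Function.uncurry]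
    rw [norm_mul, norm_ee, one_mul, Complex.norm_real, Real.norm_of_nonneg (gaussW_nonneg _ _)]
  calc _ = ∫ θ, ∫ z, ee (∑ i, θ i * polyMap k n b c z i) * (gaussW η θ : ℂ) ∂unitMeas s := by
        refine integral_congr_ae (ae_of_all _ fun θ => ?_)
        simp only [sint_eq_integral, integral_mul_const]
    _ = ∫ z, ∫ θ, ee (∑ i, θ i * polyMap k n b c z i) * (gaussW η θ : ℂ) ∂volume ∂unitMeas s :=
      integral_integral_swap hInt
    _ = _ := by
      rw [← integral_complex_ofReal]
      refine integral_congr_ae (ae_of_all _ fun z => ?_)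
      have h : ∀ θ : Fin 3 → ℝ, ee (∑ i, θ i * polyMap k n b c z i) * (gaussW η θ : ℂ) =
          ∏ i, (ee (θ i * polyMap k n b c z i) *
            (Real.exp (-(Real.pi * η ^ 2) * θ i ^ 2) : ℂ)) := fun θ => by
        rw [ee_sum, gaussW, prod_mul_distrib, Complex.ofReal_prod]
      simp only [h]
      rw [volume_pi, integral_fintype_prod_eq_prod (fun i (t : ℝ) =>
        ee (t * polyMap k n b c z i) * (Real.exp (-(Real.pi * η ^ 2) * t ^ 2) : ℂ))]
      simp only [integral_ee_gaussian hη, Complex.ofReal_prod]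

lemma tendsto_integral_sint_gaussW (hi : Integrable (sint k n b c)) :
    Filter.Tendsto (fun N : ℕ => ∫ θ, sint k n b c θ * (gaussW (1 / ((N : ℝ) + 1)) θ : ℂ))
      Filter.atTop (nhds (∫ θ, sint k n b c θ)) := by
  refine tendsto_integral_of_dominated_convergence (fun θ => ‖sint k n b c θ‖)
    (fun N => ((continuous_sint k n b c).mul
      (Complex.continuous_ofReal.comp (continuous_gaussW _))).aestronglyMeasurable) hi.norm
    (fun N => ae_of_all _ fun θ => ?_) (ae_of_all _ fun θ => ?_)
  · rw [norm_mul, Complex.norm_real, Real.norm_of_nonneg (gaussW_nonneg _ _)]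
    exact mul_le_of_le_one_right (norm_nonneg _) (gaussW_le_one _ _)
  · have h1 : Continuous fun η : ℝ => sint k n b c θ * (gaussW η θ : ℂ) := by
      unfold gaussW; fun_prop
    have h2 := (h1.tendsto 0).comp tendsto_one_div_add_atTop_nhds_zero_nat
    simpa [gaussW, Function.comp_def] using h2

end

section
variable {s : ℕ} (k n : ℕ) (b : Fin s → ℤ) (c : Fin 2 → Fin s → ℤ)

lemma exists_le_unitMeas {x : Fin s → ℝ} (hx : ∀ j, 0 < x j ∧ x j < 1)
    (hF : polyMap k n b c x = 0) (hr : (jac k n b c x).rank = 3) :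
    ∃ C > 0, ∃ η₀ > 0, ∀ η, 0 < η → η ≤ η₀ →
      C * η ^ 3 ≤ (unitMeas s).real {z | ∀ i, |polyMap k n b c z i| ≤ η} := by
  classical
  obtain ⟨e, he⟩ := exists_mixMap_preimage k n b c hr
  obtain ⟨D, hD, -⟩ := exists_hasStrictFDerivAt_mixMap k n b c e x
  obtain ⟨L, S, hS, hL⟩ := hD.exists_lipschitzOnWith
  have hV : Set.pi Set.univ (fun _ : Fin s => Set.Ioo (0 : ℝ) 1) ∈ nhds x :=
    set_pi_mem_nhds Set.finite_univ fun j _ => Ioo_mem_nhds (hx j).1 (hx j).2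
  obtain ⟨ε, hε, hU⟩ := he _ (Filter.inter_mem hS hV)
  obtain ⟨Y, hY⟩ : ∃ Y : ℝ, Y = ∏ j with j ∉ univ.map e, (2 * ε) := ⟨_, rfl⟩
  have hY0 : 0 < Y := by rw [hY]; exact prod_pos fun _ _ => by positivity
  refine ⟨8 * Y / ((L : ℝ) ^ s + 1), by positivity, ε, hε, fun η hη hηε => ?_⟩
  obtain ⟨ρ, hρ⟩ : ∃ ρ : Fin s → ℝ, ρ = fun j => if j ∈ univ.map e then η else ε := ⟨_, rfl⟩
  have hρ0 : ∀ j, 0 < ρ j := fun j => by rw [hρ]; dsimp only; split_ifs <;> assumption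
  have hρε : ∀ j, ρ j ≤ ε := fun j => by
    rw [hρ]; dsimp only; split_ifs
    · exact hηε
    · exact le_rfl
  obtain ⟨B, hB⟩ : ∃ B : Set (Fin s → ℝ),
      B = Set.pi Set.univ fun j => Metric.ball (mixMap k n b c e x j) (ρ j) := ⟨_, rfl⟩
  obtain ⟨A, hA⟩ : ∃ A : Set (Fin s → ℝ), A = {z | z ∈ S ∧
      z ∈ Set.pi Set.univ (fun _ : Fin s => Set.Ioo (0 : ℝ) 1) ∧
      ∀ i, |polyMap k n b c z i| ≤ η} := ⟨_, rfl⟩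
  have hBA : B ⊆ mixMap k n b c e '' A := by
    intro w hw
    rw [hB] at hw
    have hw' : ∀ j, ‖w j - mixMap k n b c e x j‖ < ρ j := fun j => by
      rw [← dist_eq_norm]; exact hw j trivial
    obtain ⟨y, hy, hyw⟩ := hU w ((pi_norm_lt_iff hε).2 fun j => (hw' j).trans_le (hρε j))
    refine ⟨y, ?_, hyw⟩
    rw [hA]
    refine ⟨hy.1, hy.2, fun i => ?_⟩
    have h1 := hw' (e i)
    rw [mixMap_apply, hF, ← hyw, mixMap_apply, Pi.zero_apply, sub_zero, Real.norm_eq_abs] at h1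
    refine h1.le.trans ?_
    rw [hρ]; simp
  have hvB : volume B = ENNReal.ofReal (8 * Y * η ^ 3) := by
    rw [hB, volume_pi_pi]
    simp only [Real.volume_ball]
    rw [← ENNReal.ofReal_prod_of_nonneg fun j _ => by have := hρ0 j; positivity]
    congr 1
    have h1 : ∏ j with j ∈ univ.map e, 2 * ρ j = 8 * η ^ 3 := by
      have : ({j | j ∈ univ.map e} : Finset (Fin s)) = univ.map e := by ext; simp
      rw [this, prod_map, Fin.prod_univ_three]
      simp only [hρ, mem_map_of_mem _ (mem_univ _), if_true]
      ring
    have h2 : ∏ j with j ∉ univ.map e, 2 * ρ j = Y := by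
      rw [hY]
      refine prod_congr rfl fun j hj => ?_
      rw [mem_filter] at hj
      rw [hρ]; dsimp only; rw [if_neg hj.2]
    rw [← prod_filter_mul_prod_filter_not univ (fun j => j ∈ univ.map e), h1, h2]
    ring
  have hLA : LipschitzOnWith L (mixMap k n b c e) A := hL.mono fun z hz => by rw [hA] at hz; exact hz.1
  have h1 := hLA.hausdorffMeasure_image_le (d := (Fintype.card (Fin s) : ℝ)) (by positivity)
  rw [hausdorffMeasure_pi_real] at h1
  have hvA : volume A ≤ unitMeas s {z | ∀ i, |polyMap k n b c z i| ≤ η} := by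
    rw [unitMeas, ← Measure.restrict_pi_pi,
      Measure.restrict_apply' (MeasurableSet.univ_pi fun _ => measurableSet_Ioc)]
    refine measure_mono fun z hz => ?_
    rw [hA] at hz
    exact ⟨hz.2.2, fun j _ => Set.Ioo_subset_Ioc_self (hz.2.1 j trivial)⟩
  have h2 : ENNReal.ofReal (8 * Y * η ^ 3) ≤
      (L : ENNReal) ^ s * unitMeas s {z | ∀ i, |polyMap k n b c z i| ≤ η} := by
    rw [← hvB]
    refine (measure_mono hBA).trans (h1.trans ?_)
    rw [ENNReal.rpow_natCast, Fintype.card_fin]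
    gcongr
  have h3 := ENNReal.toReal_mono (ENNReal.mul_ne_top (by simp) (measure_ne_top _ _)) h2
  rw [ENNReal.toReal_ofReal (by positivity), ENNReal.toReal_mul, ENNReal.toReal_pow,
    ENNReal.coe_toReal] at h3
  rw [div_mul_eq_mul_div, div_le_iff₀ (by positivity), mul_comm ((unitMeas s).real _)]
  refine h3.trans ?_
  exact mul_le_mul_of_nonneg_right (by linarith) measureReal_nonneg

theorem exists_integral_sint_eq (hi : Integrable (sint k n b c)) {x : Fin s → ℝ}
    (hx : ∀ j, 0 < x j) (hF : polyMap k n b c x = 0) (hr : (jac k n b c x).rank = 3) :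
    ∃ J : ℝ, 0 < J ∧ ∫ θ, sint k n b c θ = J := by
  obtain ⟨t, ht⟩ : ∃ t : ℝ, t = (1 + ∑ j, x j)⁻¹ := ⟨_, rfl⟩
  have hsum : 0 ≤ ∑ j, x j := sum_nonneg fun j _ => (hx j).le
  have ht0 : 0 < t := by rw [ht]; positivity
  have hx1 : ∀ j, 0 < (t • x) j ∧ (t • x) j < 1 := fun j => by
    refine ⟨mul_pos ht0 (hx j), ?_⟩
    have : x j ≤ ∑ j, x j := single_le_sum (fun j _ => (hx j).le) (mem_univ j)
    rw [Pi.smul_apply, smul_eq_mul, ht, inv_mul_lt_iff₀ (by linarith)]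
    linarith
  have hF1 : polyMap k n b c (t • x) = 0 := by
    funext i
    rw [polyMap_smul, hF]; simp
  obtain ⟨C, hC, η₀, hη₀, hA⟩ := exists_le_unitMeas k n b c hx1 hF1
    (by rw [rank_jac_smul _ _ _ _ ht0.ne', hr])
  obtain ⟨C', hC'⟩ : ∃ C' : ℝ, C' = C * Real.exp (-Real.pi) ^ 3 := ⟨_, rfl⟩
  have hC'0 : 0 < C' := by rw [hC']; positivity
  have hclosed : IsClosed {w : ℂ | C' ≤ w.re ∧ w.im = 0} :=
    (isClosed_le continuous_const Complex.continuous_re).inter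
      (isClosed_eq Complex.continuous_im continuous_const)
  have hmem : ∫ θ, sint k n b c θ ∈ {w : ℂ | C' ≤ w.re ∧ w.im = 0} := by
    refine hclosed.mem_of_tendsto (tendsto_integral_sint_gaussW k n b c hi) ?_
    filter_upwards [tendsto_one_div_add_atTop_nhds_zero_nat.eventually_le_const hη₀] with N hN
    have hη : 0 < 1 / ((N : ℝ) + 1) := by positivity
    obtain ⟨η, hη'⟩ : ∃ η, η = 1 / ((N : ℝ) + 1) := ⟨_, rfl⟩
    rw [← hη'] at hN hη ⊢
    rw [integral_sint_gaussW k n b c hη]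
    refine ⟨?_, Complex.ofReal_im _⟩
    rw [Complex.ofReal_re]
    have hcont : Continuous fun z : Fin s → ℝ =>
        ∏ i, η⁻¹ * Real.exp (-(Real.pi * polyMap k n b c z i ^ 2 / η ^ 2)) := by
      unfold polyMap; fun_prop
    have hle : ∀ z : Fin s → ℝ,
        ∏ i, η⁻¹ * Real.exp (-(Real.pi * polyMap k n b c z i ^ 2 / η ^ 2)) ≤ (η⁻¹) ^ 3 := by
      intro z
      rw [show (η⁻¹) ^ 3 = ∏ _i : Fin 3, η⁻¹ by simp]
      refine prod_le_prod (fun i _ => by positivity) fun i _ => ?_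
      refine mul_le_of_le_one_right (by positivity) ?_
      rw [Real.exp_le_one_iff]
      have : 0 ≤ Real.pi * polyMap k n b c z i ^ 2 / η ^ 2 := by positivity
      linarith
    have hnn : ∀ z : Fin s → ℝ,
        0 ≤ ∏ i, η⁻¹ * Real.exp (-(Real.pi * polyMap k n b c z i ^ 2 / η ^ 2)) := fun z =>
      prod_nonneg fun i _ => by positivity
    have hInt : Integrable (fun z : Fin s → ℝ =>
        ∏ i, η⁻¹ * Real.exp (-(Real.pi * polyMap k n b c z i ^ 2 / η ^ 2))) (unitMeas s) :=
      Integrable.of_bound hcont.aestronglyMeasurable ((η⁻¹) ^ 3)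
        (ae_of_all _ fun z => by rw [Real.norm_of_nonneg (hnn z)]; exact hle z)
    have hms : MeasurableSet {z : Fin s → ℝ | ∀ i, |polyMap k n b c z i| ≤ η} := by
      rw [Set.ofPred_forall]
      refine MeasurableSet.iInter fun i => ?_
      exact (isClosed_le (((continuous_apply i).comp (continuous_polyMap k n b c)).abs)
        continuous_const).measurableSet
    calc C' = (C * η ^ 3) * ((η⁻¹) ^ 3 * Real.exp (-Real.pi) ^ 3) := by
          rw [hC']; field_simp
      _ ≤ (unitMeas s).real {z | ∀ i, |polyMap k n b c z i| ≤ η} *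
          ((η⁻¹) ^ 3 * Real.exp (-Real.pi) ^ 3) :=
        mul_le_mul_of_nonneg_right (hA η hη hN) (by positivity)
      _ = ∫ z in {z | ∀ i, |polyMap k n b c z i| ≤ η},
          ((η⁻¹) ^ 3 * Real.exp (-Real.pi) ^ 3) ∂unitMeas s := by
        rw [setIntegral_const, smul_eq_mul]
      _ ≤ ∫ z in {z | ∀ i, |polyMap k n b c z i| ≤ η},
          ∏ i, η⁻¹ * Real.exp (-(Real.pi * polyMap k n b c z i ^ 2 / η ^ 2)) ∂unitMeas s := by
        refine setIntegral_mono_on (integrable_const _).integrableOn hInt.integrableOn hms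
          fun z hz => ?_
        rw [← mul_pow, show (η⁻¹ * Real.exp (-Real.pi)) ^ 3 =
          ∏ _i : Fin 3, η⁻¹ * Real.exp (-Real.pi) by simp]
        refine prod_le_prod (fun i _ => by positivity) fun i _ => ?_
        gcongr
        have h1 : polyMap k n b c z i ^ 2 ≤ η ^ 2 := by
          rw [← sq_abs (polyMap k n b c z i)]
          exact pow_le_pow_left₀ (abs_nonneg _) (hz i) 2
        rw [mul_div_assoc]
        exact mul_le_of_le_one_right Real.pi_pos.le ((div_le_one (by positivity)).2 h1)
      _ ≤ _ := setIntegral_le_integral hInt (ae_of_all _ hnn)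
  refine ⟨(∫ θ, sint k n b c θ).re, hC'0.trans_le hmem.1, ?_⟩
  exact Complex.ext (by simp) (by simpa using hmem.2)

end

lemma ee_nat_mul (a : ℕ) (t : ℝ) : ee (a * t) = ee t ^ a := by
  rw [ee, ee, ← Complex.exp_nat_mul]; congr 1; push_cast; ring

lemma sum_Icc_ee {W : ℕ} (hW : 1 ≤ W) (m : ℤ) :
    ∑ a ∈ Icc 1 W, ee (a * ((m : ℝ) / W)) = if (W : ℤ) ∣ m then (W : ℂ) else 0 := by
  have hW0 : (W : ℝ) ≠ 0 := by positivity
  split_ifs with h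
  · obtain ⟨d, rfl⟩ := h
    have : ∀ a ∈ Icc 1 W, ee (a * (((W * d : ℤ) : ℝ) / W)) = 1 := fun a _ => by
      rw [← ee_int (a * d)]; congr 1; push_cast; field_simp
    rw [sum_congr rfl this]; simp
  · obtain ⟨ζ, hζ⟩ : ∃ ζ, ζ = ee ((m : ℝ) / W) := ⟨_, rfl⟩
    have h1 : ζ ^ W = 1 := by
      rw [hζ, ← ee_nat_mul, ← ee_int m]; congr 1; field_simp
    have h2 : ζ ≠ 1 := fun h1 => h <| by
      rw [hζ, ee, Complex.exp_eq_one_iff] at h1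
      obtain ⟨d, hd⟩ := h1
      have h3 : (((m : ℝ) / W : ℝ) : ℂ) = d := by
        have hne : (2 * Real.pi * Complex.I : ℂ) ≠ 0 := Complex.two_pi_I_ne_zero
        refine mul_left_cancel₀ hne ?_
        rw [hd]; ring
      have h4 : (m : ℝ) / W = d := by exact_mod_cast h3
      rw [div_eq_iff hW0] at h4
      exact ⟨d, by rw [mul_comm]; exact_mod_cast h4⟩
    simp only [ee_nat_mul, ← hζ]
    have h3 := geom_sum_eq h2 W
    rw [h1, sub_self, zero_div] at h3
    calc ∑ a ∈ Icc 1 W, ζ ^ a = ∑ a ∈ range W, ζ ^ (a + 1) := by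
          rw [range_eq_Ico, sum_Ico_add' (fun a => ζ ^ a) 0 W 1]; rfl
      _ = ζ * ∑ a ∈ range W, ζ ^ a := by
          rw [mul_sum]; exact sum_congr rfl fun a _ => by ring
      _ = 0 := by rw [h3, mul_zero]

/-- The points of `(0, 1]³` with denominator `W`. -/
def denPts (W : ℕ) : Finset (Fin 3 → ℚ) :=
  (Fintype.piFinset fun _ : Fin 3 => Icc 1 W).image fun a i => (a i : ℚ) / W

lemma mem_denPts {W : ℕ} {r : Fin 3 → ℚ} : r ∈ denPts W ↔
    ∃ a : Fin 3 → ℕ, (∀ i, 1 ≤ a i ∧ a i ≤ W) ∧ ∀ i, r i = a i / W := by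
  simp only [denPts, mem_image, Fintype.mem_piFinset, mem_Icc, funext_iff, eq_comm]

lemma mem_unitPts_of_mem_denPts {W : ℕ} {r : Fin 3 → ℚ} (hr : r ∈ denPts W) : r ∈ unitPts := by
  obtain ⟨a, ha, hra⟩ := mem_denPts.1 hr
  have hW : 1 ≤ W := (ha 0).1.trans (ha 0).2
  exact mem_unitPts_of_mem_ratPts (mem_ratPts.2 ⟨W, ⟨hW, le_rfl⟩, a, ha, hra⟩)

section
variable {s : ℕ} (k n : ℕ) (b : Fin s → ℤ) (c : Fin 2 → Fin s → ℤ)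

/-- The solutions of the system in a ring. -/
abbrev Sol (R : Type*) [CommRing R] : Type _ := {x : Fin s → R // polyMap k n b c x = 0}

lemma polyMap_map {R S : Type*} [CommRing R] [CommRing S] (f : R →+* S) (x : Fin s → R) (i : Fin 3) :
    polyMap k n b c (fun j => f (x j)) i = f (polyMap k n b c x i) := by
  simp [polyMap, map_sum]

/-- A ring homomorphism induces a map on solutions. -/
def Sol.map {R S : Type*} [CommRing R] [CommRing S] (f : R →+* S) (x : Sol k n b c R) :
    Sol k n b c S :=
  ⟨fun j => f (x.1 j), by funext i; rw [polyMap_map, x.2]; simp⟩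

lemma card_sol_zmod {W : ℕ} (hW : 1 ≤ W) : Nat.card (Sol k n b c (ZMod W)) =
    #{x ∈ Fintype.piFinset fun _ : Fin s => range W |
      ∀ i, (W : ℤ) ∣ polyMap k n b c (fun j => (x j : ℤ)) i} := by
  classical
  have : NeZero W := ⟨by omega⟩
  rw [Nat.subtype_card (univ.filter fun x : Fin s → ZMod W => polyMap k n b c x = 0)
    fun x => by simp]
  have key : ∀ x : Fin s → ℕ, polyMap k n b c (fun j => (x j : ZMod W)) = 0 ↔
      ∀ i, (W : ℤ) ∣ polyMap k n b c (fun j => (x j : ℤ)) i := fun x => by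
    rw [funext_iff]
    refine forall_congr' fun i => ?_
    rw [← ZMod.intCast_zmod_eq_zero_iff_dvd, Pi.zero_apply]
    have := polyMap_map k n b c (Int.castRingHom (ZMod W)) (fun j => (x j : ℤ)) i
    simp only [eq_intCast, Int.cast_natCast] at this
    rw [this]
  have hval : ∀ x : Fin s → ZMod W, (fun j => (((x j).val : ℕ) : ZMod W)) = x := fun x =>
    funext fun j => ZMod.natCast_zmod_val (x j)
  refine card_bij' (fun x _ j => (x j).val) (fun x _ j => (x j : ZMod W)) ?_ ?_ ?_ ?_
  · intro x hx
    rw [mem_filter, Fintype.mem_piFinset]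
    refine ⟨fun j => mem_range.2 (ZMod.val_lt _), (key _).1 ?_⟩
    rw [hval]
    exact (mem_filter.1 hx).2
  · intro x hx
    exact mem_filter.2 ⟨mem_univ _, (key x).2 (mem_filter.1 hx).2⟩
  · intro x _
    exact hval x
  · intro x hx
    rw [mem_filter, Fintype.mem_piFinset] at hx
    funext j
    exact ZMod.val_cast_of_lt (mem_range.1 (hx.1 j))

lemma prod_phase (W : ℕ) (a : Fin 3 → ℕ) (x : Fin s → ℕ) :
    ∏ j, phase k n (b j * ((a 0 : ℚ) / W)) (c 0 j * ((a 1 : ℚ) / W) + c 1 j * ((a 2 : ℚ) / W))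
      (x j) = ∏ i, ee (a i * (((polyMap k n b c (fun j => (x j : ℤ)) i : ℤ) : ℝ) / W)) := by
  rw [← ee_sum]
  simp only [phase]
  rw [← ee_sum]
  congr 1
  simp only [Fin.sum_univ_three, polyMap]
  push_cast
  simp only [sum_div, mul_sum, ← sum_add_distrib]
  refine sum_congr rfl fun j _ => ?_
  simp [coef, deg]
  ring

lemma sum_denPts {W : ℕ} (hW : 1 ≤ W) : ∑ r ∈ denPts W, sser k n b c r =
    (W : ℂ) ^ 3 / (W : ℂ) ^ s * Nat.card (Sol k n b c (ZMod W)) := by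
  classical
  have hW0 : (W : ℚ) ≠ 0 := by positivity
  have hWc : (W : ℂ) ≠ 0 := by exact_mod_cast (by omega : W ≠ 0)
  rw [denPts, sum_image]
  swap
  · intro a _ a' _ h
    funext i
    have := congrFun h i
    field_simp at this
    exact_mod_cast this
  have h1 : ∀ a : Fin 3 → ℕ, sser k n b c (fun i => (a i : ℚ) / W) =
      (1 / (W : ℂ) ^ s) * ∑ x ∈ Fintype.piFinset fun _ : Fin s => range W,
        ∏ i, ee (a i * (((polyMap k n b c (fun j => (x j : ℤ)) i : ℤ) : ℝ) / W)) := fun a => by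
    rw [sum_congr rfl fun x _ => (prod_phase k n b c W a x).symm]
    rw [← prod_univ_sum (fun _ => range W) fun j x => phase k n (b j * ((a 0 : ℚ) / W))
      (c 0 j * ((a 1 : ℚ) / W) + c 1 j * ((a 2 : ℚ) / W)) x]
    rw [sser, show 1 / (W : ℂ) ^ s = ∏ _j : Fin s, (1 / (W : ℂ)) by simp, ← prod_mul_distrib]
    refine prod_congr rfl fun j _ => ?_
    rw [gauss_eq k n hW (a := b j * a 0) (a' := c 0 j * a 1 + c 1 j * a 2)
      (by push_cast; field_simp) (by push_cast; field_simp), avg]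
    ring
  simp only [h1]
  rw [← mul_sum, sum_comm]
  have h2 : ∀ x : Fin s → ℕ, (∑ a ∈ Fintype.piFinset fun _ : Fin 3 => Icc 1 W,
      ∏ i, ee (a i * (((polyMap k n b c (fun j => (x j : ℤ)) i : ℤ) : ℝ) / W))) =
      if ∀ i, (W : ℤ) ∣ polyMap k n b c (fun j => (x j : ℤ)) i then (W : ℂ) ^ 3 else 0 := fun x => by
    rw [← prod_univ_sum (fun _ => Icc 1 W) fun i (a : ℕ) =>
      ee (a * (((polyMap k n b c (fun j => (x j : ℤ)) i : ℤ) : ℝ) / W))]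
    simp only [sum_Icc_ee hW]
    split_ifs with h
    · simp [h]
    · push Not at h
      obtain ⟨i, hi⟩ := h
      exact prod_eq_zero (mem_univ i) (if_neg hi)
  simp only [h2]
  rw [← sum_filter, sum_const, card_sol_zmod k n b c hW, nsmul_eq_mul]
  ring

end

section
variable {s : ℕ} (k n : ℕ) (b : Fin s → ℤ) (c : Fin 2 → Fin s → ℤ)

/-- The density of solutions modulo `W`. -/
noncomputable def dens (W : ℕ) : ℝ := (W : ℝ) ^ 3 / (W : ℝ) ^ s * Nat.card (Sol k n b c (ZMod W))

lemma sum_denPts_eq_dens {W : ℕ} (hW : 1 ≤ W) :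
    ∑ r ∈ denPts W, sser k n b c r = (dens k n b c W : ℂ) := by
  rw [sum_denPts k n b c hW, dens]; push_cast; rfl

lemma card_sol_mul {u v : ℕ} (h : u.Coprime v) : Nat.card (Sol k n b c (ZMod (u * v))) =
    Nat.card (Sol k n b c (ZMod u)) * Nat.card (Sol k n b c (ZMod v)) := by
  rw [← Nat.card_prod]
  obtain ⟨φ, -⟩ : ∃ φ : ZMod (u * v) ≃+* ZMod u × ZMod v, φ = ZMod.chineseRemainder h := ⟨_, rfl⟩
  refine Nat.card_eq_of_bijective (fun x => (x.map k n b c ((RingHom.fst _ _).comp φ.toRingHom),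
    x.map k n b c ((RingHom.snd _ _).comp φ.toRingHom))) ⟨fun x y hxy => ?_, fun z => ?_⟩
  · ext j
    simp only [Prod.mk.injEq, Subtype.ext_iff, funext_iff, Sol.map] at hxy
    exact φ.injective (Prod.ext (hxy.1 j) (hxy.2 j))
  · have hz : polyMap k n b c (fun j => φ.symm (z.1.1 j, z.2.1 j)) = 0 := by
      funext i
      have h1 := polyMap_map k n b c φ.symm.toRingHom (fun j => (z.1.1 j, z.2.1 j)) i
      have h2 := polyMap_map k n b c (RingHom.fst (ZMod u) (ZMod v))
        (fun j => (z.1.1 j, z.2.1 j)) i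
      have h3 := polyMap_map k n b c (RingHom.snd (ZMod u) (ZMod v))
        (fun j => (z.1.1 j, z.2.1 j)) i
      have h4 : polyMap k n b c (fun j => (z.1.1 j, z.2.1 j)) i = 0 := by
        refine Prod.ext (h2.symm.trans ?_) (h3.symm.trans ?_)
        · exact congrFun z.1.2 i
        · exact congrFun z.2.2 i
      rw [h4, map_zero] at h1
      exact h1
    refine ⟨⟨_, hz⟩, ?_⟩
    refine Prod.ext (Subtype.ext ?_) (Subtype.ext ?_) <;> funext j <;> simp [Sol.map]

lemma dens_mul {u v : ℕ} (h : u.Coprime v) :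
    dens k n b c (u * v) = dens k n b c u * dens k n b c v := by
  rw [dens, dens, dens, card_sol_mul k n b c h]
  push_cast
  rw [mul_pow, mul_pow, mul_div_mul_comm]
  ring

lemma dens_nonneg (W : ℕ) : 0 ≤ dens k n b c W := by rw [dens]; positivity

variable {p : ℕ} [hp : Fact p.Prime]

lemma exists_integral_solution {x : Fin s → ℚ_[p]} (hF : polyMap k n b c x = 0)
    (hr : (jac k n b c x).rank = 3) : ∃ y : Fin s → ℚ_[p], (∀ j, ‖y j‖ ≤ 1) ∧
      polyMap k n b c y = 0 ∧ (jac k n b c y).rank = 3 := by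
  have hp1 : (1 : ℝ) < p := by exact_mod_cast hp.out.one_lt
  have hp0 : (p : ℚ_[p]) ≠ 0 := by exact_mod_cast hp.out.ne_zero
  obtain ⟨m, hm⟩ := pow_unbounded_of_one_lt ‖x‖ hp1
  refine ⟨(p : ℚ_[p]) ^ m • x, fun j => ?_, ?_, ?_⟩
  · rw [Pi.smul_apply, smul_eq_mul, norm_mul, norm_pow, Padic.norm_p, inv_pow,
      inv_mul_le_iff₀ (by positivity), mul_one]
    exact (norm_le_pi_norm x j).trans hm.le
  · funext i
    rw [polyMap_smul, hF]; simp
  · rw [rank_jac_smul k n b c (pow_ne_zero m hp0), hr]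

lemma exists_le_card_sol {x : Fin s → ℚ_[p]} (hF : polyMap k n b c x = 0)
    (hr : (jac k n b c x).rank = 3) : ∃ m : ℕ, ∀ h, m ≤ h →
      (p ^ (h - m)) ^ (s - 3) ≤ Nat.card (Sol k n b c (ZMod (p ^ h))) := by
  classical
  have hp1 : (1 : ℝ) < p := by exact_mod_cast hp.out.one_lt
  obtain ⟨y, hy, hFy, hry⟩ := exists_integral_solution k n b c hF hr
  obtain ⟨e, he⟩ := exists_mixMap_preimage k n b c hry
  have hU : {z : Fin s → ℚ_[p] | ∀ j, ‖z j‖ ≤ 1} ∈ nhds y := by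
    refine Filter.mem_of_superset (Metric.ball_mem_nhds y one_pos) fun z hz j => ?_
    rw [mem_ball_iff_norm] at hz
    have h1 : z j = (z - y) j + y j := by simp
    rw [h1]
    refine (Padic.nonarchimedean _ _).trans (max_le ?_ (hy j))
    exact (norm_le_pi_norm (z - y) j).trans hz.le
  obtain ⟨ε, hε, hε'⟩ := he _ hU
  obtain ⟨m, hm⟩ : ∃ m : ℕ, ((p : ℝ)⁻¹) ^ m < ε :=
    exists_pow_lt_of_lt_one hε (inv_lt_one_of_one_lt₀ hp1)
  refine ⟨m, fun h hmh => ?_⟩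
  obtain ⟨J, hJ⟩ : ∃ J : Finset (Fin s), J = univ.filter fun j => ¬∃ i, e i = j := ⟨_, rfl⟩
  have hJc : #J = s - 3 := by
    have h1 : univ.filter (fun j => ¬∃ i, e i = j) = (univ.map e)ᶜ := by ext; simp
    rw [hJ, h1, card_compl, card_map]; simp
  have key : ∀ u : Fin s → ℕ, ∃ z : Fin s → ℤ_[p], polyMap k n b c z = 0 ∧
      ∀ j ∈ J, (z j : ℚ_[p]) = y j + p ^ m * u j := fun u => by
    obtain ⟨z, hz, hzw⟩ := hε' (fun j => if j ∈ J then y j + p ^ m * u j else 0) (by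
      refine lt_of_le_of_lt ((pi_norm_le_iff_of_nonneg (by positivity)).2 fun j => ?_) hm
      rw [Pi.sub_apply]
      by_cases hj : j ∈ J
      · have hj' := hj
        rw [hJ, mem_filter] at hj'
        rw [if_pos hj, mixMap_apply' k n b c e y hj'.2, add_sub_cancel_left, norm_mul, norm_pow,
          Padic.norm_p]
        refine mul_le_of_le_one_right (by positivity) ?_
        exact_mod_cast Padic.norm_int_le_one (p := p) (u j)
      · have hj' := hj
        rw [hJ, mem_filter, not_and, not_not] at hj'
        obtain ⟨i, rfl⟩ := hj' (mem_univ _)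
        rw [if_neg hj, mixMap_apply, hFy]
        simp only [Pi.zero_apply, sub_zero, norm_zero]
        positivity)
    refine ⟨fun j => ⟨z j, hz j⟩, ?_, fun j hj => ?_⟩
    · funext i
      have h1 := polyMap_map k n b c (PadicInt.Coe.ringHom (p := p))
        (fun j => (⟨z j, hz j⟩ : ℤ_[p])) i
      have h2 := congrFun hzw (e i)
      rw [mixMap_apply, if_neg (by rw [hJ]; simp)] at h2
      apply Subtype.ext
      exact h1.symm.trans h2
    · have h2 := congrFun hzw j
      have hj' := hj
      rw [hJ, mem_filter] at hj'
      rw [mixMap_apply' k n b c e z hj'.2, if_pos hj] at h2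
      exact h2
  choose z hz hzJ using key
  have hne : NeZero (p ^ h) := ⟨pow_ne_zero _ hp.out.ne_zero⟩
  obtain ⟨g, hg⟩ : ∃ g : (J → Fin (p ^ (h - m))) → Fin s → ℕ,
      g = fun u j => if hj : j ∈ J then (u ⟨j, hj⟩ : ℕ) else 0 := ⟨_, rfl⟩
  have hcard : Nat.card (J → Fin (p ^ (h - m))) = (p ^ (h - m)) ^ (s - 3) := by
    rw [Nat.card_fun, Nat.card_eq_fintype_card, Nat.card_eq_fintype_card, Fintype.card_fin,
      Fintype.card_coe, hJc]
  have hfin : Finite (Sol k n b c (ZMod (p ^ h))) := inferInstance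
  rw [← hcard]
  refine Nat.card_le_card_of_injective (fun u =>
    Sol.map k n b c (PadicInt.toZModPow h) ⟨z (g u), hz (g u)⟩) fun u u' huu => ?_
  funext j
  have h1 : PadicInt.toZModPow h (z (g u) j) = PadicInt.toZModPow h (z (g u') j) :=
    congrFun (Subtype.ext_iff.1 huu) j
  rw [← sub_eq_zero, ← map_sub, ← RingHom.mem_ker, PadicInt.ker_toZModPow,
    Ideal.mem_span_singleton] at h1
  obtain ⟨w, hw⟩ := h1
  have h2 : (p : ℚ_[p]) ^ m * ((u j : ℕ) - (u' j : ℕ)) = p ^ m * (p ^ (h - m) * w) := by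
    have h3 := congrArg (fun t : ℤ_[p] => (t : ℚ_[p])) hw
    simp only [PadicInt.coe_sub, hzJ _ _ j.2, PadicInt.coe_mul, PadicInt.coe_pow,
      PadicInt.coe_natCast] at h3
    rw [← mul_assoc, ← pow_add, Nat.add_sub_cancel' hmh, ← h3, hg]
    simp only [coe_mem, dite_true, Subtype.coe_eta]
    ring
  have h4 := mul_left_cancel₀ (pow_ne_zero m (by exact_mod_cast hp.out.ne_zero)) h2
  have h5 : (p : ℤ_[p]) ^ (h - m) ∣ (((u j : ℕ) - (u' j : ℕ) : ℤ) : ℤ_[p]) :=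
    ⟨w, Subtype.ext (by push_cast; exact h4)⟩
  rw [PadicInt.pow_p_dvd_int_iff] at h5
  apply Fin.ext
  have h7 := (u j).2
  have h8 := (u' j).2
  have h9 := Int.eq_zero_of_abs_lt_dvd h5 (by
    rw [abs_lt]; push_cast at *; constructor <;> zify at h7 h8 <;> omega)
  omega

end

section
variable {s : ℕ} (k n : ℕ) (b : Fin s → ℤ) (c : Fin 2 → Fin s → ℤ)

lemma dens_pos (hk : k ≠ 0) (hn : n ≠ 0) {W : ℕ} (hW : 1 ≤ W) :
    1 ≤ Nat.card (Sol k n b c (ZMod W)) := by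
  have : NeZero W := ⟨by omega⟩
  have : Nonempty (Sol k n b c (ZMod W)) :=
    ⟨⟨0, by rw [polyMap_eq_zero]; simp [hk, hn]⟩⟩
  have : Finite (Sol k n b c (ZMod W)) := inferInstance
  exact Nat.card_pos

lemma exists_le_dens_pow (hk : k ≠ 0) (hn : n ≠ 0) (hs : 3 ≤ s) {p : ℕ} [hp : Fact p.Prime]
    {x : Fin s → ℚ_[p]} (hF : polyMap k n b c x = 0) (hr : (jac k n b c x).rank = 3) :
    ∃ C : ℝ, 0 < C ∧ ∀ h, C ≤ dens k n b c (p ^ h) := by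
  have hp0 : (0 : ℝ) < p := by exact_mod_cast hp.out.pos
  have hp1 : (1 : ℝ) ≤ p := by exact_mod_cast hp.out.one_lt.le
  obtain ⟨m, hm⟩ := exists_le_card_sol k n b c hF hr
  refine ⟨((p : ℝ) ^ (m * (s - 3)))⁻¹, by positivity, fun h => ?_⟩
  have key : (p : ℝ) ^ (h * (s - 3)) ≤
      p ^ (m * (s - 3)) * Nat.card (Sol k n b c (ZMod (p ^ h))) := by
    rcases le_total m h with hmh | hmh
    · have h1 : (((p ^ (h - m)) ^ (s - 3) : ℕ) : ℝ) ≤ Nat.card (Sol k n b c (ZMod (p ^ h))) := by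
        exact_mod_cast hm h hmh
      refine le_trans (le_of_eq ?_) (mul_le_mul_of_nonneg_left h1 (by positivity))
      push_cast
      rw [← pow_mul, ← pow_add, ← add_mul, Nat.add_sub_cancel' hmh]
    · have h1 : (1 : ℝ) ≤ Nat.card (Sol k n b c (ZMod (p ^ h))) := by
        exact_mod_cast dens_pos k n b c hk hn (Nat.one_le_pow _ _ hp.out.pos)
      calc (p : ℝ) ^ (h * (s - 3)) ≤ p ^ (m * (s - 3)) :=
            pow_le_pow_right₀ hp1 (Nat.mul_le_mul_right _ hmh)
        _ ≤ _ := le_mul_of_one_le_right (by positivity) h1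
  have h2 : ((p ^ h : ℕ) : ℝ) ^ s = ((p ^ h : ℕ) : ℝ) ^ 3 * p ^ (h * (s - 3)) := by
    push_cast
    rw [← pow_mul, ← pow_mul, ← pow_add, ← mul_add, Nat.add_sub_cancel' hs]
  have h3 : (((p ^ h : ℕ) : ℝ) ^ 3) ≠ 0 :=
    pow_ne_zero _ (by exact_mod_cast pow_ne_zero h hp.out.ne_zero)
  rw [dens, h2, div_mul_eq_div_div, div_self h3, one_div, inv_mul_eq_div, le_div_iff₀ (by positivity),
    inv_mul_le_iff₀ (by positivity)]
  exact key

lemma exists_half_le_dens (hS : Summable (unitPts.indicator fun r => ‖sser k n b c r‖)) :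
    ∃ Q : ℕ, ∀ W, 1 ≤ W → (∀ p, p.Prime → p ∣ W → Q < p) → 1 / 2 ≤ dens k n b c W := by
  classical
  obtain ⟨v, hv⟩ := summable_iff_vanishing_norm.1 hS (1 / 2) (by norm_num)
  obtain ⟨Q, -, hQ⟩ := exists_subset_ratPts (v.filter fun r => r ∈ unitPts)
    fun r hr => (mem_filter.1 hr).2
  refine ⟨Q, fun W hW hWp => ?_⟩
  have hW0 : (W : ℚ) ≠ 0 := by positivity
  have h1 : (fun _ => 1 : Fin 3 → ℚ) ∈ denPts W :=
    mem_denPts.2 ⟨fun _ => W, fun _ => ⟨hW, le_rfl⟩, fun _ => by field_simp⟩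
  have hdis : Disjoint ((denPts W).erase fun _ => 1) v := by
    rw [disjoint_left]
    intro r hr hrv
    rw [mem_erase] at hr
    refine hr.1 (funext fun i => ?_)
    obtain ⟨q, hq, a, -, hra⟩ := mem_ratPts.1
      (hQ (mem_filter.2 ⟨hrv, mem_unitPts_of_mem_denPts hr.2⟩))
    obtain ⟨a', ha', hra'⟩ := mem_denPts.1 hr.2
    have hq0 : (q : ℚ) ≠ 0 := by exact_mod_cast (by omega : q ≠ 0)
    have hcop : W.Coprime q := Nat.Coprime.symm <| Nat.coprime_of_dvd fun p hp hpq hpW => by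
      have := hWp p hp hpW
      have := Nat.le_of_dvd (by omega) hpq
      omega
    have h2 := hra i
    rw [hra' i, div_eq_div_iff hW0 hq0] at h2
    have h3 : a' i * q = a i * W := by exact_mod_cast h2
    have h4 : W ∣ a' i := hcop.dvd_of_dvd_mul_right ⟨a i, by rw [h3, mul_comm]⟩
    have h5 : a' i = W := le_antisymm (ha' i).2 (Nat.le_of_dvd (ha' i).1 h4)
    rw [hra' i, h5, div_self hW0]
  have h2 := hv _ hdis
  have h3 : (dens k n b c W : ℂ) - 1 = ∑ r ∈ (denPts W).erase fun _ => 1, sser k n b c r := by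
    rw [← sum_denPts_eq_dens k n b c hW, ← add_sum_erase _ _ h1, sser_one]; ring
  have h4 : ‖(dens k n b c W : ℂ) - 1‖ < 1 / 2 := by
    rw [h3]
    refine (norm_sum_le _ _).trans_lt (lt_of_eq_of_lt ?_ ((le_abs_self _).trans_lt h2))
    exact sum_congr rfl fun r hr => (Set.indicator_of_mem
      (mem_unitPts_of_mem_denPts (mem_of_mem_erase hr)) fun r => ‖sser k n b c r‖).symm
  have h5 : |dens k n b c W - 1| < 1 / 2 := by
    rw [← Real.norm_eq_abs, ← Complex.norm_real]; push_cast; exact h4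
  rw [abs_lt] at h5
  linarith [h5.1]

lemma exists_le_dens (hS : Summable (unitPts.indicator fun r => ‖sser k n b c r‖))
    (hloc : ∀ p : ℕ, p.Prime → ∃ C : ℝ, 0 < C ∧ ∀ h, C ≤ dens k n b c (p ^ h)) :
    ∃ C : ℝ, 0 < C ∧ ∀ W, 1 ≤ W → C ≤ dens k n b c W := by
  obtain ⟨Q, hQ⟩ := exists_half_le_dens k n b c hS
  have key : ∃ C : ℝ, 0 < C ∧ ∀ W, 1 ≤ W → (∀ p, p.Prime → p ∣ W → 0 ≤ p) →
      C ≤ dens k n b c W := by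
    refine Nat.decreasingInduction (n := Q + 1) (m := 0) (motive := fun m _ =>
      ∃ C : ℝ, 0 < C ∧ ∀ W, 1 ≤ W → (∀ p, p.Prime → p ∣ W → m ≤ p) → C ≤ dens k n b c W)
      (fun m _ hm => ?_) ⟨1 / 2, by norm_num, hQ⟩ (Nat.zero_le _)
    obtain ⟨C, hC, hCW⟩ := hm
    by_cases hpm : m.Prime
    · obtain ⟨C', hC', hCp⟩ := hloc m hpm
      refine ⟨C' * C, by positivity, fun W hW hWp => ?_⟩
      obtain ⟨h, W', hW', rfl⟩ := Nat.exists_eq_pow_mul_and_not_dvd (n := W) (by omega) m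
        hpm.ne_one
      rw [dens_mul k n b c (Nat.Coprime.pow_left h ((Nat.Prime.coprime_iff_not_dvd hpm).2 hW'))]
      refine mul_le_mul (hCp h) (hCW W' (Nat.pos_of_mul_pos_left hW) fun p hp hpW => ?_)
        hC.le (dens_nonneg k n b c _)
      refine Nat.lt_of_le_of_ne (hWp p hp (hpW.mul_left _)) ?_
      rintro rfl
      exact hW' hpW
    · refine ⟨C, hC, fun W hW hWp => hCW W hW fun p hp hpW => ?_⟩
      refine Nat.lt_of_le_of_ne (hWp p hp hpW) ?_
      rintro rfl
      exact hpm hp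
  obtain ⟨C, hC, h⟩ := key
  exact ⟨C, hC, fun W hW => h W hW fun p _ _ => Nat.zero_le p⟩

theorem exists_tsum_sser_eq (hS : Summable (unitPts.indicator fun r => ‖sser k n b c r‖))
    (hloc : ∀ p : ℕ, p.Prime → ∃ C : ℝ, 0 < C ∧ ∀ h, C ≤ dens k n b c (p ^ h)) :
    ∃ S : ℝ, 0 < S ∧ ∑' r, unitPts.indicator (sser k n b c) r = S := by
  obtain ⟨C, hC, hCW⟩ := exists_le_dens k n b c hS hloc
  have hclosed : IsClosed {w : ℂ | C ≤ w.re ∧ w.im = 0} :=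
    (isClosed_le continuous_const Complex.continuous_re).inter
      (isClosed_eq Complex.continuous_im continuous_const)
  have hmem : ∑' r, unitPts.indicator (sser k n b c) r ∈ {w : ℂ | C ≤ w.re ∧ w.im = 0} := by
    refine hclosed.mem_of_tendsto (tendsto_sum_of_exhaust (R := fun N : ℕ => denPts N.factorial)
      (l := Filter.atTop) hS (fun N r hr => mem_unitPts_of_mem_denPts hr) fun r hr => ?_)
      (Filter.Eventually.of_forall fun N => ?_)
    · obtain ⟨Q, hQ⟩ := exists_mem_ratPts hr
      obtain ⟨q, hq, a, ha, hra⟩ := mem_ratPts.1 hQ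
      filter_upwards [Filter.eventually_ge_atTop Q] with N hN
      obtain ⟨d, hd⟩ := Nat.dvd_factorial (by omega : 0 < q) (hq.2.trans hN)
      have hd0 : 0 < d := Nat.pos_of_ne_zero fun h => by
        have := Nat.factorial_pos N
        rw [hd, h] at this; simp at this
      have hq0 : (q : ℚ) ≠ 0 := by exact_mod_cast (by omega : q ≠ 0)
      have hdq : (d : ℚ) ≠ 0 := by exact_mod_cast hd0.ne'
      rw [hd]
      refine mem_denPts.2 ⟨fun i => a i * d, fun i => ⟨Nat.mul_pos (ha i).1 hd0,
        Nat.mul_le_mul_right _ (ha i).2⟩, fun i => ?_⟩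
      rw [hra i]; push_cast; field_simp
    · rw [sum_denPts_eq_dens k n b c (Nat.factorial_pos N)]
      exact ⟨by rw [Complex.ofReal_re]; exact hCW _ (Nat.factorial_pos N), Complex.ofReal_im _⟩
  refine ⟨(∑' r, unitPts.indicator (sser k n b c) r).re, hC.trans_le hmem.1, ?_⟩
  exact Complex.ext (by simp) (by simpa using hmem.2)

end

lemma two_rr_add_le {k n s : ℕ} (hkn : n < k) (hn : 2 ≤ n)
    (hs : (k ≤ n * (n - 1) ∧ 2 * k * (k - 1) + 2 * n * (n - 1) + 1 ≤ s) ∨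
      (n * (n - 1) ≤ k ∧ 2 * k ^ 2 + 1 ≤ s)) : 2 * rr k + 2 * rr n + 1 ≤ s := by
  have h1 : 2 * rr k ≤ k * (k + 1) := Nat.mul_div_le _ _
  have h2 : 2 * rr n ≤ n * (n + 1) := Nat.mul_div_le _ _
  obtain ⟨m, rfl⟩ : ∃ m, n = m + 2 := ⟨n - 2, by omega⟩
  obtain ⟨l, rfl⟩ : ∃ l, k = m + 3 + l := ⟨k - (m + 3), by omega⟩
  rw [show m + 3 + l - 1 = m + 2 + l by omega, show m + 2 - 1 = m + 1 by omega] at hs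
  rcases hs with ⟨h3, h4⟩ | ⟨-, h4⟩
  · obtain ⟨u, rfl⟩ : ∃ u, m = u + 1 := by
      refine ⟨m - 1, ?_⟩
      rcases Nat.eq_zero_or_pos m with rfl | h <;> omega
    nlinarith
  · nlinarith

end CircleMethod

/-- Corollary 1.3 of Brandes–Parsell, the bound on `G̃*(k,n,n)`:
for `k > n ≥ 2`, a system of one degree-`k` form and two degree-`n` forms, highly
non-singular, with `s ≥ 2k(k-1)+2n(n-1)+1` if `k ≤ n(n-1)` or `s ≥ 2k²+1` if
`k ≥ n(n-1)`, and possessing a non-singular positive real solution and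
non-singular `p`-adic solutions for all `p`, satisfies
`N(P) = (C+o(1))P^{s-k-2n}` with `C > 0`. -/
theorem statement4 (k n s : ℕ) (hkn : n < k) (hn : 2 ≤ n)
    (hs : (k ≤ n * (n - 1) ∧ 2 * k * (k - 1) + 2 * n * (n - 1) + 1 ≤ s) ∨
          (n * (n - 1) ≤ k ∧ 2 * k ^ 2 + 1 ≤ s))
    (b : Fin s → ℤ) (c : Fin 2 → Fin s → ℤ)
    (hb0 : ∀ j, b j ≠ 0) (hc0 : ∀ i j, c i j ≠ 0)
    (hminor : ∀ j₁ j₂ : Fin s, j₁ ≠ j₂ → c 0 j₁ * c 1 j₂ - c 0 j₂ * c 1 j₁ ≠ 0)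
    (hreal : ∃ x : Fin s → ℝ, (∀ j, 0 < x j) ∧
      (∑ j, (b j : ℝ) * x j ^ k = 0) ∧
      (∀ i : Fin 2, ∑ j, (c i j : ℝ) * x j ^ n = 0) ∧
      (Matrix.of fun (i : Fin 1 ⊕ Fin 2) (j : Fin s) =>
        Sum.elim (fun _ : Fin 1 => (k : ℝ) * (b j : ℝ) * x j ^ (k - 1))
          (fun i₂ : Fin 2 => (n : ℝ) * (c i₂ j : ℝ) * x j ^ (n - 1)) i).rank = 3)
    (hpadic : ∀ (p : ℕ) [Fact p.Prime], ∃ x : Fin s → ℚ_[p],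
      (∑ j, (b j : ℚ_[p]) * x j ^ k = 0) ∧
      (∀ i : Fin 2, ∑ j, (c i j : ℚ_[p]) * x j ^ n = 0) ∧
      (Matrix.of fun (i : Fin 1 ⊕ Fin 2) (j : Fin s) =>
        Sum.elim (fun _ : Fin 1 => (k : ℚ_[p]) * (b j : ℚ_[p]) * x j ^ (k - 1))
          (fun i₂ : Fin 2 => (n : ℚ_[p]) * (c i₂ j : ℚ_[p]) * x j ^ (n - 1)) i).rank = 3) :
    ∃ C : ℝ, 0 < C ∧ Filter.Tendsto
      (fun P : ℕ => ((Nat.card {x : Fin s → ℕ // (∀ j, 1 ≤ x j ∧ x j ≤ P) ∧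
          (∑ j, b j * (x j : ℤ) ^ k = 0) ∧
          (∀ i : Fin 2, ∑ j, c i j * (x j : ℤ) ^ n = 0)}) : ℝ) /
        (P : ℝ) ^ ((s : ℝ) - (k : ℝ) - 2 * (n : ℝ)))
      Filter.atTop (nhds C) := by
  obtain ⟨y, hy, hy1, hy2, hy3⟩ := hreal
  have hs' := CircleMethod.two_rr_add_le hkn hn hs
  have hs3 : 3 ≤ s := by
    have h := Matrix.rank_le_width (CircleMethod.jac k n b c y)
    rwa [CircleMethod.rank_jac, hy3] at h
  obtain ⟨J, hJ, hJe⟩ := CircleMethod.exists_integral_sint_eq k n b c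
    (CircleMethod.integrable_sint k n b c hkn (by omega) hb0 hminor hs') hy
    ((CircleMethod.polyMap_eq_zero k n b c).2 ⟨hy1, hy2⟩)
    ((CircleMethod.rank_jac k n b c y).trans hy3)
  obtain ⟨S, hS, hSe⟩ := CircleMethod.exists_tsum_sser_eq k n b c
    (CircleMethod.summable_sser k n b c hkn (by omega) hb0 hminor hs') fun p hp => by
      have : Fact p.Prime := ⟨hp⟩
      obtain ⟨x, hx1, hx2, hx3⟩ := hpadic p
      exact CircleMethod.exists_le_dens_pow k n b c (by omega) (by omega) hs3
        ((CircleMethod.polyMap_eq_zero k n b c).2 ⟨hx1, hx2⟩)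
        ((CircleMethod.rank_jac k n b c x).trans hx3)
  refine ⟨S * J, mul_pos hS hJ, ?_⟩
  have h := CircleMethod.tendsto_solCount k n b c hkn (by omega) hb0 hminor hs'
  rw [hSe, hJe, ← Complex.ofReal_mul] at h
  have h' := (Complex.continuous_re.tendsto _).comp h
  rw [Complex.ofReal_re] at h'
  refine h'.congr' ?_
  filter_upwards [Filter.eventually_ge_atTop 1] with P hP
  rw [CircleMethod.rpow_eq_pow_div k n hP, Function.comp_apply]
  change _ = (CircleMethod.solCount k n b c P : ℝ) / _
  rw [← Complex.ofReal_re ((CircleMethod.solCount k n b c P : ℝ) / _)]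
  push_cast
  rfl
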